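/- Let a = (a_n)_{n≥1} be a sequence of positive integers and let (p_n/q_n)_{n≥1} denote the convergents of α = [0; a₁, a₂, …]. Assume the sequence (q_ℓ^{1/ℓ})_{ℓ≥1} is bounded, and set M = limsup_{ℓ→∞} q_ℓ^{1/ℓ} and m = liminf_{ℓ→∞} q_ℓ^{1/ℓ}. Let w and w' be positive rational numbers with w' > 2·(log M / log m) − 1. If a satisfies Condition (*)_{w,w'}, then α is transcendental. -/

import Mathlib

open Filter Topology

/-- Numerators of the convergents of `[0; a 1, a 2, ...]`. -/
def cfNum (a : ℕ → ℕ) : ℕ → ℕ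
  | 0 => 0
  | 1 => 1
  | n + 2 => a (n + 2) * cfNum a (n + 1) + cfNum a n

/-- Denominators of the convergents of `[0; a 1, a 2, ...]`. -/
def cfDen (a : ℕ → ℕ) : ℕ → ℕ
  | 0 => 1
  | 1 => a 1
  | n + 2 => a (n + 2) * cfDen a (n + 1) + cfDen a n

/-- The infinite word `a 1, a 2, a 3, ...` is eventually periodic. -/
def EventuallyPeriodic (a : ℕ → ℕ) : Prop :=
  ∃ n₀ T : ℕ, 0 < T ∧ ∀ n, n₀ ≤ n → a (n + T) = a n

/-- The finite word `L` is a prefix of the infinite word `a 1, a 2, a 3, ...`. -/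
def IsPrefixOfSeq (L : List ℕ) (a : ℕ → ℕ) : Prop :=
  ∀ i, i < L.length → L.getD i 0 = a (i + 1)

/-- Condition `(*)_{w,w'}`: the word `a 1 a 2 ...` is not eventually periodic and begins in
prefixes `Wₙ Uₙ Vₙ Ūₙ` with `|Vₙ|/|Uₙ| ≤ w`, `|Uₙ|/|Wₙ| ≥ w'` and `|Uₙ|` increasing. -/
def ConditionStarStar (w w' : ℚ) (a : ℕ → ℕ) : Prop :=
  ¬ EventuallyPeriodic a ∧
    ∃ U V W : ℕ → List ℕ,
      (∀ n, 1 ≤ n → IsPrefixOfSeq (W n ++ U n ++ V n ++ (U n).reverse) a) ∧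
      (∀ n, 1 ≤ n → ((V n).length : ℚ) ≤ w * (U n).length) ∧
      (∀ n, 1 ≤ n → w' * ((W n).length : ℚ) ≤ (U n).length) ∧
      StrictMono (fun n => (U n).length)


section
open MvPolynomial

namespace SST

section l1
variable {σ A : Type*} [CommRing A]

/-- The `ℓ¹`-length of a polynomial with respect to a ring seminorm on the coefficients. -/
noncomputable def l1 (ν : RingSeminorm A) (f : MvPolynomial σ A) : ℝ :=
  ∑ I ∈ f.support, ν (coeff I f)

variable (ν : RingSeminorm A)

lemma l1_nonneg (f : MvPolynomial σ A) : 0 ≤ l1 ν f :=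
  Finset.sum_nonneg fun _ _ => apply_nonneg ν _

lemma l1_eq_of_subset (f : MvPolynomial σ A) (s : Finset (σ →₀ ℕ)) (h : f.support ⊆ s) :
    l1 ν f = ∑ I ∈ s, ν (coeff I f) := by
  refine Finset.sum_subset h fun I _ hI => ?_
  rw [notMem_support_iff.mp hI, map_zero]

lemma coeff_le_l1 (f : MvPolynomial σ A) (I : σ →₀ ℕ) : ν (coeff I f) ≤ l1 ν f := by
  classical
  rw [l1_eq_of_subset ν f (f.support ∪ {I}) Finset.subset_union_left]
  exact Finset.single_le_sum (f := fun I => ν (coeff I f)) (fun _ _ => apply_nonneg ν _) (by simp)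

lemma l1_zero : l1 ν (0 : MvPolynomial σ A) = 0 := by simp [l1]

lemma l1_add (f g : MvPolynomial σ A) : l1 ν (f + g) ≤ l1 ν f + l1 ν g := by
  classical
  set s := (f + g).support ∪ f.support ∪ g.support
  rw [l1_eq_of_subset ν (f + g) s (by intro x hx; simp [s] at hx ⊢; tauto),
    l1_eq_of_subset ν f s (by intro x hx; simp [s] at hx ⊢; tauto),
    l1_eq_of_subset ν g s (by intro x hx; simp [s] at hx ⊢; tauto), ← Finset.sum_add_distrib]
  exact Finset.sum_le_sum fun I _ => by rw [coeff_add]; exact map_add_le_add ν _ _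

lemma l1_neg (f : MvPolynomial σ A) : l1 ν (-f) = l1 ν f := by
  simp [l1, support_neg, coeff_neg, map_neg_eq_map]

lemma l1_sum {ι : Type*} (s : Finset ι) (f : ι → MvPolynomial σ A) :
    l1 ν (∑ i ∈ s, f i) ≤ ∑ i ∈ s, l1 ν (f i) := by
  classical
  induction s using Finset.induction_on with
  | empty => simp [l1_zero]
  | insert a s ha ih =>
    rw [Finset.sum_insert ha, Finset.sum_insert ha]
    exact (l1_add ν _ _).trans (by gcongr)

lemma l1_monomial (I : σ →₀ ℕ) (c : A) : l1 ν (monomial I c) = ν c := by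
  classical
  rw [l1_eq_of_subset ν _ {I} support_monomial_subset]; simp

lemma l1_C (c : A) : l1 ν (C c : MvPolynomial σ A) = ν c := l1_monomial ν 0 c

lemma l1_monomial_mul (I : σ →₀ ℕ) (c : A) (g : MvPolynomial σ A) :
    l1 ν (monomial I c * g) ≤ ν c * l1 ν g := by
  classical
  conv_lhs => rw [g.as_sum, Finset.mul_sum]
  refine (l1_sum ν _ _).trans ?_
  rw [l1, Finset.mul_sum]
  refine Finset.sum_le_sum fun J _ => ?_
  rw [monomial_mul, l1_monomial]
  exact map_mul_le_mul ν _ _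

lemma l1_mul (f g : MvPolynomial σ A) : l1 ν (f * g) ≤ l1 ν f * l1 ν g := by
  classical
  conv_lhs => rw [f.as_sum, Finset.sum_mul]
  refine (l1_sum ν _ _).trans ?_
  rw [l1, Finset.sum_mul]
  exact Finset.sum_le_sum fun J _ => l1_monomial_mul ν _ _ _

variable {ν}

lemma l1_one (h1 : ν 1 ≤ 1) : l1 ν (1 : MvPolynomial σ A) ≤ 1 := by
  rw [← C_1, l1_C]; exact h1

lemma l1_pow (h1 : ν 1 ≤ 1) (f : MvPolynomial σ A) (n : ℕ) : l1 ν (f ^ n) ≤ l1 ν f ^ n := by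
  induction n with
  | zero => simpa using l1_one h1
  | succ n ih =>
    rw [pow_succ, pow_succ]
    exact (l1_mul ν _ _).trans (mul_le_mul_of_nonneg_right ih (l1_nonneg ν f))

lemma l1_prod (h1 : ν 1 ≤ 1) {ι : Type*} (s : Finset ι) (f : ι → MvPolynomial σ A) :
    l1 ν (∏ i ∈ s, f i) ≤ ∏ i ∈ s, l1 ν (f i) := by
  classical
  induction s using Finset.induction_on with
  | empty => simpa using l1_one h1
  | insert a s ha ih =>
    rw [Finset.prod_insert ha, Finset.prod_insert ha]
    exact (l1_mul ν _ _).trans (mul_le_mul_of_nonneg_left ih (l1_nonneg ν _))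

lemma nu_natCast_mul (n : ℕ) (x : A) : ν ((n : A) * x) ≤ n * ν x := by
  induction n with
  | zero => simp
  | succ n ih =>
    push_cast
    rw [add_mul, add_mul, one_mul, one_mul]
    exact (map_add_le_add ν _ _).trans (by gcongr)

lemma l1_det (h1 : ν 1 ≤ 1) {s : ℕ} (M : Matrix (Fin s) (Fin s) (MvPolynomial σ A)) (B : ℝ)
    (hB : ∀ i j, l1 ν (M i j) ≤ B) : l1 ν M.det ≤ s.factorial * B ^ s := by
  rw [Matrix.det_apply]
  refine (l1_sum ν _ _).trans ?_
  have : ∀ π ∈ (Finset.univ : Finset (Equiv.Perm (Fin s))),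
      l1 ν (Equiv.Perm.sign π • ∏ i, M (π i) i) ≤ B ^ s := by
    intro π _
    have h2 : l1 ν (∏ i, M (π i) i) ≤ B ^ s := by
      refine (l1_prod h1 _ _).trans ?_
      calc ∏ i, l1 ν (M (π i) i) ≤ ∏ _i : Fin s, B :=
            Finset.prod_le_prod (fun _ _ => l1_nonneg ν _) fun i _ => hB _ _
        _ = B ^ s := by simp
    rcases Int.units_eq_one_or (Equiv.Perm.sign π) with h | h <;> rw [h]
    · simpa using h2
    · rw [Units.neg_smul, one_smul, l1_neg]; exact h2
  refine (Finset.sum_le_card_nsmul _ _ _ this).trans ?_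
  simp [Fintype.card_perm]

end l1

section hasse
variable {σ A : Type*} [CommRing A]

/-- `∏ choose (J v + κ v) (κ v)` -/
noncomputable def bB (J κ : σ →₀ ℕ) : ℕ := κ.prod fun v k => (J v + k).choose k

lemma bB_eq (J κ : σ →₀ ℕ) (S : Finset σ) (h : κ.support ⊆ S) :
    bB J κ = ∏ v ∈ S, (J v + κ v).choose (κ v) :=
  Finsupp.prod_of_support_subset _ h _ (by simp)

lemma bB_zero (J : σ →₀ ℕ) : bB J 0 = 1 := by simp [bB]

lemma bB_pos (J κ : σ →₀ ℕ) : 0 < bB J κ :=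
  Finset.prod_pos fun v _ => Nat.choose_pos (by omega)

lemma bB_le (J κ : σ →₀ ℕ) : bB J κ ≤ 2 ^ (J + κ).degree := by
  classical
  rw [bB_eq J κ ((J + κ).support) (by intro v; simp; omega), Finsupp.degree_apply,
    ← Finset.prod_pow_eq_pow_sum]
  exact Finset.prod_le_prod' fun v _ => Nat.choose_le_two_pow _ _

open Finsupp in
lemma bB_succ (J κ : σ →₀ ℕ) (a : σ) :
    (J a + 1) * bB (J + single a 1) κ = (κ a + 1) * bB J (κ + single a 1) := by
  classical
  set S := κ.support ∪ {a}
  have haS : a ∈ S := by simp [S]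
  rw [bB_eq _ κ S (by simp [S]), bB_eq J _ S (by
    intro v; simp only [S, Finsupp.mem_support_iff, Finset.mem_union, Finset.mem_singleton]
    intro h
    by_contra hc
    push Not at hc
    simp [hc.1, Finsupp.single_apply, Ne.symm hc.2] at h),
    ← Finset.mul_prod_erase S _ haS, ← Finset.mul_prod_erase S _ haS, ← mul_assoc, ← mul_assoc]
  congr 1
  · simp only [Finsupp.add_apply, Finsupp.single_eq_same]
    have h := Nat.add_one_mul_choose_eq (J a + κ a) (κ a)
    have h2 := Nat.choose_mul_succ_eq (J a + κ a) (κ a)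
    have e1 : J a + κ a + 1 - κ a = J a + 1 := by omega
    rw [e1] at h2
    have e2 : J a + 1 + κ a = J a + κ a + 1 := by omega
    have e3 : J a + (κ a + 1) = J a + κ a + 1 := by omega
    rw [e2, e3]
    linarith
  · refine Finset.prod_congr rfl fun v hv => ?_
    have : v ≠ a := Finset.ne_of_mem_erase hv
    simp [Finsupp.single_apply, this.symm]

/-- Hasse derivative. -/
noncomputable def hasse (κ : σ →₀ ℕ) (f : MvPolynomial σ A) : MvPolynomial σ A :=
  ∑ I ∈ f.support, monomial (I - κ) (((κ.prod fun v k => (I v).choose k : ℕ) : A) * coeff I f)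

lemma coeff_hasse (κ J : σ →₀ ℕ) (f : MvPolynomial σ A) :
    coeff J (hasse κ f) = (bB J κ : A) * coeff (J + κ) f := by
  classical
  rw [hasse, coeff_sum]
  rw [Finset.sum_eq_single (J + κ)]
  · rw [coeff_monomial, if_pos (by simp)]
    rfl
  · intro I _ hI
    rw [coeff_monomial]
    split_ifs with h
    · have : ∃ v ∈ κ.support, I v < κ v := by
        by_contra hc
        push Not at hc
        apply hI
        ext v
        rw [← h]
        have : κ v ≤ I v := by
          by_cases hv : v ∈ κ.support
          · exact hc v hv
          · simp [Finsupp.notMem_support_iff.mp hv]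
        simp [this]
      obtain ⟨v, hv, hlt⟩ := this
      have : (κ.prod fun v k => (I v).choose k) = 0 :=
        Finset.prod_eq_zero hv (Nat.choose_eq_zero_of_lt hlt)
      simp [this]
    · rfl
  · intro h
    rw [notMem_support_iff.mp h]; simp

lemma hasse_zero_left (f : MvPolynomial σ A) : hasse 0 f = f := by
  ext J; simp [coeff_hasse, bB_zero]

lemma hasse_add (κ : σ →₀ ℕ) (f g : MvPolynomial σ A) :
    hasse κ (f + g) = hasse κ f + hasse κ g := by
  ext J; simp [coeff_hasse, mul_add]

lemma hasse_C_mul (κ : σ →₀ ℕ) (c : A) (g : MvPolynomial σ A) :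
    hasse κ (C c * g) = C c * hasse κ g := by
  ext J; simp [coeff_hasse, coeff_C_mul]; ring

lemma hasse_zero (κ : σ →₀ ℕ) : hasse κ (0 : MvPolynomial σ A) = 0 := by
  ext J; simp [coeff_hasse]

lemma hasse_sum {ι : Type*} (κ : σ →₀ ℕ) (s : Finset ι) (f : ι → MvPolynomial σ A) :
    hasse κ (∑ i ∈ s, f i) = ∑ i ∈ s, hasse κ (f i) := by
  ext J; simp [coeff_hasse, coeff_sum, Finset.mul_sum]

lemma hasse_map {B : Type*} [CommRing B] (φ : A →+* B) (κ : σ →₀ ℕ) (f : MvPolynomial σ A) :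
    hasse κ (map φ f) = map φ (hasse κ f) := by
  ext J; simp [coeff_hasse, coeff_map]

lemma pderiv_hasse (κ : σ →₀ ℕ) (a : σ) (f : MvPolynomial σ A) :
    pderiv a (hasse κ f) = C ((κ a + 1 : ℕ) : A) * hasse (κ + Finsupp.single a 1) f := by
  ext J
  rw [coeff_pderiv, coeff_C_mul, coeff_hasse, coeff_hasse]
  have h := congrArg (Nat.cast : ℕ → A) (bB_succ J κ a)
  push_cast at h ⊢
  have e : J + Finsupp.single a 1 + κ = J + (κ + Finsupp.single a 1) := by
    rw [add_assoc, add_comm (Finsupp.single a 1)]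
  rw [e]
  linear_combination coeff (J + (κ + Finsupp.single a 1)) f * h

lemma hasse_hasse (κ κ' : σ →₀ ℕ) (f : MvPolynomial σ A) :
    ∃ c : ℕ, hasse κ (hasse κ' f) = C (c : A) * hasse (κ + κ') f := by
  classical
  set S := κ.support ∪ κ'.support
  refine ⟨∏ v ∈ S, (κ v + κ' v).choose (κ v), ?_⟩
  ext J
  rw [coeff_C_mul, coeff_hasse, coeff_hasse, coeff_hasse, bB_eq _ κ S (by simp [S]),
    bB_eq _ κ' S (by simp [S]), bB_eq _ (κ + κ') S (by
      intro v; simp only [S, Finsupp.mem_support_iff, Finset.mem_union, Finsupp.add_apply]; omega),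
    add_assoc]
  have key : (∏ v ∈ S, (J v + κ v).choose (κ v)) * (∏ v ∈ S, ((J + κ) v + κ' v).choose (κ' v)) =
      (∏ v ∈ S, (κ v + κ' v).choose (κ v)) *
        ∏ v ∈ S, (J v + (κ + κ') v).choose ((κ + κ') v) := by
    rw [← Finset.prod_mul_distrib, ← Finset.prod_mul_distrib]
    refine Finset.prod_congr rfl fun v _ => ?_
    simp only [Finsupp.add_apply]
    have := Nat.choose_mul (n := J v + (κ v + κ' v)) (k := κ v + κ' v) (s := κ' v) (by omega)
    have e1 : J v + (κ v + κ' v) - κ' v = J v + κ v := by omega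
    have e2 : κ v + κ' v - κ' v = κ v := by omega
    rw [e1, e2] at this
    have e3 : (κ v + κ' v).choose (κ' v) = (κ v + κ' v).choose (κ v) := by
      rw [Nat.choose_symm_add]
    rw [e3] at this
    rw [show J v + κ v + κ' v = J v + (κ v + κ' v) by ring]
    linarith
  have key2 := congrArg (Nat.cast : ℕ → A) key
  rw [Nat.cast_mul, Nat.cast_mul] at key2
  rw [← mul_assoc, ← mul_assoc, key2]

lemma l1_hasse {ν : RingSeminorm A} (κ : σ →₀ ℕ) (f : MvPolynomial σ A) (D : ℕ)
    (hD : ∀ I ∈ f.support, I.degree ≤ D) : l1 ν (hasse κ f) ≤ 2 ^ D * l1 ν f := by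
  classical
  have : l1 ν (hasse κ f) ≤ ∑ J ∈ (hasse κ f).support, 2 ^ D * ν (coeff (J + κ) f) := by
    refine Finset.sum_le_sum fun J hJ => ?_
    rw [coeff_hasse]
    refine (nu_natCast_mul _ _).trans ?_
    have hJ' : J + κ ∈ f.support := by
      rw [mem_support_iff] at hJ ⊢
      intro h; apply hJ; rw [coeff_hasse, h, mul_zero]
    gcongr
    calc (bB J κ : ℝ) ≤ (2 ^ (J + κ).degree : ℕ) := by exact_mod_cast bB_le J κ
      _ ≤ 2 ^ D := by push_cast; exact pow_le_pow_right₀ (by norm_num) (hD _ hJ')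
  refine this.trans ?_
  rw [← Finset.mul_sum]
  gcongr
  have h2 : ∑ J ∈ (hasse κ f).support, ν (coeff (J + κ) f) =
      ∑ I ∈ (hasse κ f).support.map (addRightEmbedding κ), ν (coeff I f) := by
    rw [Finset.sum_map]; rfl
  rw [h2, l1]
  refine Finset.sum_le_sum_of_subset_of_nonneg ?_ fun _ _ _ => apply_nonneg ν _
  intro I hI
  rw [Finset.mem_map] at hI
  obtain ⟨J, hJ, rfl⟩ := hI
  rw [mem_support_iff] at hJ ⊢
  intro h; apply hJ
  rw [coeff_hasse]
  simp only [addRightEmbedding_apply] at h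
  rw [h, mul_zero]

lemma degreeOf_hasse (κ : σ →₀ ℕ) (f : MvPolynomial σ A) (v : σ) :
    degreeOf v (hasse κ f) ≤ degreeOf v f := by
  classical
  rw [degreeOf_le_iff]
  intro J hJ
  have : J + κ ∈ f.support := by
    rw [mem_support_iff] at hJ ⊢
    intro h; apply hJ; rw [coeff_hasse, h, mul_zero]
  have := monomial_le_degreeOf v this
  simp at this
  omega

/-- Translation of a polynomial. -/
noncomputable def shift (ξ : σ → A) : MvPolynomial σ A →ₐ[A] MvPolynomial σ A :=
  aeval fun v => X v + C (ξ v)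

lemma shift_X (ξ : σ → A) (v : σ) : shift ξ (X v) = X v + C (ξ v) := by simp [shift]
lemma shift_C (ξ : σ → A) (c : A) : shift ξ (C c) = C c := by
  rw [← algebraMap_eq]; exact AlgHom.commutes _ _

lemma pderiv_shift (ξ : σ → A) (a : σ) (f : MvPolynomial σ A) :
    pderiv a (shift ξ f) = shift ξ (pderiv a f) := by
  classical
  induction f using MvPolynomial.induction_on with
  | C c => simp [shift_C]
  | add p q hp hq => simp [hp, hq]
  | mul_X p v hp =>
    rw [map_mul, pderiv_mul, hp, pderiv_mul, map_add, map_mul, map_mul, shift_X]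
    congr 2
    rw [map_add, pderiv_C, add_zero, pderiv_X, Pi.single_apply]
    split_ifs <;> simp

lemma shift_shift (ξ η : σ → A) (f : MvPolynomial σ A) :
    shift ξ (shift η f) = shift (ξ + η) f := by
  induction f using MvPolynomial.induction_on with
  | C c => simp [shift_C]
  | add p q hp hq => simp [hp, hq]
  | mul_X p v hp => simp [hp, shift_X, shift_C, add_assoc]

lemma shift_zero (f : MvPolynomial σ A) : shift (0 : σ → A) f = f := by
  induction f using MvPolynomial.induction_on with
  | C c => simp [shift_C]
  | add p q hp hq => simp [hp, hq]
  | mul_X p v hp => simp [hp, shift_X]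

lemma shift_injective (ξ : σ → A) : Function.Injective (shift ξ) := by
  intro f g h
  have := congrArg (shift (-ξ)) h
  simpa [shift_shift, shift_zero] using this

lemma constantCoeff_shift (ξ : σ → A) (f : MvPolynomial σ A) :
    constantCoeff (shift ξ f) = eval ξ f := by
  induction f using MvPolynomial.induction_on with
  | C c => simp [shift_C]
  | add p q hp hq => simp [hp, hq]
  | mul_X p v hp => simp [hp, shift_X]

lemma exists_sub_single {κ : σ →₀ ℕ} (h : κ ≠ 0) :
    ∃ a κ', κ = κ' + Finsupp.single a 1 ∧ κ'.degree + 1 = κ.degree := by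
  classical
  obtain ⟨a, ha⟩ : ∃ a, κ a ≠ 0 := by
    by_contra hc; push Not at hc; exact h (Finsupp.ext hc)
  have e : κ = (κ - Finsupp.single a 1) + Finsupp.single a 1 := by
    ext v
    simp only [Finsupp.add_apply, Finsupp.tsub_apply, Finsupp.single_apply]
    split_ifs with hv
    · subst hv; omega
    · omega
  refine ⟨a, κ - Finsupp.single a 1, e, ?_⟩
  conv_rhs => rw [e]
  simp

lemma hasse_shift [IsDomain A] [CharZero A] (κ : σ →₀ ℕ) (ξ : σ → A) (f : MvPolynomial σ A) :
    hasse κ (shift ξ f) = shift ξ (hasse κ f) := by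
  induction hn : κ.degree generalizing κ with
  | zero =>
    have : κ = 0 := (Finsupp.degree_eq_zero_iff κ).mp hn
    rw [this, hasse_zero_left, hasse_zero_left]
  | succ n ih =>
    obtain ⟨a, κ', rfl, h2⟩ := exists_sub_single (κ := κ) (by rintro rfl; simp at hn)
    have h := ih κ' (by omega)
    have h3 := congrArg (pderiv a) h
    rw [pderiv_hasse, pderiv_shift, pderiv_hasse, map_mul, shift_C] at h3
    have hne : (C ((κ' a + 1 : ℕ) : A) : MvPolynomial σ A) ≠ 0 := by
      rw [Ne, C_eq_zero]; exact Nat.cast_ne_zero.mpr (Nat.succ_ne_zero _)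
    exact mul_left_cancel₀ hne h3

lemma coeff_shift [IsDomain A] [CharZero A] (κ : σ →₀ ℕ) (ξ : σ → A) (f : MvPolynomial σ A) :
    coeff κ (shift ξ f) = eval ξ (hasse κ f) := by
  rw [← constantCoeff_shift, ← hasse_shift, constantCoeff_eq, coeff_hasse]
  have : bB (0 : σ →₀ ℕ) κ = 1 := by simp [bB]
  simp [this]

end hasse
end SST

end

section
open MvPolynomial

namespace SST

section wronskian
variable {σ : Type*}

lemma prop_of_wronsk_zero_aux (g u : MvPolynomial σ ℚ) (hg : constantCoeff g ≠ 0)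
    (hu : constantCoeff u = 0)
    (h : ∀ a, g * pderiv a u = u * pderiv a g) : u = 0 := by
  classical
  have main : ∀ n : ℕ, ∀ J : σ →₀ ℕ, J.degree = n → coeff J u = 0 := by
    intro n
    induction n using Nat.strong_induction_on with
    | _ n ih =>
    intro J hJ
    by_cases h0 : J = 0
    · subst h0; rwa [constantCoeff_eq] at hu
    obtain ⟨a, J', rfl, hd⟩ := exists_sub_single h0
    have h1 := congrArg (coeff J') (h a)
    rw [coeff_mul, coeff_mul] at h1
    rw [Finset.sum_eq_single ((0 : σ →₀ ℕ), J')] at h1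
    · rw [Finset.sum_eq_zero] at h1
      · rw [coeff_pderiv] at h1
        have h3 : (((J' a : ℕ) : ℚ) + 1) ≠ 0 := by positivity
        simp only [constantCoeff_eq] at hg
        have : coeff 0 g * coeff (J' + Finsupp.single a 1) u * ((J' a : ℚ) + 1) = 0 := by
          rw [← h1]; ring
        rcases mul_eq_zero.mp this with h4 | h4
        · rcases mul_eq_zero.mp h4 with h5 | h5
          · exact absurd h5 hg
          · exact h5
        · exact absurd h4 h3
      · rintro ⟨p, q⟩ hpq
        rw [Finset.HasAntidiagonal.mem_antidiagonal] at hpq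
        simp only at hpq ⊢
        have : p.degree + q.degree = J'.degree := by rw [← hpq]; simp
        rw [ih p.degree (by omega) p rfl, zero_mul]
    · rintro ⟨p, q⟩ hpq hne
      rw [Finset.HasAntidiagonal.mem_antidiagonal] at hpq
      simp only at hpq ⊢
      have hp : p ≠ 0 := by
        rintro rfl; apply hne; rw [zero_add] at hpq; rw [hpq]
      have hp' : p.degree ≠ 0 := fun hc => hp ((Finsupp.degree_eq_zero_iff p).mp hc)
      have e : p.degree + q.degree = J'.degree := by rw [← hpq]; simp
      rw [coeff_pderiv, ih (q.degree + 1) (by omega) _ (by simp)]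
      simp
    · intro hc
      exact absurd (by simp) hc
  ext J
  rw [main _ J rfl, coeff_zero]

lemma prop_of_wronsk_zero (g f : MvPolynomial σ ℚ) (hg : g ≠ 0)
    (h : ∀ a, g * pderiv a f = f * pderiv a g) : ∃ c : ℚ, f = C c * g := by
  classical
  obtain ⟨x, hx⟩ : ∃ x : σ → ℚ, eval x g ≠ 0 := by
    by_contra hc
    push Not at hc
    exact hg (MvPolynomial.funext fun x => by simpa using hc x)
  refine ⟨eval x f / eval x g, ?_⟩
  set c := eval x f / eval x g
  set u := f - C c * g with hu
  have : shift x u = 0 := by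
    apply prop_of_wronsk_zero_aux (shift x g)
    · rwa [constantCoeff_shift]
    · rw [constantCoeff_shift, hu]; simp [c, hx]
    · intro a
      rw [pderiv_shift, pderiv_shift, ← map_mul, ← map_mul]
      congr 1
      rw [hu, map_sub, pderiv_C_mul, mul_sub, h a]
      ring
  have h2 : u = 0 := shift_injective x (by rw [this, map_zero])
  exact sub_eq_zero.mp h2

lemma wronsk_key : ∀ (s : ℕ) (φ : Fin s → MvPolynomial σ ℚ), LinearIndependent ℚ φ →
    ∀ w : Fin s → MvPolynomial σ ℚ,
    (∀ μ : σ →₀ ℕ, μ.degree + 1 ≤ s → ∑ j, w j * hasse μ (φ j) = 0) → w = 0 := by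
  classical
  intro s
  induction s with
  | zero => intro φ _ w _; ext j; exact j.elim0
  | succ s ih =>
    intro φ hφ w hw
    have hφ' : LinearIndependent ℚ (φ ∘ Fin.castSucc) := hφ.comp _ (Fin.castSucc_injective s)
    have claim : ∀ v : Fin (s + 1) → MvPolynomial σ ℚ, v (Fin.last s) = 0 →
        (∀ μ : σ →₀ ℕ, μ.degree + 1 ≤ s → ∑ j, v j * hasse μ (φ j) = 0) → v = 0 := by
      intro v hv hrel
      have := ih _ hφ' (v ∘ Fin.castSucc) (by
        intro μ hμ
        have := hrel μ hμ
        rw [Fin.sum_univ_castSucc, hv, zero_mul, add_zero] at this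
        exact this)
      ext1 j
      refine Fin.lastCases hv (fun j => ?_) j
      exact congrFun this j
    by_cases hl : w (Fin.last s) = 0
    · exact claim w hl fun μ hμ => hw μ (by omega)
    exfalso
    have hd : ∀ a (μ : σ →₀ ℕ), μ.degree + 1 ≤ s →
        ∑ j, pderiv a (w j) * hasse μ (φ j) = 0 := by
      intro a μ hμ
      have h1 := congrArg (pderiv a) (hw μ (by omega))
      rw [map_sum, map_zero] at h1
      simp only [pderiv_mul, pderiv_hasse] at h1
      rw [Finset.sum_add_distrib] at h1
      have h2 := hw (μ + Finsupp.single a 1) (by simp; omega)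
      have h3 : ∑ j, w j * (C ((μ a + 1 : ℕ) : ℚ) * hasse (μ + Finsupp.single a 1) (φ j)) = 0 := by
        have : ∀ j, w j * (C ((μ a + 1 : ℕ) : ℚ) * hasse (μ + Finsupp.single a 1) (φ j)) =
          C ((μ a + 1 : ℕ) : ℚ) * (w j * hasse (μ + Finsupp.single a 1) (φ j)) := fun j => by ring
        simp only [this]
        rw [← Finset.mul_sum, h2, mul_zero]
      rw [h3, add_zero] at h1
      exact h1
    have hprop : ∀ a j, w (Fin.last s) * pderiv a (w j) = w j * pderiv a (w (Fin.last s)) := by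
      intro a j
      have := claim (fun j => w (Fin.last s) * pderiv a (w j) - w j * pderiv a (w (Fin.last s)))
        (by simp) (by
          intro μ hμ
          have : ∀ j, (w (Fin.last s) * pderiv a (w j) - w j * pderiv a (w (Fin.last s)))
              * hasse μ (φ j) = w (Fin.last s) * (pderiv a (w j) * hasse μ (φ j)) -
              pderiv a (w (Fin.last s)) * (w j * hasse μ (φ j)) := fun j => by ring
          simp only [this]
          rw [Finset.sum_sub_distrib, ← Finset.mul_sum, ← Finset.mul_sum, hd a μ hμ,
            hw μ (by omega)]
          simp)
      exact sub_eq_zero.mp (congrFun this j)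
    have hc : ∀ j, ∃ c : ℚ, w j = C c * w (Fin.last s) := fun j =>
      prop_of_wronsk_zero _ _ hl fun a => hprop a j
    choose c hc using hc
    have h0 := hw 0 (by simp)
    simp only [hasse_zero_left] at h0
    have h1 : w (Fin.last s) * ∑ j, c j • φ j = 0 := by
      rw [← h0, Finset.mul_sum]
      refine Finset.sum_congr rfl fun j _ => ?_
      conv_rhs => rw [hc j]
      rw [smul_eq_C_mul]; ring
    have h2 := (mul_eq_zero.mp h1).resolve_left hl
    have h3 := Fintype.linearIndependent_iff.mp hφ c h2 (Fin.last s)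
    have h4 := hc (Fin.last s)
    rw [h3] at h4
    simp at h4
    exact hl h4

lemma wronskian (s : ℕ) (φ : Fin s → MvPolynomial σ ℚ) (hφ : LinearIndependent ℚ φ) :
    ∃ μ : Fin s → (σ →₀ ℕ), (∀ i, (μ i).degree + 1 ≤ s) ∧
      (Matrix.of fun i j => hasse (μ i) (φ j)).det ≠ 0 := by
  classical
  let K := FractionRing (MvPolynomial σ ℚ)
  let ψ := algebraMap (MvPolynomial σ ℚ) K
  have hψ : Function.Injective ψ := IsFractionRing.injective _ _
  let r : {μ : σ →₀ ℕ // μ.degree + 1 ≤ s} → (Fin s → K) := fun μ j => ψ (hasse μ.1 (φ j))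
  have hspan : Submodule.span K (Set.range r) = ⊤ := by
    by_contra hne
    obtain ⟨f, hf0, hf⟩ := Submodule.exists_le_ker_of_lt_top _ (lt_top_iff_ne_top.mpr hne)
    obtain ⟨b, hb⟩ := IsLocalization.exist_integer_multiples_of_finite
      (nonZeroDivisors (MvPolynomial σ ℚ)) (fun j : Fin s => f (Pi.single j 1))
    choose w hw using hb
    have hw0 : w = 0 := by
      refine wronsk_key s φ hφ w fun μ hμ => ?_
      apply hψ
      have h1 : f (r ⟨μ, hμ⟩) = 0 := hf (Submodule.subset_span ⟨_, rfl⟩)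
      rw [map_sum, map_zero]
      have h2 : f (r ⟨μ, hμ⟩) = ∑ j, ψ (hasse μ (φ j)) * f (Pi.single j 1) := by
        conv_lhs => rw [← LinearMap.sum_single_apply (φ := fun _ => K) (r ⟨μ, hμ⟩), map_sum]
        refine Finset.sum_congr rfl fun j _ => ?_
        rw [← smul_eq_mul, ← map_smul, ← Pi.single_smul, smul_eq_mul,
          mul_one]
      rw [h2] at h1
      have h3 := congrArg (fun x => ψ b.1 * x) h1
      simp only [mul_zero, Finset.mul_sum] at h3
      rw [← h3]
      refine Finset.sum_congr rfl fun j _ => ?_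
      have := hw j
      rw [map_mul]
      change ψ (w j) = _ at this
      rw [this, Algebra.smul_def]
      change ψ b.1 * _ * _ = _
      ring
    apply hf0
    refine LinearMap.pi_ext' fun j => ?_
    ext
    simp only [LinearMap.comp_apply, LinearMap.single_apply, LinearMap.zero_apply]
    have := hw j
    rw [hw0, Pi.zero_apply, map_zero, Algebra.smul_def] at this
    refine (mul_eq_zero.mp this.symm).resolve_left ?_
    intro hc
    exact nonZeroDivisors.ne_zero b.2 (hψ (by rw [map_zero]; exact hc))
  obtain ⟨B, hB, hBs, hBl⟩ := exists_linearIndependent K (Set.range r)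
  have hB2 : Submodule.span K (Set.range (Subtype.val : B → (Fin s → K))) = ⊤ := by
    rw [Subtype.range_coe, hBs, hspan]
  let bas := Module.Basis.mk hBl hB2.ge
  have e : B ≃ Fin s := by
    haveI : Fintype B := FiniteDimensional.fintypeBasisIndex bas
    refine Fintype.equivOfCardEq ?_
    rw [← Module.finrank_eq_card_basis bas]
    simp
  have hch : ∀ i : Fin s, ∃ μ : {μ : σ →₀ ℕ // μ.degree + 1 ≤ s}, r μ = (e.symm i).1 :=
    fun i => hB (e.symm i).2
  choose μ hμ using hch
  refine ⟨fun i => (μ i).1, fun i => (μ i).2, ?_⟩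
  intro hdet
  have hli : LinearIndependent K (fun i => r (μ i)) := by
    have : (fun i => r (μ i)) = (Subtype.val : B → (Fin s → K)) ∘ e.symm := by
      ext1 i; simp [hμ]
    rw [this]
    exact hBl.comp _ e.symm.injective
  have hu : IsUnit (Matrix.of fun i => r (μ i)) :=
    Matrix.linearIndependent_rows_iff_isUnit.mp hli
  rw [Matrix.isUnit_iff_isUnit_det, isUnit_iff_ne_zero] at hu
  apply hu
  have h5 : (Matrix.of fun i => r (μ i)) =
      ψ.mapMatrix (Matrix.of fun i j => hasse (μ i).1 (φ j)) := by
    ext i j; simp [r]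
  rw [h5, ← RingHom.map_det, hdet, map_zero]

end wronskian
end SST

end

section
open MvPolynomial

namespace SST

/-- absolute value on `ℤ` as a ring seminorm -/
noncomputable def nuZ : RingSeminorm ℤ where
  toFun x := |(x : ℝ)|
  map_zero' := by simp
  add_le' x y := by push_cast; exact abs_add_le _ _
  neg' x := by simp
  mul_le' x y := by push_cast; rw [abs_mul]

lemma nuZ_apply (x : ℤ) : nuZ x = |(x : ℝ)| := rfl
lemma nuZ_one : nuZ 1 ≤ 1 := by simp [nuZ_apply]

lemma one_le_l1 {σ : Type*} {f : MvPolynomial σ ℤ} (hf : f ≠ 0) : 1 ≤ l1 nuZ f := by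
  obtain ⟨I, hI⟩ := MvPolynomial.ne_zero_iff.mp hf
  refine le_trans ?_ (coeff_le_l1 nuZ f I)
  rw [nuZ_apply]
  exact_mod_cast Int.one_le_abs hI

/-- `f` only involves monomials of weight at least `θ` -/
def LB {σ A : Type*} [CommRing A] (w : (σ →₀ ℕ) →+ ℝ) (f : MvPolynomial σ A) (θ : ℝ) : Prop :=
  ∀ K, coeff K f ≠ 0 → θ ≤ w K

section LB
variable {σ A : Type*} [CommRing A] {w : (σ →₀ ℕ) →+ ℝ}

lemma LB.mul {f g : MvPolynomial σ A} {a b : ℝ} (hf : LB w f a) (hg : LB w g b) :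
    LB w (f * g) (a + b) := by
  classical
  intro K hK
  rw [coeff_mul] at hK
  obtain ⟨⟨p, q⟩, hpq, h⟩ := Finset.exists_ne_zero_of_sum_ne_zero hK
  rw [Finset.HasAntidiagonal.mem_antidiagonal] at hpq
  simp only at hpq h
  rw [← hpq, map_add]
  exact add_le_add (hf _ (left_ne_zero_of_mul h)) (hg _ (right_ne_zero_of_mul h))

lemma LB.prod {ι : Type*} (s : Finset ι) {f : ι → MvPolynomial σ A} {a : ι → ℝ}
    (h : ∀ i ∈ s, LB w (f i) (a i)) : LB w (∏ i ∈ s, f i) (∑ i ∈ s, a i) := by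
  classical
  induction s using Finset.induction_on with
  | empty =>
    intro K hK
    simp only [Finset.prod_empty, coeff_one] at hK
    have : K = 0 := by
      by_contra hc
      exact hK (if_neg (Ne.symm hc))
    simp [this]
  | insert i s hi ih =>
    rw [Finset.prod_insert hi, Finset.sum_insert hi]
    exact (h i (by simp)).mul (ih fun j hj => h j (by simp [hj]))

lemma LB.sum {ι : Type*} (s : Finset ι) {f : ι → MvPolynomial σ A} {a : ℝ}
    (h : ∀ i ∈ s, LB w (f i) a) : LB w (∑ i ∈ s, f i) a := by
  intro K hK
  rw [coeff_sum] at hK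
  obtain ⟨i, hi, h2⟩ := Finset.exists_ne_zero_of_sum_ne_zero hK
  exact h i hi K h2

lemma LB.det {s : ℕ} {M : Matrix (Fin s) (Fin s) (MvPolynomial σ A)} {a : Fin s → ℝ}
    (h : ∀ i j, LB w (M i j) (a j)) : LB w M.det (∑ j, a j) := by
  rw [Matrix.det_apply]
  refine LB.sum _ fun π _ => ?_
  have h2 := LB.prod (w := w) Finset.univ (f := fun i => M (π i) i) (a := a) fun i _ => h _ _
  rcases Int.units_eq_one_or (Equiv.Perm.sign π) with h3 | h3 <;> rw [h3]
  · simpa using h2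
  · intro K hK
    rw [Units.neg_smul, one_smul, coeff_neg] at hK
    exact h2 K (by simpa using hK)

end LB

/-- weight given by coefficients -/
noncomputable def wtHom {σ : Type*} (s : Finset σ) (c : σ → ℝ) : (σ →₀ ℕ) →+ ℝ where
  toFun K := ∑ v ∈ s, K v * c v
  map_zero' := by simp
  map_add' x y := by simp [add_mul, Finset.sum_add_distrib]

lemma wtHom_apply {σ : Type*} (s : Finset σ) (c : σ → ℝ) (K : σ →₀ ℕ) :
    wtHom s c K = ∑ v ∈ s, K v * c v := rfl

section sep
variable {A : Type*} [CommRing A] {m : ℕ}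

/-- no variable `m` -/
def Off (m : ℕ) (f : MvPolynomial ℕ A) : Prop := ∀ I, coeff I f ≠ 0 → I m = 0
/-- only variable `m` -/
def On (m : ℕ) (f : MvPolynomial ℕ A) : Prop := ∀ I, coeff I f ≠ 0 → I = Finsupp.single m (I m)

lemma Off_iff {f : MvPolynomial ℕ A} : Off m f ↔ f ∈ supported A ({m}ᶜ : Set ℕ) := by
  classical
  rw [mem_supported]
  constructor
  · intro h v hv
    simp only [Finset.mem_coe, mem_vars] at hv
    obtain ⟨I, hI, hv⟩ := hv
    rintro rfl
    exact (Finsupp.mem_support_iff.mp hv) (h I (mem_support_iff.mp hI))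
  · intro h I hI
    by_contra hc
    have : m ∈ f.vars := by
      rw [mem_vars]; exact ⟨I, mem_support_iff.mpr hI, Finsupp.mem_support_iff.mpr hc⟩
    exact h this rfl

lemma On_iff {f : MvPolynomial ℕ A} : On m f ↔ f ∈ supported A ({m} : Set ℕ) := by
  classical
  rw [mem_supported]
  constructor
  · intro h v hv
    simp only [Finset.mem_coe, mem_vars] at hv
    obtain ⟨I, hI, hv⟩ := hv
    have h2 := h I (mem_support_iff.mp hI)
    rw [h2] at hv
    by_contra hc
    rw [Finsupp.mem_support_iff] at hv
    apply hv
    rw [Finsupp.single_apply, if_neg]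
    rintro rfl; exact hc rfl
  · intro h I hI
    ext v
    by_cases hv : v = m
    · subst hv; simp
    rw [Finsupp.single_apply, if_neg (Ne.symm hv)]
    by_contra hc
    have : v ∈ f.vars := by
      rw [mem_vars]; exact ⟨I, mem_support_iff.mpr hI, Finsupp.mem_support_iff.mpr hc⟩
    exact hv (h this)

lemma Off.hasse {f : MvPolynomial ℕ A} (h : Off m f) (κ : ℕ →₀ ℕ) : Off m (hasse κ f) := by
  intro I hI
  rw [coeff_hasse] at hI
  have := h _ (right_ne_zero_of_mul hI)
  simp at this; omega

lemma On.hasse {f : MvPolynomial ℕ A} (h : On m f) (κ : ℕ →₀ ℕ) : On m (hasse κ f) := by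
  intro I hI
  rw [coeff_hasse] at hI
  have := h _ (right_ne_zero_of_mul hI)
  ext v
  have h2 := DFunLike.congr_fun this v
  by_cases hv : v = m
  · subst hv; simp
  simp [Finsupp.single_apply, Ne.symm hv] at h2 ⊢
  omega

lemma supported_shift {S : Set ℕ} {f : MvPolynomial ℕ A} (ξ : ℕ → A) (h : f ∈ supported A S) :
    shift ξ f ∈ supported A S := by
  have : (supported A S).map (shift ξ) ≤ supported A S := by
    rw [supported, AlgHom.map_adjoin]
    refine Algebra.adjoin_le ?_
    rintro _ ⟨_, ⟨v, hv, rfl⟩, rfl⟩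
    rw [shift_X]
    exact add_mem (Algebra.subset_adjoin ⟨v, hv, rfl⟩) (Subalgebra.algebraMap_mem _ _)
  exact this ⟨f, h, rfl⟩

lemma det_mem_supported {S : Set ℕ} {s : ℕ} (M : Matrix (Fin s) (Fin s) (MvPolynomial ℕ A))
    (h : ∀ i j, M i j ∈ supported A S) : M.det ∈ supported A S := by
  rw [Matrix.det_apply]
  refine sum_mem fun π _ => ?_
  have := prod_mem (S := supported A S) (t := Finset.univ) (f := fun i => M (π i) i)
    fun i _ => h _ _
  rcases Int.units_eq_one_or (Equiv.Perm.sign π) with h3 | h3 <;> rw [h3]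
  · simpa using this
  · rw [Units.neg_smul, one_smul]; exact neg_mem this

lemma coeff_sep {φ ψ : MvPolynomial ℕ A} (hφ : Off m φ) (hψ : On m ψ) (I : ℕ →₀ ℕ) (hI : I m = 0)
    (k : ℕ) : coeff (I + Finsupp.single m k) (φ * ψ) =
      coeff I φ * coeff (Finsupp.single m k) ψ := by
  classical
  rw [coeff_mul, Finset.sum_eq_single (I, Finsupp.single m k)]
  · rintro ⟨p, q⟩ hpq hne
    rw [Finset.HasAntidiagonal.mem_antidiagonal] at hpq
    simp only at hpq ⊢
    by_contra hc
    have h1 := hφ _ (left_ne_zero_of_mul hc)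
    have h2 := hψ _ (right_ne_zero_of_mul hc)
    apply hne
    have hk : q m = k := by
      have := DFunLike.congr_fun hpq m
      simp [h1, hI] at this; exact this
    have hq : q = Finsupp.single m k := by rw [h2, hk]
    subst hq
    rw [add_right_cancel hpq]
  · intro hc
    exact absurd (by simp) hc

lemma split_exp (J : ℕ →₀ ℕ) (m : ℕ) : J = J.erase m + Finsupp.single m (J m) :=
  (Finsupp.erase_add_single m J).symm

lemma hasse_sep {φ ψ : MvPolynomial ℕ A} (hφ : Off m φ) (hψ : On m ψ) (μ : ℕ →₀ ℕ) (hμ : μ m = 0)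
    (l : ℕ) : hasse (μ + Finsupp.single m l) (φ * ψ) =
      hasse μ φ * hasse (Finsupp.single m l) ψ := by
  classical
  ext J
  rw [split_exp J m]
  set I := J.erase m
  set k := J m
  have hI : I m = 0 := by simp [I]
  rw [coeff_sep (hφ.hasse μ) (hψ.hasse _) I hI k, coeff_hasse, coeff_hasse, coeff_hasse]
  have e : I + Finsupp.single m k + (μ + Finsupp.single m l) =
      (I + μ) + Finsupp.single m (k + l) := by
    rw [Finsupp.single_add]; abel
  rw [e, coeff_sep hφ hψ (I + μ) (by simp [hI, hμ]), ← Finsupp.single_add]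
  have hb : bB (I + Finsupp.single m k) (μ + Finsupp.single m l) =
      bB I μ * bB (Finsupp.single m k) (Finsupp.single m l) := by
    set S := μ.support.erase m
    have hmS : m ∉ S := by simp [S]
    have hs1 : μ.support ⊆ insert m S := by
      intro v hv; simp only [S, Finset.mem_insert, Finset.mem_erase]; tauto
    have hs2 : (Finsupp.single m l).support ⊆ insert m S :=
      Finsupp.support_single_subset.trans (by simp)
    rw [bB_eq _ _ (insert m S) (Finsupp.support_add.trans (Finset.union_subset hs1 hs2)),
      bB_eq _ _ _ hs1, bB_eq _ _ _ hs2, Finset.prod_insert hmS, Finset.prod_insert hmS,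
      Finset.prod_insert hmS]
    have h1 : ∀ v ∈ S, v ≠ m := fun v hv => by rintro rfl; exact hmS hv
    rw [Finset.prod_congr rfl (g := fun v => (I v + μ v).choose (μ v)) (fun v hv => by
      simp [Finsupp.single_apply, (h1 v hv).symm])]
    rw [Finset.prod_eq_one (f := fun v => ((Finsupp.single m k) v + (Finsupp.single m l) v).choose
      ((Finsupp.single m l) v)) (fun v hv => by
      simp [Finsupp.single_apply, (h1 v hv).symm])]
    simp [hI, hμ]; ring
  rw [hb]; push_cast; ring

/-- extracting a sub-polynomial -/
noncomputable def extr (S : Finset (ℕ →₀ ℕ)) (J : ℕ →₀ ℕ) (f : MvPolynomial ℕ A) :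
    MvPolynomial ℕ A := ∑ I ∈ S, monomial I (coeff (I + J) f)

lemma coeff_extr (S : Finset (ℕ →₀ ℕ)) (J : ℕ →₀ ℕ) (f : MvPolynomial ℕ A) (I : ℕ →₀ ℕ) :
    coeff I (extr S J f) = if I ∈ S then coeff (I + J) f else 0 := by
  classical
  rw [extr, coeff_sum]
  simp [coeff_monomial]

lemma l1_extr (ν : RingSeminorm A) (S : Finset (ℕ →₀ ℕ)) (J : ℕ →₀ ℕ) (f : MvPolynomial ℕ A) :
    l1 ν (extr S J f) ≤ l1 ν f := by
  classical
  refine (l1_sum ν _ _).trans ?_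
  simp only [l1_monomial]
  have h2 : ∑ I ∈ S, ν (coeff (I + J) f) = ∑ I ∈ S.map (addRightEmbedding J), ν (coeff I f) := by
    rw [Finset.sum_map]; rfl
  rw [h2, l1_eq_of_subset ν f (f.support ∪ S.map (addRightEmbedding J)) Finset.subset_union_left]
  exact Finset.sum_le_sum_of_subset_of_nonneg Finset.subset_union_right
    fun _ _ _ => apply_nonneg ν _

end sep

section onevar

lemma coeff_aeval_X (m : ℕ) {A : Type*} [CommRing A] (P : Polynomial A) (j : ℕ) :
    coeff (Finsupp.single m j) (Polynomial.aeval (X m : MvPolynomial ℕ A) P) = P.coeff j := by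
  classical
  rw [Polynomial.aeval_eq_sum_range, coeff_sum]
  simp only [coeff_smul, coeff_X_pow, smul_eq_mul]
  rw [Finset.sum_eq_single j]
  · simp
  · intro i _ hi
    rw [if_neg, mul_zero]
    intro h
    exact hi (Finsupp.single_injective m h)
  · intro h
    rw [Finset.mem_range, not_lt] at h
    rw [Polynomial.coeff_eq_zero_of_natDegree_lt (by omega), zero_mul]

lemma On.exists_poly {m : ℕ} {A : Type*} [CommRing A] {f : MvPolynomial ℕ A} (h : On m f) :
    ∃ P : Polynomial A, f = Polynomial.aeval (X m : MvPolynomial ℕ A) P := by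
  classical
  refine ⟨∑ I ∈ f.support, Polynomial.monomial (I m) (coeff I f), ?_⟩
  rw [map_sum]
  conv_lhs => rw [f.as_sum]
  refine Finset.sum_congr rfl fun I hI => ?_
  rw [Polynomial.aeval_monomial, h I (mem_support_iff.mp hI)]
  simp only [Finsupp.single_eq_same]
  rw [← C_mul_X_pow_eq_monomial]; rfl

lemma onevar_bound {m : ℕ} {f : MvPolynomial ℕ ℤ} (h : On m f) (hf : f ≠ 0) (p q : ℤ)
    (hq : 0 < q) (hpq : IsCoprime p q) (ξ : ℕ → ℚ) (hξ : ξ m = (p : ℚ) / q) (k : ℕ)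
    (hk : ∀ j < k, coeff (Finsupp.single m j) (shift ξ (map (Int.castRingHom ℚ) f)) = 0) :
    (q : ℝ) ^ k ≤ l1 nuZ f := by
  classical
  obtain ⟨P, hP⟩ := h.exists_poly
  have hP0 : P ≠ 0 := by rintro rfl; simp at hP; exact hf hP
  have hmap : map (Int.castRingHom ℚ) f =
      Polynomial.aeval (X m : MvPolynomial ℕ ℚ) (P.map (Int.castRingHom ℚ)) := by
    rw [hP]
    rw [Polynomial.aeval_def, Polynomial.aeval_def, Polynomial.hom_eval₂, Polynomial.eval₂_map,
      map_X]
    congr 1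
    exact RingHom.ext_int _ _
  have hsh : shift ξ (map (Int.castRingHom ℚ) f) = Polynomial.aeval (X m : MvPolynomial ℕ ℚ)
      (Polynomial.taylor (ξ m) (P.map (Int.castRingHom ℚ))) := by
    rw [hmap, ← Polynomial.aeval_algHom_apply, shift_X, Polynomial.taylor_apply,
      Polynomial.aeval_comp]
    simp [algebraMap_eq]
  have hdvd : (Polynomial.X : Polynomial ℚ) ^ k ∣
      Polynomial.taylor (ξ m) (P.map (Int.castRingHom ℚ)) := by
    rw [Polynomial.X_pow_dvd_iff]
    intro j hj
    rw [← coeff_aeval_X m, ← hsh, hk j hj]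
  have hdvd2 : (Polynomial.X - Polynomial.C (ξ m)) ^ k ∣ P.map (Int.castRingHom ℚ) := by
    obtain ⟨Q, hQ⟩ := hdvd
    refine ⟨Polynomial.taylor (-ξ m) Q, ?_⟩
    have := congrArg (Polynomial.taylor (-ξ m)) hQ
    rw [Polynomial.taylor_taylor] at this
    simpa [Polynomial.taylor_mul, sub_eq_add_neg, Polynomial.taylor_pow] using this
  set R : Polynomial ℤ := Polynomial.C q * Polynomial.X - Polynomial.C p with hR
  have hRprim : R.IsPrimitive := by
    intro r hr
    rw [Polynomial.C_dvd_iff_dvd_coeff] at hr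
    have h0 := hr 0
    have h1 := hr 1
    have e0 : R.coeff 0 = -p := by
      simp only [hR, Polynomial.coeff_sub, Polynomial.coeff_C_mul, Polynomial.coeff_X_zero,
        Polynomial.coeff_C_zero]; ring
    have e1 : R.coeff 1 = q := by
      simp only [hR, Polynomial.coeff_sub, Polynomial.coeff_C_mul, Polynomial.coeff_X_one,
        Polynomial.coeff_C_succ]; ring
    rw [e0, dvd_neg] at h0
    rw [e1] at h1
    exact hpq.isUnit_of_dvd' h0 h1
  have hRk : (R ^ k).IsPrimitive := by
    induction k with
    | zero => simpa using Polynomial.isPrimitive_one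
    | succ k ih =>
      rw [pow_succ]
      exact (ih (fun j hj => hk j (by omega)) ((pow_dvd_pow _ (Nat.le_succ k)).trans hdvd)
        ((pow_dvd_pow _ (Nat.le_succ k)).trans hdvd2)).mul hRprim
  have hqQ : (q : ℚ) ≠ 0 := by exact_mod_cast hq.ne'
  have hdvd3 : R ^ k ∣ P := by
    refine (Polynomial.IsPrimitive.Int.dvd_iff_map_cast_dvd_map_cast _ _ hRk).mpr ?_
    · have : (R ^ k).map (Int.castRingHom ℚ) =
        Polynomial.C ((q : ℚ) ^ k) * (Polynomial.X - Polynomial.C (ξ m)) ^ k := by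
        rw [Polynomial.map_pow, Polynomial.C_pow, ← mul_pow]
        congr 1
        simp only [hR, Polynomial.map_sub, Polynomial.map_mul, Polynomial.map_C, Polynomial.map_X,
          mul_sub, ← Polynomial.C_mul, hξ]
        congr 2
        simp; field_simp
      rw [this]
      obtain ⟨Q, hQ⟩ := hdvd2
      refine ⟨Polynomial.C (((q : ℚ) ^ k)⁻¹) * Q, ?_⟩
      rw [hQ]
      have : Polynomial.C ((q : ℚ) ^ k) * Polynomial.C (((q : ℚ) ^ k)⁻¹) = 1 := by
        rw [← Polynomial.C_mul, mul_inv_cancel₀ (pow_ne_zero _ hqQ), Polynomial.C_1]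
      calc _ = 1 * ((Polynomial.X - Polynomial.C (ξ m)) ^ k * Q) := by rw [one_mul]
        _ = _ := by rw [← this]; ring
  obtain ⟨Q, hQ⟩ := hdvd3
  have hlc : P.leadingCoeff = q ^ k * Q.leadingCoeff := by
    rw [hQ, Polynomial.leadingCoeff_mul, Polynomial.leadingCoeff_pow]
    congr 2
    have : R = Polynomial.C q * Polynomial.X + Polynomial.C (-p) := by simp [hR, sub_eq_add_neg]
    rw [this, Polynomial.leadingCoeff_linear hq.ne']
  have hQ0 : Q.leadingCoeff ≠ 0 := by
    rw [Ne, Polynomial.leadingCoeff_eq_zero]; rintro rfl; simp at hQ; exact hP0 hQ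
  have h5 : (q : ℝ) ^ k ≤ nuZ P.leadingCoeff := by
    rw [nuZ_apply, hlc]
    push_cast
    rw [abs_mul, abs_of_pos (pow_pos (by exact_mod_cast hq) k)]
    have : (1 : ℝ) ≤ |(Q.leadingCoeff : ℝ)| := by exact_mod_cast Int.one_le_abs hQ0
    nlinarith [pow_pos (show (0 : ℝ) < q by exact_mod_cast hq) k]
  refine h5.trans ?_
  rw [Polynomial.leadingCoeff, ← coeff_aeval_X m P P.natDegree, ← hP]
  exact coeff_le_l1 _ _ _

end onevar
end SST

end

section
open MvPolynomial

namespace SST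

section decomp
variable {E : Type*} [CommRing E] [Algebra ℚ E]

/-- `f` is a sum of `s` products -/
def SumProd (A B : Submodule ℚ E) (f : E) (s : ℕ) : Prop :=
  ∃ φ ψ : Fin s → E, (∀ j, φ j ∈ A) ∧ (∀ j, ψ j ∈ B) ∧ f = ∑ j, φ j * ψ j

lemma SumProd.swap {A B : Submodule ℚ E} {f : E} {s : ℕ} (h : SumProd A B f s) :
    SumProd B A f s := by
  obtain ⟨φ, ψ, h1, h2, h3⟩ := h
  exact ⟨ψ, φ, h2, h1, by rw [h3]; exact Finset.sum_congr rfl fun _ _ => mul_comm _ _⟩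

lemma sumProd_reduce {A B : Submodule ℚ E} {f : E} {s : ℕ} (φ ψ : Fin s → E) (h1 : ∀ j, φ j ∈ A)
    (h2 : ∀ j, ψ j ∈ B) (h3 : f = ∑ j, φ j * ψ j) (hd : ¬ LinearIndependent ℚ φ) :
    ∃ t < s, SumProd A B f t := by
  rw [Fintype.not_linearIndependent_iff] at hd
  obtain ⟨g, hg, k, hk⟩ := hd
  match s, φ, ψ, h1, h2, h3, g, hg, k, hk with
  | 0, _, _, _, _, _, _, _, k, _ => exact k.elim0
  | s + 1, φ, ψ, h1, h2, h3, g, hg, k, hk =>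
    refine ⟨s, Nat.lt_succ_self s, fun j => φ (k.succAbove j),
      fun j => ψ (k.succAbove j) - (g (k.succAbove j) / g k) • ψ k, fun j => h1 _,
      fun j => B.sub_mem (h2 _) (B.smul_mem _ (h2 _)), ?_⟩
    rw [h3, Fin.sum_univ_succAbove _ k]
    rw [Fin.sum_univ_succAbove _ k] at hg
    have e1 : φ k = - ∑ j, (g (k.succAbove j) / g k) • φ (k.succAbove j) := by
      have : (g k)⁻¹ • (g k • φ k + ∑ j, g (k.succAbove j) • φ (k.succAbove j)) = 0 := by
        rw [hg, smul_zero]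
      rw [smul_add, smul_smul, inv_mul_cancel₀ hk, one_smul, Finset.smul_sum] at this
      rw [eq_neg_of_add_eq_zero_left this]
      congr 1
      refine Finset.sum_congr rfl fun j _ => ?_
      rw [smul_smul]; congr 1; field_simp
    rw [e1, neg_mul, Finset.sum_mul, neg_add_eq_sub, ← Finset.sum_sub_distrib]
    refine Finset.sum_congr rfl fun j _ => ?_
    rw [mul_sub, smul_mul_assoc, mul_smul_comm]

lemma sumProd_min {A B : Submodule ℚ E} {f : E} {s0 : ℕ} (h : SumProd A B f s0) :
    ∃ s ≤ s0, ∃ φ ψ : Fin s → E, (∀ j, φ j ∈ A) ∧ (∀ j, ψ j ∈ B) ∧ f = ∑ j, φ j * ψ j ∧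
      LinearIndependent ℚ φ ∧ LinearIndependent ℚ ψ := by
  classical
  have hex : ∃ s, SumProd A B f s := ⟨s0, h⟩
  obtain ⟨φ, ψ, h1, h2, h3⟩ := Nat.find_spec hex
  refine ⟨Nat.find hex, Nat.find_min' hex h, φ, ψ, h1, h2, h3, ?_, ?_⟩
  · by_contra hc
    obtain ⟨t, ht, h4⟩ := sumProd_reduce φ ψ h1 h2 h3 hc
    exact Nat.find_min hex ht h4
  · by_contra hc
    obtain ⟨t, ht, h4⟩ := sumProd_reduce ψ φ h2 h1
      (h3.trans (Finset.sum_congr rfl fun _ _ => mul_comm _ _)) hc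
    exact Nat.find_min hex ht h4.swap

end decomp

lemma decomp (m : ℕ) (f : MvPolynomial ℕ ℚ) (hf : f ≠ 0) (D : ℕ) (hD : degreeOf m f ≤ D) :
    ∃ s, 1 ≤ s ∧ s ≤ D + 1 ∧ ∃ φ ψ : Fin s → MvPolynomial ℕ ℚ, (∀ j, Off m (φ j)) ∧
      (∀ j, On m (ψ j)) ∧ f = ∑ j, φ j * ψ j ∧
      LinearIndependent ℚ φ ∧ LinearIndependent ℚ ψ := by
  classical
  have h0 : SumProd (supported ℚ ({m}ᶜ : Set ℕ)).toSubmodule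
      (supported ℚ ({m} : Set ℕ)).toSubmodule f (D + 1) := by
    refine ⟨fun j : Fin (D + 1) => ∑ I ∈ f.support with I m = (j : ℕ), monomial (I.erase m) (coeff I f),
      fun j : Fin (D + 1) => monomial (Finsupp.single m (j : ℕ)) 1, fun j => ?_, fun j => ?_, ?_⟩
    · refine sum_mem fun I _ => ?_
      rw [Subalgebra.mem_toSubmodule, ← Off_iff]
      intro K hK
      rw [coeff_monomial] at hK
      have : I.erase m = K := by by_contra hc; exact hK (if_neg hc)
      rw [← this]; simp
    · rw [Subalgebra.mem_toSubmodule, ← On_iff]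
      intro K hK
      rw [coeff_monomial] at hK
      have : Finsupp.single m (j : ℕ) = K := by by_contra hc; exact hK (if_neg hc)
      rw [← this]; simp
    · conv_lhs => rw [f.as_sum]
      rw [← Finset.sum_fiberwise_of_maps_to (s := f.support) (t := Finset.range (D + 1))
        (g := fun I => I m), Finset.sum_range]
      · refine Finset.sum_congr rfl fun j _ => ?_
        rw [Finset.sum_mul]
        refine Finset.sum_congr rfl fun I hI => ?_
        rw [monomial_mul, mul_one, ← (Finset.mem_filter.mp hI).2, Finsupp.erase_add_single]
      · intro I hI
        have := monomial_le_degreeOf m hI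
        rw [Finset.mem_range]; omega
  obtain ⟨s, hs, φ, ψ, h1, h2, h3, h4, h5⟩ := sumProd_min h0
  refine ⟨s, ?_, hs, φ, ψ, fun j => Off_iff.mpr (h1 j), fun j => On_iff.mpr (h2 j), h3, h4, h5⟩
  rcases Nat.eq_zero_or_pos s with rfl | h
  · simp at h3; exact absurd h3 hf
  · exact h

lemma wronsk_data (m : ℕ) (f : MvPolynomial ℕ ℤ) (hf : f ≠ 0) (D : ℕ) (hD : degreeOf m f ≤ D) :
    ∃ s, 1 ≤ s ∧ s ≤ D + 1 ∧ ∃ (μ : Fin s → (ℕ →₀ ℕ)) (l : Fin s → ℕ) (U V : MvPolynomial ℕ ℚ),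
      (∀ i, μ i m = 0) ∧ (∀ i, (μ i).degree + 1 ≤ s) ∧ (∀ k, l k < s) ∧ Function.Injective l ∧
      Off m U ∧ On m V ∧ U ≠ 0 ∧ V ≠ 0 ∧
      map (Int.castRingHom ℚ)
        (Matrix.of fun i k => hasse (μ i + Finsupp.single m (l k)) f).det = U * V := by
  classical
  have hinj : Function.Injective (map (Int.castRingHom ℚ) : MvPolynomial ℕ ℤ → _) :=
    map_injective _ (RingHom.injective_int _)
  obtain ⟨s, hs1, hs2, φ, ψ, h1, h2, h3, h4, h5⟩ := decomp m (map (Int.castRingHom ℚ) f)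
    (fun h => hf (hinj (by rw [h, map_zero]))) D ((degreeOf_le_iff).mpr fun I hI =>
      (monomial_le_degreeOf m (support_map_subset _ _ hI)).trans hD)
  obtain ⟨μ, hμ1, hμ2⟩ := wronskian s φ h4
  obtain ⟨κ, hκ1, hκ2⟩ := wronskian s ψ h5
  have hμm : ∀ i, μ i m = 0 := by
    intro i
    by_contra hc
    apply hμ2
    apply Matrix.det_eq_zero_of_row_eq_zero i
    intro j
    simp only [Matrix.of_apply]
    ext J
    rw [coeff_hasse, coeff_zero]
    by_contra h6
    have := h1 j _ (right_ne_zero_of_mul h6)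
    simp at this; omega
  have hκm : ∀ i, κ i = Finsupp.single m (κ i m) := by
    intro i
    by_contra hc
    apply hκ2
    apply Matrix.det_eq_zero_of_row_eq_zero i
    intro j
    simp only [Matrix.of_apply]
    ext J
    rw [coeff_hasse, coeff_zero]
    by_contra h6
    have h7 := h2 j _ (right_ne_zero_of_mul h6)
    apply hc
    ext v
    have h8 := DFunLike.congr_fun h7 v
    by_cases hv : v = m
    · subst hv; simp
    simp [Finsupp.single_apply, Ne.symm hv] at h8 ⊢
    omega
  refine ⟨s, hs1, hs2, μ, fun i => κ i m, _, _, hμm, hμ1, fun k => ?_, ?_, ?_, ?_, hμ2, hκ2, ?_⟩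
  · have := hκ1 k
    have h2 : κ k m ≤ (κ k).degree := Finsupp.le_degree m (κ k)
    show κ k m < s
    omega
  · intro i j hij
    by_contra hne
    apply hκ2
    apply Matrix.det_zero_of_row_eq hne
    ext1 k
    simp only [Matrix.of_apply]
    rw [hκm i, hκm j]; simp only at hij; rw [hij]
  · exact Off_iff.mpr (det_mem_supported _ fun i j => Off_iff.mp ((h1 j).hasse _))
  · exact On_iff.mpr (det_mem_supported _ fun i j => On_iff.mp ((h2 j).hasse _))
  · rw [RingHom.map_det, ← Matrix.det_transpose (Matrix.of fun i j => hasse (κ i) (ψ j)),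
      ← Matrix.det_mul]
    congr 1
    ext1 i k
    simp only [RingHom.mapMatrix_apply, Matrix.map_apply, Matrix.of_apply, Matrix.mul_apply,
      Matrix.transpose_apply]
    rw [← hasse_map, h3, hasse_sum]
    refine Finset.sum_congr rfl fun j _ => ?_
    rw [hasse_sep (h1 j) (h2 j) _ (hμm i)]
    conv_rhs => rw [hκm k]

end SST

end

section
open MvPolynomial

namespace SST

/-- the statement of Roth's lemma in `m` variables -/
def RothStmt (m : ℕ) : Prop :=
  ∀ ε : ℝ, 0 < ε → ∃ τ : ℝ, 0 < τ ∧ τ ≤ 1 ∧ ∀ (d : ℕ → ℕ) (p q : ℕ → ℤ) (f : MvPolynomial ℕ ℤ),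
    f ≠ 0 → (∀ v, degreeOf v f ≤ d v) → (∀ v < m, 1 ≤ d v) → (∀ v, m ≤ v → d v = 0) →
    (∀ v, v + 1 < m → (d (v + 1) : ℝ) ≤ τ * d v) →
    (∀ v < m, 0 < q v ∧ IsCoprime (p v) (q v)) →
    (∀ v < m, Real.log (l1 nuZ f) + d 0 ≤ τ * d v * Real.log (q v)) →
    ∃ I : ℕ →₀ ℕ, coeff I (shift (fun v => (p v : ℚ) / q v) (map (Int.castRingHom ℚ) f)) ≠ 0 ∧
      ∑ v ∈ Finset.range m, (I v : ℝ) / d v < ε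

lemma roth_zero : RothStmt 0 := by
  intro ε hε
  refine ⟨1, one_pos, le_rfl, ?_⟩
  intro d p q f hf hd _ _ _ _ _
  have hinj : Function.Injective (map (Int.castRingHom ℚ) : MvPolynomial ℕ ℤ → _) :=
    map_injective _ (RingHom.injective_int _)
  have : shift (fun v => (p v : ℚ) / q v) (map (Int.castRingHom ℚ) f) ≠ 0 := by
    intro h
    apply hf
    apply hinj
    apply shift_injective (fun v => (p v : ℚ) / q v)
    rw [h]; simp
  obtain ⟨I, hI⟩ := MvPolynomial.ne_zero_iff.mp this
  exact ⟨I, hI, by simpa using hε⟩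

lemma sum_max_bound (s d : ℕ) (hs : s ≤ d + 1) (hd : 1 ≤ d) (θ : ℝ) (h0 : 0 ≤ θ) (h1 : θ ≤ 1) :
    s * (θ ^ 2 / 8) ≤ ∑ l ∈ Finset.range s, max 0 (θ - l / d) := by
  set r := min s (⌊θ * d / 2⌋₊ + 1) with hr
  have hd' : (1 : ℝ) ≤ d := by exact_mod_cast hd
  have hsd : (s : ℝ) ≤ 2 * d := by
    have : (s : ℝ) ≤ d + 1 := by exact_mod_cast hs
    linarith
  have h2 : ∑ l ∈ Finset.range r, max 0 (θ - l / d) ≤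
      ∑ l ∈ Finset.range s, max 0 (θ - l / d) :=
    Finset.sum_le_sum_of_subset_of_nonneg (Finset.range_mono (min_le_left _ _))
      fun _ _ _ => le_max_left _ _
  refine le_trans ?_ h2
  have h3 : ∑ _l ∈ Finset.range r, θ / 2 ≤ ∑ l ∈ Finset.range r, max 0 (θ - l / d) := by
    refine Finset.sum_le_sum fun l hl => ?_
    refine le_trans ?_ (le_max_right _ _)
    rw [Finset.mem_range] at hl
    have hl2 : l ≤ ⌊θ * d / 2⌋₊ := by
      have := min_le_right s (⌊θ * d / 2⌋₊ + 1); omega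
    have hl3 : (l : ℝ) ≤ θ * d / 2 := (Nat.le_floor_iff (by positivity)).mp hl2
    have : (l : ℝ) / d ≤ θ / 2 := by
      rw [div_le_iff₀ (by linarith)]; linarith
    linarith
  refine le_trans ?_ h3
  rw [Finset.sum_const, Finset.card_range, nsmul_eq_mul]
  have hr2 : (s : ℝ) * θ / 4 ≤ r := by
    rw [hr]; push_cast
    apply le_min
    · have : (0 : ℝ) ≤ s := Nat.cast_nonneg s
      nlinarith
    · have := (Nat.lt_floor_add_one (θ * d / 2)).le
      nlinarith
  nlinarith

lemma log_factorial_le (s : ℕ) : Real.log s.factorial ≤ s * s := by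
  rcases Nat.eq_zero_or_pos s with rfl | h
  · simp
  have h1 : (s.factorial : ℝ) ≤ (s : ℝ) ^ s := by exact_mod_cast Nat.factorial_le_pow s
  have h2 := Real.log_le_log (by exact_mod_cast s.factorial_pos) h1
  rw [Real.log_pow] at h2
  have h3 : Real.log s ≤ s := by
    have := Real.log_le_sub_one_of_pos (show (0 : ℝ) < s by exact_mod_cast h); linarith
  exact h2.trans (by gcongr)

lemma roth_succ (m : ℕ) (ih : RothStmt m) : RothStmt (m + 1) := by
  classical
  intro ε₁ hε₁
  set ε := min ε₁ 1 with hεd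
  have hε : 0 < ε := lt_min hε₁ one_pos
  have hε1 : ε ≤ 1 := min_le_right _ _
  obtain ⟨τ', hτ'0, hτ'1, hIH⟩ := ih (ε ^ 2 / 64) (by positivity)
  set τ : ℝ := min (τ' / (m + 4)) (min (ε ^ 2 / (64 * (m + 4))) (ε / 2)) with hτd
  have hm4 : (0 : ℝ) < m + 4 := by positivity
  have hτ0 : 0 < τ := by positivity
  have hτa : (m + 4) * τ ≤ τ' := by
    have : τ ≤ τ' / (m + 4) := min_le_left _ _
    rw [le_div_iff₀ hm4] at this; linarith
  have hτb : (m + 4) * τ ≤ ε ^ 2 / 64 := by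
    have : τ ≤ ε ^ 2 / (64 * (m + 4)) := (min_le_right _ _).trans (min_le_left _ _)
    rw [le_div_iff₀ (by positivity)] at this; linarith
  have hτc : τ ≤ ε / 2 := (min_le_right _ _).trans (min_le_right _ _)
  have hττ' : τ ≤ τ' := by
    have : (0 : ℝ) ≤ m := Nat.cast_nonneg m
    nlinarith
  refine ⟨τ, hτ0, by linarith, ?_⟩
  intro d p q f hf hdeg hd1 hd0 hratio hpq hlog
  set ξ : ℕ → ℚ := fun v => (p v : ℚ) / q v with hξ
  by_contra hcon
  push Not at hcon
  have hcon' : ∀ I : ℕ →₀ ℕ, coeff I (shift ξ (map (Int.castRingHom ℚ) f)) ≠ 0 →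
      ε ≤ ∑ v ∈ Finset.range (m + 1), (I v : ℝ) / d v :=
    fun I hI => (min_le_left _ _).trans (hcon I hI)
  -- monotonicity
  have hdpos : ∀ v < m + 1, (1 : ℝ) ≤ d v := fun v hv => by exact_mod_cast hd1 v hv
  have hstep : ∀ v, v + 1 < m + 1 → (d (v + 1) : ℝ) ≤ d v := by
    intro v hv
    refine (hratio v hv).trans ?_
    have := hdpos v (by omega)
    nlinarith
  have hmono0 : ∀ v < m + 1, (d v : ℝ) ≤ d 0 := by
    intro v
    induction v with
    | zero => intro _; exact le_rfl
    | succ v ihv => intro hv; exact (hstep v hv).trans (ihv (by omega))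
  have hlast : ∀ v < m, (d m : ℝ) ≤ τ * d v := by
    intro v hv
    have : ∀ u, v + 1 ≤ u → u < m + 1 → (d u : ℝ) ≤ τ * d v := by
      intro u hu
      induction u, hu using Nat.le_induction with
      | base => exact hratio v
      | succ u hu ihu => intro h; exact (hstep u h).trans (ihu (by omega))
    exact this m hv (by omega)
  have hdm : (1 : ℝ) ≤ d m := hdpos m (by omega)
  have hfl : 1 ≤ l1 nuZ f := one_le_l1 hf
  have hlogf : 0 ≤ Real.log (l1 nuZ f) := Real.log_nonneg hfl
  have hd01 : (1 : ℝ) ≤ d 0 := hdpos 0 (by omega)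
  obtain ⟨s, hs1, hs2, μ, l, U, V, hμm, hμd, hl, hlinj, hU, hV, hU0, hV0, hW⟩ :=
    wronsk_data m f hf (d m) (hdeg m)
  set W := (Matrix.of fun i k => hasse (μ i + Finsupp.single m (l k)) f).det with hWd
  have hs1' : (1 : ℝ) ≤ s := by exact_mod_cast hs1
  have hsd : (s : ℝ) ≤ 2 * d 0 := by
    have : (s : ℝ) ≤ d m + 1 := by exact_mod_cast hs2
    have := hmono0 m (by omega)
    linarith
  have hmapinj : Function.Injective (map (Int.castRingHom ℚ) : MvPolynomial ℕ ℤ → _) :=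
    map_injective _ (RingHom.injective_int _)
  have hW0 : W ≠ 0 := by
    intro h
    rw [h, map_zero] at hW
    exact mul_ne_zero hU0 hV0 hW.symm
  -- size of W
  have hfdeg : ∀ I ∈ f.support, I.degree ≤ (m + 1) * d 0 := by
    intro I hI
    have hsub : I.support ⊆ Finset.range (m + 1) := by
      intro v hv
      rw [Finset.mem_range]
      by_contra hc
      have h1 := (monomial_le_degreeOf v hI).trans (hdeg v)
      rw [hd0 v (by omega)] at h1
      rw [Finsupp.mem_support_iff] at hv
      omega
    rw [Finsupp.degree_apply]
    calc ∑ v ∈ I.support, I v ≤ ∑ v ∈ Finset.range (m + 1), I v :=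
          Finset.sum_le_sum_of_subset hsub
      _ ≤ ∑ _v ∈ Finset.range (m + 1), d 0 := by
          refine Finset.sum_le_sum fun v hv => ?_
          have h1 := (monomial_le_degreeOf v hI).trans (hdeg v)
          have h2 : d v ≤ d 0 := by exact_mod_cast hmono0 v (Finset.mem_range.mp hv)
          omega
      _ = _ := by simp
  have hWl : Real.log (l1 nuZ W) ≤ s * (Real.log (l1 nuZ f) + (m + 3) * d 0) := by
    have h1 : l1 nuZ W ≤ s.factorial * (2 ^ ((m + 1) * d 0) * l1 nuZ f) ^ s :=
      l1_det nuZ_one _ _ fun i k => l1_hasse _ _ _ hfdeg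
    have h2 := Real.log_le_log (lt_of_lt_of_le one_pos (one_le_l1 hW0)) h1
    have hfac : (s.factorial : ℝ) ≠ 0 := by exact_mod_cast s.factorial_ne_zero
    rw [Real.log_mul hfac (by positivity), Real.log_pow, Real.log_mul (by positivity)
      (by positivity), Real.log_pow] at h2
    have h3 := log_factorial_le s
    have h4 : Real.log 2 ≤ 1 := by
      have := Real.log_two_lt_d9; linarith
    have h5 : (((m + 1) * d 0 : ℕ) : ℝ) * Real.log 2 ≤ (m + 1) * d 0 := by
      push_cast
      have : (0 : ℝ) ≤ (m + 1) * d 0 := by positivity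
      nlinarith
    calc Real.log (l1 nuZ W) ≤ s * s + s * ((m + 1) * d 0 + Real.log (l1 nuZ f)) := by
          refine h2.trans (add_le_add h3 ?_)
          gcongr
      _ ≤ s * (2 * d 0) + s * ((m + 1) * d 0 + Real.log (l1 nuZ f)) := by gcongr
      _ = _ := by ring
  have hWv : ∀ v < m + 1, Real.log (l1 nuZ W) + s * d 0 ≤
      (m + 4) * τ * (s * d v) * Real.log (q v) := by
    intro v hv
    have h1 := hlog v hv
    have h0 : (0 : ℝ) ≤ m := Nat.cast_nonneg m
    calc Real.log (l1 nuZ W) + s * d 0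
        ≤ s * (Real.log (l1 nuZ f) + (m + 3) * d 0) + s * d 0 := by linarith
      _ ≤ (m + 4) * s * (Real.log (l1 nuZ f) + d 0) := by
          have : 0 ≤ s * ((m + 3) * Real.log (l1 nuZ f)) := by positivity
          linarith
      _ ≤ (m + 4) * s * (τ * d v * Real.log (q v)) := by gcongr
      _ = _ := by ring
  -- degrees of W
  have hWdeg : ∀ v K, coeff K W ≠ 0 → K v ≤ s * d v := by
    intro v K hK
    have := LB.det (w := wtHom {v} (fun _ => -1))
      (M := Matrix.of fun i k => hasse (μ i + Finsupp.single m (l k)) f)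
      (a := fun _ => -(d v : ℝ)) (by
        intro i k J hJ
        rw [wtHom_apply]
        simp only [Finset.sum_singleton]
        have h1 : J v ≤ d v := by
          have h2 := monomial_le_degreeOf v (mem_support_iff.mpr hJ)
          exact (h2.trans (degreeOf_hasse _ _ _)).trans (hdeg v)
        have : (J v : ℝ) ≤ d v := by exact_mod_cast h1
        linarith) K hK
    rw [wtHom_apply] at this
    simp only [Finset.sum_singleton, Finset.sum_const, Finset.card_univ, Fintype.card_fin,
      nsmul_eq_mul] at this
    have h3 : (K v : ℝ) ≤ s * d v := by linarith
    exact_mod_cast h3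
  have hWcoeff : ∀ I k, I m = 0 → ((coeff (I + Finsupp.single m k) W : ℤ) : ℚ) =
      coeff I U * coeff (Finsupp.single m k) V := by
    intro I k hI
    rw [← coeff_sep hU hV I hI, ← hW, coeff_map]; rfl
  -- U side
  obtain ⟨J0, hJ0⟩ := MvPolynomial.ne_zero_iff.mp hV0
  obtain ⟨I0, hI0⟩ := MvPolynomial.ne_zero_iff.mp hU0
  set UZ := extr U.support J0 W with hUZ
  set VZ := extr V.support I0 W with hVZ
  have hmapU : map (Int.castRingHom ℚ) UZ = C (coeff J0 V) * U := by
    ext I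
    rw [coeff_map, coeff_extr, coeff_C_mul]
    split_ifs with h
    · have h1 := hWcoeff I (J0 m) (hU I (mem_support_iff.mp h))
      rw [← hV J0 hJ0] at h1
      rw [mul_comm, ← h1]; rfl
    · rw [notMem_support_iff.mp h]; simp
  have hmapV : map (Int.castRingHom ℚ) VZ = C (coeff I0 U) * V := by
    ext J
    rw [coeff_map, coeff_extr, coeff_C_mul]
    split_ifs with h
    · have h1 := hWcoeff I0 (J m) (hU I0 hI0)
      rw [← hV J (mem_support_iff.mp h)] at h1
      rw [← h1, add_comm J]; rfl
    · rw [notMem_support_iff.mp h]; simp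
  have hUZ0 : UZ ≠ 0 := by
    intro h
    rw [h, map_zero] at hmapU
    exact mul_ne_zero (by rwa [Ne, C_eq_zero]) hU0 hmapU.symm
  have hVZ0 : VZ ≠ 0 := by
    intro h
    rw [h, map_zero] at hmapV
    exact mul_ne_zero (by rwa [Ne, C_eq_zero]) hV0 hmapV.symm
  have hUZl : Real.log (l1 nuZ UZ) ≤ Real.log (l1 nuZ W) :=
    Real.log_le_log (lt_of_lt_of_le one_pos (one_le_l1 hUZ0)) (l1_extr _ _ _ _)
  have hVZl : Real.log (l1 nuZ VZ) ≤ Real.log (l1 nuZ W) :=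
    Real.log_le_log (lt_of_lt_of_le one_pos (one_le_l1 hVZ0)) (l1_extr _ _ _ _)
  obtain ⟨I1, hI1, hI1w⟩ := hIH (fun v => if v < m then s * d v else 0) p q UZ hUZ0 (by
      intro v
      rw [degreeOf_le_iff]
      intro I hI
      rw [mem_support_iff, coeff_extr] at hI
      have hIU : I ∈ U.support := by by_contra hc; exact hI (if_neg hc)
      rw [if_pos hIU] at hI
      split_ifs with hv
      · have := hWdeg v _ hI
        simp at this; omega
      · by_cases hvm : v = m
        · subst hvm; exact (hU I (mem_support_iff.mp hIU)).le
        · have := hWdeg v _ hI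
          rw [hd0 v (by omega)] at this
          simp at this; omega)
    (by intro v hv; rw [if_pos hv]; exact Nat.mul_pos hs1 (hd1 v (by omega)))
    (by intro v hv; rw [if_neg (by omega)])
    (by
      intro v hv
      rw [if_pos hv, if_pos (by omega)]
      push_cast
      have h1 := hratio v (by omega)
      have h2 : τ * d v ≤ τ' * d v := by gcongr
      calc (s : ℝ) * d (v + 1) ≤ s * (τ' * d v) := by gcongr; linarith
        _ = _ := by ring)
    (fun v hv => hpq v (by omega))
    (by
      intro v hv
      rw [if_pos hv, if_pos (by omega)]
      push_cast
      have h1 := hWv v (by omega)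
      have hq1 : (0 : ℝ) ≤ Real.log (q v) := by
        apply Real.log_nonneg
        exact_mod_cast (hpq v (by omega)).1
      calc Real.log (l1 nuZ UZ) + s * d 0 ≤ Real.log (l1 nuZ W) + s * d 0 := by linarith
        _ ≤ _ := h1
        _ ≤ τ' * (s * d v) * Real.log (q v) := by gcongr)
  have hI1U : coeff I1 (shift ξ U) ≠ 0 := by
    intro h
    apply hI1
    rw [hmapU, map_mul, shift_C, coeff_C_mul, h, mul_zero]
  have hshU : Off m (shift ξ U) := Off_iff.mpr (supported_shift ξ (Off_iff.mp hU))
  have hshV : On m (shift ξ V) := On_iff.mpr (supported_shift ξ (On_iff.mp hV))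
  -- V side
  have hexV : ∃ j, coeff (Finsupp.single m j) (shift ξ V) ≠ 0 := by
    have : shift ξ V ≠ 0 := fun h => hV0 (shift_injective ξ (by rw [h, map_zero]))
    obtain ⟨J, hJ⟩ := MvPolynomial.ne_zero_iff.mp this
    exact ⟨J m, by rw [← hshV J hJ]; exact hJ⟩
  set k := Nat.find hexV with hk
  have hkV : coeff (Finsupp.single m k) (shift ξ V) ≠ 0 := Nat.find_spec hexV
  have hVZon : On m VZ := by
    intro J hJ
    rw [coeff_extr] at hJ
    have : J ∈ V.support := by by_contra hc; exact hJ (if_neg hc)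
    exact hV J (mem_support_iff.mp this)
  have hkb := onevar_bound hVZon hVZ0 (p m) (q m) (hpq m (by omega)).1 (hpq m (by omega)).2 ξ rfl k
    (by
      intro j hj
      have := Nat.find_min hexV hj
      push Not at this
      rw [hmapV, map_mul, shift_C, coeff_C_mul, this, mul_zero])
  have hqm : (0 : ℝ) < Real.log (q m) := by
    by_contra hc
    push Not at hc
    have h1 := hlog m (by omega)
    have h2 : τ * d m * Real.log (q m) ≤ 0 := mul_nonpos_of_nonneg_of_nonpos (by positivity) hc
    linarith
  have hk2 : (k : ℝ) / d m ≤ s * ((m + 4) * τ) := by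
    have hqpos : (0 : ℝ) < q m := by exact_mod_cast (hpq m (by omega)).1
    have h1 := Real.log_le_log (pow_pos hqpos k) hkb
    rw [Real.log_pow] at h1
    have h2 := hWv m (by omega)
    have h3 : (0 : ℝ) ≤ s * d 0 := by positivity
    have h4 : (k : ℝ) * Real.log (q m) ≤ ((m + 4) * τ * (s * d m)) * Real.log (q m) := by linarith
    have h5 := le_of_mul_le_mul_right h4 hqm
    rw [div_le_iff₀ (by linarith)]
    linarith
  -- combine
  have hI1m : I1 m = 0 := hshU I1 hI1U
  have hne : coeff (I1 + Finsupp.single m k) (shift ξ (map (Int.castRingHom ℚ) W)) ≠ 0 := by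
    rw [hW, map_mul, coeff_sep hshU hshV I1 hI1m]
    exact mul_ne_zero hI1U hkV
  set w := wtHom (Finset.range (m + 1)) (fun v => 1 / (d v : ℝ)) with hw
  have hwnn : ∀ K, 0 ≤ w K := fun K => by
    rw [hw, wtHom_apply]; positivity
  have hup : w (I1 + Finsupp.single m k) < s * (ε ^ 2 / 64) + s * ((m + 4) * τ) := by
    have h1 : w (I1 + Finsupp.single m k) = ∑ v ∈ Finset.range m, (I1 v : ℝ) / d v + k / d m := by
      rw [hw, wtHom_apply, Finset.sum_range_succ]
      congr 1
      · refine Finset.sum_congr rfl fun v hv => ?_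
        have : m ≠ v := by rintro rfl; simp at hv
        simp [Finsupp.single_apply, this, div_eq_mul_inv]
      · simp [hI1m, div_eq_mul_inv]
    have h2 : ∑ v ∈ Finset.range m, (I1 v : ℝ) / d v < s * (ε ^ 2 / 64) := by
      have h3 : ∑ v ∈ Finset.range m, (I1 v : ℝ) / d v = s * ∑ v ∈ Finset.range m, (I1 v : ℝ) /
          ((if v < m then s * d v else 0 : ℕ) : ℝ) := by
        rw [Finset.mul_sum]
        refine Finset.sum_congr rfl fun v hv => ?_
        rw [if_pos (Finset.mem_range.mp hv)]
        push_cast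
        have := hdpos v (by have := Finset.mem_range.mp hv; omega)
        field_simp
      rw [h3]
      exact mul_lt_mul_of_pos_left hI1w (by linarith)
    rw [h1]
    linarith
  have hdet : shift ξ (map (Int.castRingHom ℚ) W) = (Matrix.of fun i k =>
      shift ξ (hasse (μ i + Finsupp.single m (l k)) (map (Int.castRingHom ℚ) f))).det := by
    rw [hWd, RingHom.map_det, AlgHom.map_det]
    congr 1
    ext1 i k
    simp [hasse_map]
  have hlow : LB w (shift ξ (map (Int.castRingHom ℚ) W))
      (∑ k, max 0 (ε - τ - (l k : ℝ) / d m)) := by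
    rw [hdet]
    refine LB.det fun i k K hK => ?_
    apply max_le (hwnn K)
    simp only [Matrix.of_apply] at hK
    rw [coeff_shift] at hK
    obtain ⟨c, hc⟩ := hasse_hasse K (μ i + Finsupp.single m (l k)) (map (Int.castRingHom ℚ) f)
    rw [hc, map_mul, ← coeff_shift] at hK
    have h1 := hcon' _ (right_ne_zero_of_mul hK)
    have h2 : ∑ v ∈ Finset.range (m + 1), ((K + (μ i + Finsupp.single m (l k))) v : ℝ) / d v =
        w K + ∑ v ∈ Finset.range m, (μ i v : ℝ) / d v + (l k : ℝ) / d m := by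
      have e1 : ∑ v ∈ Finset.range m, ((K + (μ i + Finsupp.single m (l k))) v : ℝ) / d v =
          ∑ v ∈ Finset.range m, K v * (1 / (d v : ℝ)) + ∑ v ∈ Finset.range m, (μ i v : ℝ) / d v := by
        rw [← Finset.sum_add_distrib]
        refine Finset.sum_congr rfl fun v hv => ?_
        have : m ≠ v := by rintro rfl; simp at hv
        simp [Finsupp.single_apply, this]; ring
      have e2 : ((K + (μ i + Finsupp.single m (l k))) m : ℝ) / d m =
          K m * (1 / (d m : ℝ)) + (l k : ℝ) / d m := by
        simp [hμm i]; ring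
      rw [hw, wtHom_apply, Finset.sum_range_succ, Finset.sum_range_succ, e1, e2]
      ring
    have h3 : ∑ v ∈ Finset.range m, (μ i v : ℝ) / d v ≤ τ := by
      calc ∑ v ∈ Finset.range m, (μ i v : ℝ) / d v
          ≤ ∑ v ∈ Finset.range m, (μ i v : ℝ) * (τ / d m) := by
            refine Finset.sum_le_sum fun v hv => ?_
            have hv' := Finset.mem_range.mp hv
            rw [div_eq_mul_inv]
            refine mul_le_mul_of_nonneg_left ?_ (Nat.cast_nonneg _)
            have h4 := hlast v hv'
            have h5 := hdpos v (by omega)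
            rw [inv_eq_one_div, div_le_div_iff₀ (by linarith) (by linarith)]
            linarith
        _ = (∑ v ∈ Finset.range m, (μ i v : ℝ)) * (τ / d m) := by rw [Finset.sum_mul]
        _ ≤ d m * (τ / d m) := by
            gcongr
            have h6 : ∑ v ∈ Finset.range m, μ i v ≤ (μ i).degree := by
              rw [Finsupp.degree_apply]
              calc ∑ v ∈ Finset.range m, μ i v ≤ ∑ v ∈ Finset.range m ∪ (μ i).support, μ i v :=
                    Finset.sum_le_sum_of_subset Finset.subset_union_left
                _ = _ := (Finset.sum_subset Finset.subset_union_right fun v _ hv => by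
                    simpa using hv).symm
            have h7 := hμd i
            exact_mod_cast (show ∑ v ∈ Finset.range m, μ i v ≤ d m by omega)
        _ = τ := by field_simp
    push_cast at h1 h2
    linarith
  have hfin := hlow _ hne
  have hsum : ∑ k, max 0 (ε - τ - (l k : ℝ) / d m) =
      ∑ j ∈ Finset.range s, max 0 (ε - τ - (j : ℝ) / d m) := by
    have himg : Finset.univ.image l = Finset.range s := by
      apply Finset.eq_of_subset_of_card_le
      · intro j hj
        obtain ⟨i, _, rfl⟩ := Finset.mem_image.mp hj
        exact Finset.mem_range.mpr (hl i)
      · rw [Finset.card_image_of_injective _ hlinj]; simp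
    rw [← himg, Finset.sum_image (fun _ _ _ _ h => hlinj h)]
  rw [hsum] at hfin
  have hsb := sum_max_bound s (d m) hs2 (hd1 m (by omega)) (ε - τ) (by linarith) (by linarith)
  have h8 : ε ^ 2 / 32 ≤ (ε - τ) ^ 2 / 8 := by nlinarith
  have h9 : (s : ℝ) * (ε ^ 2 / 32) ≤ s * ((ε - τ) ^ 2 / 8) := by gcongr
  have h10 : (s : ℝ) * ((m + 4) * τ) ≤ s * (ε ^ 2 / 64) := by gcongr
  linarith

/-- Roth's lemma. -/
theorem roth_lemma (m : ℕ) : RothStmt m := by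
  induction m with
  | zero => exact roth_zero
  | succ m ih => exact roth_succ m ih

end SST

end

section
open MvPolynomial

namespace SST

lemma hermite_unique (A t d : ℕ) (h : d < A * (t + 1)) (p : Polynomial ℝ) (hp : p.natDegree ≤ d)
    (h0 : ∀ a < A, ∀ k < t + 1, (Polynomial.taylor (a : ℝ) p).coeff k = 0) : p = 0 := by
  have h1 : ∀ a < A, (Polynomial.X - Polynomial.C (a : ℝ)) ^ (t + 1) ∣ p := by
    intro a ha
    have : (Polynomial.X : Polynomial ℝ) ^ (t + 1) ∣ Polynomial.taylor (a : ℝ) p :=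
      Polynomial.X_pow_dvd_iff.mpr (h0 a ha)
    obtain ⟨Q, hQ⟩ := this
    refine ⟨Polynomial.taylor (-(a : ℝ)) Q, ?_⟩
    have := congrArg (Polynomial.taylor (-(a : ℝ))) hQ
    rw [Polynomial.taylor_taylor] at this
    simpa [Polynomial.taylor_mul, sub_eq_add_neg, Polynomial.taylor_pow] using this
  have h2 : ∏ a ∈ Finset.range A, (Polynomial.X - Polynomial.C (a : ℝ)) ^ (t + 1) ∣ p := by
    apply Finset.prod_dvd_of_coprime
    · intro a _ b _ hab
      apply IsCoprime.pow
      apply Polynomial.isCoprime_X_sub_C_of_isUnit_sub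
      rw [isUnit_iff_ne_zero, sub_ne_zero]
      exact_mod_cast hab
    · intro a ha; exact h1 a (Finset.mem_range.mp ha)
  by_contra hne
  have h3 := Polynomial.natDegree_le_of_dvd h2 hne
  rw [Polynomial.natDegree_prod _ _ (fun a _ => pow_ne_zero _ (Polynomial.X_sub_C_ne_zero _))] at h3
  simp only [Polynomial.natDegree_pow, Polynomial.natDegree_X_sub_C, mul_one, Finset.sum_const,
    Finset.card_range, smul_eq_mul] at h3
  omega

lemma hermite_dual (A t d : ℕ) (h : d < A * (t + 1)) :
    ∃ γ : ℕ → Fin A × Fin (t + 1) → ℝ, ∀ i ≤ d, ∀ j ≤ d, ∑ x : Fin A × Fin (t + 1),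
      γ j x * ((i.choose x.2 : ℝ) * ((x.1 : ℕ) : ℝ) ^ (i - (x.2 : ℕ))) = if i = j then 1 else 0 := by
  classical
  let H : Matrix (Fin A × Fin (t + 1)) (Fin (d + 1)) ℝ :=
    Matrix.of fun x i => ((i : ℕ).choose x.2 : ℝ) * ((x.1 : ℕ) : ℝ) ^ ((i : ℕ) - (x.2 : ℕ))
  have hinj : LinearMap.ker H.mulVecLin = ⊥ := by
    rw [LinearMap.ker_eq_bot']
    intro c hc
    let p : Polynomial ℝ := ∑ i : Fin (d + 1), Polynomial.monomial (i : ℕ) (c i)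
    have hcoef : ∀ i : Fin (d + 1), p.coeff i = c i := by
      intro i
      simp only [p, Polynomial.finset_sum_coeff, Polynomial.coeff_monomial]
      rw [Finset.sum_eq_single i]
      · simp
      · intro b _ hb; rw [if_neg]; exact fun h => hb (Fin.ext h)
      · simp
    have hp0 : p = 0 := by
      apply hermite_unique A t d h
      · apply Polynomial.natDegree_sum_le_of_forall_le
        intro i _
        exact (Polynomial.natDegree_monomial_le _).trans (by omega)
      · intro a ha k hk
        have := congrFun hc (⟨a, ha⟩, ⟨k, hk⟩)
        rw [Matrix.mulVecLin_apply, Matrix.mulVec, dotProduct] at this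
        simp only [p, map_sum, Polynomial.finset_sum_coeff, Polynomial.taylor_monomial,
          Polynomial.coeff_C_mul, Polynomial.coeff_X_add_C_pow]
        rw [Pi.zero_apply] at this
        rw [← this]
        refine Finset.sum_congr rfl fun i _ => ?_
        simp only [H, Matrix.of_apply]
        ring
    ext i
    rw [← hcoef i, hp0]; simp
  obtain ⟨g, hg⟩ := LinearMap.exists_leftInverse_of_injective H.mulVecLin hinj
  refine ⟨fun j x => if hj : j < d + 1 then g (Pi.single x 1) ⟨j, hj⟩ else 0, ?_⟩
  intro i hi j hj
  have hj' : j < d + 1 := by omega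
  have hi' : i < d + 1 := by omega
  simp only [dif_pos hj']
  have h1 := congrFun (LinearMap.congr_fun hg (Pi.single ⟨i, hi'⟩ 1)) ⟨j, hj'⟩
  simp only [LinearMap.comp_apply, LinearMap.id_apply] at h1
  have h2 : H.mulVecLin (Pi.single ⟨i, hi'⟩ 1) = ∑ x, H x ⟨i, hi'⟩ • Pi.single x (1 : ℝ) := by
    ext x
    rw [Matrix.mulVecLin_apply, Matrix.mulVec_single_one]
    simp [Finset.sum_apply, Pi.single_apply]
  rw [h2, map_sum] at h1
  simp only [map_smul, Finset.sum_apply, Pi.smul_apply, smul_eq_mul] at h1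
  rw [Pi.single_apply] at h1
  simp only [Fin.mk.injEq] at h1
  rw [show (if i = j then (1 : ℝ) else 0) = if j = i then 1 else 0 by simp [eq_comm], ← h1]
  refine Finset.sum_congr rfl fun x _ => ?_
  simp only [H, Matrix.of_apply]; ring

lemma coeff_shift_expand {τ : Type*} [Fintype τ] (F : MvPolynomial τ ℝ) (z : τ → ℝ) (κ : τ →₀ ℕ) :
    coeff κ (shift z F) =
      ∑ I ∈ F.support, coeff I F * ∏ v, (((I v).choose (κ v) : ℝ) * z v ^ (I v - κ v)) := by
  classical
  rw [coeff_shift, hasse, map_sum]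
  refine Finset.sum_congr rfl fun I _ => ?_
  rw [eval_monomial, Finsupp.prod_fintype _ _ (by simp), Finsupp.prod_fintype _ _ (by simp),
    Finset.prod_mul_distrib]
  simp only [Finsupp.tsub_apply]
  push_cast
  ring

lemma grid_lemma {τ : Type*} [Fintype τ] (F : MvPolynomial τ ℝ) (A : ℕ) (t d : τ → ℕ)
    (hd : ∀ v, degreeOf v F ≤ d v) (hA : ∀ v, d v < A * (t v + 1))
    (h : ∀ z : τ → ℕ, (∀ v, z v < A) → ∀ κ : τ →₀ ℕ, (∀ v, κ v ≤ t v) →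
      coeff κ (shift (fun v => (z v : ℝ)) F) = 0) : F = 0 := by
  classical
  choose γ hγ using fun v => hermite_dual A (t v) (d v) (hA v)
  by_contra hF
  obtain ⟨J, hJ⟩ := MvPolynomial.ne_zero_iff.mp hF
  apply hJ
  have hle : ∀ I ∈ F.support, ∀ v, I v ≤ d v := fun I hI v =>
    (monomial_le_degreeOf v hI).trans (hd v)
  have hJs : J ∈ F.support := mem_support_iff.mpr hJ
  have h1 : coeff J F = ∑ I ∈ F.support, coeff I F * ∏ v, (if I v = J v then (1 : ℝ) else 0) := by
    rw [Finset.sum_eq_single J]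
    · simp
    · intro I _ hI
      obtain ⟨v, hv⟩ : ∃ v, I v ≠ J v := by
        by_contra hc; push Not at hc; exact hI (Finsupp.ext hc)
      rw [Finset.prod_eq_zero (Finset.mem_univ v) (if_neg hv), mul_zero]
    · intro hc; exact absurd hJs hc
  rw [h1]
  have h2 : ∀ I ∈ F.support, coeff I F * ∏ v, (if I v = J v then (1 : ℝ) else 0) =
      ∑ x ∈ Fintype.piFinset fun v => (Finset.univ : Finset (Fin A × Fin (t v + 1))),
        (∏ v, γ v (J v) (x v)) * (coeff I F * ∏ v, (((I v).choose (x v).2 : ℝ) *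
          (((x v).1 : ℕ) : ℝ) ^ (I v - ((x v).2 : ℕ)))) := by
    intro I hI
    rw [Finset.prod_congr rfl fun v _ => (hγ v (I v) (hle I hI v) (J v) (hle J hJs v)).symm,
      Finset.prod_univ_sum, Finset.mul_sum]
    refine Finset.sum_congr rfl fun x _ => ?_
    rw [Finset.prod_mul_distrib]; ring
  rw [Finset.sum_congr rfl h2, Finset.sum_comm]
  refine Finset.sum_eq_zero fun x _ => ?_
  rw [← Finset.mul_sum]
  have h3 := h (fun v => (x v).1) (fun v => (x v).1.2)
    (Finsupp.equivFunOnFinite.symm fun v => ((x v).2 : ℕ)) (fun v => by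
      simp only [Finsupp.equivFunOnFinite_symm_apply_apply]; omega)
  rw [coeff_shift_expand] at h3
  simp only [Finsupp.equivFunOnFinite_symm_apply_apply] at h3
  rw [h3, mul_zero]

end SST

end

section
open MvPolynomial

namespace SST

lemma hasse_monomial {σ A : Type*} [CommRing A] (κ J : σ →₀ ℕ) (c : A) :
    hasse κ (monomial J c) =
      if κ ≤ J then monomial (J - κ) ((bB (J - κ) κ : A) * c) else 0 := by
  classical
  ext K
  rw [coeff_hasse, coeff_monomial]
  by_cases h : κ ≤ J
  · rw [if_pos h, coeff_monomial]
    by_cases h2 : J = K + κ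
    · subst h2; simp
    · rw [if_neg h2, if_neg, mul_zero]
      rintro rfl
      exact h2 (tsub_add_cancel_of_le h).symm
  · rw [if_neg h, if_neg, mul_zero, coeff_zero]
    rintro rfl
    exact h (by simp)

section red
variable {H ι : Type*} [Fintype H] [Fintype ι] [DecidableEq H] [DecidableEq ι]
  (a b : H → ι)

noncomputable def rA (J : H × ι →₀ ℕ) : H →₀ ℕ :=
  Finsupp.equivFunOnFinite.symm fun h => J (h, a h)
noncomputable def rO (J : H × ι →₀ ℕ) : H × ι →₀ ℕ :=
  Finsupp.equivFunOnFinite.symm fun v => if v.2 = a v.1 then 0 else if v.2 = b v.1 then 0 else J v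
noncomputable def eA (i : H →₀ ℕ) : H × ι →₀ ℕ :=
  Finsupp.equivFunOnFinite.symm fun v => if v.2 = a v.1 then i v.1 else 0

lemma rA_apply (J : H × ι →₀ ℕ) (h : H) : rA a J h = J (h, a h) := rfl
lemma rO_apply (J : H × ι →₀ ℕ) (v : H × ι) :
    rO a b J v = if v.2 = a v.1 then 0 else if v.2 = b v.1 then 0 else J v := rfl
lemma eA_apply (i : H →₀ ℕ) (v : H × ι) :
    eA a i v = if v.2 = a v.1 then i v.1 else 0 := rfl

lemma eA_le (i : H →₀ ℕ) (J : H × ι →₀ ℕ) : eA a i ≤ J ↔ i ≤ rA a J := by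
  constructor
  · intro h k
    have := h (k, a k)
    simpa [eA_apply, rA_apply] using this
  · rintro h ⟨k, x⟩
    rw [eA_apply]
    by_cases hx : x = a k
    · subst hx; simpa [rA_apply] using h k
    · simp [hx]

lemma rA_sub (i : H →₀ ℕ) (J : H × ι →₀ ℕ) : rA a (J - eA a i) = rA a J - i := by
  ext k; simp [rA_apply, eA_apply]

lemma rO_sub (i : H →₀ ℕ) (J : H × ι →₀ ℕ) : rO a b (J - eA a i) = rO a b J := by
  ext v; simp only [rO_apply, Finsupp.tsub_apply, eA_apply]
  split_ifs <;> simp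

lemma bB_eA (i : H →₀ ℕ) (J : H × ι →₀ ℕ) : bB J (eA a i) = bB (rA a J) i := by
  rw [bB_eq _ _ Finset.univ (by simp), bB_eq _ _ Finset.univ (by simp), Fintype.prod_prod_type]
  refine Finset.prod_congr rfl fun h _ => ?_
  rw [Finset.prod_eq_single (a h)]
  · simp [eA_apply, rA_apply]
  · intro x _ hx; simp [eA_apply, hx]
  · simp

variable (ξ : H → ℝ) (l : H → ι → ℝ)

noncomputable def gA (h : H) : MvPolynomial (H × ι) ℝ :=
  C (ξ h) + ∑ i, if i = a h then 0 else if i = b h then 0 else C (l h i) * X (h, i)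

noncomputable def gS (v : H × ι) : MvPolynomial (H × ι) ℝ :=
  if v.2 = a v.1 then gA a b ξ l v.1 else if v.2 = b v.1 then 1 else X v

lemma constantCoeff_gA (h : H) : constantCoeff (gA a b ξ l h) = ξ h := by
  rw [gA, map_add, constantCoeff_C, map_sum, Finset.sum_eq_zero, add_zero]
  intro i _
  split_ifs <;> simp

lemma coeff_gS (nu J : H × ι →₀ ℕ) (c : ℝ) (hJ : nu.degree ≤ (rO a b J).degree) :
    coeff nu (aeval (gS a b ξ l) (monomial J c)) =
      if rO a b J = nu then eval ξ (monomial (rA a J) c) else 0 := by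
  have h1 : aeval (gS a b ξ l) (monomial J c) =
      monomial (rO a b J) c * ∏ h, (gA a b ξ l h) ^ J (h, a h) := by
    rw [aeval_monomial, Finsupp.prod_fintype _ _ (by simp)]
    have : ∀ v, gS a b ξ l v ^ J v =
        (X v ^ (rO a b J v)) * (if v.2 = a v.1 then gA a b ξ l v.1 ^ J (v.1, a v.1) else 1) := by
      rintro ⟨h, x⟩
      simp only [gS, rO_apply]
      by_cases hx : x = a h
      · subst hx; simp
      · by_cases hb : x = b h
        · subst hb; simp [hx]
        · simp [hx, hb]
    rw [Finset.prod_congr rfl fun v _ => this v, Finset.prod_mul_distrib]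
    rw [monomial_eq, Finsupp.prod_fintype _ _ (by simp), algebraMap_eq, mul_assoc]
    congr 2
    rw [Fintype.prod_prod_type]
    refine Finset.prod_congr rfl fun h _ => ?_
    simp
  rw [h1, coeff_monomial_mul']
  by_cases h2 : rO a b J ≤ nu
  · have h3 : rO a b J = nu := by
      obtain ⟨k, hk⟩ := exists_add_of_le h2
      have : k.degree = 0 := by
        rw [hk, map_add] at hJ; omega
      rw [Finsupp.degree_eq_zero_iff] at this
      rw [hk, this, add_zero]
    rw [if_pos h2, if_pos h3, h3, tsub_self, ← constantCoeff_eq, map_prod, eval_monomial,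
      Finsupp.prod_fintype _ _ (by simp)]
    simp [constantCoeff_gA, rA_apply]
  · rw [if_neg h2, if_neg (fun h => h2 h.le)]

lemma point_gS (mv : H → ι → ℝ) (hab : ∀ h, a h ≠ b h) (hma : ∀ h, mv h (a h) ≠ 0)
    (y : H × ι → ℝ) (h : H) :
    ∑ i, mv h i * eval y (gS a b (fun h => - mv h (b h) / mv h (a h))
      (fun h i => - mv h i / mv h (a h)) (h, i)) = 0 := by
  set S : ℝ := ∑ i, if i = a h then 0 else if i = b h then 0 else mv h i * y (h, i) with hS
  have hA : mv h (a h) * eval y (gA a b (fun h => - mv h (b h) / mv h (a h))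
      (fun h i => - mv h i / mv h (a h)) h) = - mv h (b h) - S := by
    rw [gA, map_add, map_sum, mul_add, eval_C, mul_div_cancel₀ _ (hma h), Finset.mul_sum, hS,
      sub_eq_add_neg, ← Finset.sum_neg_distrib]
    congr 1
    refine Finset.sum_congr rfl fun i _ => ?_
    split_ifs
    · simp
    · simp
    · simp only [map_mul, eval_C, eval_X]; field_simp [hma h]
  have : ∀ i, mv h i * eval y (gS a b (fun h => - mv h (b h) / mv h (a h))
      (fun h i => - mv h i / mv h (a h)) (h, i)) =
      (if i = a h then - mv h (b h) - S else 0) + (if i = b h then mv h (b h) else 0) +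
        (if i = a h then 0 else if i = b h then 0 else mv h i * y (h, i)) := by
    intro i
    by_cases hi : i = a h
    · subst hi
      simp only [gS, if_true, hA, if_neg (hab h)]; ring
    · by_cases hb : i = b h
      · subst hb
        simp [gS, hi]
      · simp [gS, hi, hb]
  rw [Finset.sum_congr rfl fun i _ => this i, Finset.sum_add_distrib, Finset.sum_add_distrib,
    Finset.sum_ite_eq' , Finset.sum_ite_eq', ← hS]
  simp only [Finset.mem_univ, if_true]
  ring

/-- extraction of one variable per block -/
noncomputable def extrP (nu : H × ι →₀ ℕ) (P : MvPolynomial (H × ι) ℤ) : MvPolynomial H ℤ :=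
  ∑ J ∈ P.support, if rO a b J = nu then monomial (rA a J) (coeff J P) else 0

lemma l1_extrP (nu : H × ι →₀ ℕ) (P : MvPolynomial (H × ι) ℤ) :
    l1 nuZ (extrP a b nu P) ≤ l1 nuZ P := by
  refine (l1_sum _ _ _).trans ?_
  rw [l1]
  refine Finset.sum_le_sum fun J _ => ?_
  split_ifs
  · rw [l1_monomial]
  · rw [l1_zero]; exact apply_nonneg _ _

lemma degreeOf_extrP (nu : H × ι →₀ ℕ) (P : MvPolynomial (H × ι) ℤ) (r : H → ℕ)
    (hr : ∀ J ∈ P.support, ∀ h, ∑ i, J (h, i) = r h) (h : H) :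
    degreeOf h (extrP a b nu P) ≤ r h := by
  refine (degreeOf_sum_le _ _ _).trans ?_
  refine Finset.sup_le fun J hJ => ?_
  split_ifs
  · have h0 : degreeOf h (monomial (rA a J) (coeff J P)) ≤ rA a J h := by
      rw [degreeOf_le_iff]
      intro K hK
      have := support_monomial_subset hK
      rw [Finset.mem_singleton] at this
      rw [this]
    refine h0.trans ?_
    rw [rA_apply, ← hr J hJ h]
    exact Finset.single_le_sum (f := fun i => J (h, i)) (fun _ _ => Nat.zero_le _)
      (Finset.mem_univ _)
  · simp

lemma extrP_ne (hab : ∀ h, a h ≠ b h) (P : MvPolynomial (H × ι) ℤ) (r : H → ℕ)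
    (hr : ∀ J ∈ P.support, ∀ h, ∑ i, J (h, i) = r h) (J₀ : H × ι →₀ ℕ) (hJ₀ : J₀ ∈ P.support) :
    extrP a b (rO a b J₀) P ≠ 0 := by
  rw [ne_zero_iff]
  refine ⟨rA a J₀, ?_⟩
  rw [extrP, coeff_sum, Finset.sum_eq_single J₀]
  · simpa using hJ₀
  · intro J hJ hne
    split_ifs with h
    · rw [coeff_monomial, if_neg]
      intro h2
      apply hne
      have key : ∀ k x, x ≠ b k → J (k, x) = J₀ (k, x) := by
        intro k x hx
        by_cases hxa : x = a k
        · subst hxa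
          exact DFunLike.congr_fun h2 k
        · have := DFunLike.congr_fun h (k, x)
          simpa [rO_apply, hxa, hx] using this
      ext ⟨k, x⟩
      by_cases hx : x = b k
      · subst hx
        have h3 := hr J hJ k
        have h4 := hr J₀ hJ₀ k
        rw [← Finset.add_sum_erase _ _ (Finset.mem_univ (b k))] at h3 h4
        have h5 : ∑ x ∈ Finset.univ.erase (b k), J (k, x) =
            ∑ x ∈ Finset.univ.erase (b k), J₀ (k, x) :=
          Finset.sum_congr rfl fun x hx => key k x (Finset.ne_of_mem_erase hx)
        omega
      · exact key k x hx
    · simp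
  · intro h; exact absurd hJ₀ h

lemma extrP_index (P : MvPolynomial (H × ι) ℤ) (hP : P ≠ 0)
    (mv : H → ι → ℝ) (hab : ∀ h, a h ≠ b h) (hma : ∀ h, mv h (a h) ≠ 0)
    (r : H → ℕ) (hr : ∀ J ∈ P.support, ∀ h, ∑ i, J (h, i) = r h) :
    ∃ f : MvPolynomial H ℤ, f ≠ 0 ∧ l1 nuZ f ≤ l1 nuZ P ∧ (∀ h, degreeOf h f ≤ r h) ∧
      ∀ i : H →₀ ℕ, (∀ x : H × ι → ℝ, (∀ h, ∑ k, mv h k * x (h, k) = 0) →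
        eval x (map (Int.castRingHom ℝ) (hasse (eA a i) P)) = 0) →
        eval (fun h => - mv h (b h) / mv h (a h)) (map (Int.castRingHom ℝ) (hasse i f)) = 0 := by
  have hne : P.support.Nonempty := by simpa using hP
  obtain ⟨J₀, hJ₀, hmin⟩ := Finset.exists_min_image P.support (fun J => (rO a b J).degree) hne
  refine ⟨extrP a b (rO a b J₀) P, extrP_ne a b hab P r hr J₀ hJ₀, l1_extrP _ _ _ _,
    degreeOf_extrP a b _ P r hr, ?_⟩
  intro i hi
  set ξ : H → ℝ := fun h => - mv h (b h) / mv h (a h) with hξ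
  set l : H → ι → ℝ := fun h i => - mv h i / mv h (a h) with hl
  have hG : aeval (gS a b ξ l) (map (Int.castRingHom ℝ) (hasse (eA a i) P)) = 0 := by
    apply MvPolynomial.funext
    intro y
    rw [map_zero, ← hi (fun v => eval y (gS a b ξ l v)) (fun h => point_gS a b mv hab hma y h)]
    induction map (Int.castRingHom ℝ) (hasse (eA a i) P) using MvPolynomial.induction_on with
    | C c => simp
    | add p q hp hq => simp only [map_add, hp, hq]
    | mul_X p v hp => simp only [map_mul, hp, aeval_X, eval_X]
  have h2 := congrArg (coeff (rO a b J₀)) hG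
  rw [coeff_zero] at h2
  rw [← h2]
  rw [extrP, hasse_sum, map_sum, map_sum]
  conv_rhs => rw [P.as_sum, hasse_sum, map_sum, map_sum, coeff_sum]
  refine Finset.sum_congr rfl fun J hJ => ?_
  rw [hasse_monomial]
  by_cases hle : eA a i ≤ J
  · rw [if_pos hle, map_monomial, coeff_gS _ _ _ _ _ _ _ (by rw [rO_sub]; exact hmin J hJ), rO_sub]
    split_ifs with h
    · rw [hasse_monomial, if_pos ((eA_le a i J).mp hle), map_monomial, rA_sub, bB_eA, rA_sub]
    · rw [hasse_zero]; simp
  · rw [if_neg hle]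
    split_ifs with h
    · rw [hasse_monomial, if_neg (fun h => hle ((eA_le a i J).mpr h))]; simp
    · rw [hasse_zero]; simp

end red

end SST

end

section
open MvPolynomial

namespace SST

lemma l1_rename {σ τ : Type*} (e : σ → τ) (f : MvPolynomial σ ℤ) :
    l1 nuZ (rename e f) ≤ l1 nuZ f := by
  conv_lhs => rw [f.as_sum, map_sum]
  refine (l1_sum _ _ _).trans ?_
  rw [l1]
  refine Finset.sum_le_sum fun J _ => ?_
  rw [rename_monomial, l1_monomial]

lemma shift_rename {σ τ A : Type*} [CommRing A] (e : σ → τ) (ξ : τ → A) (f : MvPolynomial σ A) :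
    shift ξ (rename e f) = rename e (shift (ξ ∘ e) f) := by
  induction f using MvPolynomial.induction_on with
  | C c => simp [shift_C]
  | add p q hp hq => simp only [map_add, hp, hq]
  | mul_X p v hp => simp only [map_mul, hp, rename_X, shift_X, map_add, rename_C, Function.comp]

theorem roth_fin (m : ℕ) (ε : ℝ) (hε : 0 < ε) : ∃ τ : ℝ, 0 < τ ∧ τ ≤ 1 ∧
    ∀ (d : Fin m → ℕ) (p q : Fin m → ℤ) (f : MvPolynomial (Fin m) ℤ),
    f ≠ 0 → (∀ v, degreeOf v f ≤ d v) → (∀ v, 1 ≤ d v) →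
    (∀ v v' : Fin m, v'.val = v.val + 1 → (d v' : ℝ) ≤ τ * d v) →
    (∀ v, 0 < q v ∧ IsCoprime (p v) (q v)) →
    (∀ v v', Real.log (l1 nuZ f) + d v' ≤ τ * d v * Real.log (q v)) →
    ∃ I : Fin m →₀ ℕ,
      coeff I (shift (fun v => (p v : ℚ) / q v) (map (Int.castRingHom ℚ) f)) ≠ 0 ∧
      ∑ v, (I v : ℝ) / d v < ε := by
  obtain ⟨τ, h0, h1, H⟩ := roth_lemma m ε hε
  refine ⟨τ, h0, h1, ?_⟩
  intro d p q f hf hd hd1 hrat hpq hlog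
  set d' : ℕ → ℕ := fun v => if h : v < m then d ⟨v, h⟩ else 0 with hd'
  set p' : ℕ → ℤ := fun v => if h : v < m then p ⟨v, h⟩ else 0 with hp'
  set q' : ℕ → ℤ := fun v => if h : v < m then q ⟨v, h⟩ else 0 with hq'
  have hinj : Function.Injective (Fin.val : Fin m → ℕ) := Fin.val_injective
  have hne : rename Fin.val f ≠ 0 := by
    rw [← map_zero (rename (Fin.val : Fin m → ℕ))]
    exact fun h => hf (rename_injective _ hinj h)
  have HH := H d' p' q' (rename Fin.val f) hne ?_ ?_ ?_ ?_ ?_ ?_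
  · obtain ⟨I, hI, hw⟩ := HH
    rw [map_rename, shift_rename] at hI
    obtain ⟨u, rfl, hu⟩ := coeff_rename_ne_zero _ _ _ hI
    refine ⟨u, ?_, ?_⟩
    · have e : (fun v : Fin m => (p v : ℚ) / q v) =
          (fun v : ℕ => (p' v : ℚ) / q' v) ∘ Fin.val := by
        ext v
        simp [p', q']
      rw [e]; exact hu
    · rw [Finset.sum_range] at hw
      convert hw using 2 with v
      rw [Finsupp.mapDomain_apply hinj]
      simp [d']
  · intro v
    rw [degreeOf_le_iff]
    intro J hJ
    rw [mem_support_iff] at hJ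
    obtain ⟨u, rfl, hu⟩ := coeff_rename_ne_zero _ _ _ hJ
    by_cases hv : v < m
    · have : Finsupp.mapDomain Fin.val u v = u ⟨v, hv⟩ :=
        Finsupp.mapDomain_apply hinj u (⟨v, hv⟩ : Fin m)
      rw [this]
      simp only [d', dif_pos hv]
      exact (degreeOf_le_iff.mp (hd ⟨v, hv⟩)) u (mem_support_iff.mpr hu)
    · rw [Finsupp.mapDomain_notin_range]
      · simp
      · rintro ⟨x, rfl⟩; exact hv x.2
  · intro v hv; simp only [d', dif_pos hv]; exact hd1 _
  · intro v hv; simp [d', hv.not_gt]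
  · intro v hv
    simp only [d', dif_pos hv, dif_pos (show v < m by omega)]
    exact hrat ⟨v, _⟩ ⟨v + 1, hv⟩ rfl
  · intro v hv; simp only [p', q', dif_pos hv]; exact hpq _
  · intro v hv
    simp only [d', q', dif_pos hv, dif_pos (show 0 < m by omega)]
    refine le_trans ?_ (hlog ⟨v, hv⟩ ⟨0, by omega⟩)
    have := one_le_l1 hne
    gcongr
    exact l1_rename _ _

/-- choice of the two indices in a primitive vector. -/
lemma choose_ab {ι : Type*} [Fintype ι] [DecidableEq ι] [Nontrivial ι] (v : ι → ℤ)
    (hprim : ∃ c : ι → ℤ, ∑ i, c i * v i = 1) (B : ℝ) (hB1 : 0 < B) (hB : ∃ i, B ≤ |(v i : ℝ)|) :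
    ∃ a b : ι, a ≠ b ∧ v a ≠ 0 ∧ ∃ p q : ℤ, 0 < q ∧ IsCoprime p q ∧
      - (v b : ℝ) / v a = p / q ∧ Real.log B / Fintype.card ι ≤ Real.log q := by
  obtain ⟨i, hi⟩ := hB
  obtain ⟨a, -, hmax⟩ := Finset.exists_max_image Finset.univ (fun i => |(v i : ℝ)|) ⟨i, by simp⟩
  have ha : B ≤ |(v a : ℝ)| := hi.trans (hmax i (by simp))
  have hva : v a ≠ 0 := by
    intro h; rw [h] at ha; simp at ha; linarith
  set q : ι → ℤ := fun b => |v a| / Int.gcd (v a) (v b) with hq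
  have hgpos : ∀ b, 0 < (Int.gcd (v a) (v b) : ℤ) := fun b => by
    exact_mod_cast Int.gcd_pos_of_ne_zero_left _ hva
  have hgdvd : ∀ b, (Int.gcd (v a) (v b) : ℤ) ∣ |v a| := fun b =>
    (dvd_abs _ _).mpr (Int.gcd_dvd_left ..)
  have hqpos : ∀ b, 0 < q b := fun b =>
    Int.ediv_pos_of_pos_of_dvd (abs_pos.mpr hva) (hgpos b).le (hgdvd b)
  have hqmul : ∀ b, q b * (Int.gcd (v a) (v b) : ℤ) = |v a| := fun b =>
    Int.ediv_mul_cancel (hgdvd b)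
  have hdvd1 : ∀ b, v a ∣ v b * q b := by
    intro b
    obtain ⟨k, hk⟩ := Int.gcd_dvd_right (a := v a) (b := v b)
    rw [← abs_dvd, ← hqmul b]
    refine ⟨k, ?_⟩
    conv_lhs => rw [hk]
    ring
  set Q := ∏ b ∈ Finset.univ.erase a, q b with hQ
  have hdvd2 : v a ∣ Q := by
    obtain ⟨c, hc⟩ := hprim
    have : Q = ∑ i, c i * (v i * Q) := by
      calc Q = (∑ i, c i * v i) * Q := by rw [hc, one_mul]
        _ = _ := by
          rw [Finset.sum_mul]
          exact Finset.sum_congr rfl fun i _ => by ring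
    rw [this]
    refine Finset.dvd_sum fun i _ => Dvd.dvd.mul_left ?_ _
    by_cases hia : i = a
    · subst hia; exact Dvd.intro _ rfl
    · exact (hdvd1 i).trans (mul_dvd_mul_left _
        (Finset.dvd_prod_of_mem q (Finset.mem_erase.mpr ⟨hia, Finset.mem_univ _⟩)))
  have hQpos : 0 < Q := Finset.prod_pos fun b _ => hqpos b
  have hle : |v a| ≤ Q := Int.le_of_dvd hQpos ((abs_dvd _ _).mpr hdvd2)
  obtain ⟨b0, hb0⟩ := exists_ne a
  obtain ⟨b, hb, hbmax⟩ := Finset.exists_max_image (Finset.univ.erase a) q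
    ⟨b0, by simp [hb0]⟩
  have hba : b ≠ a := Finset.ne_of_mem_erase hb
  have hQle : (Q : ℝ) ≤ (q b : ℝ) ^ (Fintype.card ι) := by
    have h1 : (Q : ℤ) ≤ q b ^ (Finset.univ.erase a).card := by
      rw [← Finset.prod_const]
      exact Finset.prod_le_prod (fun i _ => (hqpos i).le) hbmax
    have h2 : q b ^ (Finset.univ.erase a).card ≤ q b ^ (Fintype.card ι) :=
      pow_le_pow_right₀ (hqpos b) (Finset.card_le_univ _)
    exact_mod_cast h1.trans h2
  have hg := hgpos b
  refine ⟨a, b, hba.symm, hva, - (v b / Int.gcd (v a) (v b)) * Int.sign (v a), q b, hqpos b, ?_, ?_, ?_⟩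
  · have hcop : IsCoprime (v a / Int.gcd (v a) (v b)) (v b / Int.gcd (v a) (v b)) := by
      rw [Int.isCoprime_iff_gcd_eq_one]
      exact Int.gcd_ediv_gcd_ediv_gcd (by exact_mod_cast hg)
    have hqe : q b = v a / Int.gcd (v a) (v b) * Int.sign (v a) := by
      rw [hq]
      simp only
      rw [← Int.sign_mul_self_eq_abs, Int.mul_ediv_assoc _ (Int.gcd_dvd_left ..), mul_comm]
    have hs : IsUnit (Int.sign (v a)) := by
      rcases lt_or_gt_of_ne hva with h | h
      · rw [Int.sign_eq_neg_one_of_neg h]; simp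
      · rw [Int.sign_eq_one_of_pos h]; simp
    rw [hqe, isCoprime_mul_unit_right hs, IsCoprime.neg_left_iff]
    exact hcop.symm
  · have h1 : (v a : ℝ) = q b * (Int.gcd (v a) (v b) : ℤ) * Int.sign (v a) := by
      have : v a = q b * (Int.gcd (v a) (v b) : ℤ) * Int.sign (v a) := by
        rw [hqmul b, mul_comm, Int.sign_mul_abs]
      exact_mod_cast this
    have h2 : (v b : ℝ) = ((v b / Int.gcd (v a) (v b) : ℤ) : ℝ) * (Int.gcd (v a) (v b) : ℤ) := by
      exact_mod_cast (Int.ediv_mul_cancel (Int.gcd_dvd_right ..)).symm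
    have h3 : ((Int.sign (v a) : ℤ) : ℝ) * (Int.sign (v a) : ℤ) = 1 := by
      rcases lt_or_gt_of_ne hva with h | h
      · rw [Int.sign_eq_neg_one_of_neg h]; simp
      · rw [Int.sign_eq_one_of_pos h]; simp
    have hq0 : (q b : ℝ) ≠ 0 := by exact_mod_cast (hqpos b).ne'
    have hg0 : (((Int.gcd (v a) (v b) : ℕ) : ℤ) : ℝ) ≠ 0 := by exact_mod_cast hg.ne'
    have hva0 : (v a : ℝ) ≠ 0 := by exact_mod_cast hva
    rw [div_eq_div_iff hva0 hq0, h1]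
    conv_lhs => rw [h2]
    push_cast
    linear_combination ((v b / Int.gcd (v a) (v b) : ℤ) : ℝ) * q b * (((Int.gcd (v a) (v b) : ℕ) : ℤ) : ℝ) * h3
  · rw [div_le_iff₀ (by exact_mod_cast Fintype.card_pos), mul_comm, ← Real.log_pow]
    refine Real.log_le_log hB1 (ha.trans (le_trans ?_ hQle))
    rw [← Int.cast_abs]; exact_mod_cast hle

theorem index_thm (m : ℕ) {ι : Type*} [Fintype ι] [DecidableEq ι] [Nontrivial ι] (θ : ℝ)
    (hθ : 0 < θ) : ∃ τ : ℝ, 0 < τ ∧ τ ≤ 1 ∧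
    ∀ (r : Fin m → ℕ) (mv : Fin m → ι → ℤ) (B : Fin m → ℝ) (P : MvPolynomial (Fin m × ι) ℤ),
    P ≠ 0 → (∀ J ∈ P.support, ∀ h, ∑ i, J (h, i) = r h) → (∀ h, 1 ≤ r h) →
    (∀ v v' : Fin m, v'.val = v.val + 1 → (r v' : ℝ) ≤ τ * r v) →
    (∀ h, ∃ c : ι → ℤ, ∑ i, c i * mv h i = 1) →
    (∀ h, 0 < B h ∧ ∃ i, B h ≤ |(mv h i : ℝ)|) →
    (∀ h h', Real.log (l1 nuZ P) + r h' ≤ τ * r h * (Real.log (B h) / Fintype.card ι)) →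
    ∃ I : Fin m × ι →₀ ℕ, ∑ h, ((∑ i, I (h, i) : ℕ) : ℝ) / r h < θ ∧
      ∃ x : Fin m × ι → ℝ, (∀ h, ∑ k, (mv h k : ℝ) * x (h, k) = 0) ∧
        eval x (map (Int.castRingHom ℝ) (hasse I P)) ≠ 0 := by
  obtain ⟨τ, h0, h1, H⟩ := roth_fin m θ hθ
  refine ⟨τ, h0, h1, ?_⟩
  intro r mv B P hP hhom hr1 hrat hprim hB hlog
  have hab := fun h => choose_ab (mv h) (hprim h) (B h) (hB h).1 (hB h).2
  choose a b hab hva p q hq hcop hξ hlogq using hab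
  by_contra hcon
  push Not at hcon
  obtain ⟨f, hf, hfl, hfd, hfi⟩ := extrP_index a b P hP (fun h k => (mv h k : ℝ)) hab
    (fun h => by exact_mod_cast hva h) r hhom
  have HH := H r p q f hf hfd hr1 hrat (fun v => ⟨hq v, hcop v⟩) ?_
  · obtain ⟨I, hI, hw⟩ := HH
    have := hfi I (fun x hx => hcon (eA a I) ?_ x hx)
    · apply hI
      rw [coeff_shift, hasse_map]
      have e1 : (fun h => - (mv h (b h) : ℝ) / mv h (a h)) =
          fun h => ((((p h : ℚ) / q h : ℚ)) : ℝ) := by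
        ext h; rw [hξ h]; push_cast; rfl
      rw [e1] at this
      have e2 : eval (fun h => ((((p h : ℚ) / q h : ℚ)) : ℝ))
          (map (Int.castRingHom ℝ) (hasse I f)) =
          ((eval (fun h => (p h : ℚ) / q h) (map (Int.castRingHom ℚ) (hasse I f)) : ℚ) : ℝ) := by
        rw [eval_map, eval_map]
        change _ = (algebraMap ℚ ℝ) _
        rw [hom_eval₂]
        congr 1
      rw [e2] at this
      exact_mod_cast this
    · convert hw using 3 with h
      norm_cast
      rw [Finset.sum_eq_single (a h)]
      · simp [eA_apply]
      · intro x _ hx; simp [eA_apply, hx]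
      · simp
  · intro v v'
    have hl := one_le_l1 hf
    have : Real.log (l1 nuZ f) ≤ Real.log (l1 nuZ P) := Real.log_le_log (by linarith) hfl
    have h3 := hlog v v'
    have h4 : τ * r v * (Real.log (B v) / Fintype.card ι) ≤ τ * r v * Real.log (q v) := by
      have := hlogq v
      gcongr
    linarith

end SST

end

section
open MvPolynomial

namespace SST

/-- A ring of algebraic integers with a real embedding and a submultiplicative height. -/
structure HR (R : Type*) [CommRing R] where
  d : ℕ
  d_pos : 0 < d
  bas : Module.Basis (Fin d) ℤ R
  φ : R →+* ℝ
  inj : Function.Injective φ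
  ν : RingSeminorm R
  nu_one : ν 1 ≤ 1
  K : ℝ
  K1 : 1 ≤ K
  repr_le : ∀ z j, |(bas.repr z j : ℝ)| ≤ K * ν z
  phi_le : ∀ z, |φ z| ≤ K * ν z
  c : ℝ
  c_pos : 0 < c
  liou : ∀ z, z ≠ 0 → c ≤ |φ z| * ν z ^ d
  nu_ge : ∀ z, z ≠ 0 → 1 ≤ ν z

section mk
open Matrix
attribute [local instance] Matrix.linftyOpNormedRing Matrix.linftyOpNormedAddCommGroup

variable {R : Type*} [CommRing R] [IsDomain R] {d : ℕ} (b : Module.Basis (Fin d) ℤ R)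

noncomputable def matNu : RingSeminorm R where
  toFun z := ‖Algebra.leftMulMatrix b z‖
  map_zero' := by simp
  add_le' x y := by rw [map_add]; exact norm_add_le _ _
  neg' x := by rw [map_neg, norm_neg]
  mul_le' x y := by rw [map_mul]; exact norm_mul_le _ _

lemma matNu_apply (z : R) : matNu b z = ‖Algebra.leftMulMatrix b z‖ := rfl

lemma entry_le (M : Matrix (Fin d) (Fin d) ℤ) (i j : Fin d) : |(M i j : ℝ)| ≤ ‖M‖ := by
  have h1 : (∑ j, ‖M i j‖₊) ≤ ‖M‖₊ := by
    rw [Matrix.linfty_opNNNorm_def]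
    exact Finset.le_sup (f := fun i => ∑ j, ‖M i j‖₊) (Finset.mem_univ i)
  have h2 : ‖M i j‖₊ ≤ ∑ j, ‖M i j‖₊ :=
    Finset.single_le_sum (f := fun j => ‖M i j‖₊) (fun _ _ => zero_le) (Finset.mem_univ j)
  have h3 := h2.trans h1
  rw [← Int.norm_eq_abs]
  exact_mod_cast h3

theorem exists_HR (b : Module.Basis (Fin d) ℤ R) (hd : 0 < d) (φ : R →+* ℝ) (hφ : Function.Injective φ) :
    ∃ h : HR R, h.φ = φ := by
  classical
  haveI : Nonempty (Fin d) := ⟨⟨0, hd⟩⟩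
  have hge : ∀ z : R, z ≠ 0 → 1 ≤ matNu b z := by
    intro z hz
    have : Algebra.leftMulMatrix b z ≠ 0 := fun h =>
      hz (Algebra.leftMulMatrix_injective b (by rw [h, map_zero]))
    have : ∃ i j, Algebra.leftMulMatrix b z i j ≠ 0 := by
      by_contra h; push Not at h; exact this (by ext i j; exact h i j)
    obtain ⟨i, j, hij⟩ := this
    refine le_trans ?_ (entry_le _ i j)
    exact_mod_cast Int.one_le_abs hij
  -- coordinates
  set S : ℝ := ∑ k, |(b.repr 1 k : ℝ)| with hS
  have hS0 : 0 ≤ S := Finset.sum_nonneg fun _ _ => abs_nonneg _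
  have hrepr : ∀ z j, |(b.repr z j : ℝ)| ≤ S * matNu b z := by
    intro z j
    have h1 := congrFun (Algebra.leftMulMatrix_mulVec_repr b z 1) j
    rw [mul_one] at h1
    rw [← h1, Matrix.mulVec, dotProduct, hS, Finset.sum_mul]
    push_cast
    refine (Finset.abs_sum_le_sum_abs _ _).trans (Finset.sum_le_sum fun k _ => ?_)
    rw [abs_mul, mul_comm]
    exact mul_le_mul_of_nonneg_left (entry_le _ _ _) (abs_nonneg _)
  set S2 : ℝ := ∑ k, |φ (b k)| with hS2
  have hS20 : 0 ≤ S2 := Finset.sum_nonneg fun _ _ => abs_nonneg _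
  have hphi : ∀ z, φ z = ∑ k, (b.repr z k : ℝ) * φ (b k) := by
    intro z
    conv_lhs => rw [← b.sum_repr z]
    rw [map_sum]
    refine Finset.sum_congr rfl fun k _ => ?_
    rw [zsmul_eq_mul, map_mul, map_intCast]
  have hphile : ∀ z, |φ z| ≤ (S * S2) * matNu b z := by
    intro z
    rw [hphi z]
    refine (Finset.abs_sum_le_sum_abs _ _).trans ?_
    rw [show S * S2 * matNu b z = ∑ k, (S * matNu b z) * |φ (b k)| by
      rw [← Finset.mul_sum]; ring]
    refine Finset.sum_le_sum fun k _ => ?_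
    rw [abs_mul]
    exact mul_le_mul_of_nonneg_right (hrepr z k) (abs_nonneg _)
  -- Liouville
  set j0 : Fin d := ⟨0, hd⟩
  have hu0 : 0 < |φ (b j0)| := by
    rw [abs_pos]
    intro h
    rw [← map_zero φ] at h
    exact b.ne_zero j0 (hφ h)
  have hS2pos : 0 < S2 := lt_of_lt_of_le hu0
    (Finset.single_le_sum (f := fun k => |φ (b k)|) (fun _ _ => abs_nonneg _) (Finset.mem_univ j0))
  have hliou : ∀ z, z ≠ 0 → |φ (b j0)| ≤ |φ z| * ((S2 * d.factorial) * matNu b z ^ d) := by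
    intro z hz
    set M := Algebra.leftMulMatrix b z with hM
    have hN := hge z hz
    have hdet : 1 ≤ |(M.det : ℝ)| := by
      have : M.det ≠ 0 := by
        rw [hM, ← Algebra.norm_eq_matrix_det b]
        haveI := Module.Finite.of_basis b
        haveI := Module.Free.of_basis b
        exact Algebra.norm_ne_zero_iff.mpr hz
      exact_mod_cast Int.one_le_abs this
    have heig : ∀ j, ∑ i, φ (b i) * (M i j : ℝ) = φ z * φ (b j) := by
      intro j
      rw [← map_mul, hphi (z * b j)]
      refine Finset.sum_congr rfl fun i _ => ?_
      rw [hM, Algebra.leftMulMatrix_eq_repr_mul, mul_comm]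
    have hadj : ∀ i j, |(M.adjugate i j : ℝ)| ≤ d.factorial * matNu b z ^ d := by
      intro i j
      rw [Matrix.adjugate_apply, Matrix.det_apply]
      push_cast
      refine (Finset.abs_sum_le_sum_abs _ _).trans ?_
      have : ∀ σ ∈ (Finset.univ : Finset (Equiv.Perm (Fin d))),
          |((Equiv.Perm.sign σ • ∏ k, (M.updateRow j (Pi.single i 1)) (σ k) k : ℤ) : ℝ)| ≤
            matNu b z ^ d := by
        intro σ _
        have h1 : |((∏ k, (M.updateRow j (Pi.single i 1)) (σ k) k : ℤ) : ℝ)| ≤ matNu b z ^ d := by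
          push_cast
          rw [Finset.abs_prod]
          calc ∏ k, |((M.updateRow j (Pi.single i 1) (σ k) k : ℤ) : ℝ)|
              ≤ ∏ _k : Fin d, matNu b z := by
                refine Finset.prod_le_prod (fun _ _ => abs_nonneg _) fun k _ => ?_
                rw [Matrix.updateRow_apply]
                split_ifs
                · rw [Pi.single_apply]; split_ifs
                  · simpa using hN
                  · simpa using zero_le_one.trans hN
                · exact entry_le _ _ _
            _ = _ := by simp
        rcases Int.units_eq_one_or (Equiv.Perm.sign σ) with h | h <;> rw [h]
        · simpa using h1
        · simpa using h1
      refine le_trans (Finset.sum_le_sum fun σ hσ => ?_) ((Finset.sum_le_card_nsmul _ _ _ this).trans ?_)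
      · exact le_of_eq (by push_cast; rfl)
      · simp [Fintype.card_perm]
    have hmul : (M.det : ℝ) * φ (b j0) = φ z * ∑ k, φ (b k) * (M.adjugate k j0 : ℝ) := by
      have h1 : ∀ i, ∑ k, (M i k : ℝ) * (M.adjugate k j0 : ℝ) = if i = j0 then (M.det : ℝ) else 0 := by
        intro i
        have := congrFun (congrFun (Matrix.mul_adjugate M) i) j0
        rw [Matrix.mul_apply, Matrix.smul_apply, Matrix.one_apply] at this
        have h2 : ((∑ k, M i k * M.adjugate k j0 : ℤ) : ℝ) = ((M.det • (if i = j0 then (1:ℤ) else 0) : ℤ) : ℝ) := by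
          rw [this]
        push_cast at h2
        rw [h2]
        split_ifs <;> simp
      calc (M.det : ℝ) * φ (b j0) = ∑ i, φ (b i) * (if i = j0 then (M.det : ℝ) else 0) := by
            simp [mul_comm]
        _ = ∑ i, ∑ k, φ (b i) * ((M i k : ℝ) * (M.adjugate k j0 : ℝ)) := by
            refine Finset.sum_congr rfl fun i _ => by rw [← h1, Finset.mul_sum]
        _ = ∑ k, (∑ i, φ (b i) * (M i k : ℝ)) * (M.adjugate k j0 : ℝ) := by
            rw [Finset.sum_comm]
            refine Finset.sum_congr rfl fun k _ => by
              rw [Finset.sum_mul]; exact Finset.sum_congr rfl fun i _ => by ring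
        _ = _ := by
            rw [Finset.mul_sum]
            exact Finset.sum_congr rfl fun k _ => by rw [heig]; ring
    have h5 : |∑ k, φ (b k) * (M.adjugate k j0 : ℝ)| ≤ (S2 * d.factorial) * matNu b z ^ d := by
      refine (Finset.abs_sum_le_sum_abs _ _).trans ?_
      rw [mul_assoc, hS2, Finset.sum_mul]
      refine Finset.sum_le_sum fun k _ => ?_
      rw [abs_mul]
      exact mul_le_mul_of_nonneg_left (hadj k j0) (abs_nonneg _)
    calc |φ (b j0)| ≤ |(M.det : ℝ)| * |φ (b j0)| := le_mul_of_one_le_left hu0.le hdet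
      _ = |φ z| * |∑ k, φ (b k) * (M.adjugate k j0 : ℝ)| := by rw [← abs_mul, hmul, abs_mul]
      _ ≤ _ := mul_le_mul_of_nonneg_left h5 (abs_nonneg _)
  have hF : (0 : ℝ) < d.factorial := by exact_mod_cast d.factorial_pos
  have hnn : ∀ z, 0 ≤ matNu b z := fun z => apply_nonneg _ _
  refine ⟨⟨d, hd, b, φ, hφ, matNu b, ?_, max 1 (max S (S * S2)), le_max_left _ _, ?_, ?_,
    |φ (b j0)| / (S2 * d.factorial), by positivity, ?_, hge⟩, rfl⟩
  · rw [matNu_apply, map_one, norm_one]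
  · intro z j
    exact (hrepr z j).trans (mul_le_mul_of_nonneg_right
      ((le_max_left _ _).trans (le_max_right _ _)) (hnn z))
  · intro z
    exact (hphile z).trans (mul_le_mul_of_nonneg_right
      ((le_max_right _ _).trans (le_max_right _ _)) (hnn z))
  · intro z hz
    rw [div_le_iff₀ (by positivity)]
    calc _ ≤ _ := hliou z hz
      _ = _ := by ring

end mk

end SST

end

section
open MvPolynomial

namespace SST

section count
variable {H ι : Type*} [Fintype H] [Fintype ι] [DecidableEq H] [DecidableEq ι]

lemma sum_piAntidiag_symm (n : ℕ) (i j : ι) :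
    ∑ k ∈ Finset.piAntidiag (Finset.univ : Finset ι) n, (k i : ℝ) =
    ∑ k ∈ Finset.piAntidiag (Finset.univ : Finset ι) n, (k j : ℝ) := by
  refine Finset.sum_bij' (fun k _ => k ∘ Equiv.swap i j) (fun k _ => k ∘ Equiv.swap i j) ?_ ?_ ?_ ?_ ?_
  · intro k hk
    rw [Finset.mem_piAntidiag] at hk ⊢
    refine ⟨?_, by simp⟩
    rw [← hk.1]
    exact Equiv.sum_comp (Equiv.swap i j) k
  · intro k hk
    rw [Finset.mem_piAntidiag] at hk ⊢
    refine ⟨?_, by simp⟩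
    rw [← hk.1]
    exact Equiv.sum_comp (Equiv.swap i j) k
  · intro k _; ext x; simp
  · intro k _; ext x; simp
  · intro k _; simp

lemma sum_piAntidiag_mean [Nonempty ι] (n : ℕ) (hn : 1 ≤ n) (i : ι) :
    ∑ k ∈ Finset.piAntidiag (Finset.univ : Finset ι) n,
      ((k i : ℝ) / n - 1 / Fintype.card ι) = 0 := by
  have hN : (Fintype.card ι : ℝ) ≠ 0 := by exact_mod_cast Fintype.card_ne_zero
  have hn' : (n : ℝ) ≠ 0 := by exact_mod_cast (by omega : n ≠ 0)
  have h1 : (Fintype.card ι : ℝ) * ∑ k ∈ Finset.piAntidiag (Finset.univ : Finset ι) n, (k i : ℝ) =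
      n * (Finset.piAntidiag (Finset.univ : Finset ι) n).card := by
    calc _ = ∑ j : ι, ∑ k ∈ Finset.piAntidiag (Finset.univ : Finset ι) n, (k j : ℝ) := by
          rw [Finset.sum_congr rfl fun j _ => sum_piAntidiag_symm n j i]; simp
      _ = ∑ k ∈ Finset.piAntidiag (Finset.univ : Finset ι) n, (n : ℝ) := by
          rw [Finset.sum_comm]
          refine Finset.sum_congr rfl fun k hk => ?_
          rw [Finset.mem_piAntidiag] at hk
          exact_mod_cast hk.1
      _ = _ := by simp [mul_comm]
  rw [Finset.sum_sub_distrib, ← Finset.sum_div, Finset.sum_const, nsmul_eq_mul]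
  field_simp
  linarith

/-- multi-index set -/
def mI (ι : Type*) [Fintype ι] [DecidableEq ι] (r : H → ℕ) : Finset (H → ι → ℕ) :=
  Fintype.piFinset fun h => Finset.piAntidiag (Finset.univ : Finset ι) (r h)

lemma mem_mI (r : H → ℕ) (J : H → ι → ℕ) : J ∈ mI ι r ↔ ∀ h, ∑ i, J h i = r h := by
  simp [mI, Finset.mem_piAntidiag]

lemma variance_bound [Nonempty ι] (r : H → ℕ) (hr : ∀ h, 1 ≤ r h) (i : ι) :
    ∑ J ∈ mI ι r, (∑ h, (J h i : ℝ) / r h - (Fintype.card H : ℝ) / Fintype.card ι) ^ 2 ≤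
      Fintype.card H * (mI ι r).card := by
  set z : H → (ι → ℕ) → ℝ := fun h k => (k i : ℝ) / r h - 1 / Fintype.card ι with hz
  have hN : (1 : ℝ) ≤ (Fintype.card ι : ℝ) := by exact_mod_cast Fintype.card_pos
  have h1 : ∀ J : H → ι → ℕ, ∑ h, (J h i : ℝ) / r h - (Fintype.card H : ℝ) / Fintype.card ι =
      ∑ h, z h (J h) := by
    intro J
    simp only [hz, Finset.sum_sub_distrib, Finset.sum_const, nsmul_eq_mul, Finset.card_univ]
    ring
  have hoff : ∀ h h', h ≠ h' → ∑ J ∈ mI ι r, z h (J h) * z h' (J h') = 0 := by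
    intro h h' hne
    set f : H → (ι → ℕ) → ℝ := fun k x =>
      (if k = h then z h x else 1) * (if k = h' then z h' x else 1) with hf
    have h2 : ∀ J : H → ι → ℕ, z h (J h) * z h' (J h') = ∏ k, f k (J k) := by
      intro J
      simp only [hf]
      rw [Finset.prod_mul_distrib, Finset.prod_ite_eq', Finset.prod_ite_eq']
      simp
    rw [Finset.sum_congr rfl fun J _ => h2 J, mI, ← Finset.prod_univ_sum]
    refine Finset.prod_eq_zero (Finset.mem_univ h) ?_
    simp only [hf, if_true, if_neg hne, mul_one]
    exact sum_piAntidiag_mean (r h) (hr h) i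
  have hdiag : ∀ h, ∑ J ∈ mI ι r, z h (J h) * z h (J h) ≤ (mI ι r).card := by
    intro h
    have : ∀ J ∈ mI ι r, z h (J h) * z h (J h) ≤ 1 := by
      intro J hJ
      rw [mem_mI] at hJ
      have h3 : (J h i : ℝ) ≤ r h := by
        rw [← hJ h]
        exact_mod_cast Finset.single_le_sum (f := fun i => J h i) (fun _ _ => Nat.zero_le _)
          (Finset.mem_univ i)
      have h4 : (0 : ℝ) < r h := by exact_mod_cast hr h
      have h5 : (J h i : ℝ) / r h ≤ 1 := by rw [div_le_one h4]; exact h3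
      have h6 : 0 ≤ (J h i : ℝ) / r h := by positivity
      have h7 : 1 / (Fintype.card ι : ℝ) ≤ 1 := by
        rw [div_le_one (by linarith)]; exact hN
      have h8 : 0 ≤ 1 / (Fintype.card ι : ℝ) := by positivity
      simp only [hz]
      nlinarith
    refine (Finset.sum_le_card_nsmul _ _ _ this).trans ?_
    simp
  calc _ = ∑ J ∈ mI ι r, ∑ h, ∑ h', z h (J h) * z h' (J h') := by
        refine Finset.sum_congr rfl fun J _ => ?_
        rw [h1, sq, Finset.sum_mul_sum]
    _ = ∑ h, ∑ h', ∑ J ∈ mI ι r, z h (J h) * z h' (J h') := by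
        rw [Finset.sum_comm]
        refine Finset.sum_congr rfl fun h _ => by rw [Finset.sum_comm]
    _ = ∑ h, ∑ J ∈ mI ι r, z h (J h) * z h (J h) := by
        refine Finset.sum_congr rfl fun h _ => ?_
        refine Finset.sum_eq_single h (fun h' _ hne => hoff h h' hne.symm) (by simp)
    _ ≤ ∑ _h : H, ((mI ι r).card : ℝ) := Finset.sum_le_sum fun h _ => hdiag h
    _ = _ := by simp

open Classical in
/-- bad multi-indices -/
noncomputable def badI (ι : Type*) [Fintype ι] [DecidableEq ι] (r : H → ℕ) (ε : ℝ) : Finset (H → ι → ℕ) :=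
  (mI ι r).filter fun J => ∃ i, ε * Fintype.card H <
    |∑ h, (J h i : ℝ) / r h - (Fintype.card H : ℝ) / Fintype.card ι|

lemma bad_count [Nonempty ι] [Nonempty H] (r : H → ℕ) (hr : ∀ h, 1 ≤ r h) (ε : ℝ) (hε : 0 < ε) :
    ((badI ι r ε).card : ℝ) * (ε ^ 2 * Fintype.card H) ≤ Fintype.card ι * (mI ι r).card := by
  classical
  have hm : (0 : ℝ) < Fintype.card H := by exact_mod_cast Fintype.card_pos
  have h1 : ∀ J ∈ badI ι r ε, (ε * Fintype.card H) ^ 2 ≤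
      ∑ i, (∑ h, (J h i : ℝ) / r h - (Fintype.card H : ℝ) / Fintype.card ι) ^ 2 := by
    intro J hJ
    obtain ⟨-, i, hi⟩ := Finset.mem_filter.mp hJ
    refine le_trans ?_ (Finset.single_le_sum (f := fun i =>
      (∑ h, (J h i : ℝ) / r h - (Fintype.card H : ℝ) / Fintype.card ι) ^ 2)
      (fun _ _ => sq_nonneg _) (Finset.mem_univ i))
    rw [← sq_abs (∑ h, _ - _)]
    gcongr
  have h2 : ((badI ι r ε).card : ℝ) * (ε * Fintype.card H) ^ 2 ≤
      Fintype.card ι * (Fintype.card H * (mI ι r).card) := by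
    rw [← nsmul_eq_mul]
    refine (Finset.card_nsmul_le_sum _ _ _ h1).trans ?_
    refine (Finset.sum_le_sum_of_subset_of_nonneg (Finset.filter_subset _ (mI ι r))
      (fun _ _ _ => Finset.sum_nonneg fun _ _ => sq_nonneg _)).trans ?_
    rw [Finset.sum_comm]
    refine (Finset.sum_le_sum fun i _ => variance_bound r hr i).trans ?_
    simp
  have h3 : ((badI ι r ε).card : ℝ) * (ε ^ 2 * Fintype.card H) * Fintype.card H ≤
      Fintype.card ι * (mI ι r).card * Fintype.card H := by nlinarith
  exact le_of_mul_le_mul_right h3 hm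

lemma card_mI_le (r : H → ℕ) :
    (mI ι r).card ≤ (2 ^ Fintype.card ι) ^ (∑ h, r h) := by
  have : mI ι r ⊆ Fintype.piFinset fun h => Fintype.piFinset fun _ : ι => Finset.range (r h + 1) := by
    intro J hJ
    rw [mem_mI] at hJ
    simp only [Fintype.mem_piFinset, Finset.mem_range]
    intro h i
    have := Finset.single_le_sum (f := fun i => J h i) (fun _ _ => Nat.zero_le _)
          (Finset.mem_univ i)
    rw [hJ h] at this

    omega
  refine (Finset.card_le_card this).trans ?_
  simp only [Fintype.card_piFinset, Finset.card_range, Finset.prod_const, Finset.card_univ]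
  rw [← Finset.prod_pow_eq_pow_sum]
  refine Finset.prod_le_prod' fun h _ => ?_
  rw [← pow_mul, mul_comm, pow_mul]
  exact Nat.pow_le_pow_left Nat.lt_two_pow_self _

lemma card_mI_pos [Nonempty ι] (r : H → ℕ) : 0 < (mI ι r).card := by
  rw [Finset.card_pos]
  obtain ⟨i⟩ := ‹Nonempty ι›
  refine ⟨fun h => Pi.single i (r h), ?_⟩
  rw [mem_mI]; intro h; simp

end count
end SST

end

section
open MvPolynomial

namespace SST

section siegel
attribute [local instance] Matrix.seminormedAddCommGroup

lemma siegel {α β : Type*} [Fintype α] [Fintype β] (A : Matrix α β ℤ) (Y : ℝ) (hY : 1 ≤ Y)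
    (hA : ∀ i j, |(A i j : ℝ)| ≤ Y) (h : 2 * Fintype.card α ≤ Fintype.card β)
    (hβ : 0 < Fintype.card β) :
    ∃ t : β → ℤ, t ≠ 0 ∧ A.mulVec t = 0 ∧ ∀ j, |(t j : ℝ)| ≤ Fintype.card β * Y := by
  classical
  have hβ1 : (1 : ℝ) ≤ Fintype.card β := by exact_mod_cast hβ
  rcases Nat.eq_zero_or_pos (Fintype.card α) with h0 | h0
  · haveI := Fintype.card_eq_zero_iff.mp h0
    obtain ⟨b⟩ := Fintype.card_pos_iff.mp hβ
    refine ⟨fun _ => 1, fun h => by simpa using congrFun h b, Subsingleton.elim _ _, fun j => ?_⟩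
    simp only [Int.cast_one, abs_one]
    nlinarith
  · obtain ⟨t, ht, hAt, hn⟩ := Int.Matrix.exists_ne_zero_int_vec_norm_le A (by omega) h0
    refine ⟨t, ht, hAt, fun j => ?_⟩
    have hA' : max 1 ‖A‖ ≤ Y := by
      refine max_le hY ?_
      rw [Matrix.norm_le_iff (by linarith)]
      intro i j
      rw [Int.norm_eq_abs]; exact hA i j
    have h1 : (1 : ℝ) ≤ Fintype.card β * max 1 ‖A‖ := by
      have := le_max_left 1 ‖A‖
      nlinarith
    have hr : (2 : ℝ) * Fintype.card α ≤ Fintype.card β := by exact_mod_cast h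
    have h0' : (0 : ℝ) < Fintype.card α := by exact_mod_cast h0
    have he : (Fintype.card α : ℝ) / (Fintype.card β - Fintype.card α) ≤ 1 := by
      rw [div_le_one (by linarith)]; linarith
    have h2 := Real.rpow_le_rpow_of_exponent_le h1 he
    rw [Real.rpow_one] at h2
    have h3 : |(t j : ℝ)| ≤ ‖t‖ := by
      rw [← Int.norm_eq_abs]; exact norm_le_pi_norm t j
    refine h3.trans (hn.trans (h2.trans ?_))
    gcongr
end siegel

section aux
variable {H ι : Type*} [Fintype H] [Fintype ι] [DecidableEq H] [DecidableEq ι]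
variable {R : Type*} [CommRing R]

noncomputable def toF (J : H → ι → ℕ) : H × ι →₀ ℕ :=
  Finsupp.equivFunOnFinite.symm fun v => J v.1 v.2
lemma toF_apply (J : H → ι → ℕ) (v : H × ι) : toF J v = J v.1 v.2 := rfl
lemma toF_inj : Function.Injective (toF : (H → ι → ℕ) → _) := by
  intro J K h
  ext a b
  exact DFunLike.congr_fun h (a, b)
lemma toF_curry (J : H × ι →₀ ℕ) : toF (fun h i => J (h, i)) = J := by
  ext v; rfl

/-- the linear substitution in each block -/
noncomputable def subst (B : Matrix ι ι R) (v : H × ι) : MvPolynomial (H × ι) R :=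
  ∑ j, C (B v.2 j) * X (v.1, j)

noncomputable def hat (B : Matrix ι ι R) : MvPolynomial (H × ι) ℤ →ₐ[ℤ] MvPolynomial (H × ι) R :=
  aeval (subst B)

lemma hat_monomial (B : Matrix ι ι R) (J : H × ι →₀ ℕ) (c : ℤ) :
    hat B (monomial J c) = C (c : R) * ∏ v, subst B v ^ J v := by
  rw [hat, aeval_monomial, Finsupp.prod_fintype _ _ (by simp)]
  simp

lemma subst_hom (B : Matrix ι ι R) (v : H × ι) :
    IsWeightedHomogeneous (fun v : H × ι => (Pi.single v.1 1 : H → ℕ)) (subst B v)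
      (Pi.single v.1 1) := by
  refine IsWeightedHomogeneous.sum _ _ _ fun j _ => ?_
  exact IsWeightedHomogeneous.C_mul (isWeightedHomogeneous_X _ _ (v.1, j)) _

lemma weight_eq (J : H × ι →₀ ℕ) (h : H) :
    Finsupp.weight (fun v : H × ι => (Pi.single v.1 1 : H → ℕ)) J h = ∑ i, J (h, i) := by
  rw [Finsupp.weight_apply, Finsupp.sum_fintype _ _ (by simp), Finset.sum_apply,
    Fintype.sum_prod_type]
  rw [Finset.sum_eq_single h]
  · simp
  · intro b _ hb; simp [Pi.single_apply, hb.symm]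
  · simp

lemma prod_subst_hom (B : Matrix ι ι R) (J : H × ι →₀ ℕ) (K : H × ι →₀ ℕ)
    (h : coeff K (∏ v, subst B v ^ J v) ≠ 0) (k : H) : ∑ i, K (k, i) = ∑ i, J (k, i) := by
  have h1 : IsWeightedHomogeneous (fun v : H × ι => (Pi.single v.1 1 : H → ℕ))
      (∏ v, subst B v ^ J v) (∑ v, J v • (Pi.single v.1 1 : H → ℕ)) :=
    IsWeightedHomogeneous.prod _ _ _ fun v _ => (subst_hom B v).pow _
  have h2 := congrFun (h1 h) k
  rw [weight_eq] at h2
  rw [h2, ← weight_eq, Finsupp.weight_apply, Finsupp.sum_fintype _ _ (by simp)]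

lemma l1_prod_subst (ν : RingSeminorm R) (h1 : ν 1 ≤ 1) (B : Matrix ι ι R) (J : H × ι →₀ ℕ) :
    l1 ν (∏ v, subst B v ^ J v) ≤ (1 + ∑ i, ∑ j, ν (B i j)) ^ J.degree := by
  refine (l1_prod h1 _ _).trans ?_
  rw [Finsupp.degree_eq_sum, ← Finset.prod_pow_eq_pow_sum]
  refine Finset.prod_le_prod (fun _ _ => l1_nonneg _ _) fun v _ => ?_
  refine (l1_pow h1 _ _).trans ?_
  refine pow_le_pow_left₀ (l1_nonneg _ _) ?_ _
  refine (l1_sum _ _ _).trans ?_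
  have : ∀ j ∈ (Finset.univ : Finset ι), l1 ν (C (B v.2 j) * X (v.1, j) : MvPolynomial (H × ι) R) ≤ ν (B v.2 j) := by
    intro j _
    rw [C_mul_X_eq_monomial, l1_monomial]
  refine (Finset.sum_le_sum this).trans ?_
  have := Finset.single_le_sum (f := fun i => ∑ j, ν (B i j))
    (fun _ _ => Finset.sum_nonneg fun _ _ => apply_nonneg ν _) (Finset.mem_univ v.2)
  exact this.trans (by linarith)

theorem aux_poly (hR : HR R) [Nonempty ι] [Nonempty H] (B : Matrix ι ι R) (ε : ℝ) (hε : 0 < ε)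
    (hm : 2 * hR.d * Fintype.card ι ≤ ε ^ 2 * Fintype.card H) :
    ∃ C₀ : ℝ, 1 ≤ C₀ ∧ ∀ r : H → ℕ, (∀ h, 1 ≤ r h) →
      ∃ P : MvPolynomial (H × ι) ℤ, P ≠ 0 ∧ (∀ J ∈ P.support, ∀ h, ∑ i, J (h, i) = r h) ∧
        l1 nuZ P ≤ C₀ ^ (∑ h, r h) ∧ l1 hR.ν (hat B P) ≤ C₀ ^ (∑ h, r h) ∧
        ∀ J, coeff J (hat B P) ≠ 0 → (∀ h, ∑ i, J (h, i) = r h) ∧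
          ∀ i, |∑ h, (J (h, i) : ℝ) / r h - (Fintype.card H : ℝ) / Fintype.card ι| ≤
            ε * Fintype.card H := by
  classical
  set b : ℝ := 1 + ∑ i, ∑ j, hR.ν (B i j) with hb
  have hb1 : 1 ≤ b := by
    have : 0 ≤ ∑ i, ∑ j, hR.ν (B i j) :=
      Finset.sum_nonneg fun _ _ => Finset.sum_nonneg fun _ _ => apply_nonneg _ _
    linarith
  have hK := hR.K1
  set q : ℝ := (2 : ℝ) ^ Fintype.card ι with hq
  have hq1 : 1 ≤ q := one_le_pow₀ (by norm_num)
  refine ⟨q * q * (hR.K * b) * b, ?_, ?_⟩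
  · have h1 : 1 ≤ hR.K * b := by nlinarith
    have h2 : 1 ≤ q * q := by nlinarith
    have h3 : 1 ≤ q * q * (hR.K * b) := by nlinarith
    nlinarith
  intro r hr
  set D := ∑ h, r h with hD
  have hD1 : 1 ≤ D := by
    obtain ⟨h⟩ := ‹Nonempty H›
    exact (hr h).trans (Finset.single_le_sum (fun _ _ => Nat.zero_le _) (Finset.mem_univ h))
  have hdeg : ∀ K ∈ mI ι r, (toF K).degree = D := by
    intro K hK
    rw [mem_mI] at hK
    rw [Finsupp.degree_eq_sum, Fintype.sum_prod_type, hD]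
    exact Finset.sum_congr rfl fun h _ => hK h
  set G : (H → ι → ℕ) → MvPolynomial (H × ι) R := fun K => ∏ v, subst B v ^ (toF K) v with hG
  have hGl : ∀ K ∈ mI ι r, l1 hR.ν (G K) ≤ b ^ D := by
    intro K hK
    have := l1_prod_subst hR.ν hR.nu_one B (toF K)
    rwa [hdeg K hK] at this
  set A : Matrix ((badI ι r ε) × Fin hR.d) (mI ι r) ℤ :=
    fun x K => hR.bas.repr (coeff (toF x.1.1) (G K.1)) x.2 with hA
  have hAle : ∀ x K, |(A x K : ℝ)| ≤ (hR.K * b) ^ D := by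
    intro x K
    refine (hR.repr_le _ _).trans ?_
    have h1 := (coeff_le_l1 hR.ν (G K.1) (toF x.1.1)).trans (hGl K.1 K.2)
    rw [mul_pow]
    have h2 : hR.K ≤ hR.K ^ D := le_self_pow₀ hK (by omega)
    exact mul_le_mul h2 h1 (apply_nonneg _ _) (by positivity)
  have hcard : 2 * Fintype.card ((badI ι r ε) × Fin hR.d) ≤ Fintype.card (mI ι r) := by
    rw [Fintype.card_prod, Fintype.card_coe, Fintype.card_coe, Fintype.card_fin]
    have h1 := bad_count (ι := ι) r hr ε hε
    have h2 : (0 : ℝ) ≤ (badI ι r ε).card := Nat.cast_nonneg _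
    have hN : (0 : ℝ) < Fintype.card ι := by exact_mod_cast Fintype.card_pos
    have h3 : (Fintype.card ι : ℝ) * (2 * ((badI ι r ε).card * hR.d)) ≤
        Fintype.card ι * (mI ι r).card := by nlinarith
    have h4 := le_of_mul_le_mul_left h3 hN
    exact_mod_cast h4
  obtain ⟨t, ht0, hAt, htb⟩ := siegel A ((hR.K * b) ^ D) (one_le_pow₀ (by nlinarith)) hAle hcard
    (by rw [Fintype.card_coe]; exact card_mI_pos r)
  rw [Fintype.card_coe] at htb
  have hcardle : ((mI ι r).card : ℝ) ≤ q ^ D := by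
    have := card_mI_le (ι := ι) r
    rw [hq, hD]
    exact_mod_cast this
  have htb' : ∀ K, |(t K : ℝ)| ≤ q ^ D * (hR.K * b) ^ D := fun K =>
    (htb K).trans (by gcongr)
  set P : MvPolynomial (H × ι) ℤ := ∑ K : mI ι r, monomial (toF K.1) (t K) with hP
  have hPc : ∀ K : mI ι r, coeff (toF K.1) P = t K := by
    intro K
    rw [hP, coeff_sum, Finset.sum_eq_single K]
    · simp
    · intro K' _ hne
      rw [coeff_monomial, if_neg]
      exact fun h => hne (Subtype.ext (toF_inj h))
    · simp
  have hhat : hat B P = ∑ K : mI ι r, C (t K : R) * G K.1 := by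
    rw [hP, map_sum]
    exact Finset.sum_congr rfl fun K _ => hat_monomial _ _ _
  have hnut : ∀ K, hR.ν (t K : R) ≤ |(t K : ℝ)| := by
    intro K
    have h1 : ∀ n : ℕ, hR.ν ((n : R)) ≤ n := by
      intro n
      have := nu_natCast_mul (ν := hR.ν) n 1
      rw [mul_one] at this
      refine this.trans ?_
      have := hR.nu_one
      have hn : (0 : ℝ) ≤ n := Nat.cast_nonneg n
      nlinarith
    have h2 : ∀ z : ℤ, hR.ν (z : R) ≤ |(z : ℝ)| := by
      intro z
      obtain ⟨n, rfl | rfl⟩ := z.eq_nat_or_neg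
      · simpa using h1 n
      · rw [Int.cast_neg, map_neg_eq_map]; simpa using h1 n
    exact h2 _
  have hcomb : ∀ x : ℝ, 1 ≤ x → q ^ D * (q ^ D * (hR.K * b) ^ D) * x ^ D ≤
      (q * q * (hR.K * b) * x) ^ D := by
    intro x hx
    simp only [mul_pow]
    exact le_of_eq (by ring)
  refine ⟨P, ?_, ?_, ?_, ?_, ?_⟩
  · intro h
    apply ht0
    ext K
    rw [← hPc K, h]; simp
  · intro J hJ
    have : ∃ K : mI ι r, toF K.1 = J := by
      by_contra hcon
      push Not at hcon
      rw [mem_support_iff] at hJ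
      apply hJ
      rw [hP, coeff_sum]
      exact Finset.sum_eq_zero fun K _ => by rw [coeff_monomial, if_neg (hcon K)]
    obtain ⟨K, rfl⟩ := this
    exact (mem_mI _ _).mp K.2
  · refine (l1_sum _ _ _).trans ?_
    have : ∀ K ∈ (Finset.univ : Finset (mI ι r)), l1 nuZ (monomial (toF K.1) (t K)) ≤
        q ^ D * (hR.K * b) ^ D := by
      intro K _
      rw [l1_monomial, nuZ_apply]; exact htb' K
    refine (Finset.sum_le_card_nsmul _ _ _ this).trans ?_
    rw [nsmul_eq_mul, Finset.card_univ, Fintype.card_coe]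
    refine le_trans ?_ (hcomb b hb1)
    have hbD : 1 ≤ b ^ D := one_le_pow₀ hb1
    have hp : 0 ≤ q ^ D * (q ^ D * (hR.K * b) ^ D) := by positivity
    calc _ ≤ q ^ D * (q ^ D * (hR.K * b) ^ D) := by gcongr
      _ ≤ _ := le_mul_of_one_le_right hp hbD
  · rw [hhat]
    refine (l1_sum _ _ _).trans ?_
    have : ∀ K ∈ (Finset.univ : Finset (mI ι r)), l1 hR.ν (C (t K : R) * G K.1) ≤
        q ^ D * (hR.K * b) ^ D * b ^ D := by
      intro K _
      refine (l1_mul _ _ _).trans ?_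
      rw [l1_C]
      exact mul_le_mul ((hnut K).trans (htb' K)) (hGl K.1 K.2) (l1_nonneg _ _) (by positivity)
    refine (Finset.sum_le_card_nsmul _ _ _ this).trans ?_
    rw [nsmul_eq_mul, Finset.card_univ, Fintype.card_coe]
    refine le_trans ?_ (hcomb b hb1)
    rw [← mul_assoc]
    gcongr
  · intro J hJ
    have hJm : ∀ h, ∑ i, J (h, i) = r h := by
      rw [hhat, coeff_sum] at hJ
      obtain ⟨K, -, hKne⟩ := Finset.exists_ne_zero_of_sum_ne_zero hJ
      rw [coeff_C_mul] at hKne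
      have := prod_subst_hom B (toF K.1) J (right_ne_zero_of_mul hKne)
      intro h
      rw [this h]
      exact (mem_mI _ _).mp K.2 h
    refine ⟨hJm, ?_⟩
    by_contra hcon
    push Not at hcon
    have hJb : (fun h i => J (h, i)) ∈ badI ι r ε := by
      rw [badI, Finset.mem_filter]
      exact ⟨(mem_mI _ _).mpr hJm, hcon⟩
    apply hJ
    apply hR.bas.repr.injective
    rw [map_zero]
    ext k
    have h1 := congrFun hAt (⟨_, hJb⟩, k)
    rw [Matrix.mulVec, dotProduct, Pi.zero_apply] at h1
    rw [hhat, coeff_sum, map_sum, Finsupp.finset_sum_apply, Finsupp.zero_apply, ← h1]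
    refine Finset.sum_congr rfl fun K _ => ?_
    rw [coeff_C_mul, ← zsmul_eq_mul, map_zsmul, Finsupp.smul_apply, hA]
    simp only [toF_curry]
    rw [smul_eq_mul, mul_comm]

end aux
end SST

end

section
open MvPolynomial

namespace SST

/-- absolute value as ring seminorm on the reals -/
noncomputable def nuR : RingSeminorm ℝ where
  toFun x := |x|
  map_zero' := abs_zero
  add_le' := abs_add_le
  neg' := abs_neg
  mul_le' x y := (abs_mul x y).le

lemma nuR_apply (x : ℝ) : nuR x = |x| := rfl

lemma coeff_scale {σ : Type*} [Fintype σ] (s : σ → ℝ) (g : MvPolynomial σ ℝ) (I : σ →₀ ℕ) :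
    coeff I (aeval (fun v => C (s v) * X v) g) = (∏ v, s v ^ I v) * coeff I g := by
  classical
  conv_lhs => rw [g.as_sum, map_sum, coeff_sum]
  have : ∀ J ∈ g.support, coeff I (aeval (fun v => C (s v) * X v) (monomial J (coeff J g))) =
      if J = I then (∏ v, s v ^ I v) * coeff I g else 0 := by
    intro J _
    have h1 : (aeval (fun v => C (s v) * X v : σ → MvPolynomial σ ℝ)) (monomial J (coeff J g)) =
        monomial J (coeff J g * ∏ v, s v ^ J v) := by
      rw [aeval_monomial, Finsupp.prod_fintype _ _ (by simp), monomial_eq,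
        Finsupp.prod_fintype _ _ (by simp), algebraMap_eq]
      simp_rw [mul_pow]
      rw [Finset.prod_mul_distrib, map_mul, map_prod]
      simp only [map_pow]
      ring
    rw [h1, coeff_monomial]
    split_ifs with h
    · subst h; ring
    · rfl
  rw [Finset.sum_congr rfl this, Finset.sum_ite_eq']
  split_ifs with h
  · rfl
  · rw [notMem_support_iff.mp h, mul_zero]

section small
variable {H ι : Type*} [Fintype H] [Fintype ι] [DecidableEq H] [DecidableEq ι]
variable {R : Type*} [CommRing R]

lemma aeval_hom_scale (P : MvPolynomial (H × ι) ℤ) (r : H → ℕ)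
    (hr : ∀ J ∈ P.support, ∀ h, ∑ i, J (h, i) = r h) (c : MvPolynomial (H × ι) ℝ)
    (g : H × ι → MvPolynomial (H × ι) ℝ) :
    aeval (fun v => c * g v) P = c ^ (∑ h, r h) * aeval g P := by
  conv_lhs => rw [P.as_sum, map_sum]
  conv_rhs => rw [P.as_sum, map_sum, Finset.mul_sum]
  refine Finset.sum_congr rfl fun J hJ => ?_
  rw [aeval_monomial, aeval_monomial, Finsupp.prod_fintype _ _ (by simp),
    Finsupp.prod_fintype _ _ (by simp)]
  simp_rw [mul_pow]
  rw [Finset.prod_mul_distrib, Finset.prod_pow_eq_pow_sum]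
  have : ∑ v, J v = ∑ h, r h := by
    rw [Fintype.sum_prod_type]
    exact Finset.sum_congr rfl fun h _ => hr J hJ h
  rw [this]; ring

lemma ringHom_aeval {σ τ : Type*} {S : Type*} [CommRing S] [Algebra ℤ S] {S' : Type*} [CommRing S'] [Algebra ℤ S'] (Ψ : S →+* S')
    (f : σ → S) (P : MvPolynomial σ ℤ) :
    Ψ (aeval f P) = aeval (fun v => Ψ (f v)) P := by
  induction P using MvPolynomial.induction_on with
  | C c => simp
  | add p q hp hq => rw [map_add, map_add, map_add, hp, hq]
  | mul_X p v hp => rw [map_mul, map_mul, map_mul, hp, aeval_X, aeval_X]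

lemma aeval_affine {σ : Type*} (x : σ → ℤ) (s : σ → ℝ) (P : MvPolynomial σ ℤ) :
    aeval (fun v => (C (x v : ℝ) + C (s v) * X v : MvPolynomial σ ℝ)) P =
      aeval (fun v : σ => (C (s v) * X v : MvPolynomial σ ℝ))
        (shift (fun v => (x v : ℝ)) (map (Int.castRingHom ℝ) P)) := by
  induction P using MvPolynomial.induction_on with
  | C c => simp [shift_C]
  | add p q hp hq => simp only [map_add, hp, hq]
  | mul_X p v hp =>
    rw [map_mul, map_mul, map_mul, map_mul, hp, aeval_X, map_X, shift_X, map_add, aeval_X, aeval_C]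
    rw [algebraMap_eq, add_comm]

/-- the real form values -/
noncomputable def gsub (φ : R →+* ℝ) (L : Matrix ι ι R) (x : H × ι → ℤ) (s : H → ℝ) (v : H × ι) :
    MvPolynomial (H × ι) ℝ :=
  C (∑ j, φ (L v.2 j) * (x (v.1, j) : ℝ)) + C (s v.1) * ∑ j, C (φ (L v.2 j)) * X (v.1, j)

lemma adj_sum (φ : R →+* ℝ) (L : Matrix ι ι R) (i k : ι) :
    ∑ j, φ (L.adjugate i j) * φ (L j k) = if i = k then φ L.det else 0 := by
  have := congrArg φ (congrFun (congrFun (Matrix.adjugate_mul L) i) k)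
  rw [Matrix.mul_apply, Matrix.smul_apply, Matrix.one_apply, map_sum] at this
  simp only [map_mul] at this
  rw [this]
  split_ifs <;> simp

lemma adj_sum2 (φ : R →+* ℝ) (L : Matrix ι ι R) (i : ι) {S : Type*} [CommRing S] [Algebra ℝ S] (y : ι → S) :
    ∑ j, algebraMap ℝ S (φ (L.adjugate i j)) * ∑ k, algebraMap ℝ S (φ (L j k)) * y k = algebraMap ℝ S (φ L.det) * y i := by
  have h1 : ∀ j, algebraMap ℝ S (φ (L.adjugate i j)) * ∑ k, algebraMap ℝ S (φ (L j k)) * y k =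
     ∑ k, algebraMap ℝ S (φ (L.adjugate i j) * φ (L j k)) * y k := by
    intro j
    rw [Finset.mul_sum]
    refine Finset.sum_congr rfl fun k _ => ?_
    rw [map_mul, mul_assoc]
  rw [Finset.sum_congr rfl fun j _ => h1 j, Finset.sum_comm]
  simp_rw [← Finset.sum_mul, ← map_sum, adj_sum]
  rw [Finset.sum_eq_single i]
  · simp
  · intro k _ hk; simp [hk.symm]
  · simp

lemma psi_subst (φ : R →+* ℝ) (L : Matrix ι ι R) (x : H × ι → ℤ) (s : H → ℝ) (v : H × ι) :
    eval₂Hom (C.comp φ) (gsub φ L x s) (subst L.adjugate v) =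
      C (φ L.det) * (C (x v : ℝ) + C (s v.1) * X v) := by
  obtain ⟨h, i⟩ := v
  rw [subst, map_sum]
  have h1 : ∀ j, eval₂Hom (C.comp φ) (gsub φ L x s) (C (L.adjugate i j) * X (h, j)) =
      C (φ (L.adjugate i j) * ∑ k, φ (L j k) * (x (h, k) : ℝ)) +
        C (s h) * (C (φ (L.adjugate i j)) * ∑ k, C (φ (L j k)) * X (h, k)) := by
    intro j
    rw [map_mul, coe_eval₂Hom, eval₂_C, eval₂_X, RingHom.comp_apply, gsub, map_mul C]
    ring
  rw [Finset.sum_congr rfl fun j _ => h1 j, Finset.sum_add_distrib, ← map_sum, ← Finset.mul_sum]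
  have h2 := adj_sum2 φ L i (S := ℝ) (fun k => (x (h, k) : ℝ))
  have h3 := adj_sum2 φ L i (S := MvPolynomial (H × ι) ℝ) (fun k => X (h, k))
  simp only [algebraMap_eq, Algebra.algebraMap_self, RingHom.id_apply] at h2 h3
  rw [h2, h3, map_mul]
  ring

lemma psi_hat (φ : R →+* ℝ) (L : Matrix ι ι R) (P : MvPolynomial (H × ι) ℤ) (r : H → ℕ)
    (hr : ∀ J ∈ P.support, ∀ h, ∑ i, J (h, i) = r h) (x : H × ι → ℤ) (s : H → ℝ) :
    eval₂Hom (C.comp φ) (gsub φ L x s) (hat L.adjugate P) = C (φ L.det ^ (∑ h, r h)) *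
      aeval (fun v : H × ι => (C (s v.1) * X v : MvPolynomial (H × ι) ℝ))
        (shift (fun v => (x v : ℝ)) (map (Int.castRingHom ℝ) P)) := by
  rw [hat, ringHom_aeval (τ := ι)]
  simp_rw [psi_subst]
  rw [aeval_hom_scale P r hr (C (φ L.det)) (fun v => C (x v : ℝ) + C (s v.1) * X v), map_pow]
  congr 1
  exact aeval_affine x (fun v => s v.1) P

lemma psi_le (φ : R →+* ℝ) (L : Matrix ι ι R) (G : MvPolynomial (H × ι) R) (x : H × ι → ℤ) (s : H → ℝ)
    (hs : ∀ h, 0 < s h) (X₀ : H × ι → ℝ)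
    (hX : ∀ h i, |∑ j, φ (L i j) * (x (h, j) : ℝ)| ≤ X₀ (h, i)) (hsX : ∀ h i, s h ≤ X₀ (h, i))
    (I : H × ι →₀ ℕ) :
    |coeff I (eval₂Hom (C.comp φ) (gsub φ L x s) G)| ≤ ∑ J ∈ G.support,
      |φ (coeff J G)| * ∏ v, (X₀ v * (2 + ∑ i, ∑ j, |φ (L i j)|)) ^ J v := by
  set Λ : ℝ := ∑ i, ∑ j, |φ (L i j)| with hΛ
  have hΛ0 : 0 ≤ Λ := Finset.sum_nonneg fun _ _ => Finset.sum_nonneg fun _ _ => abs_nonneg _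
  have h1 : nuR 1 ≤ 1 := by rw [nuR_apply]; simp
  have hg : ∀ v, l1 nuR (gsub φ L x s v) ≤ X₀ v * (2 + Λ) := by
    intro v
    have h5 : 0 < X₀ v := (hs v.1).trans_le (hsX v.1 v.2)
    rw [gsub]
    refine (l1_add _ _ _).trans ?_
    rw [l1_C, nuR_apply]
    have h2 : l1 nuR (C (s v.1) * ∑ j, C (φ (L v.2 j)) * X (v.1, j) : MvPolynomial (H × ι) ℝ) ≤
        s v.1 * Λ := by
      refine (l1_mul _ _ _).trans ?_
      rw [l1_C, nuR_apply, abs_of_pos (hs _)]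
      refine mul_le_mul_of_nonneg_left ?_ (hs _).le
      refine (l1_sum _ _ _).trans ?_
      have : ∀ j ∈ (Finset.univ : Finset ι), l1 nuR (C (φ (L v.2 j)) * X (v.1, j) : MvPolynomial (H × ι) ℝ) ≤ |φ (L v.2 j)| := by
        intro j _
        rw [C_mul_X_eq_monomial, l1_monomial, nuR_apply]
      refine (Finset.sum_le_sum this).trans ?_
      exact Finset.single_le_sum (f := fun i => ∑ j, |φ (L i j)|)
        (fun _ _ => Finset.sum_nonneg fun _ _ => abs_nonneg _) (Finset.mem_univ v.2)
    have h3 := hX v.1 v.2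
    have h4 := hsX v.1 v.2
    have h6 : s v.1 * Λ ≤ X₀ v * Λ := mul_le_mul_of_nonneg_right h4 hΛ0
    calc _ ≤ X₀ v + s v.1 * Λ := add_le_add h3 h2
      _ ≤ _ := by nlinarith
  refine (coeff_le_l1 nuR _ I).trans ?_
  conv_lhs => rw [G.as_sum, map_sum]
  refine (l1_sum _ _ _).trans (Finset.sum_le_sum fun J _ => ?_)
  rw [coe_eval₂Hom, eval₂_monomial, Finsupp.prod_fintype _ _ (by simp)]
  refine (l1_mul _ _ _).trans ?_
  rw [RingHom.comp_apply, l1_C, nuR_apply]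
  refine mul_le_mul_of_nonneg_left ?_ (abs_nonneg _)
  refine (l1_prod h1 _ _).trans ?_
  refine Finset.prod_le_prod (fun _ _ => l1_nonneg _ _) fun v _ => ?_
  exact (l1_pow h1 _ _).trans (pow_le_pow_left₀ (l1_nonneg _ _) (hg v) _)

theorem smallness (φ : R →+* ℝ) (L : Matrix ι ι R) (P : MvPolynomial (H × ι) ℤ) (r : H → ℕ)
    (hr : ∀ J ∈ P.support, ∀ h, ∑ i, J (h, i) = r h) (x : H × ι → ℤ) (s : H → ℝ)
    (hs : ∀ h, 0 < s h) (X₀ : H × ι → ℝ)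
    (hX : ∀ h i, |∑ j, φ (L i j) * (x (h, j) : ℝ)| ≤ X₀ (h, i)) (hsX : ∀ h i, s h ≤ X₀ (h, i))
    (I : H × ι →₀ ℕ) :
    |φ L.det| ^ (∑ h, r h) * (∏ v, s v.1 ^ I v) *
      |eval (fun v => (x v : ℝ)) (map (Int.castRingHom ℝ) (hasse I P))| ≤
    ∑ J ∈ (hat L.adjugate P).support, |φ (coeff J (hat L.adjugate P))| *
      ∏ v, (X₀ v * (2 + ∑ i, ∑ j, |φ (L i j)|)) ^ J v := by
  have hc := congrArg (coeff I) (psi_hat φ L P r hr x s)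
  rw [coeff_C_mul, coeff_scale, coeff_shift, hasse_map] at hc
  have hle := psi_le φ L (hat L.adjugate P) x s hs X₀ hX hsX I
  rw [hc] at hle
  refine le_trans (le_of_eq ?_) hle
  rw [abs_mul, abs_mul, abs_pow, abs_of_pos (Finset.prod_pos fun (v : H × ι) _ => pow_pos (hs v.1) _)]
  ring

end small
end SST

end

section
open MvPolynomial

namespace SST

section gv
variable {H ι κ : Type*} [Fintype H] [Fintype ι] [Fintype κ] [DecidableEq H] [DecidableEq ι]

/-- block linear substitution -/
noncomputable def blin (g : H → κ → ι → ℝ) (v : H × ι) : MvPolynomial (H × κ) ℝ :=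
  ∑ j, C (g v.1 j v.2) * X (v.1, j)

lemma block_coeff (g : H → κ → ι → ℝ) (f : MvPolynomial (H × ι) ℝ) (K : H × κ →₀ ℕ)
    (hc : coeff K (aeval (blin g) f) ≠ 0) :
    ∃ J, coeff J f ≠ 0 ∧ ∀ h, ∑ i, J (h, i) = ∑ j, K (h, j) := by
  classical
  rw [f.as_sum, map_sum, coeff_sum] at hc
  obtain ⟨J, hJ, hne⟩ := Finset.exists_ne_zero_of_sum_ne_zero hc
  refine ⟨J, mem_support_iff.mp hJ, fun h => ?_⟩
  rw [aeval_monomial, algebraMap_eq, coeff_C_mul, Finsupp.prod_fintype _ _ (by simp)] at hne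
  have hne2 := right_ne_zero_of_mul hne
  have h0 : ∀ v, IsWeightedHomogeneous (fun v : H × κ => (Pi.single v.1 1 : H → ℕ)) (blin g v)
      (Pi.single v.1 1) := by
    intro v
    refine IsWeightedHomogeneous.sum _ _ _ fun j _ => ?_
    exact IsWeightedHomogeneous.C_mul (isWeightedHomogeneous_X _ _ (v.1, j)) _
  have h1 : IsWeightedHomogeneous (fun v : H × κ => (Pi.single v.1 1 : H → ℕ))
      (∏ v, blin g v ^ J v) (∑ v, J v • (Pi.single v.1 1 : H → ℕ)) :=
    IsWeightedHomogeneous.prod _ _ _ fun v _ => (h0 v).pow _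
  have h2 := congrFun (h1 hne2) h
  rw [weight_eq] at h2
  rw [h2, ← weight_eq, Finsupp.weight_apply, Finsupp.sum_fintype _ _ (by simp)]

lemma shift_blin (g : H → κ → ι → ℝ) (z : H × κ → ℝ) (f : MvPolynomial (H × ι) ℝ) :
    shift z (aeval (blin g) f) =
      aeval (blin g) (shift (fun v => ∑ j, z (v.1, j) * g v.1 j v.2) f) := by
  induction f using MvPolynomial.induction_on with
  | C c => simp [shift_C]
  | add p q hp hq => simp only [map_add, hp, hq]
  | mul_X p v hp =>
    rw [map_mul, map_mul, map_mul, map_mul, hp, aeval_X, shift_X, map_add, aeval_X, aeval_C]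
    congr 1
    rw [blin, map_sum, algebraMap_eq]
    simp only [map_mul, shift_C, shift_X, mul_add, Finset.sum_add_distrib, map_sum]
    congr 1
    exact Finset.sum_congr rfl fun j _ => by ring

theorem grid_vanish (g : H → κ → ι → ℤ) (P : MvPolynomial (H × ι) ℤ) (r : H → ℕ)
    (hr : ∀ J ∈ P.support, ∀ h, ∑ i, J (h, i) = r h) (A : ℕ) (t : H → ℕ)
    (hA : ∀ h, r h < A * (t h + 1)) (I : H × ι →₀ ℕ)
    (hv : ∀ K : H × ι →₀ ℕ, (∀ h, ∑ i, K (h, i) ≤ Fintype.card κ * t h) →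
      ∀ z : H × κ → ℕ, (∀ v, z v < A) →
        eval (fun v => ((∑ j, (z (v.1, j) : ℤ) * g v.1 j v.2 : ℤ) : ℝ))
          (map (Int.castRingHom ℝ) (hasse (K + I) P)) = 0)
    (y : H × κ → ℝ) :
    eval (fun v => ∑ j, y (v.1, j) * (g v.1 j v.2 : ℝ)) (map (Int.castRingHom ℝ) (hasse I P)) = 0 := by
  classical
  set f := map (Int.castRingHom ℝ) (hasse I P) with hf
  set g' : H → κ → ι → ℝ := fun h j i => (g h j i : ℝ) with hg'
  have hF : aeval (blin g') f = 0 := by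
    refine grid_lemma (aeval (blin g') f) A (fun v => t v.1) (fun v => r v.1) ?_ (fun v => hA v.1) ?_
    · intro v
      rw [degreeOf_le_iff]
      intro K hK
      obtain ⟨J, hJ, hJK⟩ := block_coeff g' f K (mem_support_iff.mp hK)
      have h1 : coeff (J + I) P ≠ 0 := by
        intro h0
        apply hJ
        rw [hf, coeff_map, coeff_hasse, h0]; simp
      have h2 := hr _ (mem_support_iff.mpr h1) v.1
      calc K v = K (v.1, v.2) := rfl
        _ ≤ ∑ j, K (v.1, j) := Finset.single_le_sum (f := fun j => K (v.1, j)) (fun _ _ => Nat.zero_le _) (Finset.mem_univ v.2)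
        _ = ∑ i, J (v.1, i) := (hJK _).symm
        _ ≤ ∑ i, (J + I) (v.1, i) := Finset.sum_le_sum fun i _ => by simp
        _ = r v.1 := h2
    · intro z hz K hK
      by_contra hne
      rw [shift_blin] at hne
      obtain ⟨J, hJ, hJK⟩ := block_coeff g' _ K hne
      apply hJ
      rw [coeff_shift, hf, hasse_map]
      obtain ⟨c, hc⟩ := hasse_hasse J I P
      rw [hc, map_mul, map_mul]
      have hv' := hv J (fun h => by
        rw [hJK h]
        calc _ ≤ ∑ j : κ, t h := Finset.sum_le_sum fun j _ => hK (h, j)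
          _ = _ := by simp) z hz
      have e : (fun v : H × ι => ∑ j, (z (v.1, j) : ℝ) * g' v.1 j v.2) =
          (fun v => ((∑ j, (z (v.1, j) : ℤ) * g v.1 j v.2 : ℤ) : ℝ)) := by
        funext v; push_cast; rfl
      rw [e, hv', mul_zero]
  have h2 := congrArg (eval y) hF
  rw [map_zero] at h2
  rw [← h2]
  have : ∀ q : MvPolynomial (H × ι) ℝ, eval y (aeval (blin g') q) = eval (fun v => ∑ j, y (v.1, j) * g' v.1 j v.2) q := by
    intro q
    induction q using MvPolynomial.induction_on with
    | C c => simp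
    | add p q hp hq => simp only [map_add, hp, hq]
    | mul_X p v hp =>
      rw [map_mul, map_mul, map_mul, hp, aeval_X, eval_X, blin, map_sum]
      congr 1
      refine Finset.sum_congr rfl fun j _ => ?_
      rw [map_mul, eval_C, eval_X]; ring
  rw [this]

end gv
end SST

end

section
open MvPolynomial

namespace SST

section so
variable {H ι : Type*} [Fintype H] [Fintype ι] [DecidableEq H] [DecidableEq ι]
variable {R : Type*} [CommRing R]

lemma expo_bound (c : ι → ℝ) (cb : ℝ) (hcb : ∀ i, |c i| ≤ cb) (ℓ : H → ℝ) (r : H → ℕ)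
    (hr1 : ∀ h, 1 ≤ r h) (Rr ε' : ℝ) (hR0 : 0 < Rr) 
    (hℓ1 : ∀ h, Rr ≤ r h * ℓ h) (hℓ2 : ∀ h, r h * ℓ h ≤ (1 + ε') * Rr) (J : H × ι →₀ ℕ)
    (hJ : ∀ h, ∑ i, J (h, i) = r h) (mu dl : ℝ)
    (hJ2 : ∀ i, |∑ h, (J (h, i) : ℝ) / r h - mu| ≤ dl) :
    ∑ v : H × ι, c v.2 * ℓ v.1 * J v ≤
      Rr * ((∑ i, (c i * mu + |c i| * dl)) + cb * ε' * Fintype.card H) := by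
  have hr0 : ∀ h, (0 : ℝ) < r h := fun h => by exact_mod_cast hr1 h
  have e1 : ∀ h i, c i * ℓ h * J (h, i) ≤
      Rr * (c i * ((J (h, i) : ℝ) / r h)) + cb * ((J (h, i) : ℝ) / r h) * (ε' * Rr) := by
    intro h i
    have h0 : c i * ℓ h * J (h, i) = c i * ((J (h, i) : ℝ) / r h) * (r h * ℓ h) := by
      field_simp [(hr0 h).ne']
    have h1 : (0 : ℝ) ≤ (J (h, i) : ℝ) / r h := by positivity
    have h2 : 0 ≤ r h * ℓ h - Rr := by linarith [hℓ1 h]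
    have h3 : r h * ℓ h - Rr ≤ ε' * Rr := by linarith [hℓ2 h]
    have h4 : c i ≤ cb := (le_abs_self _).trans (hcb i)
    have h5 : 0 ≤ cb := (abs_nonneg _).trans (hcb i)
    have h6 : c i * ((J (h, i) : ℝ) / r h) * (r h * ℓ h - Rr) ≤ cb * ((J (h, i) : ℝ) / r h) * (ε' * Rr) := by
      refine (mul_le_mul_of_nonneg_right (mul_le_mul_of_nonneg_right h4 h1) h2).trans ?_
      exact mul_le_mul_of_nonneg_left h3 (mul_nonneg h5 h1)
    rw [h0]; nlinarith
  have e2 : ∀ i, c i * ∑ h, (J (h, i) : ℝ) / r h ≤ c i * mu + |c i| * dl := by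
    intro i
    have : c i * (∑ h, (J (h, i) : ℝ) / r h - mu) ≤ |c i| * dl := by
      refine (le_abs_self _).trans ?_
      rw [abs_mul]
      exact mul_le_mul_of_nonneg_left (hJ2 i) (abs_nonneg _)
    linarith
  have e3 : ∑ h, ∑ i, (J (h, i) : ℝ) / r h = Fintype.card H := by
    have : ∀ h, ∑ i, (J (h, i) : ℝ) / r h = 1 := by
      intro h
      rw [← Finset.sum_div, ← Nat.cast_sum, hJ h, div_self (hr0 h).ne']
    simp [this]
  calc ∑ v : H × ι, c v.2 * ℓ v.1 * J v = ∑ h, ∑ i, c i * ℓ h * J (h, i) := by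
        rw [Fintype.sum_prod_type]
    _ ≤ ∑ h, ∑ i, (Rr * (c i * ((J (h, i) : ℝ) / r h)) + cb * ((J (h, i) : ℝ) / r h) * (ε' * Rr)) :=
        Finset.sum_le_sum fun h _ => Finset.sum_le_sum fun i _ => e1 h i
    _ = Rr * (∑ i, c i * ∑ h, (J (h, i) : ℝ) / r h) +
        cb * (∑ h, ∑ i, (J (h, i) : ℝ) / r h) * (ε' * Rr) := by
        simp only [Finset.sum_add_distrib]
        congr 1
        · rw [Finset.sum_comm, Finset.mul_sum]
          refine Finset.sum_congr rfl fun i _ => ?_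
          rw [Finset.mul_sum, Finset.mul_sum]
        · rw [Finset.mul_sum, Finset.sum_mul]
          refine Finset.sum_congr rfl fun i _ => ?_
          rw [Finset.mul_sum, Finset.sum_mul]
    _ ≤ Rr * (∑ i, (c i * mu + |c i| * dl)) + cb * Fintype.card H * (ε' * Rr) := by
        rw [e3]
        have := mul_le_mul_of_nonneg_left (Finset.sum_le_sum fun i (_ : i ∈ Finset.univ) => e2 i) hR0.le
        linarith
    _ = _ := by ring

lemma int_zero_of_abs_lt (P : MvPolynomial (H × ι) ℤ) (x : H × ι → ℤ)
    (h : |eval (fun v => (x v : ℝ)) (map (Int.castRingHom ℝ) P)| < 1) :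
    eval (fun v => (x v : ℝ)) (map (Int.castRingHom ℝ) P) = 0 := by
  have e : eval (fun v => (x v : ℝ)) (map (Int.castRingHom ℝ) P) = ((eval x P : ℤ) : ℝ) := by
    have := eval₂_comp_right (Int.castRingHom ℝ) (RingHom.id ℤ) x P
    rw [eval_map]
    simp only [eval₂_id] at this
    rw [eval, coe_eval₂Hom]
    rw [← eq_intCast (Int.castRingHom ℝ), eval₂_comp_right]
    simp
    rfl
  rw [e] at h ⊢
  have : |eval x P| < 1 := by exact_mod_cast h
  rw [Int.abs_lt_one_iff] at this
  rw [this]; simp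

theorem small_zero (hR : HR R) (L : Matrix ι ι R) (hdet : L.det ≠ 0) [Nonempty H]
    (P : MvPolynomial (H × ι) ℤ) (r : H → ℕ)
    (hr : ∀ J ∈ P.support, ∀ h, ∑ i, J (h, i) = r h) (hr1 : ∀ h, 1 ≤ r h)
    (C₀ : ℝ) (hC₀ : 1 ≤ C₀) (hl1 : l1 hR.ν (hat L.adjugate P) ≤ C₀ ^ (∑ h, r h)) (mu dl : ℝ)
    (hsup : ∀ J, coeff J (hat L.adjugate P) ≠ 0 → (∀ h, ∑ i, J (h, i) = r h) ∧
      ∀ i, |∑ h, (J (h, i) : ℝ) / r h - mu| ≤ dl)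
    (c : ι → ℝ) (cb : ℝ) (hcb : ∀ i, |c i| ≤ cb) (hcb0 : 0 ≤ cb) (ℓ : H → ℝ) (hℓ0 : ∀ h, 0 < ℓ h)
    (Rr ε' : ℝ) (hR0 : 0 < Rr) (hε1 : ε' ≤ 1)
    (hℓ1 : ∀ h, Rr ≤ r h * ℓ h) (hℓ2 : ∀ h, r h * ℓ h ≤ (1 + ε') * Rr)
    (D : ℝ) (hD : 1 ≤ D) (x : H × ι → ℤ)
    (hx : ∀ h i, |∑ j, hR.φ (L i j) * (x (h, j) : ℝ)| ≤ D * Real.exp (c i * ℓ h))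
    (θ : ℝ) (I : H × ι →₀ ℕ) (hI : ∑ h, ((∑ i, I (h, i) : ℕ) : ℝ) / r h ≤ θ)
    (κ : ℝ) (hκ : hR.K * C₀ * (D * (2 + ∑ i, ∑ j, |hR.φ (L i j)|)) ≤ Real.exp κ * |hR.φ L.det|)
    (hneg : (∑ h, r h : ℕ) * κ + Rr * ((∑ i, (c i * mu + |c i| * dl)) +
      cb * ε' * Fintype.card H + 2 * cb * θ) < 0) :
    eval (fun v => (x v : ℝ)) (map (Int.castRingHom ℝ) (hasse I P)) = 0 := by
  apply int_zero_of_abs_lt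
  set Λ : ℝ := 2 + ∑ i, ∑ j, |hR.φ (L i j)| with hΛ
  have hΛ0 : 2 ≤ Λ := by
    have : 0 ≤ ∑ i, ∑ j, |hR.φ (L i j)| :=
      Finset.sum_nonneg fun _ _ => Finset.sum_nonneg fun _ _ => abs_nonneg _
    linarith
  have hdet' : 0 < |hR.φ L.det| := by
    rw [abs_pos]
    intro h
    exact hdet (hR.inj (by rw [h, map_zero]))
  have hr0 : ∀ h, (0 : ℝ) < r h := fun h => by exact_mod_cast hr1 h
  set n : ℕ := ∑ h, r h with hn
  have hn1 : 1 ≤ n := by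
    obtain ⟨h⟩ := ‹Nonempty H›
    exact (hr1 h).trans (Finset.single_le_sum (f := r) (fun _ _ => Nat.zero_le _) (Finset.mem_univ h))
  set E1 : ℝ := (∑ i, (c i * mu + |c i| * dl)) + cb * ε' * Fintype.card H with hE1
  have hsm := smallness hR.φ L P r hr x (fun h => Real.exp (-cb * ℓ h)) (fun h => Real.exp_pos _)
    (fun v => D * Real.exp (c v.2 * ℓ v.1)) hx (fun h i => by
      have h1 : Real.exp (-cb * ℓ h) ≤ Real.exp (c i * ℓ h) := by
        apply Real.exp_le_exp.mpr
        have := neg_le_of_abs_le (hcb i)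
        exact mul_le_mul_of_nonneg_right this (hℓ0 h).le
      have := Real.exp_pos (c i * ℓ h)
      show _ ≤ D * Real.exp (c i * ℓ h)
      nlinarith) I
  have hRHS : ∑ J ∈ (hat L.adjugate P).support, |hR.φ (coeff J (hat L.adjugate P))| *
      ∏ v : H × ι, (D * Real.exp (c v.2 * ℓ v.1) * Λ) ^ J v ≤
      hR.K * C₀ ^ n * ((D * Λ) ^ n * Real.exp (Rr * E1)) := by
    have h1 : ∀ J ∈ (hat L.adjugate P).support, |hR.φ (coeff J (hat L.adjugate P))| *
      ∏ v : H × ι, (D * Real.exp (c v.2 * ℓ v.1) * Λ) ^ J v ≤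
      hR.K * hR.ν (coeff J (hat L.adjugate P)) * ((D * Λ) ^ n * Real.exp (Rr * E1)) := by
      intro J hJ
      obtain ⟨hJ1, hJ2⟩ := hsup J (mem_support_iff.mp hJ)
      have hp : ∏ v : H × ι, (D * Real.exp (c v.2 * ℓ v.1) * Λ) ^ J v =
          (D * Λ) ^ n * Real.exp (∑ v : H × ι, c v.2 * ℓ v.1 * J v) := by
        have : ∀ v : H × ι, (D * Real.exp (c v.2 * ℓ v.1) * Λ) ^ J v =
            (D * Λ) ^ J v * Real.exp (c v.2 * ℓ v.1 * J v) := by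
          intro v
          rw [mul_comm (c v.2 * ℓ v.1) (J v : ℝ), Real.exp_nat_mul, ← mul_pow]
          ring
        rw [Finset.prod_congr rfl fun v _ => this v, Finset.prod_mul_distrib,
          Finset.prod_pow_eq_pow_sum, Real.exp_sum]
        congr 2
        rw [Fintype.sum_prod_type, hn]
        exact Finset.sum_congr rfl fun h _ => hJ1 h
      rw [hp]
      have hexp := Real.exp_le_exp.mpr (expo_bound c cb hcb ℓ r hr1 Rr ε' hR0 hℓ1 hℓ2 J hJ1 mu dl hJ2)
      have hDL : 0 ≤ (D * Λ) ^ n := by positivity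
      refine mul_le_mul (hR.phi_le _) (mul_le_mul_of_nonneg_left hexp hDL) (by positivity) ?_
      have := hR.K1
      exact mul_nonneg (by linarith) (apply_nonneg _ _)
    refine (Finset.sum_le_sum h1).trans ?_
    rw [← Finset.sum_mul, ← Finset.mul_sum]
    refine mul_le_mul_of_nonneg_right ?_ (by positivity)
    refine mul_le_mul_of_nonneg_left ?_ (by linarith [hR.K1])
    exact hl1
  have hLHS : Real.exp (-(2 * cb * θ * Rr)) ≤ ∏ v : H × ι, Real.exp (-cb * ℓ v.1) ^ I v := by
    have e : ∏ v : H × ι, Real.exp (-cb * ℓ v.1) ^ I v =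
        Real.exp (-(cb * ∑ h, ℓ h * ((∑ i, I (h, i) : ℕ) : ℝ))) := by
      have : ∀ v : H × ι, Real.exp (-cb * ℓ v.1) ^ I v = Real.exp (I v * (-cb * ℓ v.1)) := by
        intro v; rw [Real.exp_nat_mul]
      rw [Finset.prod_congr rfl fun v _ => this v, ← Real.exp_sum, Fintype.sum_prod_type]
      congr 1
      rw [Finset.mul_sum, ← Finset.sum_neg_distrib]
      refine Finset.sum_congr rfl fun h _ => ?_
      push_cast
      simp only [Finset.mul_sum]
      rw [← Finset.sum_neg_distrib]
      exact Finset.sum_congr rfl fun i _ => by ring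
    rw [e]
    apply Real.exp_le_exp.mpr
    have h1 : ∑ h, ℓ h * ((∑ i, I (h, i) : ℕ) : ℝ) ≤ θ * (2 * Rr) := by
      calc ∑ h, ℓ h * ((∑ i, I (h, i) : ℕ) : ℝ) ≤ ∑ h, ((∑ i, I (h, i) : ℕ) : ℝ) / r h * (2 * Rr) := by
            refine Finset.sum_le_sum fun h _ => ?_
            have h0 : ℓ h * ((∑ i, I (h, i) : ℕ) : ℝ) = ((∑ i, I (h, i) : ℕ) : ℝ) / r h * (r h * ℓ h) := by
              field_simp [(hr0 h).ne']
            rw [h0]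
            refine mul_le_mul_of_nonneg_left ?_ (by positivity)
            have := hℓ2 h
            nlinarith
        _ = (∑ h, ((∑ i, I (h, i) : ℕ) : ℝ) / r h) * (2 * Rr) := by rw [Finset.sum_mul]
        _ ≤ _ := mul_le_mul_of_nonneg_right hI (by linarith)
    nlinarith [mul_le_mul_of_nonneg_left h1 hcb0]
  set V := |eval (fun v => (x v : ℝ)) (map (Int.castRingHom ℝ) (hasse I P))| with hV
  have hV0 : 0 ≤ V := abs_nonneg _
  have hchain : |hR.φ L.det| ^ n * Real.exp (-(2 * cb * θ * Rr)) * V ≤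
      (hR.K * C₀ * (D * Λ)) ^ n * Real.exp (Rr * E1) := by
    calc |hR.φ L.det| ^ n * Real.exp (-(2 * cb * θ * Rr)) * V ≤
          |hR.φ L.det| ^ n * (∏ v : H × ι, Real.exp (-cb * ℓ v.1) ^ I v) * V := by gcongr
      _ ≤ _ := hsm
      _ ≤ _ := hRHS
      _ = hR.K * (C₀ ^ n * (D * Λ) ^ n * Real.exp (Rr * E1)) := by ring
      _ ≤ hR.K ^ n * (C₀ ^ n * (D * Λ) ^ n * Real.exp (Rr * E1)) := by
          refine mul_le_mul_of_nonneg_right ?_ (by positivity)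
          exact le_self_pow₀ hR.K1 (by omega)
      _ = _ := by rw [mul_pow, mul_pow]; ring
  have hchain2 : (hR.K * C₀ * (D * Λ)) ^ n ≤ Real.exp (n * κ) * |hR.φ L.det| ^ n := by
    rw [Real.exp_nat_mul, ← mul_pow]
    refine pow_le_pow_left₀ ?_ hκ _
    have := hR.K1
    positivity
  have h3 : |hR.φ L.det| ^ n * (Real.exp (-(2 * cb * θ * Rr)) * V) ≤
      |hR.φ L.det| ^ n * (Real.exp (n * κ) * Real.exp (Rr * E1)) := by
    have := mul_le_mul_of_nonneg_right hchain2 (Real.exp_pos (Rr * E1)).le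
    linarith
  have h4 := le_of_mul_le_mul_left h3 (pow_pos hdet' n)
  have h5 : Real.exp (n * κ) * Real.exp (Rr * E1) < Real.exp (-(2 * cb * θ * Rr)) := by
    rw [← Real.exp_add]
    apply Real.exp_lt_exp.mpr
    nlinarith
  have h6 := Real.exp_pos (-(2 * cb * θ * Rr))
  by_contra hcon
  push Not at hcon
  nlinarith

end so
end SST

end

section
open MvPolynomial Filter

namespace SST

lemma exists_seq (ℓ : ℕ → ℝ) (hℓ : Tendsto ℓ atTop atTop) (Y q : ℝ) (hY : 0 < Y) (hq : 1 ≤ q) :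
    ∃ k : ℕ → ℕ, (∀ h, Y ≤ ℓ (k h)) ∧ ∀ h, q * ℓ (k h) ≤ ℓ (k (h + 1)) := by
  have hF : ∀ y : ℝ, ∃ k, y ≤ ℓ k := fun y => (hℓ.eventually_ge_atTop y).exists
  choose F hF using hF
  let k : ℕ → ℕ := fun h => Nat.rec (F Y) (fun _ p => F (q * ℓ p)) h
  have h2 : ∀ h, q * ℓ (k h) ≤ ℓ (k (h + 1)) := fun h => hF _
  refine ⟨k, fun h => ?_, h2⟩
  induction h with
  | zero => exact hF _
  | succ h ih =>
    have := h2 h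
    nlinarith

section core
variable {ι κ : Type*} [Fintype ι] [Fintype κ] [DecidableEq ι] [Nontrivial ι] [Nonempty κ]
variable {R : Type*} [CommRing R]

set_option maxHeartbeats 1600000 in
theorem ht_core (hR : HR R) (L : Matrix ι ι R) (hdet : L.det ≠ 0) (c : ι → ℝ) (hc : ∑ i, c i < 0)
    (η : ℝ) (hη : 0 < η) (ℓ : ℕ → ℝ) (hℓ : Tendsto ℓ atTop atTop) (g : ℕ → κ → ι → ℤ)
    (mv : ℕ → ι → ℤ)
    (hg : ∀ k j i, |∑ i', hR.φ (L i i') * (g k j i' : ℝ)| ≤ Real.exp (c i * ℓ k))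
    (hspan : ∀ k, ∀ x : ι → ℝ, ∑ i, (mv k i : ℝ) * x i = 0 →
      ∃ y : κ → ℝ, ∀ i, x i = ∑ j, y j * (g k j i : ℝ))
    (hprim : ∀ k, ∃ c : ι → ℤ, ∑ i, c i * mv k i = 1)
    (hbig : ∀ k, ∃ i, Real.exp (η * ℓ k) ≤ |(mv k i : ℝ)|) : False := by
  classical
  set N : ℝ := (Fintype.card ι : ℝ) with hN
  set n : ℝ := (Fintype.card κ : ℝ) with hnn
  have hN1 : 1 ≤ N := by
    have : 1 ≤ Fintype.card ι := Fintype.card_pos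
    rw [hN]; exact_mod_cast this
  have hn1 : 1 ≤ n := by
    have : 1 ≤ Fintype.card κ := Fintype.card_pos
    rw [hnn]; exact_mod_cast this
  set δ : ℝ := -∑ i, c i with hδ
  have hδ0 : 0 < δ := by linarith
  set cb : ℝ := ∑ i, |c i| with hcb
  have hcbi : ∀ i, |c i| ≤ cb := fun i =>
    Finset.single_le_sum (f := fun i => |c i|) (fun _ _ => abs_nonneg _) (Finset.mem_univ i)
  have hcbδ : δ ≤ cb := by
    rw [hδ, ← Finset.sum_neg_distrib]
    exact Finset.sum_le_sum fun i _ => neg_le_abs _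
  have hcb0 : 0 < cb := by linarith
  set ε : ℝ := δ / (8 * N * cb) with hε
  have hε0 : 0 < ε := by positivity
  have hε1 : ε ≤ 1 := by
    rw [hε, div_le_one (by positivity)]
    nlinarith [mul_pos (by linarith : 0 < N) hcb0]
  have hεcb : cb * ε = δ / (8 * N) := by rw [hε]; field_simp
  obtain ⟨m, hm⟩ := exists_nat_gt (2 * hR.d * N / ε ^ 2)
  have hm0 : (0 : ℝ) < m := lt_of_le_of_lt (by positivity) hm
  have hmpos : 0 < m := by exact_mod_cast hm0
  haveI : Nonempty (Fin m) := ⟨⟨0, hmpos⟩⟩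
  have hm' : 2 * (hR.d : ℝ) * (Fintype.card ι : ℝ) ≤ ε ^ 2 * (Fintype.card (Fin m) : ℝ) := by
    rw [Fintype.card_fin]
    rw [div_lt_iff₀ (by positivity)] at hm
    linarith
  obtain ⟨C₀, hC₀, haux⟩ := aux_poly (H := Fin m) hR L.adjugate ε hε0 hm'
  set θ : ℝ := m * δ / (16 * N * cb) with hθ
  have hθ0 : 0 < θ := by positivity
  have hθcb : 2 * cb * θ = δ * m / (8 * N) := by rw [hθ]; field_simp; ring
  obtain ⟨τ, hτ0, hτ1, hidx⟩ := index_thm m (ι := ι) (θ / 2) (by positivity)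
  obtain ⟨A, hA⟩ := exists_nat_gt (2 * m * n / θ)
  have hA0 : (0 : ℝ) < A := lt_of_le_of_lt (by positivity) hA
  have hA1 : (1 : ℝ) ≤ A := by
    have : 0 < A := by exact_mod_cast hA0
    exact_mod_cast this
  set D : ℝ := n * A with hD
  have hD1 : 1 ≤ D := by nlinarith
  have hdet' : 0 < |hR.φ L.det| := by
    rw [abs_pos]
    intro h
    exact hdet (hR.inj (by rw [h, map_zero]))
  set Λ : ℝ := 2 + ∑ i, ∑ j, |hR.φ (L i j)| with hΛ
  have hΛ0 : 2 ≤ Λ := by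
    have : 0 ≤ ∑ i, ∑ j, |hR.φ (L i j)| :=
      Finset.sum_nonneg fun _ _ => Finset.sum_nonneg fun _ _ => abs_nonneg _
    linarith
  have hK1 := hR.K1
  set κ0 : ℝ := |Real.log (hR.K * C₀ * (D * Λ) / |hR.φ L.det|)| with hκ0
  have hκ00 : 0 ≤ κ0 := abs_nonneg _
  have hκ : hR.K * C₀ * (D * Λ) ≤ Real.exp κ0 * |hR.φ L.det| := by
    rw [← div_le_iff₀ hdet']
    have hp : 0 < hR.K * C₀ * (D * Λ) / |hR.φ L.det| := by positivity
    calc _ = Real.exp (Real.log (hR.K * C₀ * (D * Λ) / |hR.φ L.det|)) := (Real.exp_log hp).symm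
      _ ≤ _ := Real.exp_le_exp.mpr (le_abs_self _)
  set κ1 : ℝ := Real.log C₀ with hκ1
  have hκ10 : 0 ≤ κ1 := Real.log_nonneg hC₀
  set Y : ℝ := 1 + 4 * N * κ0 / δ + (2 * m * κ1 + 2) * N / (τ * η) with hY
  have hYa : 0 ≤ 4 * N * κ0 / δ := by positivity
  have hYb : 0 ≤ (2 * m * κ1 + 2) * N / (τ * η) := by positivity
  have hY0 : 0 < Y := by linarith
  have hY1 : 4 * N * κ0 ≤ Y * δ := by
    have : 4 * N * κ0 / δ ≤ Y := by linarith
    rwa [div_le_iff₀ hδ0] at this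
  have hY2 : (2 * m * κ1 + 2) * N ≤ Y * (τ * η) := by
    have : (2 * m * κ1 + 2) * N / (τ * η) ≤ Y := by linarith
    rwa [div_le_iff₀ (by positivity)] at this
  clear_value Y κ0 κ1 Λ D θ ε cb n
  obtain ⟨k, hkY, hkq⟩ := exists_seq ℓ hℓ Y (2 / τ) hY0 (by rw [le_div_iff₀ hτ0]; linarith)
  set l : Fin m → ℝ := fun h => ℓ (k h.val) with hl
  have hlY : ∀ h, Y ≤ l h := fun h => hkY _
  have hl0 : ∀ h, 0 < l h := fun h => hY0.trans_le (hlY h)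
  set Rr : ℝ := (∑ h, l h) / ε with hRr
  have hlR : ∀ h, l h ≤ ε * Rr := by
    intro h
    rw [hRr, mul_div_cancel₀ _ hε0.ne']
    exact Finset.single_le_sum (f := l) (fun h _ => (hl0 h).le) (Finset.mem_univ h)
  have hR0 : 0 < Rr := div_pos (Finset.sum_pos (fun h _ => hl0 h) Finset.univ_nonempty) hε0
  have hlR1 : ∀ h, l h ≤ Rr := fun h => (hlR h).trans (by
    have := mul_le_mul_of_nonneg_right hε1 hR0.le
    linarith)
  set r : Fin m → ℕ := fun h => ⌊Rr / l h⌋₊ + 1 with hr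
  have hr1 : ∀ h, 1 ≤ r h := fun h => by simp [hr]
  have hrlo : ∀ h, Rr ≤ r h * l h := by
    intro h
    have := Nat.lt_floor_add_one (Rr / l h)
    rw [div_lt_iff₀ (hl0 h)] at this
    simp only [hr]; push_cast; exact this.le
  have hrhi : ∀ h, r h * l h ≤ Rr + l h := by
    intro h
    have := Nat.floor_le (show 0 ≤ Rr / l h from div_nonneg hR0.le (hl0 h).le)
    rw [le_div_iff₀ (hl0 h)] at this
    simp only [hr]; push_cast; linarith
  clear_value Rr r
  have hrhi2 : ∀ h, r h * l h ≤ (1 + ε) * Rr := fun h => by linarith [hrhi h, hlR h]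
  have hr2 : ∀ h, r h * l h ≤ 2 * Rr := fun h => by linarith [hrhi h, hlR1 h]
  have hrY : ∀ h, (r h : ℝ) * Y ≤ 2 * Rr := fun h =>
    (mul_le_mul_of_nonneg_left (hlY h) (Nat.cast_nonneg _)).trans (hr2 h)
  have hsumr : ((∑ h, r h : ℕ) : ℝ) * Y ≤ 2 * m * Rr := by
    push_cast
    rw [Finset.sum_mul]
    calc _ ≤ ∑ h : Fin m, 2 * Rr := Finset.sum_le_sum fun h _ => hrY h
      _ = _ := by simp; ring
  obtain ⟨P, hP0, hPr, hPl, hhl, hhs⟩ := haux r hr1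
  have hlogP : Real.log (l1 nuZ P) ≤ ((∑ h, r h : ℕ) : ℝ) * κ1 := by
    rw [hκ1, ← Real.log_pow]
    exact Real.log_le_log (lt_of_lt_of_le one_pos (one_le_l1 hP0)) hPl
  have HH := hidx r (fun h => mv (k h)) (fun h => Real.exp (η * l h)) P hP0 hPr hr1 ?_
    (fun h => hprim _) (fun h => ⟨Real.exp_pos _, hbig _⟩) ?_
  rotate_left
  · intro v v' hvv
    have h1 : 2 / τ * l v ≤ l v' := by
      have := hkq v.val
      simp only [hl, hvv]; exact this
    have h2 : 2 * l v ≤ l v' * τ := by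
      rw [div_mul_eq_mul_div, div_le_iff₀ hτ0] at h1; exact h1
    have h3 := hr2 v'
    have h4 := hrlo v
    have h5 : (r v' : ℝ) * (2 * l v) ≤ τ * r v * (2 * l v) := by
      calc (r v' : ℝ) * (2 * l v) ≤ r v' * (l v' * τ) := mul_le_mul_of_nonneg_left h2 (Nat.cast_nonneg _)
        _ = (r v' * l v') * τ := by ring
        _ ≤ 2 * Rr * τ := mul_le_mul_of_nonneg_right h3 hτ0.le
        _ ≤ 2 * (r v * l v) * τ := mul_le_mul_of_nonneg_right (by linarith) hτ0.le
        _ = _ := by ring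
    exact le_of_mul_le_mul_right h5 (by linarith [hl0 v])
  · intro h h'
    rw [Real.log_exp]
    have h1 : (Real.log (l1 nuZ P) + r h') * Y ≤ (2 * m * κ1 + 2) * Rr := by
      have a1 := mul_le_mul_of_nonneg_right hlogP hY0.le
      have a2 := mul_le_mul_of_nonneg_right hsumr hκ10
      have a3 := hrY h'
      linarith
    have h2 : (2 * m * κ1 + 2) * Rr ≤ τ * r h * (η * l h / N) * Y := by
      have b1 := mul_le_mul_of_nonneg_right hY2 hR0.le
      have b2 := mul_le_mul_of_nonneg_left (hrlo h) (show 0 ≤ Y * (τ * η) by positivity)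
      have b3 : τ * r h * (η * l h / N) * Y = Y * (τ * η) * (r h * l h) / N := by
        field_simp
      rw [b3, le_div_iff₀ (by linarith)]
      linarith
    exact le_of_mul_le_mul_right (h1.trans h2) hY0
  obtain ⟨I, hIw, x, hx, hne⟩ := HH
  have hxy : ∀ h, ∃ y : κ → ℝ, ∀ i, x (h, i) = ∑ j, y j * (g (k h) j i : ℝ) := fun h =>
    hspan _ (fun i => x (h, i)) (hx h)
  choose y hy using hxy
  apply hne
  have hxe : x = fun v => ∑ j, (fun u : Fin m × κ => y u.1 u.2) (v.1, j) * (g (k v.1) j v.2 : ℝ) := by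
    funext v; exact hy v.1 v.2
  rw [hxe]
  set t : Fin m → ℕ := fun h => ⌊θ * r h / (2 * m * n)⌋₊ with ht
  have hr0 : ∀ h, (0 : ℝ) < r h := fun h => by exact_mod_cast hr1 h
  refine grid_vanish (fun h : Fin m => g (k h)) P r hPr A t ?_ I ?_ (fun u => y u.1 u.2)
  · intro h
    have h1 := Nat.lt_floor_add_one (θ * r h / (2 * m * n))
    have h2 : 2 * m * n < A * θ := by rwa [div_lt_iff₀ hθ0] at hA
    have h3 : (r h : ℝ) < A * (t h + 1) := by
      rw [div_lt_iff₀ (by positivity)] at h1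
      have h4 : (r h : ℝ) * (2 * m * n) ≤ r h * (A * θ) := mul_le_mul_of_nonneg_left h2.le (hr0 h).le
      have h5 : A * (θ * r h) < A * ((t h + 1) * (2 * m * n)) := mul_lt_mul_of_pos_left h1 hA0
      have h6 : (r h : ℝ) * (2 * m * n) < A * (t h + 1) * (2 * m * n) := by linarith
      exact lt_of_mul_lt_mul_right h6 (by positivity)
    exact_mod_cast h3
  · intro K hK z hz
    refine small_zero hR L hdet P r hPr hr1 C₀ hC₀ hhl ((Fintype.card (Fin m) : ℝ) / Fintype.card ι)
      (ε * Fintype.card (Fin m)) hhs c cb hcbi hcb0.le l hl0 Rr ε hR0 hε1 hrlo hrhi2 D hD1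
      (fun v => ∑ j, (z (v.1, j) : ℤ) * g (k v.1) j v.2) ?_ θ (K + I) ?_ κ0 (by rw [← hΛ]; exact hκ) ?_
    · intro h i
      have e : ∑ j, hR.φ (L i j) * ((∑ j', (z (h, j') : ℤ) * g (k h) j' j : ℤ) : ℝ) =
          ∑ j', (z (h, j') : ℝ) * ∑ j, hR.φ (L i j) * (g (k h) j' j : ℝ) := by
        push_cast
        simp only [Finset.mul_sum]
        rw [Finset.sum_comm]
        exact Finset.sum_congr rfl fun _ _ => Finset.sum_congr rfl fun _ _ => by ring
      show |∑ j, hR.φ (L i j) * ((∑ j', (z (h, j') : ℤ) * g (k h) j' j : ℤ) : ℝ)| ≤ _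
      rw [e]
      refine (Finset.abs_sum_le_sum_abs _ _).trans ?_
      calc _ ≤ ∑ j' : κ, (A : ℝ) * Real.exp (c i * l h) := by
            refine Finset.sum_le_sum fun j' _ => ?_
            rw [abs_mul, Nat.abs_cast]
            have : (z (h, j') : ℝ) ≤ A := by exact_mod_cast (hz _).le
            exact mul_le_mul this (hg _ _ _) (abs_nonneg _) hA0.le
        _ = _ := by simp [hD, hnn]; ring
    · have h1 : ∀ h, ((∑ i, (K + I) (h, i) : ℕ) : ℝ) / r h ≤
          θ / (2 * m) + ((∑ i, I (h, i) : ℕ) : ℝ) / r h := by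
        intro h
        have e : (∑ i, (K + I) (h, i)) = ∑ i, K (h, i) + ∑ i, I (h, i) := by
          simp [Finset.sum_add_distrib]
        rw [e, Nat.cast_add, add_div]
        refine add_le_add ?_ le_rfl
        rw [div_le_iff₀ (hr0 h)]
        have h2 : ((∑ i, K (h, i) : ℕ) : ℝ) ≤ n * t h := by
          rw [hnn]; exact_mod_cast hK h
        have h3 := Nat.floor_le (show 0 ≤ θ * r h / (2 * m * n) by positivity)
        calc _ ≤ n * (t h : ℝ) := h2
          _ ≤ n * (θ * r h / (2 * m * n)) := mul_le_mul_of_nonneg_left h3 (by linarith)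
          _ = _ := by field_simp
      calc _ ≤ ∑ h, (θ / (2 * m) + ((∑ i, I (h, i) : ℕ) : ℝ) / r h) :=
            Finset.sum_le_sum fun h _ => h1 h
        _ = θ / 2 + ∑ h, ((∑ i, I (h, i) : ℕ) : ℝ) / r h := by
            rw [Finset.sum_add_distrib]; simp; field_simp
        _ ≤ θ := by linarith
    · have e0 : ∀ p q : ℝ, ∑ i, (c i * p + |c i| * q) = (∑ i, c i) * p + (∑ i, |c i|) * q := by
        intro p q
        rw [Finset.sum_add_distrib, ← Finset.sum_mul, ← Finset.sum_mul]
      rw [e0, Fintype.card_fin, ← hN, ← hcb]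
      have e1 : ∑ i, c i = -δ := by rw [hδ]; ring
      have e2 : cb * (ε * m) = δ / (8 * N) * m := by rw [← hεcb]; ring
      rw [e1, hθcb, hεcb, e2]
      have e3 : -δ * (↑m / N) + δ / (8 * N) * m + δ / (8 * N) * m + δ * m / (8 * N) = -(5 / 8 * δ * m / N) := by
        field_simp; ring
      rw [e3]
      have h1 : ((∑ h, r h : ℕ) : ℝ) * κ0 * (4 * N) ≤ 2 * m * Rr * δ := by
        have a1 := mul_le_mul_of_nonneg_left hY1 (Nat.cast_nonneg (α := ℝ) (∑ h, r h))
        have a2 := mul_le_mul_of_nonneg_right hsumr hδ0.le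
        linarith
      have h2 : ((∑ h, r h : ℕ) : ℝ) * κ0 ≤ 2 * m * Rr * δ / (4 * N) := by
        rw [le_div_iff₀ (by linarith)]; exact h1
      have h3 : 2 * m * Rr * δ / (4 * N) + Rr * -(5 / 8 * δ * m / N) = - (1 / 8 * (m * Rr * δ) / N) := by
        field_simp; ring
      have h4 : 0 < 1 / 8 * (m * Rr * δ) / N := by positivity
      linarith

end core
end SST

end

section
open MvPolynomial Filter

namespace SST

/-- signed maximal minors -/
noncomputable def nrm {S : Type*} [CommRing S] {n : ℕ} (g : Fin n → Fin (n + 1) → S) (j : Fin (n + 1)) : S :=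
  (-1) ^ (j : ℕ) * (Matrix.of fun a b => g a (j.succAbove b)).det

/-- matrix with first row x and other rows g -/
def consM {S : Type*} {n : ℕ} (x : Fin (n + 1) → S) (g : Fin n → Fin (n + 1) → S) :
    Matrix (Fin (n + 1)) (Fin (n + 1)) S := Matrix.of (Fin.cons x g)

lemma det_consM {S : Type*} [CommRing S] {n : ℕ} (x : Fin (n + 1) → S) (g : Fin n → Fin (n + 1) → S) :
    (consM x g).det = ∑ j, x j * nrm g j := by
  rw [Matrix.det_succ_row_zero]
  refine Finset.sum_congr rfl fun j _ => ?_
  have : (consM x g).submatrix Fin.succ j.succAbove = Matrix.of fun a b => g a (j.succAbove b) := by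
    ext a b; simp [consM]
  rw [this, nrm]
  simp [consM]; ring

lemma nrm_map {S S' : Type*} [CommRing S] [CommRing S'] (f : S →+* S') {n : ℕ}
    (g : Fin n → Fin (n + 1) → S) (j : Fin (n + 1)) :
    f (nrm g j) = nrm (fun a b => f (g a b)) j := by
  rw [nrm, nrm, map_mul, map_pow, map_neg, map_one, RingHom.map_det]
  congr 2

lemma nrm_orth {S : Type*} [CommRing S] {n : ℕ} (g : Fin n → Fin (n + 1) → S) (a : Fin n) :
    ∑ j, g a j * nrm g j = 0 := by
  rw [← det_consM]
  refine Matrix.det_zero_of_row_eq (i := 0) (j := a.succ) (Fin.succ_ne_zero a).symm ?_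
  rfl

lemma det_bound {ι : Type*} [Fintype ι] [DecidableEq ι] (M : Matrix ι ι ℝ) (β γ : ι → ℝ)
    (h : ∀ i j, |M i j| ≤ β i * γ j) :
    |M.det| ≤ (Fintype.card ι).factorial * ((∏ i, β i) * ∏ j, γ j) := by
  rw [Matrix.det_apply]
  refine (Finset.abs_sum_le_sum_abs _ _).trans ?_
  have : ∀ σ ∈ (Finset.univ : Finset (Equiv.Perm ι)),
      |Equiv.Perm.sign σ • ∏ i, M (σ i) i| ≤ (∏ i, β i) * ∏ j, γ j := by
    intro σ _
    have e : |Equiv.Perm.sign σ • ∏ i, M (σ i) i| = ∏ i, |M (σ i) i| := by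
      rw [← Finset.abs_prod]
      rcases Int.units_eq_one_or (Equiv.Perm.sign σ) with h | h <;> simp [h]
    rw [e, ← Equiv.prod_comp σ β, ← Finset.prod_mul_distrib]
    exact Finset.prod_le_prod (fun _ _ => abs_nonneg _) fun i _ => h _ _
  refine (Finset.sum_le_sum this).trans ?_
  rw [Finset.sum_const, Finset.card_univ, Fintype.card_perm, nsmul_eq_mul]

lemma det_consM_ne {n : ℕ} (x : Fin (n + 1) → ℝ) (g : Fin n → Fin (n + 1) → ℝ)
    (hg : LinearIndependent ℝ g) (hx : x ∉ Submodule.span ℝ (Set.range g)) : (consM x g).det ≠ 0 := by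
  have h1 : LinearIndependent ℝ (Fin.cons x g : Fin (n + 1) → Fin (n + 1) → ℝ) :=
    linearIndependent_finCons.mpr ⟨hg, hx⟩
  have h2 : IsUnit (consM x g) := Matrix.linearIndependent_rows_iff_isUnit.mp h1
  rw [Matrix.isUnit_iff_isUnit_det] at h2
  exact h2.ne_zero

lemma exists_normal {n : ℕ} (g : Fin n → Fin (n + 1) → ℤ)
    (hg : LinearIndependent ℝ (fun j i => (g j i : ℝ))) :
    ∃ (m : Fin (n + 1) → ℤ) (t : ℤ), t ≠ 0 ∧ (∀ j, nrm g j = t * m j) ∧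
      (∃ c : Fin (n + 1) → ℤ, ∑ i, c i * m i = 1) ∧
      ∀ x : Fin (n + 1) → ℝ, ∑ i, (m i : ℝ) * x i = 0 →
        ∃ y : Fin n → ℝ, ∀ i, x i = ∑ j, y j * (g j i : ℝ) := by
  obtain ⟨m, hm1, hm2⟩ := Finset.extract_gcd (s := Finset.univ) (nrm g) Finset.univ_nonempty
  set t := Finset.univ.gcd (nrm g) with ht
  have hcast : ∀ j, ((nrm g j : ℤ) : ℝ) = nrm (fun j i => (g j i : ℝ)) j := fun j =>
    nrm_map (Int.castRingHom ℝ) g j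
  have hm1' : ∀ j, nrm g j = t * m j := fun j => hm1 j (Finset.mem_univ _)
  refine ⟨m, t, ?_, hm1', ?_, ?_⟩
  · intro h0
    have hz : ∀ j, nrm (fun j i => (g j i : ℝ)) j = 0 := by
      intro j; rw [← hcast, hm1', h0]; simp
    have htop : Submodule.span ℝ (Set.range (fun j i => (g j i : ℝ))) = (⊤ : Submodule ℝ (Fin (n+1) → ℝ)) := by
      rw [eq_top_iff]
      intro x _
      by_contra hx
      apply det_consM_ne x _ hg hx
      rw [det_consM]
      simp [hz]
    have h1 := finrank_span_eq_card hg
    rw [htop, finrank_top] at h1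
    simp at h1
  · obtain ⟨f, hf⟩ := Finset.gcd_eq_sum_mul .univ m
    refine ⟨f, ?_⟩
    rw [← hm2, hf]
    exact Finset.sum_congr rfl fun _ _ => mul_comm _ _
  · intro x hx
    have : x ∈ Submodule.span ℝ (Set.range (fun j i => (g j i : ℝ))) := by
      by_contra hx'
      apply det_consM_ne x _ hg hx'
      rw [det_consM]
      simp_rw [← hcast, hm1']
      push_cast
      calc ∑ j, x j * (t * m j) = t * ∑ j, m j * x j := by
            rw [Finset.mul_sum]; exact Finset.sum_congr rfl fun _ _ => by ring
        _ = 0 := by rw [hx, mul_zero]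
    rw [Submodule.mem_span_range_iff_exists_fun] at this
    obtain ⟨y, hy⟩ := this
    refine ⟨y, fun i => ?_⟩
    rw [← hy]; simp [Finset.sum_apply]

section ht
variable {R : Type*} [CommRing R]

lemma nu_intCast_mul (hR : HR R) (z : ℤ) (a : R) : hR.ν ((z : R) * a) ≤ |(z : ℝ)| * hR.ν a := by
  obtain ⟨n, rfl | rfl⟩ := z.eq_nat_or_neg
  · simpa using nu_natCast_mul (ν := hR.ν) n a
  · rw [Int.cast_neg, neg_mul, map_neg_eq_map]; simpa using nu_natCast_mul (ν := hR.ν) n a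

lemma b_bound (hR : HR R) {n : ℕ} (L : Matrix (Fin (n + 1)) (Fin (n + 1)) R) (hdet : L.det ≠ 0)
    (c : Fin (n + 1) → ℝ) (ℓ : ℝ) (g : Fin n → Fin (n + 1) → ℤ)
    (hg : ∀ j i, |∑ i', hR.φ (L i i') * (g j i' : ℝ)| ≤ Real.exp (c i * ℓ))
    (m : Fin (n + 1) → ℤ) (t : ℤ) (ht : t ≠ 0) (hm : ∀ j, nrm g j = t * m j) (i : Fin (n + 1)) :
    |hR.φ (∑ j, (m j : R) * L.adjugate j i)| ≤
      (n + 1).factorial * Real.exp ((∑ i, c i - c i) * ℓ) := by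
  have hdet' : hR.φ L.det ≠ 0 := by
    intro h
    exact hdet (hR.inj (by rw [h, map_zero]))
  set b := hR.φ (∑ j, (m j : R) * L.adjugate j i) with hb
  set g' : Fin n → Fin (n + 1) → ℝ := fun j i => (g j i : ℝ) with hg'
  set L' : Matrix (Fin (n + 1)) (Fin (n + 1)) ℝ := L.map hR.φ with hL'
  have hcast : ∀ j, nrm g' j = ((nrm g j : ℤ) : ℝ) := fun j =>
    (nrm_map (Int.castRingHom ℝ) g j).symm
  have h1 : (consM (fun j => hR.φ (L.adjugate j i)) g').det = t * b := by
    rw [det_consM, hb, map_sum, Finset.mul_sum]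
    refine Finset.sum_congr rfl fun j _ => ?_
    rw [hcast, hm, map_mul, map_intCast]
    push_cast; ring
  have h2 : consM (fun j => hR.φ (L.adjugate j i)) g' * L'.transpose =
      consM (fun j => hR.φ L.det * (Pi.single i 1 : Fin (n + 1) → ℝ) j)
        (fun a j => ∑ i', hR.φ (L j i') * (g a i' : ℝ)) := by
    ext a j
    rw [Matrix.mul_apply]
    refine Fin.cases ?_ (fun a => ?_) a
    · simp only [consM, Matrix.of_apply, Fin.cons_zero, Matrix.transpose_apply, hL', Matrix.map_apply]
      have := congrArg hR.φ (congrFun (congrFun (Matrix.mul_adjugate L) j) i)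
      rw [Matrix.mul_apply, Matrix.smul_apply, Matrix.one_apply, map_sum] at this
      simp only [map_mul] at this
      calc _ = ∑ x, hR.φ (L j x) * hR.φ (L.adjugate x i) := Finset.sum_congr rfl fun _ _ => mul_comm _ _
        _ = _ := by
          rw [this, Pi.single_apply]
          split_ifs <;> simp
    · simp only [consM, Matrix.of_apply, Fin.cons_succ, Matrix.transpose_apply, hL', Matrix.map_apply]
      exact Finset.sum_congr rfl fun _ _ => mul_comm _ _
  have h3 : L'.det = hR.φ L.det := (RingHom.map_det _ _).symm
  have h4 : t * b = (consM (Pi.single i 1 : Fin (n + 1) → ℝ)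
        (fun a j => ∑ i', hR.φ (L j i') * (g a i' : ℝ))).det := by
    have := congrArg Matrix.det h2
    rw [Matrix.det_mul, Matrix.det_transpose, h1, h3, det_consM] at this
    rw [det_consM]
    have h5 : hR.φ L.det * (t * b) = hR.φ L.det * ∑ j, (Pi.single i 1 : Fin (n + 1) → ℝ) j *
        nrm (fun a j => ∑ i', hR.φ (L j i') * (g a i' : ℝ)) j := by
      rw [Finset.mul_sum, mul_comm, this]
      exact Finset.sum_congr rfl fun _ _ => by ring
    exact mul_left_cancel₀ hdet' h5
  have h6 := det_bound (consM (Pi.single i 1 : Fin (n + 1) → ℝ)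
        (fun a j => ∑ i', hR.φ (L j i') * (g a i' : ℝ)))
        (Fin.cons (Real.exp (-(c i * ℓ))) (fun _ => 1)) (fun j => Real.exp (c j * ℓ)) (by
      intro a j
      refine Fin.cases ?_ (fun a => ?_) a
      · simp only [consM, Matrix.of_apply, Fin.cons_zero]
        rw [← Real.exp_add, Pi.single_apply]
        split_ifs with h
        · subst h; simp
        · rw [abs_zero]; positivity
      · simp only [consM, Matrix.of_apply, Fin.cons_succ, one_mul]
        exact hg a j)
  rw [← h4, Fintype.card_fin, Fin.prod_univ_succ, ← Real.exp_sum] at h6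
  simp only [Fin.cons_zero, Fin.cons_succ, Finset.prod_const_one, mul_one] at h6
  rw [← Real.exp_add, abs_mul] at h6
  have h7 : (1 : ℝ) ≤ |(t : ℝ)| := by
    have := Int.one_le_abs ht
    exact_mod_cast this
  have h8 : -(c i * ℓ) + ∑ j, c j * ℓ = (∑ i, c i - c i) * ℓ := by
    rw [← Finset.sum_mul]; ring
  rw [h8] at h6
  have := abs_nonneg b
  nlinarith

theorem hyper_thm (hR : HR R) {n : ℕ} (hn : 1 ≤ n) (L : Matrix (Fin (n + 1)) (Fin (n + 1)) R)
    (hdet : L.det ≠ 0) (c : Fin (n + 1) → ℝ) (hc : ∑ i, c i < 0)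
    (ℓ : ℕ → ℝ) (hℓ : Tendsto ℓ atTop atTop) (g : ℕ → Fin n → Fin (n + 1) → ℤ)
    (hli : ∀ k, LinearIndependent ℝ (fun j i => (g k j i : ℝ)))
    (hg : ∀ k j i, |∑ i', hR.φ (L i i') * (g k j i' : ℝ)| ≤ Real.exp (c i * ℓ k)) :
    ∃ m : Fin (n + 1) → ℤ, m ≠ 0 ∧ ∃ᶠ k in atTop, ∀ j, ∑ i, m i * g k j i = 0 := by
  have hdet' : 0 < |hR.φ L.det| := by
    rw [abs_pos]
    intro h
    exact hdet (hR.inj (by rw [h, map_zero]))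
  haveI : Nontrivial (Fin (n + 1)) := Fin.nontrivial_iff_two_le.mpr (by omega)
  haveI : Nonempty (Fin n) := ⟨⟨0, hn⟩⟩
  choose m t ht0 hmt hprim hspan using fun k => exists_normal (g k) (hli k)
  set s := ∑ i, c i with hs
  set b : ℕ → Fin (n + 1) → R := fun k i => ∑ j, (m k j : R) * L.adjugate j i with hb
  have hbb : ∀ k i, |hR.φ (b k i)| ≤ (n + 1).factorial * Real.exp ((s - c i) * ℓ k) := fun k i =>
    b_bound hR L hdet c (ℓ k) (g k) (hg k) (m k) (t k) (ht0 k) (hmt k) i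
  by_cases hB : ∃ k1, ∀ i, s < c i → b k1 i = 0
  · obtain ⟨k1, hk1⟩ := hB
    refine ⟨m k1, ?_, ?_⟩
    · intro h0
      obtain ⟨c', hc'⟩ := hprim k1
      simp [h0] at hc'
    · apply Eventually.frequently
      set S : ℝ := ∑ i, |hR.φ (b k1 i)| with hS
      have hlim : Tendsto (fun k => S * Real.exp (s * ℓ k)) atTop (nhds (S * 0)) := by
        refine Tendsto.const_mul _ (Real.tendsto_exp_atBot.comp ?_)
        exact hℓ.const_mul_atTop_of_neg hc
      rw [mul_zero] at hlim
      filter_upwards [hlim.eventually_lt_const hdet', hℓ.eventually_ge_atTop 0] with k hk hk0 j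
      have hid : hR.φ L.det * ((∑ i, m k1 i * g k j i : ℤ) : ℝ) =
          ∑ i, hR.φ (b k1 i) * ∑ i', hR.φ (L i i') * (g k j i' : ℝ) := by
        have e : ∀ i', ∑ i, hR.φ (b k1 i) * hR.φ (L i i') = hR.φ L.det * m k1 i' := by
          intro i'
          have h1 : ∑ i, b k1 i * L i i' = L.det * (m k1 i' : R) := by
            simp only [hb, Finset.sum_mul]
            rw [Finset.sum_comm]
            have h2 : ∀ x, ∑ i, (m k1 x : R) * L.adjugate x i * L i i' =
                m k1 x * (L.det * (1 : Matrix _ _ R) x i') := by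
              intro x
              have := congrFun (congrFun (Matrix.adjugate_mul L) x) i'
              rw [Matrix.mul_apply, Matrix.smul_apply, smul_eq_mul] at this
              rw [← this, Finset.mul_sum]
              exact Finset.sum_congr rfl fun _ _ => by ring
            rw [Finset.sum_congr rfl fun x _ => h2 x, Finset.sum_eq_single i']
            · simp; ring
            · intro x _ hx; simp [Matrix.one_apply_ne hx]
            · simp
          have := congrArg hR.φ h1
          rw [map_sum, map_mul, map_intCast] at this
          rw [← this]
          exact Finset.sum_congr rfl fun _ _ => (map_mul _ _ _).symm
        push_cast
        simp only [Finset.mul_sum]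
        rw [Finset.sum_comm]
        refine Finset.sum_congr rfl fun i' _ => ?_
        calc hR.φ L.det * (m k1 i' * g k j i') = (hR.φ L.det * m k1 i') * g k j i' := by ring
          _ = _ := by
            rw [← e, Finset.sum_mul]
            exact Finset.sum_congr rfl fun _ _ => by ring
      have hle : |hR.φ L.det * ((∑ i, m k1 i * g k j i : ℤ) : ℝ)| ≤ S * Real.exp (s * ℓ k) := by
        rw [hid, hS, Finset.sum_mul]
        refine (Finset.abs_sum_le_sum_abs _ _).trans (Finset.sum_le_sum fun i _ => ?_)
        rw [abs_mul]
        by_cases hi : s < c i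
        · rw [hk1 i hi]; simp
        · push Not at hi
          refine mul_le_mul_of_nonneg_left ?_ (abs_nonneg _)
          exact (hg k j i).trans (Real.exp_le_exp.mpr (mul_le_mul_of_nonneg_right hi hk0))
      rw [abs_mul] at hle
      have h1 : |((∑ i, m k1 i * g k j i : ℤ) : ℝ)| < 1 := by
        by_contra hcon
        push Not at hcon
        nlinarith
      have h2 : |∑ i, m k1 i * g k j i| < 1 := by exact_mod_cast h1
      exact Int.abs_lt_one_iff.mp h2
  · exfalso
    push Not at hB
    obtain ⟨gap, hgap, hgap0⟩ : ∃ gap : ℝ, (∀ i, s < c i → gap ≤ c i - s) ∧ 0 < gap := by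
      have h1 : ∀ᶠ x : ℝ in nhdsWithin 0 (Set.Ioi 0), ∀ i, s < c i → x ≤ c i - s := by
        rw [eventually_all]
        intro i
        by_cases hi : s < c i
        · have : ∀ᶠ x : ℝ in nhdsWithin 0 (Set.Ioi 0), x < c i - s :=
            nhdsWithin_le_nhds (Iio_mem_nhds (by linarith))
          filter_upwards [this] with x hx _ using hx.le
        · exact Eventually.of_forall fun x h => absurd h hi
      have h2 : ∀ᶠ x : ℝ in nhdsWithin 0 (Set.Ioi 0), 0 < x := eventually_mem_nhdsWithin
      exact (h1.and h2).exists
    have hd0 : (0 : ℝ) < hR.d := by exact_mod_cast hR.d_pos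
    set η : ℝ := gap / (2 * hR.d) with hη
    have hη0 : 0 < η := by positivity
    set V : ℝ := (∑ j, ∑ i, hR.ν (L.adjugate j i)) + 1 with hV
    have hV0 : 0 ≤ ∑ j, ∑ i, hR.ν (L.adjugate j i) :=
      Finset.sum_nonneg fun _ _ => Finset.sum_nonneg fun _ _ => apply_nonneg _ _
    set Q : ℝ := (n + 1).factorial * (V * (n + 1)) ^ hR.d with hQ
    have hlim : Tendsto (fun k => Q * Real.exp ((-(gap / 2)) * ℓ k)) atTop (nhds (Q * 0)) := by
      refine Tendsto.const_mul _ (Real.tendsto_exp_atBot.comp ?_)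
      exact hℓ.const_mul_atTop_of_neg (by linarith)
    rw [mul_zero] at hlim
    have hev : ∀ᶠ k in atTop, ∃ i, Real.exp (η * ℓ k) ≤ |(m k i : ℝ)| := by
      filter_upwards [hlim.eventually_lt_const hR.c_pos, hℓ.eventually_ge_atTop 0] with k hk hk0
      by_contra hcon
      push Not at hcon
      obtain ⟨i, hi, hbi⟩ := hB k
      have h1 := hR.liou _ hbi
      have h2 : hR.ν (b k i) ≤ V * (n + 1) * Real.exp (η * ℓ k) := by
        have a1 : hR.ν (b k i) ≤ ∑ j, |(m k j : ℝ)| * hR.ν (L.adjugate j i) := by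
          refine (Finset.le_sum_of_subadditive hR.ν (map_zero _).le (map_add_le_add _) _ _).trans ?_
          exact Finset.sum_le_sum fun j _ => nu_intCast_mul hR _ _
        refine a1.trans ?_
        calc _ ≤ ∑ j : Fin (n + 1), Real.exp (η * ℓ k) * V := by
              refine Finset.sum_le_sum fun j _ => ?_
              refine mul_le_mul (hcon j).le ?_ (apply_nonneg _ _) (Real.exp_pos _).le
              have b1 : hR.ν (L.adjugate j i) ≤ ∑ i, hR.ν (L.adjugate j i) :=
                Finset.single_le_sum (f := fun i => hR.ν (L.adjugate j i)) (fun _ _ => apply_nonneg _ _) (Finset.mem_univ i)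
              have b2 : ∑ i, hR.ν (L.adjugate j i) ≤ ∑ j, ∑ i, hR.ν (L.adjugate j i) :=
                Finset.single_le_sum (f := fun j => ∑ i, hR.ν (L.adjugate j i))
                  (fun _ _ => Finset.sum_nonneg fun _ _ => apply_nonneg _ _) (Finset.mem_univ j)
              linarith
          _ = _ := by simp; ring
      have h3 : |hR.φ (b k i)| ≤ (n + 1).factorial * Real.exp (-gap * ℓ k) := by
        refine (hbb k i).trans ?_
        refine mul_le_mul_of_nonneg_left (Real.exp_le_exp.mpr ?_) (Nat.cast_nonneg _)
        exact mul_le_mul_of_nonneg_right (by linarith [hgap i hi]) hk0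
      have h4 : |hR.φ (b k i)| * hR.ν (b k i) ^ hR.d ≤ Q * Real.exp ((-(gap / 2)) * ℓ k) := by
        calc _ ≤ (n + 1).factorial * Real.exp (-gap * ℓ k) * (V * (n + 1) * Real.exp (η * ℓ k)) ^ hR.d :=
              mul_le_mul h3 (pow_le_pow_left₀ (apply_nonneg _ _) h2 _) (pow_nonneg (apply_nonneg _ _) _) (by positivity)
          _ = Q * (Real.exp (-gap * ℓ k) * Real.exp (hR.d * (η * ℓ k))) := by
              rw [mul_pow, hQ, Real.exp_nat_mul]; ring
          _ = _ := by
              rw [← Real.exp_add]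
              congr 2
              rw [hη]; field_simp; ring
      linarith
    obtain ⟨k0, hk0⟩ := eventually_atTop.mp hev
    refine ht_core hR L hdet c hc η hη0 (fun k => ℓ (k + k0)) (hℓ.comp (tendsto_add_atTop_nat k0))
      (fun k => g (k + k0)) (fun k => m (k + k0)) (fun k => hg _) (fun k => hspan _) (fun k => hprim _)
      (fun k => hk0 _ (by omega))

end ht
end SST

end

section
open MvPolynomial Filter

namespace SST

/-- integer vector as a real vector -/
def rc {N : ℕ} (x : Fin N → ℤ) : Fin N → ℝ := fun i => (x i : ℝ)

/-- sup norm of `A x` -/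
noncomputable def nF {N : ℕ} (A : Matrix (Fin N) (Fin N) ℝ) (x : Fin N → ℤ) : ℝ := ‖A.mulVec (rc x)‖

lemma nF_nonneg {N : ℕ} (A : Matrix (Fin N) (Fin N) ℝ) (x : Fin N → ℤ) : 0 ≤ nF A x := norm_nonneg _

lemma rc_ne {N : ℕ} {x : Fin N → ℤ} (hx : x ≠ 0) : rc x ≠ 0 := by
  intro h; apply hx; funext i; have := congrFun h i; simpa [rc] using this

lemma rc_inj {N : ℕ} : Function.Injective (rc (N := N)) := by
  intro x y h; funext i; have := congrFun h i; simpa [rc] using this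

lemma nF_le_iff {N : ℕ} (A : Matrix (Fin N) (Fin N) ℝ) (x : Fin N → ℤ) {r : ℝ} (hr : 0 ≤ r) :
    nF A x ≤ r ↔ ∀ i, |A.mulVec (rc x) i| ≤ r := by
  rw [nF, pi_norm_le_iff_of_nonneg hr]; rfl

lemma le_nF {N : ℕ} (A : Matrix (Fin N) (Fin N) ℝ) (x : Fin N → ℤ) (i : Fin N) :
    |A.mulVec (rc x) i| ≤ nF A x := (nF_le_iff A x (nF_nonneg A x)).mp le_rfl i

/-- lower bound -/
lemma exists_lower {N : ℕ} (A : Matrix (Fin N) (Fin N) ℝ) (hA : A.det ≠ 0) :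
    ∃ K : ℝ, 0 < K ∧ ∀ x : Fin N → ℤ, ∀ i, |(x i : ℝ)| ≤ K * nF A x := by
  refine ⟨(∑ i, ∑ j, |A⁻¹ i j|) + 1, by positivity, fun x i => ?_⟩
  have h : rc x = A⁻¹.mulVec (A.mulVec (rc x)) := by
    rw [Matrix.mulVec_mulVec, Matrix.nonsing_inv_mul _ (Ne.isUnit hA), Matrix.one_mulVec]
  have h2 : |(x i : ℝ)| = |∑ j, A⁻¹ i j * A.mulVec (rc x) j| := by
    change |rc x i| = _
    conv_lhs => rw [h]
    rfl
  rw [h2]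
  calc _ ≤ ∑ j, |A⁻¹ i j| * nF A x := by
        refine (Finset.abs_sum_le_sum_abs _ _).trans (Finset.sum_le_sum fun j _ => ?_)
        rw [abs_mul]
        exact mul_le_mul_of_nonneg_left (le_nF A x j) (abs_nonneg _)
    _ = (∑ j, |A⁻¹ i j|) * nF A x := by rw [Finset.sum_mul]
    _ ≤ _ := by
        refine mul_le_mul_of_nonneg_right ?_ (nF_nonneg _ _)
        have : ∑ j, |A⁻¹ i j| ≤ ∑ i, ∑ j, |A⁻¹ i j| :=
          Finset.single_le_sum (f := fun i => ∑ j, |A⁻¹ i j|)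
            (fun _ _ => Finset.sum_nonneg fun _ _ => abs_nonneg _) (Finset.mem_univ i)
        linarith

lemma nF_pos {N : ℕ} (A : Matrix (Fin N) (Fin N) ℝ) (hA : A.det ≠ 0) {x : Fin N → ℤ} (hx : x ≠ 0) :
    0 < nF A x := by
  obtain ⟨K, hK, h⟩ := exists_lower A hA
  by_contra hcon
  have h0 : nF A x = 0 := le_antisymm (not_lt.mp hcon) (nF_nonneg _ _)
  apply hx; funext i
  have := h x i
  rw [h0, mul_zero] at this
  have := abs_nonpos_iff.mp this
  exact_mod_cast this

lemma exists_single_notMem {N : ℕ} (S : Submodule ℝ (Fin N → ℝ)) (hS : S ≠ ⊤) :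
    ∃ i : Fin N, rc (Pi.single i 1 : Fin N → ℤ) ∉ S := by
  by_contra hcon
  push Not at hcon
  apply hS
  rw [eq_top_iff, ← (Pi.basisFun ℝ (Fin N)).span_eq, Submodule.span_le]
  rintro _ ⟨i, rfl⟩
  have := hcon i
  have e : rc (Pi.single i 1 : Fin N → ℤ) = Pi.basisFun ℝ (Fin N) i := by
    funext j; simp [rc, Pi.single_apply]
  rw [e] at this; exact this

lemma exists_min_notMem {N : ℕ} (A : Matrix (Fin N) (Fin N) ℝ) (hA : A.det ≠ 0)
    (S : Submodule ℝ (Fin N → ℝ)) (hS : S ≠ ⊤) :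
    ∃ g : Fin N → ℤ, rc g ∉ S ∧ ∀ x : Fin N → ℤ, rc x ∉ S → nF A g ≤ nF A x := by
  obtain ⟨i, hi⟩ := exists_single_notMem S hS
  set x0 : Fin N → ℤ := Pi.single i 1 with hx0
  obtain ⟨K, hK, h⟩ := exists_lower A hA
  set T : Set (Fin N → ℤ) := {x | rc x ∉ S ∧ nF A x ≤ nF A x0} with hT
  have hfin : T.Finite := by
    obtain ⟨B, hB⟩ := exists_nat_ge (K * nF A x0)
    refine (Set.Finite.pi' (t := fun _ : Fin N => Set.Icc (-(B : ℤ)) B) (fun _ => Set.finite_Icc _ _)).subset ?_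
    rintro x ⟨_, hx⟩ j
    have h1 : |(x j : ℝ)| ≤ B := (h x j).trans ((mul_le_mul_of_nonneg_left hx hK.le).trans hB)
    have h2 : |x j| ≤ (B : ℤ) := by exact_mod_cast h1
    exact abs_le.mp h2
  obtain ⟨g, hg, hmin⟩ := Set.exists_min_image T (nF A) hfin ⟨x0, hi, le_rfl⟩
  refine ⟨g, hg.1, fun x hx => ?_⟩
  by_cases hc : nF A x ≤ nF A x0
  · exact hmin x ⟨hx, hc⟩
  · exact hg.2.trans (not_le.mp hc).le

/-- successive minima flag -/
structure Flag {N : ℕ} (A : Matrix (Fin N) (Fin N) ℝ) where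
  S : ℕ → Submodule ℝ (Fin N → ℝ)
  g : ℕ → Fin N → ℤ
  S0 : S 0 = ⊥
  Ss : ∀ j, S (j + 1) = S j ⊔ Submodule.span ℝ {rc (g j)}
  nm : ∀ j, j < N → rc (g j) ∉ S j
  mn : ∀ j, j < N → ∀ x : Fin N → ℤ, rc x ∉ S j → nF A (g j) ≤ nF A x

lemma finrank_sup_span_le {N : ℕ} (S : Submodule ℝ (Fin N → ℝ)) (v : Fin N → ℝ) :
    Module.finrank ℝ (S ⊔ Submodule.span ℝ {v} : Submodule ℝ (Fin N → ℝ)) ≤ Module.finrank ℝ S + 1 := by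
  refine (Submodule.finrank_add_le_finrank_add_finrank _ _).trans ?_
  have := finrank_span_le_card (R := ℝ) ({v} : Set (Fin N → ℝ))
  simp at this
  omega

lemma exists_flag {N : ℕ} (A : Matrix (Fin N) (Fin N) ℝ) (hA : A.det ≠ 0) : Nonempty (Flag A) := by
  have H : ∀ S : Submodule ℝ (Fin N → ℝ), ∃ g : Fin N → ℤ, S ≠ ⊤ → rc g ∉ S ∧
      ∀ x : Fin N → ℤ, rc x ∉ S → nF A g ≤ nF A x := by
    intro S
    by_cases hS : S = ⊤
    · exact ⟨0, fun h => absurd hS h⟩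
    · obtain ⟨g, hg⟩ := exists_min_notMem A hA S hS
      exact ⟨g, fun _ => hg⟩
  choose ch hch using H
  obtain ⟨S, hS0, hSs⟩ : ∃ S : ℕ → Submodule ℝ (Fin N → ℝ), S 0 = ⊥ ∧
      ∀ j, S (j + 1) = S j ⊔ Submodule.span ℝ {rc (ch (S j))} :=
    ⟨fun j => Nat.rec ⊥ (fun _ T => T ⊔ Submodule.span ℝ {rc (ch T)}) j, rfl, fun _ => rfl⟩
  have hfr : ∀ j, Module.finrank ℝ (S j) ≤ j := by
    intro j
    induction j with
    | zero => rw [hS0]; simp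
    | succ j ih => rw [hSs]; exact (finrank_sup_span_le _ _).trans (by omega)
  have hnt : ∀ j, j < N → S j ≠ ⊤ := by
    intro j hj h
    have := hfr j
    rw [h, finrank_top] at this
    simp at this
    omega
  exact ⟨⟨S, fun j => ch (S j), hS0, hSs, fun j hj => (hch _ (hnt j hj)).1,
    fun j hj => (hch _ (hnt j hj)).2⟩⟩

namespace Flag
variable {N : ℕ} {A : Matrix (Fin N) (Fin N) ℝ}

/-- successive minima -/
noncomputable def lam (f : Flag A) (j : ℕ) : ℝ := nF A (f.g j)

lemma mono (f : Flag A) : Monotone f.S := monotone_nat_of_le_succ fun j => by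
  rw [f.Ss]; exact le_sup_left

lemma g_mem (f : Flag A) {i j : ℕ} (h : i < j) : rc (f.g i) ∈ f.S j := by
  refine f.mono (Nat.succ_le_of_lt h) ?_
  rw [f.Ss]
  exact Submodule.mem_sup_right (Submodule.mem_span_singleton_self _)

lemma finrank_le (f : Flag A) (j : ℕ) : Module.finrank ℝ (f.S j) ≤ j := by
  induction j with
  | zero => rw [f.S0]; simp
  | succ j ih => rw [f.Ss]; exact (finrank_sup_span_le _ _).trans (by omega)

lemma finrank_eq (f : Flag A) {j : ℕ} (hj : j ≤ N) : Module.finrank ℝ (f.S j) = j := by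
  refine le_antisymm (f.finrank_le j) ?_
  induction j with
  | zero => simp
  | succ j ih =>
    have h1 := ih (by omega)
    have h2 : f.S j < f.S (j + 1) := by
      refine lt_of_le_of_ne (f.mono (Nat.le_succ j)) fun h => f.nm j (by omega) ?_
      rw [h]; exact f.g_mem (Nat.lt_succ_self j)
    have := Submodule.finrank_lt_finrank_of_lt h2
    omega

lemma top (f : Flag A) : f.S N = ⊤ := by
  apply Submodule.eq_top_of_finrank_eq
  rw [f.finrank_eq le_rfl]; simp

lemma lam_mono (f : Flag A) {i j : ℕ} (h : i ≤ j) (hj : j < N) : f.lam i ≤ f.lam j :=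
  f.mn i (by omega) _ fun hc => f.nm j hj (f.mono h hc)

lemma g_ne (f : Flag A) {j : ℕ} (hj : j < N) : f.g j ≠ 0 := by
  intro h
  apply f.nm j hj
  rw [h]
  have : rc (0 : Fin N → ℤ) = 0 := by funext i; simp [rc]
  rw [this]; exact Submodule.zero_mem _

lemma lam_pos (f : Flag A) (hA : A.det ≠ 0) {j : ℕ} (hj : j < N) : 0 < f.lam j := nF_pos A hA (f.g_ne hj)

lemma span_eq (f : Flag A) (j : ℕ) : f.S j = Submodule.span ℝ (Set.range fun i : Fin j => rc (f.g i)) := by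
  induction j with
  | zero => rw [f.S0]; simp
  | succ j ih =>
    refine le_antisymm ?_ ?_
    · rw [f.Ss, ih, sup_le_iff, Submodule.span_le, Submodule.span_le]
      constructor
      · rintro _ ⟨i, rfl⟩
        exact Submodule.subset_span ⟨i.castSucc, rfl⟩
      · rintro _ rfl
        exact Submodule.subset_span ⟨Fin.last j, rfl⟩
    · rw [Submodule.span_le]
      rintro _ ⟨i, rfl⟩
      exact f.g_mem i.2

lemma linInd (f : Flag A) {j : ℕ} (hj : j ≤ N) : LinearIndependent ℝ (fun i : Fin j => rc (f.g i)) := by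
  rw [linearIndependent_iff_card_eq_finrank_span]
  have := f.finrank_eq hj
  rw [f.span_eq j] at this
  rw [Set.finrank, this]; simp

/-- a point outside `S j` among any `j+1` independent vectors -/
lemma exists_notMem (f : Flag A) {j : ℕ} {ι : Type*} [Fintype ι] (hι : j < Fintype.card ι)
    (v : ι → Fin N → ℝ) (hv : LinearIndependent ℝ v) : ∃ i, v i ∉ f.S j := by
  by_contra hcon
  push Not at hcon
  have h1 : Submodule.span ℝ (Set.range v) ≤ f.S j := by
    rw [Submodule.span_le]; rintro _ ⟨i, rfl⟩; exact hcon i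
  have h2 := Submodule.finrank_mono h1
  rw [finrank_span_eq_card hv] at h2
  have := f.finrank_le j
  omega

end Flag

/-- lower Minkowski -/
lemma Flag.det_le {N : ℕ} {A : Matrix (Fin N) (Fin N) ℝ} (f : Flag A) :
    |A.det| ≤ N.factorial * ∏ j : Fin N, f.lam j := by
  set G : Matrix (Fin N) (Fin N) ℤ := Matrix.of fun j i => f.g j i with hG
  have hGr : (G.map (Int.castRingHom ℝ)) = Matrix.of fun j : Fin N => rc (f.g j) := by
    ext j i; simp [hG, rc]
  have hne : (G.map (Int.castRingHom ℝ)).det ≠ 0 := by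
    have h2 : IsUnit (Matrix.of fun j : Fin N => rc (f.g j)) :=
      Matrix.linearIndependent_rows_iff_isUnit.mp (f.linInd le_rfl)
    rw [hGr]
    exact ((Matrix.isUnit_iff_isUnit_det _).mp h2).ne_zero
  have hdd : (G.map (Int.castRingHom ℝ)).det = (G.det : ℝ) := by
    exact (RingHom.map_det (Int.castRingHom ℝ) G).symm
  have hge : (1 : ℝ) ≤ |(G.det : ℝ)| := by
    rw [hdd] at hne
    have : G.det ≠ 0 := by exact_mod_cast hne
    exact_mod_cast Int.one_le_abs this
  have hb := det_bound (A * (G.map (Int.castRingHom ℝ)).transpose) (fun _ => 1) (fun j : Fin N => f.lam j) (by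
    intro i j
    rw [one_mul]
    refine le_trans (le_of_eq ?_) (le_nF A (f.g j) i)
    rw [hGr]; rfl)
  rw [Matrix.det_mul, Matrix.det_transpose, hdd, abs_mul] at hb
  simp at hb
  have := mul_le_mul_of_nonneg_left hge (abs_nonneg A.det)
  linarith

end SST

end

section
open MvPolynomial Filter

namespace SST

lemma mink1 {N : ℕ} (A : Matrix (Fin N) (Fin N) ℝ) (hA : A.det ≠ 0) (h1 : |A.det| < 1) :
    ∃ x : Fin N → ℤ, x ≠ 0 ∧ nF A x < 1 := by
  have hli : LinearIndependent ℝ (fun j : Fin N => (A.transpose j : Fin N → ℝ)) := by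
    have h2 : IsUnit A.transpose := by
      rw [Matrix.isUnit_iff_isUnit_det, Matrix.det_transpose]
      exact Ne.isUnit hA
    exact Matrix.linearIndependent_rows_iff_isUnit.mpr h2
  have hsp : ⊤ ≤ Submodule.span ℝ (Set.range (fun j : Fin N => (A.transpose j : Fin N → ℝ))) := by
    refine (Submodule.eq_top_of_finrank_eq ?_).ge
    rw [finrank_span_eq_card hli]; simp
  set b : Module.Basis (Fin N) ℝ (Fin N → ℝ) := Module.Basis.mk hli hsp with hb
  have hb' : ∀ j, b j = A.transpose j := fun j => Module.Basis.mk_apply _ _ _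
  have hvol : MeasureTheory.volume (ZSpan.fundamentalDomain b) = ENNReal.ofReal |A.det| := by
    rw [ZSpan.volume_fundamentalDomain]
    have : Matrix.of (b : Fin N → Fin N → ℝ) = A.transpose := by
      ext i j; rw [Matrix.of_apply, hb']
    rw [this, Matrix.det_transpose]
  have : Countable (Submodule.span ℤ (Set.range b)).toAddSubgroup :=
    inferInstanceAs (Countable (Submodule.span ℤ (Set.range b)))
  have key := MeasureTheory.exists_ne_zero_mem_lattice_of_measure_mul_two_pow_lt_measure
    (ZSpan.isAddFundamentalDomain' b MeasureTheory.volume) (s := Metric.ball (0 : Fin N → ℝ) 1)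
    (by intro x hx; simpa using hx) (convex_ball _ _) (by
      rw [hvol, Real.volume_pi_ball _ one_pos]
      simp only [Module.finrank_fintype_fun_eq_card, Fintype.card_fin, mul_one]
      rw [ENNReal.ofReal_pow (by norm_num)]
      simp only [ENNReal.ofReal_ofNat]
      have h2 : ENNReal.ofReal |A.det| < 1 := by
        rw [← ENNReal.ofReal_one]
        exact (ENNReal.ofReal_lt_ofReal_iff one_pos).mpr h1
      calc _ < 1 * (2 : ENNReal) ^ N := by
            refine (ENNReal.mul_lt_mul_iff_left ?_ ?_).mpr h2
            · simp
            · simp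
        _ = _ := one_mul _)
  obtain ⟨⟨v, hv⟩, hne, hm⟩ := key
  have hv' : v ∈ Submodule.span ℤ (Set.range b) := hv
  rw [Submodule.mem_span_range_iff_exists_fun] at hv'
  obtain ⟨x, hx⟩ := hv'
  have hvx : A.mulVec (rc x) = v := by
    rw [← hx]
    funext i
    simp [Matrix.mulVec, dotProduct, hb', rc, mul_comm]
  refine ⟨x, ?_, ?_⟩
  · rintro rfl
    apply hne
    ext1
    simpa using hx.symm
  · rw [nF, hvx]
    simpa using hm

/-- one step of the Davenport argument -/
lemma dav_step {N : ℕ} (j : ℕ) (hj : j < N) (V : Submodule ℝ (Fin N → ℝ)) (hV : Module.finrank ℝ V ≤ j)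
    (σ : Equiv.Perm (Fin N)) :
    ∃ i0 : Fin N, (i0 : ℕ) ≤ j ∧ ∀ y ∈ V, ∀ t : ℝ, 0 ≤ t → (∀ i : Fin N, (i : ℕ) ≤ j → i ≠ i0 → |y (σ i)| ≤ t) →
      |y (σ i0)| ≤ N * t := by
  let e : Fin (j + 1) → Fin N := fun a => σ ⟨a, by omega⟩
  let f : V →ₗ[ℝ] (Fin (j + 1) → ℝ) := (LinearMap.funLeft ℝ ℝ e).comp V.subtype
  have hr : LinearMap.range f ≠ ⊤ := by
    intro h
    have h1 := LinearMap.finrank_range_le f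
    rw [h, finrank_top] at h1
    simp at h1
    omega
  obtain ⟨b, hb0, hb⟩ := Submodule.exists_le_ker_of_lt_top _ (lt_top_iff_ne_top.mpr hr)
  let β : Fin (j + 1) → ℝ := fun a => b (Pi.single a 1)
  have hbe : ∀ z, b z = ∑ a, β a * z a := by
    intro z
    conv_lhs => rw [← (Pi.basisFun ℝ (Fin (j + 1))).sum_repr z]
    simp [map_sum, β, mul_comm]
  obtain ⟨a0, -, ha0⟩ := Finset.exists_max_image (Finset.univ : Finset (Fin (j + 1))) (fun a => |β a|)
    Finset.univ_nonempty
  have hβ0 : 0 < |β a0| := by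
    by_contra hcon
    apply hb0
    ext z
    have : ∀ a, β a = 0 := fun a => abs_nonpos_iff.mp ((ha0 a (Finset.mem_univ a)).trans (not_lt.mp hcon))
    simp [hbe, this]
  refine ⟨⟨a0, by omega⟩, by simpa using Nat.lt_succ_iff.mp a0.2, fun y hy t ht hyt => ?_⟩
  have h0 : b (f ⟨y, hy⟩) = 0 := hb ⟨_, rfl⟩
  rw [hbe, ← Finset.add_sum_erase _ _ (Finset.mem_univ a0)] at h0
  have h1 : |β a0| * |y (σ ⟨a0, by omega⟩)| ≤ |β a0| * (N * t) := by
    have e1 : β a0 * y (σ ⟨a0, by omega⟩) = - ∑ x ∈ Finset.univ.erase a0, β x * (f ⟨y, hy⟩) x := by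
      have : f ⟨y, hy⟩ a0 = y (σ ⟨a0, by omega⟩) := rfl
      rw [← this]; linarith
    rw [← abs_mul, e1, abs_neg]
    calc _ ≤ ∑ x ∈ Finset.univ.erase a0, |β a0| * t := by
          refine (Finset.abs_sum_le_sum_abs _ _).trans (Finset.sum_le_sum fun a ha => ?_)
          rw [abs_mul]
          refine mul_le_mul (ha0 a (Finset.mem_univ a)) ?_ (abs_nonneg _) hβ0.le
          refine hyt ⟨a, by omega⟩ (by simpa using Nat.lt_succ_iff.mp a.2) ?_
          intro h
          apply (Finset.mem_erase.mp ha).1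
          ext
          simpa using h
      _ = j * (|β a0| * t) := by
          rw [Finset.sum_const, Finset.card_erase_of_mem (Finset.mem_univ _)]; simp
      _ ≤ N * (|β a0| * t) := by
          refine mul_le_mul_of_nonneg_right ?_ (by positivity)
          exact_mod_cast hj.le
      _ = _ := by ring
  exact le_of_mul_le_mul_left h1 hβ0

lemma davenport {N : ℕ} (V : ℕ → Submodule ℝ (Fin N → ℝ)) (hm : Monotone V)
    (hV : ∀ j, Module.finrank ℝ (V j) ≤ j) :
    ∃ σ : Equiv.Perm (Fin N), ∀ j ≤ N, ∀ y ∈ V j, ∀ t : ℝ, 0 ≤ t →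
      (∀ i : Fin N, (i : ℕ) < j → |y (σ i)| ≤ t) → ∀ i, |y i| ≤ (N + 1 : ℝ) ^ N * t := by
  have hN1 : (1 : ℝ) ≤ N + 1 := by linarith [(Nat.cast_nonneg N : (0 : ℝ) ≤ N)]
  have H : ∀ d, d ≤ N → ∃ σ : Equiv.Perm (Fin N), ∀ j ≤ N, N ≤ j + d → ∀ y ∈ V j, ∀ t : ℝ, 0 ≤ t →
      (∀ i : Fin N, (i : ℕ) < j → |y (σ i)| ≤ t) → ∀ i, |y i| ≤ (N + 1 : ℝ) ^ d * t := by
    intro d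
    induction d with
    | zero =>
      intro _
      refine ⟨1, fun j _ hj y _ t ht h i => ?_⟩
      simpa using h i (by omega)
    | succ d ih =>
      intro hd
      obtain ⟨σ, hσ⟩ := ih (by omega)
      set j0 := N - (d + 1) with hj0
      have hj0N : j0 < N := by omega
      obtain ⟨i0, hi0, hi0b⟩ := dav_step j0 hj0N (V j0) (hV j0) σ
      have hσ' : ∀ i, σ i = (σ * Equiv.swap i0 ⟨j0, hj0N⟩) (Equiv.swap i0 ⟨j0, hj0N⟩ i) := by
        intro i; simp
      refine ⟨σ * Equiv.swap i0 ⟨j0, hj0N⟩, fun j hjN hj y hy t ht h i => ?_⟩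
      rcases Nat.lt_or_ge j0 j with hlt | hge
      · have h2 : ∀ i : Fin N, (i : ℕ) < j → |y (σ i)| ≤ t := by
          intro i hi
          rw [hσ' i]
          apply h
          rw [Equiv.swap_apply_def]
          split_ifs <;> (try simp only []) <;> omega
        refine (hσ j hjN (by omega) y hy t ht h2 i).trans ?_
        refine mul_le_mul_of_nonneg_right ?_ ht
        exact pow_le_pow_right₀ hN1 (Nat.le_succ d)
      · have hjj : j = j0 := by omega
        clear_value j0
        subst hjj
        have h2 : ∀ i : Fin N, (i : ℕ) ≤ j → i ≠ i0 → |y (σ i)| ≤ t := by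
          intro i hi hne
          rw [hσ' i]
          apply h
          rw [Equiv.swap_apply_def, if_neg hne]
          split_ifs with h3
          · have : (i : ℕ) = j := by rw [h3]
            rcases Nat.lt_or_ge i0 j with h4 | h4
            · exact h4
            · exfalso; apply hne; ext; omega
          · rcases Nat.lt_or_ge i j with h4 | h4
            · exact h4
            · exfalso; apply h3; ext; simp; omega
        have h3 := hi0b y hy t ht h2
        have h4 : ∀ i : Fin N, (i : ℕ) < j + 1 → |y (σ i)| ≤ (N + 1) * t := by
          intro i hi
          by_cases hie : i = i0
          · rw [hie]; linarith
          · refine (h2 i (by omega) hie).trans ?_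
            have := mul_le_mul_of_nonneg_right hN1 ht
            linarith
        have h5 := hσ (j + 1) (by omega) (by omega) y (hm (Nat.le_succ j) hy) _ (by positivity) h4 i
        rw [pow_succ]
        linarith
  obtain ⟨σ, hσ⟩ := H N le_rfl
  exact ⟨σ, fun j hj => hσ j hj (by omega)⟩

/-- the constant -/
noncomputable def dC (N : ℕ) : ℝ := 2 * (N + 1 : ℝ) ^ N

lemma dC_ge (N : ℕ) : 1 ≤ dC N := by
  have : (1 : ℝ) ≤ (N + 1 : ℝ) ^ N := one_le_pow₀ (by linarith [(Nat.cast_nonneg N : (0 : ℝ) ≤ N)])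
  rw [dC]; linarith

lemma Flag.dav {N : ℕ} {A : Matrix (Fin N) (Fin N) ℝ} (hA : A.det ≠ 0) (f : Flag A) :
    ∃ σ : Equiv.Perm (Fin N), ∀ ρ : Fin N → ℝ, (∀ i, 0 < ρ i) → Antitone ρ →
      (∀ i j : Fin N, i ≤ j → ρ i * f.lam i ≤ ρ j * f.lam j) → ∀ (j : Fin N) (x : Fin N → ℤ),
      rc x ∉ f.S j → ∃ i, ρ j * f.lam j ≤ dC N * (ρ i * |A.mulVec (rc x) (σ i)|) := by
  obtain ⟨σ, hσ⟩ := davenport (fun j => (f.S j).map A.mulVecLin) (fun i j h => Submodule.map_mono (f.mono h))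
    (fun j => (Submodule.finrank_map_le _ _).trans (f.finrank_le j))
  refine ⟨σ, fun ρ hρ hanti hmono j x hx => ?_⟩
  obtain ⟨j', hj', hxj, hxj'⟩ : ∃ j' : Fin N, j ≤ j' ∧ rc x ∉ f.S j' ∧ rc x ∈ f.S (j' + 1) := by
    classical
    have hex : ∃ m, rc x ∈ f.S m := ⟨N, by rw [f.top]; trivial⟩
    set m := Nat.find hex with hm
    have h1 : rc x ∈ f.S m := Nat.find_spec hex
    have h2 : m ≤ N := Nat.find_min' hex (by rw [f.top]; trivial)
    have h3 : (j : ℕ) < m := by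
      by_contra hcon
      exact hx (f.mono (not_lt.mp hcon) h1)
    refine ⟨⟨m - 1, by omega⟩, by rw [Fin.le_def]; change (j : ℕ) ≤ m - 1; omega, ?_, ?_⟩
    · exact Nat.find_min hex (by change m - 1 < m; omega)
    · simpa [Nat.sub_add_cancel (show 1 ≤ m by omega)] using h1
  have hlam : 0 < f.lam j' := f.lam_pos hA j'.2
  have hC := dC_ge N
  have hex : ∃ i : Fin N, (i : ℕ) < j' + 1 ∧ f.lam j' ≤ dC N * |A.mulVec (rc x) (σ i)| := by
    by_contra hcon
    push Not at hcon
    have h1 := hσ (j' + 1) (by omega) (A.mulVec (rc x)) (Submodule.mem_map_of_mem (f := A.mulVecLin) hxj')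
      (f.lam j' / dC N) (by positivity) (fun i hi => by
        rw [le_div_iff₀ (by linarith)]
        have := hcon i hi
        linarith)
    have h2 : nF A x ≤ f.lam j' / 2 := by
      rw [nF_le_iff _ _ (by linarith)]
      intro i
      refine (h1 i).trans (le_of_eq ?_)
      rw [dC]
      have : (0 : ℝ) < (N + 1 : ℝ) ^ N := by positivity
      field_simp
    have h3 := f.mn j' j'.2 x hxj
    have : f.lam j' = nF A (f.g j') := rfl
    linarith
  obtain ⟨i, hi, hle⟩ := hex
  refine ⟨i, ?_⟩
  calc ρ j * f.lam j ≤ ρ j' * f.lam j' := hmono _ _ hj'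
    _ ≤ ρ i * f.lam j' := mul_le_mul_of_nonneg_right (hanti (by rw [Fin.le_def]; omega)) hlam.le
    _ ≤ ρ i * (dC N * |A.mulVec (rc x) (σ i)|) := mul_le_mul_of_nonneg_left hle (hρ i).le
    _ = _ := by ring

/-- reweighted and permuted matrix -/
def rwt {N : ℕ} (A : Matrix (Fin N) (Fin N) ℝ) (ρ : Fin N → ℝ) (σ : Equiv.Perm (Fin N)) :
    Matrix (Fin N) (Fin N) ℝ := Matrix.of fun i j => ρ i * A (σ i) j

lemma rwt_mulVec {N : ℕ} (A : Matrix (Fin N) (Fin N) ℝ) (ρ : Fin N → ℝ) (σ : Equiv.Perm (Fin N))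
    (x : Fin N → ℝ) (i : Fin N) : (rwt A ρ σ).mulVec x i = ρ i * A.mulVec x (σ i) := by
  simp [rwt, Matrix.mulVec, dotProduct, Finset.mul_sum, mul_assoc]

lemma rwt_det {N : ℕ} (A : Matrix (Fin N) (Fin N) ℝ) (ρ : Fin N → ℝ) (σ : Equiv.Perm (Fin N))
    (hρ : ∀ i, 0 < ρ i) : |(rwt A ρ σ).det| = (∏ i, ρ i) * |A.det| := by
  have h : rwt A ρ σ = Matrix.of fun i j => ρ i * (A.submatrix σ id) i j := rfl
  rw [h, Matrix.det_mul_column, Matrix.det_permute, abs_mul, abs_of_pos (Finset.prod_pos fun i _ => hρ i)]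
  congr 1
  rcases Int.units_eq_one_or (Equiv.Perm.sign σ) with h | h <;> simp [h]

/-- Minkowski second theorem -/
lemma Flag.mink2 {N : ℕ} {A : Matrix (Fin N) (Fin N) ℝ} (hA : A.det ≠ 0) (f : Flag A) :
    ∏ j : Fin N, f.lam j ≤ dC N ^ N * |A.det| := by
  obtain ⟨σ, hσ⟩ := f.dav hA
  have hC := dC_ge N
  have hpos : ∀ i : Fin N, 0 < f.lam i := fun i => f.lam_pos hA i.2
  have hP : 0 < ∏ j : Fin N, f.lam j := Finset.prod_pos fun i _ => hpos i
  set ρ : Fin N → ℝ := fun i => dC N / f.lam i with hρ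
  have hρ0 : ∀ i, 0 < ρ i := fun i => div_pos (by linarith) (hpos i)
  have hdet := rwt_det A ρ σ hρ0
  have hprod : ∏ i, ρ i = dC N ^ N / ∏ j : Fin N, f.lam j := by
    rw [hρ, Finset.prod_div_distrib]; simp
  by_contra hcon
  push Not at hcon
  have h1 : |(rwt A ρ σ).det| < 1 := by
    rw [hdet, hprod, div_mul_eq_mul_div, div_lt_one hP]; exact hcon
  have h0 : (rwt A ρ σ).det ≠ 0 := by
    rw [← abs_pos, hdet]
    exact mul_pos (Finset.prod_pos fun i _ => hρ0 i) (abs_pos.mpr hA)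
  obtain ⟨x, hx0, hx⟩ := mink1 _ h0 h1
  have hN : 0 < N := by
    rcases Nat.eq_zero_or_pos N with h | h
    · subst h; exact absurd (Subsingleton.elim x 0) hx0
    · exact h
  have hone : ∀ i, f.lam (i : Fin N) ≠ 0 := fun i => (hpos i).ne'
  obtain ⟨i, hi⟩ := hσ (fun i => (f.lam i)⁻¹) (fun i => inv_pos.mpr (hpos i))
    (fun i j h => inv_anti₀ (hpos i) (f.lam_mono (by exact_mod_cast h) j.2))
    (fun i j _ => by rw [inv_mul_cancel₀ (hone i), inv_mul_cancel₀ (hone j)]) ⟨0, hN⟩ x (by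
      change rc x ∉ f.S 0
      rw [f.S0, Submodule.mem_bot]; exact rc_ne hx0)
  rw [inv_mul_cancel₀ (hone _)] at hi
  have h2 := le_nF (rwt A ρ σ) x i
  rw [rwt_mulVec, abs_mul, abs_of_pos (hρ0 i), hρ] at h2
  have : dC N * ((f.lam i)⁻¹ * |A.mulVec (rc x) (σ i)|) = dC N / f.lam i * |A.mulVec (rc x) (σ i)| := by
    rw [div_eq_mul_inv]; ring
  linarith

end SST

end

section
open MvPolynomial Filter

namespace SST

lemma exps {N : ℕ} (u : ℕ → Fin N → ℝ) (C δ : ℝ) (hδ : 0 < δ) (hu : ∀ k i, u k i ≤ C)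
    (hs : ∀ k, ∑ i, u k i ≤ -δ) :
    ∃ c : Fin N → ℝ, ∑ i, c i < 0 ∧ ∃ φ : ℕ → ℕ, StrictMono φ ∧ ∀ k i, u (φ k) i ≤ c i := by
  wlog hC : 0 ≤ C generalizing C
  · exact this 0 (fun k i => (hu k i).trans (not_le.mp hC).le) le_rfl
  set K : ℝ := N * C + δ with hK
  have hK0 : 0 ≤ K := by positivity
  set v : ℕ → Fin N → ℝ := fun k i => max (u k i) (-K) with hv
  have hvC : ∀ k i, v k i ≤ C := fun k i => max_le (hu k i) (by linarith)
  have hvs : ∀ k, ∑ i, v k i ≤ -δ := by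
    intro k
    by_cases h : ∃ i, u k i ≤ -K
    · obtain ⟨i, hi⟩ := h
      rw [← Finset.add_sum_erase _ _ (Finset.mem_univ i)]
      have h1 : v k i = -K := max_eq_right hi
      have h2 : ∑ x ∈ Finset.univ.erase i, v k x ≤ N * C := by
        calc _ ≤ ∑ x ∈ Finset.univ.erase i, C := Finset.sum_le_sum fun x _ => hvC k x
          _ ≤ ∑ x : Fin N, C := Finset.sum_le_sum_of_subset_of_nonneg (Finset.erase_subset _ _) fun _ _ _ => hC
          _ = _ := by simp
      rw [h1]; linarith
    · push Not at h
      rw [Finset.sum_congr rfl fun i _ => max_eq_left (h i).le]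
      exact hs k
  obtain ⟨a, -, φ, hφ, hlim⟩ := (isCompact_Icc (a := fun _ : Fin N => -K) (b := fun _ => C)).tendsto_subseq
    (x := v) (fun k => ⟨fun i => le_max_right _ _, fun i => hvC k i⟩)
  have hlim' : ∀ i, Tendsto (fun k => v (φ k) i) atTop (nhds (a i)) := fun i => (tendsto_pi_nhds.mp hlim) i
  have hsum : ∑ i, a i ≤ -δ :=
    le_of_tendsto' (tendsto_finsetSum _ fun i _ => hlim' i) fun k => hvs (φ k)
  have hN0 : (0 : ℝ) ≤ N := Nat.cast_nonneg N
  set e : ℝ := δ / (N + 1) with he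
  have he0 : 0 < e := by positivity
  have hev : ∀ᶠ k in atTop, ∀ i, v (φ k) i < a i + e :=
    eventually_all.mpr fun i => (hlim' i).eventually_lt_const (by linarith)
  obtain ⟨k1, hk1⟩ := eventually_atTop.mp hev
  refine ⟨fun i => a i + e, ?_, fun k => φ (k + k1), fun x y h => hφ (by omega), fun k i => ?_⟩
  · rw [Finset.sum_add_distrib]
    have : (N : ℝ) * e < δ := by
      rw [he, mul_div_assoc', div_lt_iff₀ (by positivity)]; nlinarith
    simp; linarith
  · exact (le_max_left _ _).trans (hk1 (k + k1) (by omega) i).le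

lemma prod_cancel {N : ℕ} (a b : Fin N → ℝ) (D E : ℝ) (ha : ∀ i, 0 < a i) (hb : ∀ i, 0 < b i) (hD : 1 ≤ D)
    (hE : 0 ≤ E) (hab : ∀ i, b i ≤ D * a i) (hp : ∏ i, a i ≤ E * ∏ i, b i) (j : Fin N) :
    a j ≤ E * D ^ N * b j := by
  rw [← Finset.mul_prod_erase _ _ (Finset.mem_univ j), ← Finset.mul_prod_erase _ b (Finset.mem_univ j)] at hp
  have hP : 0 < ∏ i ∈ Finset.univ.erase j, a i := Finset.prod_pos fun i _ => ha i
  have h1 : ∏ i ∈ Finset.univ.erase j, b i ≤ D ^ N * ∏ i ∈ Finset.univ.erase j, a i := by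
    calc _ ≤ ∏ i ∈ Finset.univ.erase j, D * a i := Finset.prod_le_prod (fun i _ => (hb i).le) fun i _ => hab i
      _ = D ^ (Finset.univ.erase j).card * ∏ i ∈ Finset.univ.erase j, a i := by
          rw [Finset.prod_mul_distrib, Finset.prod_const]
      _ ≤ _ := by
          refine mul_le_mul_of_nonneg_right (pow_le_pow_right₀ hD ?_) hP.le
          exact (Finset.card_le_univ _).trans (by simp)
  refine le_of_mul_le_mul_right ?_ hP
  calc _ ≤ _ := hp
    _ ≤ E * (b j * (D ^ N * ∏ i ∈ Finset.univ.erase j, a i)) :=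
        mul_le_mul_of_nonneg_left (mul_le_mul_of_nonneg_left h1 (hb j).le) hE
    _ = _ := by ring

/-- constant -/
noncomputable def eC (N : ℕ) : ℝ := dC N ^ N * N.factorial * dC N ^ N

lemma eC_pos (N : ℕ) : 0 < eC N := by
  have := dC_ge N
  have : 0 < dC N := by linarith
  rw [eC]; positivity

lemma gt_one {n : ℕ} (hn : 1 ≤ n) (A : Matrix (Fin (n + 1)) (Fin (n + 1)) ℝ) (hA : A.det ≠ 0) (f : Flag A)
    (hgap : dC (n + 1) * eC (n + 1) * f.lam (n - 1) < f.lam n) :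
    ∃ g' : Fin n → Fin (n + 1) → ℤ, LinearIndependent ℝ (fun j => rc (g' j)) ∧ (∀ j, rc (g' j) ∈ f.S n) ∧
      ∃ σ : Equiv.Perm (Fin (n + 1)), ∀ i j,
        |A.mulVec (rc (g' j)) (σ i)| ≤ eC (n + 1) * f.lam (min (i : ℕ) (n - 1)) := by
  obtain ⟨σ, hσ⟩ := f.dav hA
  have hpos : ∀ j, j < n + 1 → 0 < f.lam j := fun j hj => f.lam_pos hA hj
  have hl0 := hpos (n - 1) (by omega)
  have hD := dC_ge (n + 1)
  have hE := eC_pos (n + 1)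
  set ρ : Fin (n + 1) → ℝ := fun i => f.lam (n - 1) / f.lam (min (i : ℕ) (n - 1)) with hρ
  have hmp : ∀ i : Fin (n + 1), 0 < f.lam (min (i : ℕ) (n - 1)) := fun i => hpos _ (by omega)
  have hρ0 : ∀ i, 0 < ρ i := fun i => div_pos hl0 (hmp i)
  have hanti : Antitone ρ := by
    intro i j hij
    have hij' : (i : ℕ) ≤ j := hij
    exact div_le_div_of_nonneg_left hl0.le (hmp i) (f.lam_mono (by omega) (by omega))
  have hlt : ∀ i : Fin (n + 1), (i : ℕ) < n → ρ i * f.lam i = f.lam (n - 1) := by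
    intro i hi
    have e : min (i : ℕ) (n - 1) = i := by omega
    rw [hρ]; simp only [e]
    exact div_mul_cancel₀ _ (hpos i i.2).ne'
  have hlast : ρ (Fin.last n) * f.lam n = f.lam n := by
    have e : min n (n - 1) = n - 1 := by omega
    rw [hρ]; simp only [Fin.val_last, e]
    rw [div_self hl0.ne', one_mul]
  have hmono : ∀ i j : Fin (n + 1), i ≤ j → ρ i * f.lam i ≤ ρ j * f.lam j := by
    intro i j hij
    have hij' : (i : ℕ) ≤ j := hij
    rcases Nat.lt_or_ge (j : ℕ) n with h | h
    · rw [hlt i (by omega), hlt j h]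
    · have hj : j = Fin.last n := by ext; simp; omega
      rcases Nat.lt_or_ge (i : ℕ) n with h' | h'
      · rw [hlt i h', hj, Fin.val_last, hlast]
        exact f.lam_mono (by omega) (by omega)
      · have hi : i = j := by ext; omega
        rw [hi]
  have hlow := hσ ρ hρ0 hanti hmono
  set A' := rwt A ρ σ with hA'
  have hdet' : |A'.det| = (∏ i, ρ i) * |A.det| := rwt_det A ρ σ hρ0
  have hA'0 : A'.det ≠ 0 := by
    rw [← abs_pos, hdet']
    exact mul_pos (Finset.prod_pos fun i _ => hρ0 i) (abs_pos.mpr hA)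
  obtain ⟨f'⟩ := exists_flag A' hA'0
  have hlow' : ∀ (j : Fin (n + 1)) (x : Fin (n + 1) → ℤ), rc x ∉ f.S j → ρ j * f.lam j ≤ dC (n + 1) * nF A' x := by
    intro j x hx
    obtain ⟨i, hi⟩ := hlow j x hx
    refine hi.trans (mul_le_mul_of_nonneg_left ?_ (by linarith))
    have := le_nF A' x i
    rwa [hA', rwt_mulVec, abs_mul, abs_of_pos (hρ0 i)] at this
  have hlam' : ∀ j : Fin (n + 1), ρ j * f.lam j ≤ dC (n + 1) * f'.lam j := by
    intro j
    obtain ⟨i, hi⟩ := f.exists_notMem (j := j) (ι := Fin (j + 1)) (by simp) _ (f'.linInd (j := j + 1) (by omega))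
    refine (hlow' j _ hi).trans (mul_le_mul_of_nonneg_left ?_ (by linarith))
    exact f'.lam_mono (by omega) j.2
  have hup : ∀ j : Fin (n + 1), f'.lam j ≤ eC (n + 1) * (ρ j * f.lam j) := by
    refine prod_cancel (fun j : Fin (n + 1) => f'.lam j) (fun j => ρ j * f.lam j) (dC (n + 1))
      (dC (n + 1) ^ (n + 1) * (n + 1).factorial) (fun j => f'.lam_pos hA'0 j.2)
      (fun j => mul_pos (hρ0 j) (hpos j j.2)) hD (by positivity) hlam' ?_
    refine (f'.mink2 hA'0).trans ?_
    rw [hdet', mul_assoc, Finset.prod_mul_distrib]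
    refine mul_le_mul_of_nonneg_left ?_ (by positivity)
    have h1 := mul_le_mul_of_nonneg_left f.det_le (Finset.prod_pos (s := Finset.univ) fun i _ => hρ0 i).le
    linarith
  have hn1 : f'.lam (n - 1) ≤ eC (n + 1) * f.lam (n - 1) := by
    have h := hup ⟨n - 1, by omega⟩
    rw [hlt ⟨n - 1, by omega⟩ (by change n - 1 < n; omega)] at h
    exact h
  have hup2 : ∀ j : Fin n, nF A' (f'.g j) ≤ eC (n + 1) * f.lam (n - 1) := fun j =>
    (f'.lam_mono (by omega) (by omega)).trans hn1
  refine ⟨fun j => f'.g j, f'.linInd (by omega), fun j => ?_, σ, fun i j => ?_⟩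
  · by_contra hcon
    have h1 := hlow' (Fin.last n) (f'.g j) hcon
    rw [Fin.val_last, hlast] at h1
    have h2 := mul_le_mul_of_nonneg_left (hup2 j) (by linarith : (0 : ℝ) ≤ dC (n + 1))
    linarith
  · have h1 := (le_nF A' (f'.g j) i).trans (hup2 j)
    rw [show A'.mulVec (rc (f'.g j)) i = _ from rwt_mulVec A ρ σ _ i, abs_mul, abs_of_pos (hρ0 i)] at h1
    have h2 : ρ i * |A.mulVec (rc (f'.g j)) (σ i)| ≤ ρ i * (eC (n + 1) * f.lam (min (i : ℕ) (n - 1))) := by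
      refine h1.trans (le_of_eq ?_)
      rw [hρ]
      have := (hmp i).ne'
      field_simp
    exact le_of_mul_le_mul_left h2 (hρ0 i)

end SST

end

section
open MvPolynomial Filter

namespace SST
variable {R : Type*} [CommRing R] [IsDomain R]

/-- scaled matrix -/
noncomputable def scM (hR : HR R) {N : ℕ} (L : Matrix (Fin N) (Fin N) R) (s : Fin N → ℝ) :
    Matrix (Fin N) (Fin N) ℝ := Matrix.of fun i j => s i * hR.φ (L i j)

lemma scM_mulVec (hR : HR R) {N : ℕ} (L : Matrix (Fin N) (Fin N) R) (s : Fin N → ℝ) (x : Fin N → ℤ) (i : Fin N) :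
    (scM hR L s).mulVec (rc x) i = s i * ∑ j, hR.φ (L i j) * (x j : ℝ) := by
  simp [scM, Matrix.mulVec, dotProduct, Finset.mul_sum, mul_assoc, rc]

lemma scM_det (hR : HR R) {N : ℕ} (L : Matrix (Fin N) (Fin N) R) (s : Fin N → ℝ) :
    (scM hR L s).det = (∏ i, s i) * hR.φ L.det := by
  have : scM hR L s = Matrix.of fun i j => s i * (L.map hR.φ) i j := rfl
  rw [this, Matrix.det_mul_column, RingHom.map_det]; rfl

lemma scM_det_ne (hR : HR R) {N : ℕ} (L : Matrix (Fin N) (Fin N) R) (hdet : L.det ≠ 0) (s : Fin N → ℝ)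
    (hs : ∀ i, 0 < s i) : (scM hR L s).det ≠ 0 := by
  rw [scM_det]
  refine mul_ne_zero (Finset.prod_pos fun i _ => hs i).ne' fun h => hdet (hR.inj ?_)
  rw [h, map_zero]

lemma scM_lam_le (hR : HR R) {N : ℕ} (L : Matrix (Fin N) (Fin N) R) :
    ∃ K : ℝ, 1 ≤ K ∧ ∀ (s : Fin N → ℝ) (B : ℝ), (∀ i, 0 < s i) → (∀ i, s i ≤ B) → ∀ f : Flag (scM hR L s),
      ∀ j < N, f.lam j ≤ K * B := by
  refine ⟨(∑ i, ∑ j, |hR.φ (L i j)|) + 1, ?_, fun s B hs hB f j hj => ?_⟩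
  · have : 0 ≤ ∑ i, ∑ j, |hR.φ (L i j)| := Finset.sum_nonneg fun _ _ => Finset.sum_nonneg fun _ _ => abs_nonneg _
    linarith
  · have hnt : f.S j ≠ ⊤ := by
      intro h
      have := f.finrank_le j
      rw [h, finrank_top] at this
      simp at this; omega
    obtain ⟨a, ha⟩ := exists_single_notMem _ hnt
    refine (f.mn j hj _ ha).trans ?_
    have hB0 : 0 ≤ B := (hs a).le.trans (hB a)
    have hS0 : 0 ≤ ∑ i, ∑ j, |hR.φ (L i j)| := Finset.sum_nonneg fun _ _ => Finset.sum_nonneg fun _ _ => abs_nonneg _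
    rw [nF_le_iff _ _ (by positivity)]
    intro i
    rw [scM_mulVec, abs_mul, abs_of_pos (hs i), mul_comm]
    refine mul_le_mul ?_ (hB i) (hs i).le (by linarith)
    have e : ∑ j, hR.φ (L i j) * (((Pi.single a 1 : Fin N → ℤ) j : ℤ) : ℝ) = hR.φ (L i a) := by
      rw [Finset.sum_eq_single a]
      · simp
      · intro b _ hb; simp [hb]
      · simp
    rw [e]
    have b1 : |hR.φ (L i a)| ≤ ∑ j, |hR.φ (L i j)| :=
      Finset.single_le_sum (f := fun j => |hR.φ (L i j)|) (fun _ _ => abs_nonneg _) (Finset.mem_univ a)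
    have b2 : ∑ j, |hR.φ (L i j)| ≤ ∑ i, ∑ j, |hR.φ (L i j)| :=
      Finset.single_le_sum (f := fun i => ∑ j, |hR.φ (L i j)|)
        (fun _ _ => Finset.sum_nonneg fun _ _ => abs_nonneg _) (Finset.mem_univ i)
    linarith

/-- product estimate -/
lemma gt_prod (hR : HR R) {n : ℕ} (hn : 1 ≤ n) (L : Matrix (Fin (n + 1)) (Fin (n + 1)) R) (hdet : L.det ≠ 0)
    (s : Fin (n + 1) → ℝ) (hs : ∀ i, 0 < s i) (f : Flag (scM hR L s)) (σ : Equiv.Perm (Fin (n + 1))) :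
    (∏ i, (eC (n + 1) * f.lam (min ((σ.symm i : Fin (n + 1)) : ℕ) (n - 1)) / s i)) * f.lam n ≤
      (eC (n + 1) ^ (n + 1) * dC (n + 1) ^ (n + 1) * |hR.φ L.det|) * f.lam (n - 1) := by
  have hA := scM_det_ne hR L hdet s hs
  have hS : 0 < ∏ i, s i := Finset.prod_pos fun i _ => hs i
  have h1 := f.mink2 hA
  rw [scM_det, abs_mul, abs_of_pos hS] at h1
  have h2 : ∏ i : Fin (n + 1), f.lam (min ((σ.symm i : Fin (n + 1)) : ℕ) (n - 1)) =
      (∏ i : Fin n, f.lam i) * f.lam (n - 1) := by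
    rw [Equiv.prod_comp σ.symm (fun i : Fin (n + 1) => f.lam (min (i : ℕ) (n - 1))), Fin.prod_univ_castSucc]
    congr 1
    · refine Finset.prod_congr rfl fun i _ => ?_
      congr 1
      simp; omega
    · congr 1
      simp
  rw [Fin.prod_univ_castSucc] at h1
  simp only [Fin.val_castSucc, Fin.val_last] at h1
  rw [Finset.prod_div_distrib, Finset.prod_mul_distrib, h2, div_mul_eq_mul_div, div_le_iff₀ hS]
  simp only [Finset.prod_const, Finset.card_univ, Fintype.card_fin]
  have hE := eC_pos (n + 1)
  have hl := f.lam_pos hA (j := n - 1) (by omega)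
  have h3 := mul_le_mul_of_nonneg_left h1 (by positivity : 0 ≤ eC (n + 1) ^ (n + 1) * f.lam (n - 1))
  linarith

theorem gt_thm (hR : HR R) {n : ℕ} (hn : 1 ≤ n) (L : Matrix (Fin (n + 1)) (Fin (n + 1)) R) (hdet : L.det ≠ 0)
    (ℓ : ℕ → ℝ) (hℓ : Tendsto ℓ atTop atTop) (s : ℕ → Fin (n + 1) → ℝ) (C : ℝ)
    (hs1 : ∀ k i, Real.exp (-(C * ℓ k)) ≤ s k i) (hs2 : ∀ k i, s k i ≤ Real.exp (C * ℓ k))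
    (f : ∀ k, Flag (scM hR L (s k))) (δ : ℝ) (hδ : 0 < δ)
    (hgap : ∀ k, (f k).lam (n - 1) ≤ Real.exp (-(δ * ℓ k)) * (f k).lam n) :
    ∃ m : Fin (n + 1) → ℤ, m ≠ 0 ∧ ∃ᶠ k in atTop, ∀ x ∈ (f k).S n, ∑ i, (m i : ℝ) * x i = 0 := by
  have hs0 : ∀ k i, 0 < s k i := fun k i => (Real.exp_pos _).trans_le (hs1 k i)
  have hA : ∀ k, (scM hR L (s k)).det ≠ 0 := fun k => scM_det_ne hR L hdet _ (hs0 k)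
  have hl : ∀ k j, j < n + 1 → 0 < (f k).lam j := fun k j hj => (f k).lam_pos (hA k) hj
  obtain ⟨K, hK1, hK⟩ := scM_lam_le hR L
  have hE := eC_pos (n + 1)
  have hD : 0 < dC (n + 1) := by linarith [dC_ge (n + 1)]
  set Q : ℝ := eC (n + 1) ^ (n + 1) * dC (n + 1) ^ (n + 1) * |hR.φ L.det| with hQ
  have hexp : ∀ a : ℝ, 0 < a → Tendsto (fun k => Real.exp (a * ℓ k)) atTop atTop := fun a ha =>
    Real.tendsto_exp_atTop.comp (hℓ.const_mul_atTop ha)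
  have hev : ∀ᶠ k in atTop, 1 ≤ ℓ k ∧ Q ≤ Real.exp (δ / 2 * ℓ k) ∧
      dC (n + 1) * eC (n + 1) < Real.exp (δ * ℓ k) := by
    filter_upwards [hℓ.eventually_ge_atTop 1, (hexp (δ / 2) (by linarith)).eventually_ge_atTop Q,
      (hexp δ hδ).eventually_gt_atTop (dC (n + 1) * eC (n + 1))] with k h1 h2 h3 using ⟨h1, h2, h3⟩
  obtain ⟨k1, hk1⟩ := eventually_atTop.mp hev
  have hone : ∀ k, ∃ g' : Fin n → Fin (n + 1) → ℤ, LinearIndependent ℝ (fun j => rc (g' j)) ∧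
      (∀ j, rc (g' j) ∈ (f (k + k1)).S n) ∧
      ∃ σ : Equiv.Perm (Fin (n + 1)), ∀ i j,
        |(scM hR L (s (k + k1))).mulVec (rc (g' j)) (σ i)| ≤ eC (n + 1) * (f (k + k1)).lam (min (i : ℕ) (n - 1)) := by
    intro k
    obtain ⟨h1, h2, h3⟩ := hk1 (k + k1) (by omega)
    refine gt_one hn _ (hA _) (f (k + k1)) ?_
    have h4 := hgap (k + k1)
    have h5 := hl (k + k1) n (by omega)
    calc _ ≤ dC (n + 1) * eC (n + 1) * (Real.exp (-(δ * ℓ (k + k1))) * (f (k + k1)).lam n) :=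
          mul_le_mul_of_nonneg_left h4 (by positivity)
      _ < Real.exp (δ * ℓ (k + k1)) * (Real.exp (-(δ * ℓ (k + k1))) * (f (k + k1)).lam n) :=
          mul_lt_mul_of_pos_right h3 (mul_pos (Real.exp_pos _) h5)
      _ = _ := by rw [← mul_assoc, ← Real.exp_add]; simp
  choose g' hli hmem σ hσ using hone
  set B : ℕ → Fin (n + 1) → ℝ := fun k i =>
    eC (n + 1) * (f (k + k1)).lam (min (((σ k).symm i : Fin (n + 1)) : ℕ) (n - 1)) / s (k + k1) i with hB
  have hB0 : ∀ k i, 0 < B k i := fun k i => div_pos (mul_pos hE (hl _ _ (by omega))) (hs0 _ _)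
  have hbound : ∀ k j i, |∑ i', hR.φ (L i i') * (g' k j i' : ℝ)| ≤ B k i := by
    intro k j i
    have h := hσ k ((σ k).symm i) j
    rw [Equiv.apply_symm_apply, scM_mulVec, abs_mul, abs_of_pos (hs0 _ _)] at h
    rw [hB, le_div_iff₀ (hs0 _ _), mul_comm]; exact h
  set u : ℕ → Fin (n + 1) → ℝ := fun k i => Real.log (B k i) / ℓ (k + k1) with hu
  have hlpos : ∀ k, 1 ≤ ℓ (k + k1) := fun k => (hk1 (k + k1) (by omega)).1
  have huB : ∀ k i, Real.exp (u k i * ℓ (k + k1)) = B k i := by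
    intro k i
    rw [hu]
    simp only
    rw [div_mul_cancel₀ _ (by linarith [hlpos k]), Real.exp_log (hB0 k i)]
  have hu1 : ∀ k i, u k i ≤ |Real.log (eC (n + 1) * K)| + 2 * C := by
    intro k i
    rw [hu]; simp only
    have h1 := hlpos k
    rw [div_le_iff₀ (by linarith)]
    have hb : B k i ≤ (eC (n + 1) * K) * Real.exp (2 * C * ℓ (k + k1)) := by
      rw [hB]; simp only
      rw [div_le_iff₀ (hs0 _ _)]
      have h2 := hK (s (k + k1)) _ (hs0 _) (hs2 _) (f (k + k1)) (min (((σ k).symm i : Fin (n + 1)) : ℕ) (n - 1)) (by omega)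
      calc _ ≤ eC (n + 1) * (K * Real.exp (C * ℓ (k + k1))) := mul_le_mul_of_nonneg_left h2 hE.le
        _ = eC (n + 1) * K * Real.exp (2 * C * ℓ (k + k1)) * Real.exp (-(C * ℓ (k + k1))) := by
            rw [mul_assoc (eC (n + 1) * K), ← Real.exp_add, mul_assoc]; congr 3; ring
        _ ≤ _ := mul_le_mul_of_nonneg_left (hs1 _ _) (by positivity)
    have h3 := Real.log_le_log (hB0 k i) hb
    rw [Real.log_mul (by positivity) (Real.exp_pos _).ne', Real.log_exp] at h3
    have h4 := le_abs_self (Real.log (eC (n + 1) * K))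
    have h5 := mul_le_mul_of_nonneg_left h1 (abs_nonneg (Real.log (eC (n + 1) * K)))
    linarith
  have hu2 : ∀ k, ∑ i, u k i ≤ -(δ / 2) := by
    intro k
    obtain ⟨h1, h2, h3⟩ := hk1 (k + k1) (by omega)
    rw [hu]; simp only
    rw [← Finset.sum_div, div_le_iff₀ (by linarith), ← Real.log_prod (fun i _ => (hB0 k i).ne')]
    have hp := gt_prod hR hn L hdet (s (k + k1)) (hs0 _) (f (k + k1)) (σ k)
    rw [← hQ] at hp
    have h5 := hl (k + k1) n (by omega)
    have hQ0 : 0 ≤ Q := by positivity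
    have hP : ∏ i, B k i ≤ Real.exp (-(δ / 2) * ℓ (k + k1)) := by
      refine le_of_mul_le_mul_right ?_ h5
      calc _ ≤ _ := hp
        _ ≤ Q * (Real.exp (-(δ * ℓ (k + k1))) * (f (k + k1)).lam n) := mul_le_mul_of_nonneg_left (hgap _) hQ0
        _ ≤ Real.exp (δ / 2 * ℓ (k + k1)) * (Real.exp (-(δ * ℓ (k + k1))) * (f (k + k1)).lam n) :=
            mul_le_mul_of_nonneg_right h2 (mul_pos (Real.exp_pos _) h5).le
        _ = _ := by rw [← mul_assoc, ← Real.exp_add]; congr 2; ring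
    calc _ ≤ Real.log (Real.exp (-(δ / 2) * ℓ (k + k1))) :=
          Real.log_le_log (Finset.prod_pos fun i _ => hB0 k i) hP
      _ = _ := Real.log_exp _
  obtain ⟨c, hc, φ, hφ, hφc⟩ := exps u _ (δ / 2) (by linarith) hu1 hu2
  have htend : Tendsto (fun k => φ k + k1) atTop atTop := tendsto_atTop_mono (fun k => Nat.le_add_right _ _) hφ.tendsto_atTop
  obtain ⟨m, hm0, hm⟩ := hyper_thm hR hn L hdet c hc (fun k => ℓ (φ k + k1)) (hℓ.comp htend)
    (fun k => g' (φ k)) (fun k => hli (φ k)) (fun k j i => by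
      refine (hbound (φ k) j i).trans ?_
      rw [← huB]
      exact Real.exp_le_exp.mpr (mul_le_mul_of_nonneg_right (hφc k i) (by linarith [hlpos (φ k)])))
  refine ⟨m, hm0, htend.frequently (hm.mono fun k hk => ?_)⟩
  have hspan : (f (φ k + k1)).S n = Submodule.span ℝ (Set.range fun j => rc (g' (φ k) j)) := by
    symm
    refine Submodule.eq_of_le_of_finrank_eq ?_ ?_
    · rw [Submodule.span_le]; rintro _ ⟨j, rfl⟩; exact hmem (φ k) j
    · rw [finrank_span_eq_card (hli (φ k)), (f _).finrank_eq (by omega)]; simp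
  intro x hx
  rw [hspan] at hx
  induction hx using Submodule.span_induction with
  | mem x h =>
    obtain ⟨j, rfl⟩ := h
    have := hk j
    simp only [rc]
    exact_mod_cast this
  | zero => simp
  | add x y _ _ hx hy => simp only [Pi.add_apply, mul_add, Finset.sum_add_distrib, hx, hy, add_zero]
  | smul a x _ hx =>
    have : ∑ i, (m i : ℝ) * (a • x) i = a * ∑ i, (m i : ℝ) * x i := by
      rw [Finset.mul_sum]; refine Finset.sum_congr rfl fun i _ => ?_
      simp; ring
    rw [this, hx, mul_zero]

end SST

end

section
open MvPolynomial Filter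

namespace SST

abbrev PS (n p : ℕ) := Set.powersetCard (Fin n) p

noncomputable def emb {n p : ℕ} (I : PS n p) : Fin p → Fin n := Set.powersetCard.ofFinEmbEquiv.symm I

/-- compound matrix -/
noncomputable def cmp {S : Type*} [CommRing S] {n : ℕ} (p : ℕ) (A : Matrix (Fin n) (Fin n) S) :
    Matrix (PS n p) (PS n p) S := Matrix.of fun I J => (A.submatrix (emb I) (emb J)).det

noncomputable def wdg {S : Type*} [CommRing S] {n p : ℕ} (v : Fin p → Fin n → S) (I : PS n p) : S :=
  (Matrix.of fun a b => v a (emb I b)).det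

section
variable {S : Type*} [CommRing S] {n p : ℕ}

lemma wdg_repr (v : Fin p → Fin n → S) (I : PS n p) :
    exteriorPower.ιMultiDual S p (Pi.basisFun S (Fin n)) I (exteriorPower.ιMulti S p v) = wdg v I := by
  rw [exteriorPower.ιMultiDual_apply_ιMulti]
  rfl

lemma wdg_col (A : Matrix (Fin n) (Fin n) S) (I J : PS n p) :
    wdg (fun b i => A i (emb J b)) I = cmp p A I J := by
  rw [wdg, cmp, Matrix.of_apply, ← Matrix.det_transpose]
  rfl

lemma wdg_row (A : Matrix (Fin n) (Fin n) S) (I J : PS n p) :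
    wdg (fun b i => A (emb J b) i) I = cmp p A J I := rfl

lemma cmp_mulVec (A : Matrix (Fin n) (Fin n) S) (v : Fin p → Fin n → S) :
    (cmp p A).mulVec (wdg v) = wdg (fun a => A.mulVec (v a)) := by
  ext I
  rw [← wdg_repr]
  have e : exteriorPower.ιMulti S p (fun a => A.mulVec (v a)) =
      exteriorPower.map p (Matrix.toLin' A) (exteriorPower.ιMulti S p v) := by
    rw [exteriorPower.map_apply_ιMulti]; rfl
  rw [e]
  conv_rhs => rw [← ((Pi.basisFun S (Fin n)).exteriorPower p).sum_repr (exteriorPower.ιMulti S p v)]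
  simp only [map_sum, map_smul, exteriorPower.basis_repr_apply, wdg_repr]
  refine Finset.sum_congr rfl fun J _ => ?_
  rw [exteriorPower.basis_apply, exteriorPower.ιMulti_family, exteriorPower.map_apply_ιMulti, wdg_repr, smul_eq_mul, mul_comm]
  change wdg v J * cmp p A I J = _
  rw [← wdg_col]
  congr 2
  ext b i
  simp [emb, Matrix.toLin'_apply]

lemma cmp_mul (A B : Matrix (Fin n) (Fin n) S) : cmp p (A * B) = cmp p A * cmp p B := by
  ext I J
  have := congrFun (cmp_mulVec A (fun b i => B i (emb J b))) I
  have e : (fun a => A.mulVec fun i => B i (emb J a)) = fun b i => (A * B) i (emb J b) := by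
    ext b i; rfl
  rw [e, wdg_col] at this
  rw [← this, Matrix.mul_apply]
  simp only [Matrix.mulVec, dotProduct, wdg_col]

lemma cmp_one : cmp p (1 : Matrix (Fin n) (Fin n) S) = 1 := by
  ext I J
  rw [← wdg_col, ← wdg_repr]
  have e : (fun b i => (1 : Matrix (Fin n) (Fin n) S) i (emb J b)) = (Pi.basisFun S (Fin n)) ∘ emb J := by
    ext b i
    simp [Matrix.one_apply, Pi.single_apply]
  rw [e]
  change exteriorPower.ιMultiDual S p (Pi.basisFun S (Fin n)) I (exteriorPower.ιMulti_family S p _ J) = _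
  by_cases h : I = J
  · subst h; rw [exteriorPower.ιMultiDual_apply_diag]; simp
  · rw [exteriorPower.ιMultiDual_apply_nondiag _ _ _ _ _ h, Matrix.one_apply_ne h]

lemma cmp_smul (c : S) (A : Matrix (Fin n) (Fin n) S) : cmp p (c • A) = c ^ p • cmp p A := by
  ext I J
  simp only [cmp, Matrix.of_apply, Matrix.smul_apply, smul_eq_mul]
  have : (c • A).submatrix (emb I) (emb J) = c • (A.submatrix (emb I) (emb J)) := rfl
  rw [this, Matrix.det_smul, Fintype.card_fin]

lemma cmp_det_ne [IsDomain S] (A : Matrix (Fin n) (Fin n) S) (h : A.det ≠ 0) : (cmp p A).det ≠ 0 := by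
  have e := congrArg Matrix.det (cmp_mul (p := p) A A.adjugate)
  rw [Matrix.mul_adjugate, cmp_smul, cmp_one, Matrix.det_smul, Matrix.det_one, mul_one, Matrix.det_mul] at e
  intro h0
  rw [h0, zero_mul] at e
  exact pow_ne_zero _ (pow_ne_zero _ h) e

lemma cmp_map {T : Type*} [CommRing T] (φ : S →+* T) (A : Matrix (Fin n) (Fin n) S) (I J : PS n p) :
    cmp p (A.map φ) I J = φ (cmp p A I J) := by
  rw [cmp, cmp, Matrix.of_apply, Matrix.of_apply, RingHom.map_det]
  rfl

lemma wdg_map {T : Type*} [CommRing T] (φ : S →+* T) (v : Fin p → Fin n → S) (I : PS n p) :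
    wdg (fun a i => φ (v a i)) I = φ (wdg v I) := by
  rw [wdg, wdg, RingHom.map_det]
  rfl

lemma cmp_rowscale (s : Fin n → S) (A : Matrix (Fin n) (Fin n) S) (I J : PS n p) :
    cmp p (Matrix.of fun i j => s i * A i j) I J = (∏ a, s (emb I a)) * cmp p A I J := by
  rw [cmp, Matrix.of_apply]
  exact Matrix.det_mul_column (fun a => s (emb I a)) (A.submatrix (emb I) (emb J))

end

lemma emb_inj {n p : ℕ} (I : PS n p) : Function.Injective (emb I) :=
  (Set.powersetCard.ofFinEmbEquiv.symm I).injective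

lemma emb_mem {n p : ℕ} (I : PS n p) (i : Fin n) : (∃ a, emb I a = i) ↔ i ∈ I.val :=
  Set.powersetCard.mem_range_ofFinEmbEquiv_symm_iff_mem I i

lemma prod_emb {n p : ℕ} (I : PS n p) (s : Fin n → ℝ) : ∏ a, s (emb I a) = ∏ i ∈ I.val, s i := by
  have : I.val = Finset.univ.map ⟨emb I, emb_inj I⟩ := by
    ext i; simp [← emb_mem]
  rw [this, Finset.prod_map]; rfl

lemma prodPS (n p : ℕ) (hp : 1 ≤ p) : ∃ e : ℕ, ∀ s : Fin n → ℝ, ∏ I : PS n p, ∏ a, s (emb I a) = (∏ i, s i) ^ e := by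
  classical
  refine ⟨(n - 1).choose (p - 1), fun s => ?_⟩
  simp only [prod_emb]
  have e1 : ∀ I : PS n p, ∏ i ∈ I.val, s i = ∏ i, if i ∈ I.val then s i else 1 := by
    intro I; simp
  simp only [e1]
  rw [Finset.prod_comm, ← Finset.prod_pow]
  refine Finset.prod_congr rfl fun i _ => ?_
  rw [Finset.prod_ite, Finset.prod_const_one, mul_one, Finset.prod_const]
  congr 1
  have h := Finset.card_filter_powersetCard_subset {i} (Finset.univ : Finset (Fin n)) p (by simp) (by simpa using hp)
  simp only [Finset.card_univ, Fintype.card_fin, Finset.card_singleton, Finset.singleton_subset_iff] at h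
  rw [← h]
  refine Finset.card_bij (fun I _ => I.val) ?_ ?_ ?_
  · intro I hI
    simp only [Finset.mem_filter, Finset.mem_univ, true_and] at hI
    simp only [Finset.mem_filter, Finset.mem_powersetCard, Finset.subset_univ, true_and]
    exact ⟨I.prop, hI⟩
  · intro I _ J _ h; exact Subtype.ext h
  · intro I hI
    simp only [Finset.mem_filter, Finset.mem_powersetCard, Finset.subset_univ, true_and] at hI
    exact ⟨⟨I, hI.1⟩, by simpa using hI.2, rfl⟩
end SST

end

section
open MvPolynomial Filter

namespace SST

section
variable {n p N : ℕ} (ε : PS n p ≃ Fin N)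

noncomputable def cmpF (A : Matrix (Fin n) (Fin n) ℝ) : Matrix (Fin N) (Fin N) ℝ :=
  (cmp p A).submatrix ε.symm ε.symm

noncomputable def wz (v : Fin p → Fin n → ℤ) : Fin N → ℤ := fun i => wdg v (ε.symm i)

lemma cmpF_mulVec (A : Matrix (Fin n) (Fin n) ℝ) (v : Fin p → Fin n → ℤ) (i : Fin N) :
    (cmpF ε A).mulVec (rc (wz ε v)) i = wdg (fun a => A.mulVec (rc (v a))) (ε.symm i) := by
  rw [← cmp_mulVec]
  simp only [cmpF, Matrix.mulVec, dotProduct, Matrix.submatrix_apply]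
  rw [← Equiv.sum_comp ε.symm]
  refine Finset.sum_congr rfl fun j _ => ?_
  congr 1
  exact (wdg_map (Int.castRingHom ℝ) v (ε.symm j)).symm

lemma nF_wz (A : Matrix (Fin n) (Fin n) ℝ) (v : Fin p → Fin n → ℤ) :
    nF (cmpF ε A) (wz ε v) ≤ p.factorial * ∏ a, nF A (v a) := by
  have h0 : 0 ≤ ∏ a, nF A (v a) := Finset.prod_nonneg fun a _ => nF_nonneg _ _
  rw [nF_le_iff _ _ (by positivity)]
  intro i
  rw [cmpF_mulVec, wdg]
  refine (det_bound _ (fun a => nF A (v a)) (fun _ => 1) ?_).trans ?_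
  · intro a b
    rw [mul_one]
    exact le_nF _ _ _
  · simp

lemma cmpF_det_ne (A : Matrix (Fin n) (Fin n) ℝ) (hA : A.det ≠ 0) : (cmpF ε A).det ≠ 0 := by
  rw [cmpF, Matrix.det_submatrix_equiv_self]
  exact cmp_det_ne A hA

lemma flag_det_ne {A : Matrix (Fin N) (Fin N) ℝ} (f : Flag A) :
    (Matrix.of fun i : Fin N => rc (f.g i)).det ≠ 0 := by
  have := f.linInd le_rfl
  have h2 := (Matrix.linearIndependent_rows_iff_isUnit (A := Matrix.of fun i : Fin N => rc (f.g i))).1 this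
  rw [Matrix.isUnit_iff_isUnit_det] at h2
  exact h2.ne_zero

/-- the integer vectors -/
noncomputable def gJ {A : Matrix (Fin n) (Fin n) ℝ} (f : Flag A) (J : PS n p) : Fin N → ℤ :=
  wz ε (fun a => f.g (emb J a))

noncomputable def lJ {A : Matrix (Fin n) (Fin n) ℝ} (f : Flag A) (J : PS n p) : ℝ :=
  ∏ a, f.lam (emb J a)

lemma lJ_pos {A : Matrix (Fin n) (Fin n) ℝ} (hA : A.det ≠ 0) (f : Flag A) (J : PS n p) : 0 < lJ f J :=
  Finset.prod_pos fun a _ => f.lam_pos hA (emb J a).2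

lemma nF_gJ {A : Matrix (Fin n) (Fin n) ℝ} (f : Flag A) (J : PS n p) :
    nF (cmpF ε A) (gJ ε f J) ≤ p.factorial * lJ f J := nF_wz ε A _

lemma gJ_det_ne {A : Matrix (Fin n) (Fin n) ℝ} (f : Flag A) :
    (Matrix.of fun i : Fin N => rc (gJ ε f (ε.symm i))).det ≠ 0 := by
  have e : (Matrix.of fun i : Fin N => rc (gJ ε f (ε.symm i))) =
      (cmp p (Matrix.of fun i : Fin n => rc (f.g i))).submatrix ε.symm ε.symm := by
    ext i j
    simp only [Matrix.of_apply, Matrix.submatrix_apply]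
    rw [← wdg_row]
    exact (wdg_map (Int.castRingHom ℝ) _ (ε.symm j)).symm
  rw [e, Matrix.det_submatrix_equiv_self]
  exact cmp_det_ne _ (flag_det_ne f)

/-- lower bound for the last minimum -/
lemma lam_lower {A : Matrix (Fin n) (Fin n) ℝ} (hA : A.det ≠ 0) (f : Flag A) (hN : 1 ≤ N) (h : Flag (cmpF ε A))
    (J0 : PS n p) :
    |(cmpF ε A).det| * lJ f J0 ≤ N.factorial * ((p.factorial : ℝ) ^ N * (h.lam (N - 1) * ∏ J : PS n p, lJ f J)) := by
  classical
  set B : Matrix (Fin N) (Fin N) ℝ := Matrix.of fun i : Fin N => rc (gJ ε f (ε.symm i)) with hB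
  have hBd := gJ_det_ne ε f
  rw [← hB] at hBd
  set i0 := ε J0
  have hex : ∃ j, j < N ∧ (B.updateRow i0 (rc (h.g j))).det ≠ 0 := by
    by_contra hcon
    push Not at hcon
    have h1 : ∀ x ∈ h.S N, (B.updateRow i0 x).det = 0 := by
      intro x hx
      rw [h.span_eq] at hx
      induction hx using Submodule.span_induction with
      | mem x hx => obtain ⟨i, rfl⟩ := hx; exact hcon i i.2
      | zero => exact Matrix.det_eq_zero_of_row_eq_zero i0 (by simp)
      | add x y _ _ hx hy => rw [Matrix.det_updateRow_add, hx, hy, add_zero]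
      | smul c x _ hx => rw [Matrix.det_updateRow_smul, hx, mul_zero]
    have h2 := h1 (B i0) (by rw [h.top]; trivial)
    rw [Matrix.updateRow_eq_self] at h2
    exact hBd h2
  obtain ⟨j, hj, hd⟩ := hex
  set B1 := B.updateRow i0 (rc (h.g j)) with hB1
  have hintg : 1 ≤ |B1.det| := by
    set Z : Matrix (Fin N) (Fin N) ℤ :=
      (Matrix.of fun i : Fin N => gJ ε f (ε.symm i)).updateRow i0 (h.g j) with hZ
    have e : B1 = Z.map (Int.castRingHom ℝ) := by
      ext a b
      by_cases hab : a = i0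
      · subst hab; simp [hB1, hZ, rc]
      · simp [hB1, hZ, Matrix.updateRow_ne hab, hB, rc]
    have e2 : B1.det = ((Z.det : ℤ) : ℝ) := by
      rw [e]; exact (RingHom.map_det (Int.castRingHom ℝ) Z).symm
    rw [e2] at hd ⊢
    have : Z.det ≠ 0 := fun h0 => hd (by rw [h0]; simp)
    rw [← Int.cast_abs]
    exact_mod_cast Int.one_le_abs this
  set β : Fin N → ℝ := fun i => if i = i0 then h.lam (N - 1) else p.factorial * lJ f (ε.symm i) with hβ
  have hb := det_bound (B1 * (cmpF ε A).transpose) β (fun _ => 1) (by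
    intro a b
    rw [mul_one]
    have e : (B1 * (cmpF ε A).transpose) a b = (cmpF ε A).mulVec (B1 a) b := by
      simp [Matrix.mul_apply, Matrix.mulVec, dotProduct, mul_comm]
    rw [e]
    by_cases hab : a = i0
    · have : B1 a = rc (h.g j) := by rw [hab, hB1, Matrix.updateRow_self]
      rw [this]
      simp only [hβ, hab, if_true]
      exact (le_nF _ _ _).trans (h.lam_mono (by omega) (by omega))
    · have : B1 a = rc (gJ ε f (ε.symm a)) := by rw [hB1, Matrix.updateRow_ne hab]; rfl
      rw [this]
      simp only [hβ, hab, if_false]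
      exact (le_nF _ _ _).trans (nF_gJ ε f _))
  rw [Matrix.det_mul, Matrix.det_transpose, abs_mul, Finset.prod_const_one, mul_one, Fintype.card_fin] at hb
  have hl0 : 0 ≤ h.lam (N - 1) := nF_nonneg _ _
  have hp1 : (1 : ℝ) ≤ p.factorial := by exact_mod_cast p.factorial_pos
  have hprod : (∏ i, β i) * lJ f J0 ≤ (p.factorial : ℝ) ^ N * (h.lam (N - 1) * ∏ J : PS n p, lJ f J) := by
    have e3 : ∏ J : PS n p, lJ f J = ∏ i, lJ f (ε.symm i) := (Equiv.prod_comp ε.symm _).symm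
    have e4 : ∏ i, β i = h.lam (N - 1) * ∏ i ∈ Finset.univ.erase i0, (p.factorial * lJ f (ε.symm i)) := by
      rw [← Finset.mul_prod_erase _ _ (Finset.mem_univ i0)]
      congr 1
      · simp [hβ]
      · exact Finset.prod_congr rfl fun i hi => by simp [hβ, Finset.ne_of_mem_erase hi]
    rw [e4, e3, ← Finset.mul_prod_erase _ (fun i => lJ f (ε.symm i)) (Finset.mem_univ i0), Finset.prod_mul_distrib, Finset.prod_const]
    have e5 : lJ f (ε.symm i0) = lJ f J0 := by simp [i0]
    rw [e5]
    have e6 : (p.factorial : ℝ) ^ (Finset.univ.erase i0).card ≤ (p.factorial : ℝ) ^ N :=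
      pow_le_pow_right₀ hp1 (by simp)
    have h0 : 0 ≤ h.lam (N - 1) * (lJ f J0 * ∏ i ∈ Finset.univ.erase i0, lJ f (ε.symm i)) :=
      mul_nonneg hl0 (mul_nonneg (lJ_pos hA f _).le (Finset.prod_nonneg fun i _ => (lJ_pos hA f _).le))
    have := mul_le_mul_of_nonneg_right e6 h0
    calc _ = (p.factorial : ℝ) ^ (Finset.univ.erase i0).card * (h.lam (N - 1) * (lJ f J0 * ∏ i ∈ Finset.univ.erase i0, lJ f (ε.symm i))) := by ring
      _ ≤ _ := this
  have h3 : |(cmpF ε A).det| ≤ N.factorial * ∏ i, β i := by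
    refine le_trans ?_ hb
    exact le_mul_of_one_le_left (abs_nonneg _) hintg
  calc _ ≤ (N.factorial * ∏ i, β i) * lJ f J0 := mul_le_mul_of_nonneg_right h3 (lJ_pos hA f _).le
    _ = N.factorial * ((∏ i, β i) * lJ f J0) := by ring
    _ ≤ _ := mul_le_mul_of_nonneg_left hprod (by positivity)

lemma pow_swap {a b : ℝ} (ha : 0 ≤ a) (hab : a ≤ b) {r : ℕ} (hr : 1 ≤ r) : a ^ r * b ≤ b ^ r * a := by
  obtain ⟨r, rfl⟩ := Nat.exists_eq_add_of_le' hr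
  have : a ^ r ≤ b ^ r := pow_le_pow_left₀ ha hab r
  have h2 := mul_le_mul_of_nonneg_right this (mul_nonneg ha (ha.trans hab))
  rw [pow_succ, pow_succ]
  linarith

lemma lJ_swap {A : Matrix (Fin n) (Fin n) ℝ} (hA : A.det ≠ 0) (f : Flag A) {k0 : ℕ} (hk : 1 ≤ k0) (hkn : k0 < n)
    (J0 J : PS n p) (hJ0 : ∀ i : Fin n, i ∈ J0.val ↔ k0 ≤ i.val) (hJ : J ≠ J0) :
    lJ f J * f.lam k0 ≤ lJ f J0 * f.lam (k0 - 1) := by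
  classical
  have e : ∀ K : PS n p, lJ f K = ∏ i ∈ K.val, f.lam i := fun K => prod_emb K (fun i => f.lam i)
  rw [e, e]
  have c1 : J.val.card = p := J.prop
  have c2 : J0.val.card = p := J0.prop
  have hc : (J.val \ J0.val).card = (J0.val \ J.val).card := Finset.card_sdiff_comm (c1.trans c2.symm)
  set r := (J.val \ J0.val).card with hr
  have hr1 : 1 ≤ r := by
    rw [hr, Nat.one_le_iff_ne_zero, Finset.card_ne_zero, Finset.sdiff_nonempty]
    intro hsub
    exact hJ (Subtype.ext (Finset.eq_of_subset_of_card_le hsub (by omega)))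
  rw [← Finset.prod_inter_mul_prod_diff J.val J0.val, ← Finset.prod_inter_mul_prod_diff J0.val J.val, Finset.inter_comm J0.val J.val]
  have hp : ∀ i : Fin n, 0 ≤ f.lam i := fun i => nF_nonneg _ _
  have b1 : ∏ i ∈ J.val \ J0.val, f.lam i ≤ f.lam (k0 - 1) ^ r := by
    rw [hr, ← Finset.prod_const]
    refine Finset.prod_le_prod (fun i _ => hp i) fun i hi => f.lam_mono ?_ (by omega)
    rw [Finset.mem_sdiff, hJ0] at hi
    omega
  have b2 : f.lam k0 ^ r ≤ ∏ i ∈ J0.val \ J.val, f.lam i := by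
    rw [hc, ← Finset.prod_const]
    refine Finset.prod_le_prod (fun i _ => nF_nonneg _ _) fun i hi => f.lam_mono ?_ i.2
    rw [Finset.mem_sdiff, hJ0] at hi
    omega
  have b3 := pow_swap (nF_nonneg _ _) (f.lam_mono (Nat.sub_le k0 1) hkn) hr1
  have hI : 0 ≤ ∏ i ∈ J.val ∩ J0.val, f.lam i := Finset.prod_nonneg fun i _ => hp i
  rw [mul_assoc, mul_assoc]
  refine mul_le_mul_of_nonneg_left ?_ hI
  exact (mul_le_mul_of_nonneg_right b1 (nF_nonneg _ _)).trans (b3.trans (mul_le_mul_of_nonneg_right b2 (nF_nonneg _ _)))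

lemma lam_upper {A : Matrix (Fin n) (Fin n) ℝ} (hA : A.det ≠ 0) (f : Flag A) (hN : 2 ≤ N) (h : Flag (cmpF ε A))
    {k0 : ℕ} (hk : 1 ≤ k0) (hkn : k0 < n)
    (J0 : PS n p) (hJ0 : ∀ i : Fin n, i ∈ J0.val ↔ k0 ≤ i.val) :
    h.lam (N - 2) * f.lam k0 ≤ p.factorial * (lJ f J0 * f.lam (k0 - 1)) := by
  classical
  have hli : LinearIndependent ℝ (fun i : Fin N => rc (gJ ε f (ε.symm i))) := by
    have h2 := (Matrix.isUnit_iff_isUnit_det _).2 (isUnit_iff_ne_zero.2 (gJ_det_ne ε f))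
    exact (Matrix.linearIndependent_rows_iff_isUnit).2 h2
  have hli2 := hli.comp (fun i : {i : Fin N // i ≠ ε J0} => i.1) Subtype.val_injective
  obtain ⟨⟨i, hi⟩, hi2⟩ := h.exists_notMem (j := N - 2) (by
    rw [Fintype.card_subtype_compl]; simp; omega) _ hli2
  have h1 := h.mn (N - 2) (by omega) _ hi2
  have hJ : ε.symm i ≠ J0 := by
    intro h0; apply hi; rw [← h0]; simp
  have h2 := lJ_swap hA f hk hkn J0 _ hJ0 hJ
  have h3 : h.lam (N - 2) ≤ p.factorial * lJ f (ε.symm i) := h1.trans (nF_gJ ε f _)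
  calc _ ≤ (p.factorial * lJ f (ε.symm i)) * f.lam k0 := mul_le_mul_of_nonneg_right h3 (nF_nonneg _ _)
    _ = p.factorial * (lJ f (ε.symm i) * f.lam k0) := by ring
    _ ≤ _ := mul_le_mul_of_nonneg_left h2 (by positivity)

end
end SST

end

section
open MvPolynomial Filter

namespace SST

noncomputable def Wm {n p N : ℕ} (ε : PS n p ≃ Fin N) (m : Fin N → ℤ) : (Fin n → ℝ) [⋀^Fin p]→ₗ[ℝ] ℝ :=
  ∑ I, (m (ε I) : ℝ) • (Matrix.detRowAlternating (n := Fin p) (R := ℝ)).compLinearMap (LinearMap.funLeft ℝ ℝ (emb I))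

lemma Wm_apply {n p N : ℕ} (ε : PS n p ≃ Fin N) (m : Fin N → ℤ) (v : Fin p → Fin n → ℝ) :
    Wm ε m v = ∑ I, (m (ε I) : ℝ) * wdg v I := by
  classical
  have : ∀ (s : Finset (PS n p)) (F : PS n p → (Fin n → ℝ) [⋀^Fin p]→ₗ[ℝ] ℝ), (∑ I ∈ s, F I) v = ∑ I ∈ s, F I v := by
    intro s F
    induction s using Finset.induction_on with
    | empty => rfl
    | insert a s ha ih => rw [Finset.sum_insert ha, Finset.sum_insert ha, ← ih]; rfl
  rw [Wm, this]
  rfl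

lemma Wm_gJ {n p N : ℕ} (ε : PS n p ≃ Fin N) (m : Fin N → ℤ) {A : Matrix (Fin n) (Fin n) ℝ} (f : Flag A) (J : PS n p) :
    Wm ε m (fun a => rc (f.g (emb J a))) = ∑ i, (m i : ℝ) * rc (gJ ε f J) i := by
  rw [Wm_apply, ← Equiv.sum_comp ε.symm]
  refine Finset.sum_congr rfl fun i _ => ?_
  rw [Equiv.apply_symm_apply]
  congr 1
  exact wdg_map (Int.castRingHom ℝ) _ (ε.symm i)

lemma Wm_single {n p N : ℕ} (ε : PS n p ≃ Fin N) (m : Fin N → ℤ) (I : PS n p) :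
    Wm ε m (fun a => Pi.single (emb I a) 1) = m (ε I) := by
  rw [Wm_apply]
  have e : (fun a => (Pi.single (emb I a) 1 : Fin n → ℝ)) = fun b i => (1 : Matrix (Fin n) (Fin n) ℝ) (emb I b) i := by
    ext a i
    simp [Matrix.one_apply, Pi.single_apply, eq_comm]
  simp only [e, wdg_row, cmp_one]
  rw [Finset.sum_eq_single I]
  · simp
  · intro J _ hJ; rw [Matrix.one_apply_ne hJ.symm, mul_zero]
  · simp

lemma exists_emb {n p : ℕ} (t : Fin p → Fin n) (ht : Function.Injective t) :
    ∃ (J : PS n p) (σ : Equiv.Perm (Fin p)), t = emb J ∘ σ := by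
  let J : PS n p := Set.powersetCard.ofFinEmb p (Fin n) ⟨t, ht⟩
  have h : ∀ a, ∃ b, emb J b = t a := by
    intro a
    rw [emb_mem]
    show t a ∈ J
    rw [Set.powersetCard.mem_ofFinEmb_iff_mem_range]
    exact ⟨a, rfl⟩
  choose σ hσ using h
  have hinj : Function.Injective σ := fun a b hab => ht (by rw [← hσ, ← hσ, hab])
  exact ⟨J, Equiv.ofBijective σ (Finite.injective_iff_bijective.1 hinj), by ext a; simp [hσ]⟩

lemma Wm_zero {n q N : ℕ} (ε : PS n (q + 1) ≃ Fin N) (m : Fin N → ℤ) {A : Matrix (Fin n) (Fin n) ℝ} (f : Flag A) {k0 : ℕ}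
    (J0 : PS n (q + 1)) (hJ0 : ∀ i : Fin n, i ∈ J0.val ↔ k0 ≤ i.val) (hkn : k0 ≤ n)
    (h : ∀ J, J ≠ J0 → ∑ i, (m i : ℝ) * rc (gJ ε f J) i = 0) (v : Fin (q + 1) → Fin n → ℝ) (hv : v 0 ∈ f.S k0) :
    Wm ε m v = 0 := by
  classical
  have hli := f.linInd le_rfl
  have hsp : ⊤ ≤ Submodule.span ℝ (Set.range fun i : Fin n => rc (f.g i)) := by
    rw [← f.span_eq, f.top]
  let b := Module.Basis.mk hli hsp
  have hb : ∀ i, b i = rc (f.g i) := fun i => Module.Basis.mk_apply hli hsp i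
  let π : (Fin n → ℝ) →ₗ[ℝ] (Fin n → ℝ) := b.constr ℝ fun i => if i.val < k0 then b i else 0
  have hπ : ∀ i, π (b i) = if i.val < k0 then b i else 0 := fun i => b.constr_basis ℝ _ i
  have hπS : ∀ x ∈ f.S k0, π x = x := by
    intro x hx
    rw [f.span_eq] at hx
    induction hx using Submodule.span_induction with
    | mem x hx =>
      obtain ⟨i, rfl⟩ := hx
      have := hπ ⟨i, by omega⟩
      rw [hb] at this
      simpa using this
    | zero => simp
    | add x y _ _ hx hy => rw [map_add, hx, hy]
    | smul c x _ hx => rw [map_smul, hx]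
  let W2 : MultilinearMap ℝ (fun _ : Fin (q + 1) => Fin n → ℝ) ℝ :=
    (Wm ε m).toMultilinearMap.compLinearMap fun a => if a = 0 then π else LinearMap.id
  have hW2 : W2 = 0 := by
    refine Module.Basis.ext_multilinear (fun _ => b) fun t => ?_
    show Wm ε m (fun a => (if a = 0 then π else LinearMap.id) (b (t a))) = 0
    by_cases ht0 : (t 0).val < k0
    · have e : (fun a => (if a = 0 then π else LinearMap.id) (b (t a))) = fun a => b (t a) := by
        ext a : 1
        by_cases ha : a = 0
        · subst ha; simp [hπ, ht0]
        · simp [ha]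
      rw [e]
      by_cases hti : Function.Injective t
      · obtain ⟨J, σ, rfl⟩ := exists_emb t hti
        have := (Wm ε m).map_perm (fun a => b (emb J a)) σ
        have hJ : J ≠ J0 := by
          rintro rfl
          have h1 : (emb J ∘ σ) 0 ∈ J.val := (emb_mem J _).1 ⟨σ 0, rfl⟩
          rw [hJ0] at h1
          omega
        have h0 := h J hJ
        rw [← Wm_gJ] at h0
        simp only [← hb] at h0
        rw [h0, smul_zero] at this
        exact this
      · rw [Function.not_injective_iff] at hti
        obtain ⟨a, a', haa, hne⟩ := hti
        exact (Wm ε m).map_eq_zero_of_eq _ (by simp [haa]) hne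
    · exact (Wm ε m).map_coord_zero 0 (by simp [hπ, ht0])
  have := congrArg (fun W => W v) hW2
  change Wm ε m (fun a => (if a = 0 then π else LinearMap.id) (v a)) = 0 at this
  rw [← this]
  congr 1
  ext a : 1
  by_cases ha : a = 0
  · subst ha; simp [hπS _ hv]
  · simp [ha]

lemma kill {n q N : ℕ} (ε : PS n (q + 1) ≃ Fin N) (m : Fin N → ℤ) (hm : m ≠ 0) :
    ∃ z : Fin n → ℤ, z ≠ 0 ∧ ∀ (A : Matrix (Fin n) (Fin n) ℝ) (f : Flag A) (k0 : ℕ)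
      (J0 : PS n (q + 1)) (_ : ∀ i : Fin n, i ∈ J0.val ↔ k0 ≤ i.val) (_ : k0 ≤ n)
      (_ : ∀ J, J ≠ J0 → ∑ i, (m i : ℝ) * rc (gJ ε f J) i = 0), ∀ x ∈ f.S k0, ∑ i, (z i : ℝ) * x i = 0 := by
  classical
  obtain ⟨i, hi⟩ := Function.ne_iff.1 hm
  set I := ε.symm i with hI
  set v : Fin (q + 1) → Fin n → ℝ := fun a => Pi.single (emb I a) 1 with hv
  set z : Fin n → ℤ := fun l => ∑ J, m (ε J) * wdg (Function.update (fun a => Pi.single (emb I a) 1) 0 (Pi.single l 1)) J with hz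
  have hzW : ∀ l, (z l : ℝ) = Wm ε m (Function.update v 0 (Pi.single l 1)) := by
    intro l
    rw [Wm_apply, hz]
    push_cast
    refine Finset.sum_congr rfl fun J _ => ?_
    congr 1
    refine (wdg_map (Int.castRingHom ℝ) _ J).symm.trans ?_
    congr 1
    ext a b
    by_cases ha : a = 0
    · subst ha; simp [Pi.single_apply]
    · simp [ha, hv, Pi.single_apply]
  have hzx : ∀ x : Fin n → ℝ, ∑ l, (z l : ℝ) * x l = Wm ε m (Function.update v 0 x) := by
    intro x
    have := LinearMap.pi_apply_eq_sum_univ ((Wm ε m).toMultilinearMap.toLinearMap v 0) x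
    change Wm ε m (Function.update v 0 x) = _ at this
    rw [this]
    refine Finset.sum_congr rfl fun l _ => ?_
    rw [hzW, smul_eq_mul, mul_comm]
    have e : (fun j => if l = j then (1 : ℝ) else 0) = Pi.single l 1 := by
      ext j
      simp [Pi.single_apply, eq_comm]
    rw [e]
    rfl
  refine ⟨z, ?_, ?_⟩
  · intro h0
    have h1 := hzW (emb I 0)
    have e : Function.update v 0 (Pi.single (emb I 0) 1) = v := Function.update_eq_self 0 v
    rw [e, hv, Wm_single, h0] at h1
    simp only [Pi.zero_apply, Int.cast_zero] at h1
    apply hi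
    have : (m (ε I) : ℝ) = 0 := h1.symm
    rw [hI, Equiv.apply_symm_apply] at this
    exact_mod_cast this
  · intro A f k0 J0 hJ0 hk h x hx
    rw [hzx]
    exact Wm_zero ε m f J0 hJ0 hk h _ (by simpa using hx)
end SST

end

section
open MvPolynomial Filter

namespace SST

lemma comp_est {n p N : ℕ} (ε : PS n p ≃ Fin N) (hN : 2 ≤ N) {k0 : ℕ} (hk : 1 ≤ k0) (hkn : k0 < n)
    (J0 : PS n p) (hJ0 : ∀ i : Fin n, i ∈ J0.val ↔ k0 ≤ i.val) (e : ℕ)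
    (he : ∀ s : Fin n → ℝ, ∏ I : PS n p, ∏ a, s (emb I a) = (∏ i, s i) ^ e) (κ : ℝ) (hκ : 0 < κ) :
    ∃ K : ℝ, 0 < K ∧ ∀ (A : Matrix (Fin n) (Fin n) ℝ) (_ : A.det ≠ 0) (A' : Matrix (Fin N) (Fin N) ℝ) (_ : A' = cmpF ε A)
      (_ : κ * |A.det| ^ e ≤ |A'.det|) (f : Flag A) (h : Flag A'),
      h.lam (N - 2) * f.lam k0 ≤ K * f.lam (k0 - 1) * h.lam (N - 1) ∧
      (K * f.lam (k0 - 1) < f.lam k0 → ∀ J, J ≠ J0 → rc (gJ ε f J) ∈ h.S (N - 1)) := by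
  have hd0 : 0 < dC n := lt_of_lt_of_le one_pos (dC_ge n)
  refine ⟨N.factorial * (p.factorial : ℝ) ^ N * (dC n ^ n) ^ e * p.factorial / κ, by positivity, ?_⟩
  set K := N.factorial * (p.factorial : ℝ) ^ N * (dC n ^ n) ^ e * p.factorial / κ with hK
  intro A hA A' hE hdet f h
  subst hE
  have hA' := cmpF_det_ne ε A hA
  have h1 := lam_lower ε hA f (by omega) h J0
  have h2 : ∏ J : PS n p, lJ f J = (∏ i : Fin n, f.lam i) ^ e := he fun i => f.lam i
  have h3 := f.mink2 hA
  have h4 : ∏ J : PS n p, lJ f J ≤ (dC n ^ n) ^ e * |A.det| ^ e := by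
    rw [h2, ← mul_pow]
    exact pow_le_pow_left₀ (Finset.prod_nonneg fun i _ => nF_nonneg _ _) h3 e
  have hl : 0 < h.lam (N - 1) := h.lam_pos hA' (by omega)
  have hD : 0 < |A.det| ^ e := pow_pos (abs_pos.2 hA) e
  have hJp := lJ_pos hA f J0
  have key : p.factorial * lJ f J0 ≤ K * h.lam (N - 1) := by
    have h5 : |A.det| ^ e * (κ * lJ f J0) ≤ |A.det| ^ e * (N.factorial * (p.factorial : ℝ) ^ N * (dC n ^ n) ^ e * h.lam (N - 1)) := by
      calc _ = (κ * |A.det| ^ e) * lJ f J0 := by ring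
        _ ≤ |(cmpF ε A).det| * lJ f J0 := mul_le_mul_of_nonneg_right hdet hJp.le
        _ ≤ _ := h1
        _ ≤ N.factorial * ((p.factorial : ℝ) ^ N * (h.lam (N - 1) * ((dC n ^ n) ^ e * |A.det| ^ e))) := by gcongr
        _ = _ := by ring
    have h6 := le_of_mul_le_mul_left h5 hD
    rw [hK, div_mul_eq_mul_div, le_div_iff₀ hκ]
    have := mul_le_mul_of_nonneg_left h6 (Nat.cast_nonneg (α := ℝ) p.factorial)
    linarith
  have hl0 : 0 ≤ f.lam (k0 - 1) := nF_nonneg _ _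
  constructor
  · have h7 := lam_upper ε hA f hN h hk hkn J0 hJ0
    have := mul_le_mul_of_nonneg_right key hl0
    linarith
  · intro hlt J hJ
    by_contra hcon
    have h8 : h.lam (N - 1) ≤ p.factorial * lJ f J := (h.mn (N - 1) (by omega) _ hcon).trans (nF_gJ ε f J)
    have h9 := lJ_swap hA f hk hkn J0 J hJ0 hJ
    have a1 := mul_le_mul_of_nonneg_right h8 (nF_nonneg A (f.g k0))
    have a2 := mul_le_mul_of_nonneg_left h9 (Nat.cast_nonneg (α := ℝ) p.factorial)
    have a3 := mul_le_mul_of_nonneg_right key hl0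
    have a4 := mul_lt_mul_of_pos_right hlt hl
    change h.lam (N - 1) * f.lam k0 ≤ _ * f.lam k0 at a1
    linarith

variable {R : Type*} [CommRing R] [IsDomain R]

lemma scM_cmp (hR : HR R) {n p N : ℕ} (ε : PS n p ≃ Fin N) (L : Matrix (Fin n) (Fin n) R) (s : Fin n → ℝ) :
    scM hR ((cmp p L).submatrix ε.symm ε.symm) (fun i => ∏ a, s (emb (ε.symm i) a)) = cmpF ε (scM hR L s) := by
  ext i j
  rw [cmpF, Matrix.submatrix_apply]
  have : scM hR L s = Matrix.of fun i j => s i * (L.map hR.φ) i j := rfl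
  rw [this, cmp_rowscale, cmp_map]
  rfl

/-- a gap anywhere gives a fixed rational hyperplane infinitely often -/
theorem gap_thm (hR : HR R) {n : ℕ} (L : Matrix (Fin n) (Fin n) R) (hdet : L.det ≠ 0) (ℓ : ℕ → ℝ)
    (hℓ : Tendsto ℓ atTop atTop) (s : ℕ → Fin n → ℝ) (C : ℝ)
    (hs1 : ∀ k i, Real.exp (-(C * ℓ k)) ≤ s k i) (hs2 : ∀ k i, s k i ≤ Real.exp (C * ℓ k))
    (f : ∀ k, Flag (scM hR L (s k))) (δ : ℝ) (hδ : 0 < δ) (k0 : ℕ) (hk : 1 ≤ k0) (hkn : k0 < n)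
    (hgap : ∀ k, (f k).lam (k0 - 1) ≤ Real.exp (-(δ * ℓ k)) * (f k).lam k0) :
    ∃ z : Fin n → ℤ, z ≠ 0 ∧ ∃ᶠ k in atTop, ∀ x ∈ (f k).S k0, ∑ i, (z i : ℝ) * x i = 0 := by
  classical
  obtain ⟨q, hq⟩ : ∃ q, n = k0 + (q + 1) := ⟨n - k0 - 1, by omega⟩
  have hcard : Fintype.card (PS n (q + 1)) = n.choose (q + 1) := by
    rw [← Nat.card_eq_fintype_card, Set.powersetCard.card, Nat.card_eq_fintype_card, Fintype.card_fin]
  have hN2 : 2 ≤ n.choose (q + 1) := by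
    have h1 : Nontrivial (PS n (q + 1)) := Set.powersetCard.nontrivial' (by omega) (by simp; omega)
    rw [← hcard]
    exact Fintype.one_lt_card
  obtain ⟨n', hn'⟩ : ∃ n', n.choose (q + 1) = n' + 1 := ⟨n.choose (q + 1) - 1, by omega⟩
  have ε : PS n (q + 1) ≃ Fin (n' + 1) := Fintype.equivFinOfCardEq (hcard.trans hn')
  obtain ⟨e, he⟩ := prodPS n (q + 1) (by omega)
  have hJc : (Finset.univ.filter fun i : Fin n => k0 ≤ i.val).card = q + 1 := by
    have e1 : (Finset.univ.filter fun i : Fin n => k0 ≤ i.val) = Finset.Ici (⟨k0, hkn⟩ : Fin n) := by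
      ext i; simp [Fin.le_def]
    rw [e1, Fin.card_Ici]; simp; omega
  set J0 : PS n (q + 1) := ⟨_, hJc⟩ with hJ0d
  have hJ0 : ∀ i : Fin n, i ∈ J0.val ↔ k0 ≤ i.val := by intro i; simp [hJ0d]
  set L' : Matrix (Fin (n' + 1)) (Fin (n' + 1)) R := (cmp (q + 1) L).submatrix ε.symm ε.symm with hL'
  have hL'd : L'.det ≠ 0 := by
    rw [hL', Matrix.det_submatrix_equiv_self]; exact cmp_det_ne L hdet
  have hφ : ∀ r : R, r ≠ 0 → 0 < |hR.φ r| := fun r hr => abs_pos.2 fun h => hr (hR.inj (by rw [h, map_zero]))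
  set κ := |hR.φ L'.det| / |hR.φ L.det| ^ e with hκd
  have hκ : 0 < κ := div_pos (hφ _ hL'd) (pow_pos (hφ _ hdet) _)
  obtain ⟨K, hK, HK⟩ := comp_est ε (by omega) hk hkn J0 hJ0 e he κ hκ
  set s' : ℕ → Fin (n' + 1) → ℝ := fun k i => ∏ a, s k (emb (ε.symm i) a) with hs'
  have hsp : ∀ k i, 0 < s k i := fun k i => (Real.exp_pos _).trans_le (hs1 k i)
  have hs'p : ∀ k i, 0 < s' k i := fun k i => Finset.prod_pos fun a _ => hsp k _
  have hAne : ∀ k, (scM hR L (s k)).det ≠ 0 := fun k => scM_det_ne hR L hdet _ (hsp k)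
  have hdets : ∀ k, κ * |(scM hR L (s k)).det| ^ e ≤ |(scM hR L' (s' k)).det| := by
    intro k
    rw [scM_det, scM_det]
    have e1 : ∏ i, s' k i = (∏ i, s k i) ^ e := by
      rw [← he, ← Equiv.prod_comp ε.symm]
    have h0 : 0 < ∏ i, s k i := Finset.prod_pos fun i _ => hsp k i
    rw [e1, abs_mul, abs_mul, mul_pow, abs_pow, hκd]
    have := (pow_pos (hφ _ hdet) e).ne'
    refine le_of_eq ?_
    field_simp
  have hf : ∀ k, Nonempty (Flag (scM hR L' (s' k))) := fun k => exists_flag _ (scM_det_ne hR L' hL'd _ (hs'p k))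
  let h : ∀ k, Flag (scM hR L' (s' k)) := fun k => (hf k).some
  have hev : ∀ᶠ k in atTop, K * Real.exp (-(δ * ℓ k)) ≤ Real.exp (-(δ / 2 * ℓ k)) ∧ K * Real.exp (-(δ * ℓ k)) < 1 := by
    have t1 : Tendsto (fun k => δ / 2 * ℓ k) atTop atTop := hℓ.const_mul_atTop (by positivity)
    filter_upwards [t1.eventually_ge_atTop (Real.log K), t1.eventually_gt_atTop 0] with k h1 h2
    have h3 : K * Real.exp (-(δ * ℓ k)) ≤ Real.exp (-(δ / 2 * ℓ k)) := by
      rw [← Real.exp_log hK, ← Real.exp_add, Real.exp_le_exp]; linarith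
    exact ⟨h3, h3.trans_lt (by rw [Real.exp_lt_one_iff]; linarith)⟩
  obtain ⟨k1, hk1⟩ := eventually_atTop.1 hev
  have HH := gt_thm hR (n := n') (by omega) L' hL'd (fun k => ℓ (k + k1))
    (hℓ.comp (tendsto_add_atTop_nat k1)) (fun k => s' (k + k1)) ((q + 1 : ℕ) * C) ?_ ?_ (fun k => h (k + k1)) (δ / 2) (by positivity) ?_
  rotate_left
  · intro k i
    calc _ = ∏ _a : Fin (q + 1), Real.exp (-(C * ℓ (k + k1))) := by
            rw [Finset.prod_const, ← Real.exp_nat_mul]; simp; ring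
      _ ≤ _ := Finset.prod_le_prod (fun _ _ => (Real.exp_pos _).le) fun a _ => hs1 _ _
  · intro k i
    calc _ ≤ ∏ _a : Fin (q + 1), Real.exp (C * ℓ (k + k1)) :=
            Finset.prod_le_prod (fun _ _ => (hsp _ _).le) fun a _ => hs2 _ _
      _ = _ := by rw [Finset.prod_const, ← Real.exp_nat_mul]; simp; ring
  · intro k
    have h1 := (HK _ (hAne (k + k1)) _ (scM_cmp hR ε L (s (k + k1))) (hdets (k + k1)) (f (k + k1)) (h (k + k1))).1
    have h2 := hgap (k + k1)
    have h3 := (hk1 (k + k1) (by omega)).1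
    have hlk : 0 < (f (k + k1)).lam k0 := (f (k + k1)).lam_pos (hAne _) hkn
    have hl0 : 0 ≤ (h (k + k1)).lam (n' + 1 - 1) := nF_nonneg _ _
    refine le_of_mul_le_mul_right (h1.trans ?_) hlk
    calc _ ≤ K * (Real.exp (-(δ * ℓ (k + k1))) * (f (k + k1)).lam k0) * (h (k + k1)).lam (n' + 1 - 1) := by gcongr
      _ = (K * Real.exp (-(δ * ℓ (k + k1)))) * ((f (k + k1)).lam k0 * (h (k + k1)).lam (n' + 1 - 1)) := by ring
      _ ≤ Real.exp (-(δ / 2 * ℓ (k + k1))) * ((f (k + k1)).lam k0 * (h (k + k1)).lam (n' + 1 - 1)) := by gcongr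
      _ = _ := by simp only [Nat.add_sub_cancel]; ring
  obtain ⟨m, hm, hfr⟩ := HH
  obtain ⟨z, hz, hzk⟩ := kill ε m hm
  refine ⟨z, hz, ?_⟩
  rw [frequently_atTop] at hfr ⊢
  intro a
  obtain ⟨b, hb, hb2⟩ := hfr a
  refine ⟨b + k1, by omega, ?_⟩
  refine hzk _ (f (b + k1)) k0 J0 hJ0 hkn.le fun J hJ => hb2 _ ?_
  refine (HK _ (hAne (b + k1)) _ (scM_cmp hR ε L (s (b + k1))) (hdets (b + k1)) (f (b + k1)) (h (b + k1))).2 ?_ J hJ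
  have hlk : 0 < (f (b + k1)).lam k0 := (f (b + k1)).lam_pos (hAne _) hkn
  have h2 := mul_le_mul_of_nonneg_left (hgap (b + k1)) hK.le
  have h3 := mul_lt_mul_of_pos_right (hk1 (b + k1) (by omega)).2 hlk
  linarith
end SST

end

section
open MvPolynomial Filter

namespace SST
variable {R : Type*} [CommRing R] [IsDomain R]

/-- Schmidt's subspace theorem (parametric form along a sequence) -/
theorem subspace_thm (hR : HR R) {n : ℕ} (L : Matrix (Fin n) (Fin n) R) (hdet : L.det ≠ 0) (ℓ : ℕ → ℝ)
    (hℓ : Tendsto ℓ atTop atTop) (x : ℕ → Fin n → ℤ) (hx : ∀ k, x k ≠ 0) (c : Fin n → ℝ) (hc : ∑ i, c i < 0)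
    (hb : ∀ k i, |∑ j, hR.φ (L i j) * (x k j : ℝ)| ≤ Real.exp (c i * ℓ k)) :
    ∃ z : Fin n → ℤ, z ≠ 0 ∧ ∃ᶠ k in atTop, ∑ i, z i * x k i = 0 := by
  classical
  have hn : 1 ≤ n := by
    rcases Nat.eq_zero_or_pos n with rfl | h
    · simp at hc
    · exact h
  set s : ℕ → Fin n → ℝ := fun k i => Real.exp (-(c i * ℓ k)) with hs
  have hsp : ∀ k i, 0 < s k i := fun k i => Real.exp_pos _
  have hA : ∀ k, (scM hR L (s k)).det ≠ 0 := fun k => scM_det_ne hR L hdet _ (hsp k)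
  have hf : ∀ k, Nonempty (Flag (scM hR L (s k))) := fun k => exists_flag _ (hA k)
  let f : ∀ k, Flag (scM hR L (s k)) := fun k => (hf k).some
  have hx1 : ∀ k, nF (scM hR L (s k)) (x k) ≤ 1 := by
    intro k
    rw [nF_le_iff _ _ zero_le_one]
    intro i
    rw [scM_mulVec, abs_mul, abs_of_pos (hsp k i), hs]
    calc _ ≤ Real.exp (-(c i * ℓ k)) * Real.exp (c i * ℓ k) := mul_le_mul_of_nonneg_left (hb k i) (Real.exp_pos _).le
      _ = 1 := by rw [← Real.exp_add]; simp
  have hl0 : ∀ k, (f k).lam 0 ≤ 1 := by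
    intro k
    refine ((f k).mn 0 hn (x k) ?_).trans (hx1 k)
    rw [(f k).S0]
    simpa using rc_ne (hx k)
  set σ := -∑ i, c i with hσ
  have hσ0 : 0 < σ := by linarith
  have hn0 : (0 : ℝ) < n := by exact_mod_cast hn
  set η := σ / (2 * (n : ℝ) ^ 2) with hη
  have hη0 : 0 < η := by positivity
  have hφ : 0 < |hR.φ L.det| := abs_pos.2 fun h => hdet (hR.inj (by rw [h, map_zero]))
  have hev : ∀ᶠ k in atTop, 0 ≤ ℓ k ∧ ∃ j < n, Real.exp (j * η * ℓ k) < (f k).lam j := by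
    have t1 : Tendsto (fun k => σ / 2 * ℓ k) atTop atTop := hℓ.const_mul_atTop (by positivity)
    have t2 := (Real.tendsto_exp_atTop.comp t1).eventually_gt_atTop (n.factorial / |hR.φ L.det|)
    filter_upwards [t2, hℓ.eventually_ge_atTop 0] with k h2 h0
    refine ⟨h0, ?_⟩
    by_contra hcon
    push Not at hcon
    have h1 := (f k).det_le
    rw [scM_det, abs_mul] at h1
    have e1 : |∏ i, s k i| = Real.exp (σ * ℓ k) := by
      rw [abs_of_pos (Finset.prod_pos fun i _ => hsp k i), hs, ← Real.exp_sum, hσ]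
      congr 1
      rw [Finset.sum_neg_distrib, ← Finset.sum_mul, neg_mul]
    have e2 : ∏ j : Fin n, (f k).lam j ≤ Real.exp (σ / 2 * ℓ k) := by
      calc _ ≤ ∏ _j : Fin n, Real.exp (n * η * ℓ k) := by
            refine Finset.prod_le_prod (fun j _ => nF_nonneg _ _) fun j _ => (hcon j j.2).trans ?_
            rw [Real.exp_le_exp]
            have : ((j : ℕ) : ℝ) ≤ n := by exact_mod_cast j.2.le
            gcongr
        _ = _ := by
            rw [Finset.prod_const, ← Real.exp_nat_mul]
            congr 1
            simp only [Finset.card_univ, Fintype.card_fin, hη]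
            field_simp
    rw [e1] at h1
    have e3 : Real.exp (σ * ℓ k) = Real.exp (σ / 2 * ℓ k) * Real.exp (σ / 2 * ℓ k) := by
      rw [← Real.exp_add]; congr 1; ring
    rw [e3] at h1
    have h4 : Real.exp (σ / 2 * ℓ k) * (Real.exp (σ / 2 * ℓ k) * |hR.φ L.det|) ≤ Real.exp (σ / 2 * ℓ k) * n.factorial := by
      calc _ = Real.exp (σ / 2 * ℓ k) * Real.exp (σ / 2 * ℓ k) * |hR.φ L.det| := by ring
        _ ≤ _ := h1
        _ ≤ n.factorial * Real.exp (σ / 2 * ℓ k) := mul_le_mul_of_nonneg_left e2 (by positivity)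
        _ = _ := by ring
    have h5 := le_of_mul_le_mul_left h4 (Real.exp_pos _)
    rw [div_lt_iff₀ hφ] at h2
    simp only [Function.comp] at h2
    linarith
  have hev2 : ∀ᶠ k in atTop, ∃ j : Fin n, 0 ≤ ℓ k ∧ 1 ≤ j.val ∧ (f k).lam (j.val - 1) ≤ Real.exp ((j.val - 1 : ℕ) * η * ℓ k) ∧
      Real.exp (j.val * η * ℓ k) < (f k).lam j := by
    filter_upwards [hev] with k hk
    obtain ⟨h0, hex⟩ := hk
    have hsp := Nat.find_spec hex
    have hmin := fun j => Nat.find_min hex (m := j)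
    set j := Nat.find hex
    have hj1 : 1 ≤ j := by
      by_contra h
      have hj0 : j = 0 := by omega
      have := hsp.2
      rw [hj0] at this
      simp at this
      linarith [hl0 k]
    refine ⟨⟨j, hsp.1⟩, h0, hj1, ?_, hsp.2⟩
    have := hmin (j - 1) (by omega)
    push Not at this
    exact this (by omega)
  obtain ⟨j, hj⟩ : ∃ j : Fin n, ∃ᶠ k in atTop, 0 ≤ ℓ k ∧ 1 ≤ j.val ∧ (f k).lam (j.val - 1) ≤ Real.exp ((j.val - 1 : ℕ) * η * ℓ k) ∧
      Real.exp (j.val * η * ℓ k) < (f k).lam j := by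
    by_contra hcon
    rw [not_exists] at hcon
    simp only [not_frequently] at hcon
    obtain ⟨k, h1, h2⟩ := (hev2.and (eventually_all.2 hcon)).exists
    obtain ⟨j, hj⟩ := h1
    exact h2 j hj
  obtain ⟨ψ, hψ, hP⟩ := extraction_of_frequently_atTop hj
  have hk1 : 1 ≤ j.val := (hP 0).2.1
  have HH := gap_thm hR L hdet (fun k => ℓ (ψ k)) (hℓ.comp hψ.tendsto_atTop) (fun k => s (ψ k)) (∑ i, |c i|) ?_ ?_
    (fun k => f (ψ k)) η hη0 j.val hk1 j.2 ?_
  rotate_left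
  · intro k i
    have h0 := (hP k).1
    have : |c i| ≤ ∑ i, |c i| := Finset.single_le_sum (f := fun i => |c i|) (fun _ _ => abs_nonneg _) (Finset.mem_univ i)
    rw [hs]
    simp only [Real.exp_le_exp, neg_le_neg_iff]
    exact mul_le_mul_of_nonneg_right ((le_abs_self _).trans this) h0
  · intro k i
    have h0 := (hP k).1
    have : |c i| ≤ ∑ i, |c i| := Finset.single_le_sum (f := fun i => |c i|) (fun _ _ => abs_nonneg _) (Finset.mem_univ i)
    rw [hs]
    simp only [Real.exp_le_exp]
    rw [← neg_mul]
    exact mul_le_mul_of_nonneg_right ((neg_le_abs _).trans this) h0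
  · intro k
    obtain ⟨_, _, h1, h2⟩ := hP k
    refine h1.trans ?_
    refine le_trans ?_ (mul_le_mul_of_nonneg_left h2.le (Real.exp_pos _).le)
    rw [← Real.exp_add, Real.exp_le_exp]
    rw [Nat.cast_sub hk1]
    push_cast
    linarith
  obtain ⟨z, hz, hfr⟩ := HH
  refine ⟨z, hz, ?_⟩
  rw [frequently_atTop] at hfr ⊢
  intro a
  obtain ⟨b, hb1, hb2⟩ := hfr a
  refine ⟨ψ b, hb1.trans (hψ.id_le b), ?_⟩
  have hmem : rc (x (ψ b)) ∈ (f (ψ b)).S j := by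
    by_contra hcon
    have h1 := (f (ψ b)).mn j j.2 _ hcon
    obtain ⟨h0, _, _, h2⟩ := hP b
    have h3 : 1 ≤ Real.exp (j.val * η * ℓ (ψ b)) := Real.one_le_exp (by positivity)
    have h4 := hx1 (ψ b)
    change (f (ψ b)).lam j ≤ _ at h1
    linarith
  have := hb2 _ hmem
  simp only [rc] at this
  exact_mod_cast this
end SST

end

section
open MvPolynomial Filter

namespace SST


/-- ring with height for a real algebraic number -/
lemma exists_ring (α : ℝ) (hα : IsAlgebraic ℚ α) :
    ∃ (D : ℤ), D ≠ 0 ∧ ∃ (β : ℝ), β = D * α ∧ ∃ h : HR (Algebra.adjoin ℤ {β}), ∀ r, h.φ r = r.1 := by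
  have hZ : IsAlgebraic ℤ α := (IsFractionRing.isAlgebraic_iff ℤ ℚ ℝ).2 hα
  obtain ⟨D, hD, hintg⟩ := hZ.exists_integral_multiple
  refine ⟨D, hD, D * α, rfl, ?_⟩
  have hint2 : IsIntegral ℤ ((D : ℝ) * α) := by simpa using hintg
  let pb := Algebra.adjoin.powerBasis' hint2
  obtain ⟨h, hh⟩ := exists_HR pb.basis pb.dim_pos (Algebra.adjoin ℤ {(D : ℝ) * α}).val.toRingHom Subtype.val_injective
  exact ⟨h, fun r => by rw [hh]; rfl⟩

theorem subspace_alg (α : ℝ) (hα : IsAlgebraic ℚ α) {n : ℕ} (P Q : Matrix (Fin n) (Fin n) ℤ)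
    (hdet : (Matrix.of fun i j => (P i j : ℝ) + Q i j * α).det ≠ 0) (ℓ : ℕ → ℝ) (hℓ : Tendsto ℓ atTop atTop)
    (x : ℕ → Fin n → ℤ) (hx : ∀ k, x k ≠ 0) (E : ℕ → Fin n → ℝ) (hE0 : ∀ k i, 0 < E k i) (C δ : ℝ) (hδ : 0 < δ)
    (hE1 : ∀ k i, E k i ≤ Real.exp (C * ℓ k)) (hE2 : ∀ k, ∏ i, E k i ≤ Real.exp (-(δ * ℓ k)))
    (hb : ∀ k i, |∑ j, ((P i j : ℝ) + Q i j * α) * (x k j : ℝ)| ≤ E k i) :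
    ∃ z : Fin n → ℤ, z ≠ 0 ∧ ∃ᶠ k in atTop, ∑ i, z i * x k i = 0 := by
  obtain ⟨D, hD, β, hβ, hR, hφ⟩ := exists_ring α hα
  have hDr : (D : ℝ) ≠ 0 := by exact_mod_cast hD
  set b : Algebra.adjoin ℤ {β} := ⟨β, Algebra.subset_adjoin rfl⟩ with hbd
  set L : Matrix (Fin n) (Fin n) (Algebra.adjoin ℤ {β}) := Matrix.of fun i j => (D * P i j : ℤ) + (Q i j : ℤ) * b with hL
  have hLφ : ∀ i j, hR.φ (L i j) = D * ((P i j : ℝ) + Q i j * α) := by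
    intro i j
    rw [hL, Matrix.of_apply, map_add, map_mul, map_intCast, map_intCast, hφ]
    simp only [hbd, hβ]
    push_cast; ring
  have hLdet : L.det ≠ 0 := by
    intro h0
    have h1 := congrArg hR.φ h0
    rw [map_zero, RingHom.map_det] at h1
    have e : (hR.φ.mapMatrix L) = (D : ℝ) • (Matrix.of fun i j => (P i j : ℝ) + Q i j * α) := by
      ext i j
      simp [hLφ]
    rw [e, Matrix.det_smul] at h1
    exact mul_ne_zero (pow_ne_zero _ hDr) hdet h1
  have hD0 : 0 < |(D : ℝ)| := abs_pos.2 hDr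
  obtain ⟨k1, hk1⟩ := eventually_atTop.1 ((hℓ.eventually_ge_atTop 1).and
    ((hℓ.const_mul_atTop (half_pos hδ)).eventually_ge_atTop (n * Real.log |(D : ℝ)|)))
  have hn0 : (0 : ℝ) ≤ n := Nat.cast_nonneg n
  obtain ⟨c, hc, φ, hφm, hφc⟩ := exps (fun k (i : Fin n) => Real.log (|(D : ℝ)| * E (k + k1) i) / ℓ (k + k1))
    (|(Real.log |(D : ℝ)|)| + C) (δ / 2) (half_pos hδ) (by
      intro k i
      have h1 := (hk1 (k + k1) (by omega)).1
      rw [div_le_iff₀ (by linarith), Real.log_mul hD0.ne' (hE0 _ _).ne']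
      have h2 : Real.log (E (k + k1) i) ≤ C * ℓ (k + k1) := (Real.log_le_iff_le_exp (hE0 _ _)).2 (hE1 _ _)
      have h3 : Real.log |(D : ℝ)| ≤ |(Real.log |(D : ℝ)|)| * ℓ (k + k1) :=
        (le_abs_self _).trans (le_mul_of_one_le_right (abs_nonneg _) h1)
      linarith) (by
      intro k
      obtain ⟨h1, h2⟩ := hk1 (k + k1) (by omega)
      rw [← Finset.sum_div, div_le_iff₀ (by linarith)]
      have h3 : ∑ i, Real.log (|(D : ℝ)| * E (k + k1) i) = n * Real.log |(D : ℝ)| + Real.log (∏ i, E (k + k1) i) := by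
        rw [Real.log_prod (fun i _ => (hE0 _ i).ne')]
        simp only [Real.log_mul hD0.ne' (hE0 _ _).ne', Finset.sum_add_distrib]
        simp
      have h4 : Real.log (∏ i, E (k + k1) i) ≤ -(δ * ℓ (k + k1)) :=
        (Real.log_le_iff_le_exp (Finset.prod_pos fun i _ => hE0 _ i)).2 (hE2 _)
      rw [h3]
      linarith)
  have HH := subspace_thm hR L hLdet (fun k => ℓ (φ k + k1))
    (hℓ.comp ((tendsto_add_atTop_nat k1).comp hφm.tendsto_atTop)) (fun k => x (φ k + k1)) (fun k => hx _) c hc ?_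
  rotate_left
  · intro k i
    have h1 := (hk1 (φ k + k1) (by omega)).1
    have h2 := hφc k i
    rw [div_le_iff₀ (by linarith), Real.log_le_iff_le_exp (mul_pos hD0 (hE0 _ _))] at h2
    refine le_trans ?_ h2
    simp only [hLφ]
    calc _ = |(D : ℝ) * ∑ j, ((P i j : ℝ) + Q i j * α) * (x (φ k + k1) j : ℝ)| := by
          rw [Finset.mul_sum]; congr 1; exact Finset.sum_congr rfl fun j _ => by ring
      _ ≤ _ := by rw [abs_mul]; exact mul_le_mul_of_nonneg_left (hb _ _) (abs_nonneg _)
  obtain ⟨z, hz, hfr⟩ := HH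
  refine ⟨z, hz, ?_⟩
  rw [frequently_atTop] at hfr ⊢
  intro a
  obtain ⟨b, hb1, hb2⟩ := hfr a
  exact ⟨φ b + k1, by have := hφm.id_le b; simp only [id] at this; omega, hb2⟩
end SST

end

section
open MvPolynomial Filter Topology

namespace SST
section
variable (a : ℕ → ℕ)

def lM (l : ℕ) : Matrix (Fin 2) (Fin 2) ℤ := !![(l : ℤ), 1; 1, 0]

def cm : ℕ → Matrix (Fin 2) (Fin 2) ℤ
  | 0 => 1
  | n + 1 => cm n * lM (a (n + 1))

lemma cm_succ (n : ℕ) : cm a (n + 1) = !![(a (n + 1) : ℤ) * cm a n 0 0 + cm a n 0 1, cm a n 0 0;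
    (a (n + 1) : ℤ) * cm a n 1 0 + cm a n 1 1, cm a n 1 0] := by
  rw [cm, lM]
  ext i j
  fin_cases i <;> fin_cases j <;> simp [Matrix.mul_apply, Fin.sum_univ_two, mul_comm]

lemma cm_aux (n : ℕ) : (cm a n 0 0 = cfDen a n ∧ cm a n 1 0 = cfNum a n) ∧
    (cm a (n + 1) 0 0 = cfDen a (n + 1) ∧ cm a (n + 1) 1 0 = cfNum a (n + 1)) := by
  induction n with
  | zero => simp [cm, lM, cfDen, cfNum]
  | succ n ih =>
    refine ⟨ih.2, ?_⟩
    rw [cm_succ a (n + 1)]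
    simp only [Matrix.of_apply, Matrix.cons_val', Matrix.cons_val_zero, Matrix.cons_val_one, Matrix.cons_val_fin_one]
    rw [ih.2.1, ih.2.2]
    have h1 : cm a (n + 1) 0 1 = cm a n 0 0 := by rw [cm_succ]; rfl
    have h2 : cm a (n + 1) 1 1 = cm a n 1 0 := by rw [cm_succ]; rfl
    rw [h1, h2, ih.1.1, ih.1.2, cfDen, cfNum]
    push_cast
    exact ⟨rfl, rfl⟩

lemma cm00 (n : ℕ) : cm a n 0 0 = cfDen a n := (cm_aux a n).1.1
lemma cm10 (n : ℕ) : cm a n 1 0 = cfNum a n := (cm_aux a n).1.2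
lemma cm01 (n : ℕ) : cm a (n + 1) 0 1 = cfDen a n := by rw [← cm00, cm_succ]; rfl
lemma cm11 (n : ℕ) : cm a (n + 1) 1 1 = cfNum a n := by rw [← cm10, cm_succ]; rfl

lemma lM_det (l : ℕ) : (lM l).det = -1 := by simp [lM, Matrix.det_fin_two]

lemma cm_det (n : ℕ) : (cm a n).det = (-1) ^ n := by
  induction n with
  | zero => simp [cm]
  | succ n ih => rw [cm, Matrix.det_mul, ih, lM_det, pow_succ]

/-- determinant identity -/
lemma cf_det (n : ℕ) : (cfDen a (n + 1) : ℝ) * cfNum a n - cfNum a (n + 1) * cfDen a n = (-1) ^ (n + 1) := by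
  have := cm_det a (n + 1)
  rw [Matrix.det_fin_two, cm00, cm01, cm10, cm11] at this
  have h2 := congrArg (fun z : ℤ => (z : ℝ)) this
  push_cast at h2
  linarith

end

lemma cfDen_rec (a : ℕ → ℕ) (n : ℕ) : cfDen a (n + 2) = a (n + 2) * cfDen a (n + 1) + cfDen a n := rfl
lemma cfNum_rec (a : ℕ → ℕ) (n : ℕ) : cfNum a (n + 2) = a (n + 2) * cfNum a (n + 1) + cfNum a n := rfl

lemma cf_basic {a : ℕ → ℕ} (ha : ∀ n, 1 ≤ n → 1 ≤ a n) (n : ℕ) : (1 ≤ cfDen a n ∧ cfNum a n ≤ cfDen a n) ∧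
    (1 ≤ cfDen a (n + 1) ∧ cfNum a (n + 1) ≤ cfDen a (n + 1)) ∧ cfDen a n ≤ cfDen a (n + 1) ∧ n ≤ cfDen a n ∧ n + 1 ≤ cfDen a (n + 1) := by
  induction n with
  | zero =>
    have := ha 1 le_rfl
    simp [cfDen, cfNum]; omega
  | succ n ih =>
    obtain ⟨⟨h1, h2⟩, ⟨h3, h4⟩, h5, h6, h7⟩ := ih
    have h8 := ha (n + 2) (by omega)
    have e1 := cfDen_rec a n
    have e2 := cfNum_rec a n
    have m1 : 1 * cfDen a (n + 1) ≤ a (n + 2) * cfDen a (n + 1) := Nat.mul_le_mul_right _ h8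
    have m2 : a (n + 2) * cfNum a (n + 1) ≤ a (n + 2) * cfDen a (n + 1) := Nat.mul_le_mul_left _ h4
    have e3 : n + 1 + 1 = n + 2 := rfl
    rw [e3, e1, e2]
    refine ⟨⟨h3, h4⟩, ⟨?_, ?_⟩, ?_, h7, ?_⟩ <;> omega

lemma den_pos {a : ℕ → ℕ} (ha : ∀ n, 1 ≤ n → 1 ≤ a n) (n : ℕ) : 1 ≤ cfDen a n := (cf_basic ha n).1.1
lemma num_le {a : ℕ → ℕ} (ha : ∀ n, 1 ≤ n → 1 ≤ a n) (n : ℕ) : cfNum a n ≤ cfDen a n := (cf_basic ha n).1.2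
lemma den_mono {a : ℕ → ℕ} (ha : ∀ n, 1 ≤ n → 1 ≤ a n) : Monotone (cfDen a) :=
  monotone_nat_of_le_succ fun n => (cf_basic ha n).2.2.1
lemma le_den {a : ℕ → ℕ} (ha : ∀ n, 1 ≤ n → 1 ≤ a n) (n : ℕ) : n ≤ cfDen a n := (cf_basic ha n).2.2.2.1

lemma den_posR {a : ℕ → ℕ} (ha : ∀ n, 1 ≤ n → 1 ≤ a n) (n : ℕ) : (0 : ℝ) < cfDen a n := by
  exact_mod_cast den_pos ha n

/-- signed error -/
noncomputable def eE (a : ℕ → ℕ) (α : ℝ) (n : ℕ) : ℝ := (-1) ^ n * (cfDen a n * α - cfNum a n)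

lemma eE_rec (a : ℕ → ℕ) (α : ℝ) (n : ℕ) : eE a α n = a (n + 2) * eE a α (n + 1) + eE a α (n + 2) := by
  simp only [eE, cfDen_rec, cfNum_rec, pow_succ]
  push_cast
  ring

lemma eE_id (a : ℕ → ℕ) (α : ℝ) (n : ℕ) : cfDen a (n + 1) * eE a α n + cfDen a n * eE a α (n + 1) = 1 := by
  have h := cf_det a n
  have h2 : ((-1 : ℝ) ^ n) * (-1) ^ n = 1 := by rw [← mul_pow]; norm_num
  have e : cfDen a (n + 1) * eE a α n + cfDen a n * eE a α (n + 1) =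
      -((-1) ^ n * ((cfDen a (n + 1) : ℝ) * cfNum a n - cfNum a (n + 1) * cfDen a n)) := by
    simp only [eE, pow_succ]; ring
  rw [e, h, pow_succ]
  linarith

lemma cross (a : ℕ → ℕ) (n j : ℕ) : 0 ≤ (-1 : ℝ) ^ n * (cfDen a n * cfNum a (n + j) - cfNum a n * cfDen a (n + j)) ∧
    0 ≤ (-1 : ℝ) ^ n * (cfDen a n * cfNum a (n + (j + 1)) - cfNum a n * cfDen a (n + (j + 1))) := by
  induction j with
  | zero =>
    have h := cf_det a n
    have h2 : ((-1 : ℝ) ^ n) * (-1) ^ n = 1 := by rw [← mul_pow]; norm_num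
    constructor
    · simp [mul_comm]
    · rw [pow_succ] at h
      have : (-1 : ℝ) ^ n * (cfDen a n * cfNum a (n + (0 + 1)) - cfNum a n * cfDen a (n + (0 + 1))) = 1 := by
        have : (cfDen a n * cfNum a (n + (0 + 1)) - cfNum a n * cfDen a (n + (0 + 1)) : ℝ) = (-1) ^ n := by
          simp only [zero_add]; linarith
        rw [this, h2]
      linarith
  | succ j ih =>
    refine ⟨ih.2, ?_⟩
    have e : n + (j + 1 + 1) = (n + j) + 2 := by ring
    have e2 : n + (j + 1) = (n + j) + 1 := by ring
    rw [e2] at ih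
    rw [e, cfDen_rec, cfNum_rec]
    have h1 := mul_nonneg (Nat.cast_nonneg (α := ℝ) (a (n + j + 2))) ih.2
    have h2 := ih.1
    push_cast
    linarith

lemma eE_nonneg {a : ℕ → ℕ} (ha : ∀ n, 1 ≤ n → 1 ≤ a n) {α : ℝ}
    (hα : Tendsto (fun n => (cfNum a n : ℝ) / cfDen a n) atTop (𝓝 α)) (n : ℕ) : 0 ≤ eE a α n := by
  have h1 : Tendsto (fun j => (-1 : ℝ) ^ n * (cfDen a n * ((cfNum a j : ℝ) / cfDen a j) - cfNum a n)) atTop (𝓝 (eE a α n)) :=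
    ((hα.const_mul _).sub_const _).const_mul _
  refine ge_of_tendsto h1 ?_
  filter_upwards [eventually_ge_atTop n] with j hj
  obtain ⟨i, rfl⟩ := Nat.exists_eq_add_of_le hj
  have h2 := (cross a n i).1
  have h3 := den_posR ha (n + i)
  have : (-1 : ℝ) ^ n * (cfDen a n * ((cfNum a (n + i) : ℝ) / cfDen a (n + i)) - cfNum a n) =
    ((-1 : ℝ) ^ n * (cfDen a n * cfNum a (n + i) - cfNum a n * cfDen a (n + i))) / cfDen a (n + i) := by
    field_simp
  rw [this]
  positivity

lemma eE_pos {a : ℕ → ℕ} (ha : ∀ n, 1 ≤ n → 1 ≤ a n) {α : ℝ}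
    (hα : Tendsto (fun n => (cfNum a n : ℝ) / cfDen a n) atTop (𝓝 α)) (n : ℕ) : 0 < eE a α n := by
  refine lt_of_le_of_ne (eE_nonneg ha hα n) fun h0 => ?_
  have h1 := eE_nonneg ha hα (n + 1)
  have h2 := eE_nonneg ha hα (n + 2)
  have h3 := eE_rec a α n
  have h4 : (1 : ℝ) ≤ a (n + 2) := by exact_mod_cast ha (n + 2) (by omega)
  have h5 := mul_le_mul_of_nonneg_right h4 h1
  have h6 : eE a α (n + 1) = 0 := by linarith
  have h7 := eE_id a α n
  rw [← h0, h6] at h7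
  simp at h7

lemma eE_le {a : ℕ → ℕ} (ha : ∀ n, 1 ≤ n → 1 ≤ a n) {α : ℝ}
    (hα : Tendsto (fun n => (cfNum a n : ℝ) / cfDen a n) atTop (𝓝 α)) (n : ℕ) : eE a α n * cfDen a (n + 1) ≤ 1 := by
  have h7 := eE_id a α n
  have := mul_nonneg (den_posR ha n).le (eE_nonneg ha hα (n + 1))
  linarith

lemma eE_abs (a : ℕ → ℕ) (α : ℝ) (n : ℕ) (h : 0 ≤ eE a α n) : |cfDen a n * α - cfNum a n| = eE a α n := by
  rw [← abs_of_nonneg h, eE, abs_mul, abs_pow]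
  simp

lemma eE_lt {a : ℕ → ℕ} (ha : ∀ n, 1 ≤ n → 1 ≤ a n) {α : ℝ}
    (hα : Tendsto (fun n => (cfNum a n : ℝ) / cfDen a n) atTop (𝓝 α)) (n : ℕ) : eE a α (n + 1) < eE a α n := by
  have h1 := eE_pos ha hα (n + 1)
  have h2 := eE_pos ha hα (n + 2)
  have h3 := eE_rec a α n
  have h4 : (1 : ℝ) ≤ a (n + 2) := by exact_mod_cast ha (n + 2) (by omega)
  have h5 := mul_le_mul_of_nonneg_right h4 h1.le
  linarith

lemma cf_irr {a : ℕ → ℕ} (ha : ∀ n, 1 ≤ n → 1 ≤ a n) {α : ℝ}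
    (hα : Tendsto (fun n => (cfNum a n : ℝ) / cfDen a n) atTop (𝓝 α)) (u v : ℤ) (h : (u : ℝ) + v * α = 0) : u = 0 ∧ v = 0 := by
  have hv : v = 0 := by
    by_contra hv
    have hv1 : (1 : ℝ) ≤ |(v : ℝ)| := by rw [← Int.cast_abs]; exact_mod_cast Int.one_le_abs hv
    set n := v.natAbs with hn
    have hvn : |(v : ℝ)| = n := by rw [hn, Nat.cast_natAbs]; simp
    have h1 := eE_pos ha hα n
    have h2 := eE_le ha hα n
    have h3 : (n + 1 : ℝ) ≤ cfDen a (n + 1) := by exact_mod_cast le_den ha (n + 1)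
    have h4 : |(v : ℝ)| * eE a α n = |((-(cfDen a n * u + v * cfNum a n) : ℤ) : ℝ)| := by
      rw [← eE_abs a α n h1.le, ← abs_mul]
      congr 1
      push_cast
      have : (v : ℝ) * α = -u := by linarith
      calc _ = cfDen a n * ((v : ℝ) * α) - v * cfNum a n := by ring
        _ = _ := by rw [this]; ring
    have h5 : |(v : ℝ)| * eE a α n < 1 := by
      rw [hvn]
      have := mul_le_mul_of_nonneg_left h3 h1.le
      linarith
    have h6 : 0 < |(v : ℝ)| * eE a α n := mul_pos (by linarith) h1
    rw [h4, ← Int.cast_abs] at h5 h6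
    have h7 : |(-(cfDen a n * u + v * cfNum a n) : ℤ)| < 1 := by exact_mod_cast h5
    have h8 : 0 < |(-(cfDen a n * u + v * cfNum a n) : ℤ)| := by exact_mod_cast h6
    omega
  subst hv
  simp at h
  exact ⟨h, rfl⟩

end SST

end

section
open MvPolynomial Filter Topology

namespace SST

noncomputable def tE (a : ℕ → ℕ) (α : ℝ) (n : ℕ) : ℝ := eE a α n / eE a α (n + 1)

lemma tE_step {a : ℕ → ℕ} (ha : ∀ n, 1 ≤ n → 1 ≤ a n) {α : ℝ}
    (hα : Tendsto (fun n => (cfNum a n : ℝ) / cfDen a n) atTop (𝓝 α)) (n : ℕ) :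
    a (n + 2) = ⌊tE a α n⌋₊ ∧ tE a α (n + 1) = (tE a α n - a (n + 2))⁻¹ := by
  have h1 := eE_pos ha hα (n + 1)
  have h2 := eE_pos ha hα (n + 2)
  have h3 := eE_rec a α n
  have h4 := eE_lt ha hα (n + 1)
  have e : tE a α n = a (n + 2) + eE a α (n + 2) / eE a α (n + 1) := by
    rw [tE, h3]; field_simp
  have p1 : 0 < eE a α (n + 2) / eE a α (n + 1) := by positivity
  have p2 : eE a α (n + 2) / eE a α (n + 1) < 1 := by rw [div_lt_one h1]; exact h4
  constructor
  · symm
    rw [Nat.floor_eq_iff (by rw [e]; positivity)]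
    constructor <;> linarith
  · rw [e, add_sub_cancel_left, inv_div, tE]

lemma tE_per {a : ℕ → ℕ} (ha : ∀ n, 1 ≤ n → 1 ≤ a n) {α : ℝ}
    (hα : Tendsto (fun n => (cfNum a n : ℝ) / cfDen a n) atTop (𝓝 α)) (n m : ℕ) (hnm : n < m) (h : tE a α n = tE a α m) :
    EventuallyPeriodic a := by
  have key : ∀ j, tE a α (n + j) = tE a α (m + j) := by
    intro j
    induction j with
    | zero => exact h
    | succ j ih =>
      have h1 := tE_step ha hα (n + j)
      have h2 := tE_step ha hα (m + j)
      rw [← add_assoc, ← add_assoc, h1.2, h2.2, h1.1, h2.1, ih]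
  refine ⟨n + 2, m - n, by omega, fun k hk => ?_⟩
  obtain ⟨j, rfl⟩ := Nat.exists_eq_add_of_le hk
  have h1 := tE_step ha hα (n + j)
  have h2 := tE_step ha hα (m + j)
  have e1 : n + 2 + j + (m - n) = m + j + 2 := by omega
  have e2 : n + 2 + j = n + j + 2 := by omega
  rw [e1, e2, h1.1, h2.1, key]

lemma quad_fin (A B C : ℝ) (hA : A ≠ 0) : {t : ℝ | A * t ^ 2 + B * t + C = 0}.Finite := by
  by_cases h : ∃ t0, A * t0 ^ 2 + B * t0 + C = 0
  · obtain ⟨t0, h0⟩ := h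
    refine Set.Finite.subset (Set.toFinite {t0, -B / A - t0}) fun t ht => ?_
    simp only [Set.mem_setOf_eq] at ht
    have : (t - t0) * (A * (t + t0) + B) = 0 := by linear_combination ht - h0
    rcases mul_eq_zero.1 this with h | h
    · left; linarith
    · right
      simp only [Set.mem_singleton_iff]
      field_simp
      linarith
  · convert Set.finite_empty (α := ℝ)
    ext t
    simp only [Set.mem_setOf_eq, Set.mem_empty_iff_false, iff_false]
    exact fun ht => h ⟨t, ht⟩

lemma lagrange {a : ℕ → ℕ} (ha : ∀ n, 1 ≤ n → 1 ≤ a n) {α : ℝ}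
    (hα : Tendsto (fun n => (cfNum a n : ℝ) / cfDen a n) atTop (𝓝 α)) (A B C : ℤ)
    (hne : ¬ (A = 0 ∧ B = 0 ∧ C = 0)) (hq : (A : ℝ) * α ^ 2 + B * α + C = 0) : EventuallyPeriodic a := by
  set G : ℝ := |2 * A * α + B| with hG
  have hG0 : 0 ≤ G := abs_nonneg _
  obtain ⟨K, hK⟩ := exists_nat_ge (2 * G + 2 * |(A : ℝ)|)
  have hA0 := abs_nonneg (A : ℝ)
  let S : Set ℝ := ⋃ x ∈ (((Finset.Icc (-(K : ℤ)) K ×ˢ Finset.Icc (-(K : ℤ)) K ×ˢ Finset.Icc (-(K : ℤ)) K).filter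
    fun x => x.1 ≠ 0 : Finset (ℤ × ℤ × ℤ)) : Set (ℤ × ℤ × ℤ)),
      {t : ℝ | (x.1 : ℝ) * t ^ 2 + (x.2.1 : ℝ) * t + (x.2.2 : ℝ) = 0}
  have hS : S.Finite := by
    refine Set.Finite.biUnion (Finset.finite_toSet _) fun x hx => quad_fin _ _ _ ?_
    have := (Finset.mem_filter.1 (Finset.mem_coe.1 hx)).2
    exact_mod_cast this
  have hmem : ∀ n, tE a α n ∈ S := by
    intro n
    have p0 := eE_pos ha hα n
    have p1 := eE_pos ha hα (n + 1)
    have l0 := eE_le ha hα n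
    have l1 := eE_le ha hα (n + 1)
    have b0 := eE_abs a α n p0.le
    have b1 := eE_abs a α (n + 1) p1.le
    have q0 := den_posR ha n
    have q1 := den_posR ha (n + 1)
    have q1' : (1 : ℝ) ≤ cfDen a (n + 1) := by exact_mod_cast den_pos ha (n + 1)
    have q01 : (cfDen a n : ℝ) ≤ cfDen a (n + 1) := by exact_mod_cast den_mono ha (Nat.le_succ n)
    have q12 : (cfDen a (n + 1) : ℝ) ≤ cfDen a (n + 2) := by exact_mod_cast den_mono ha (Nat.le_succ (n + 1))
    have lt := eE_lt ha hα n
    have hrel : eE a α n = tE a α n * eE a α (n + 1) := by rw [tE]; field_simp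
    have hrel' : (cfDen a n * α - cfNum a n : ℝ) = -(tE a α n * (cfDen a (n + 1) * α - cfNum a (n + 1))) := by
      have h2 : ((-1 : ℝ) ^ n) * (-1) ^ n = 1 := by rw [← mul_pow]; norm_num
      rw [eE, eE, pow_succ] at hrel
      have := congrArg (fun z => (-1 : ℝ) ^ n * z) hrel
      linear_combination this + ((cfDen a n * α - cfNum a n : ℝ) * (-1) + -(tE a α n * (cfDen a (n + 1) * α - cfNum a (n + 1)))) * h2
    have e0 : eE a α n * cfDen a n ≤ 1 := le_trans (mul_le_mul_of_nonneg_left q01 p0.le) l0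
    have e1 : eE a α (n + 1) * cfDen a (n + 1) ≤ 1 := le_trans (mul_le_mul_of_nonneg_left q12 p1.le) l1
    have e10 : eE a α (n + 1) * cfDen a n ≤ 1 := le_trans (mul_le_mul_of_nonneg_left q01 p1.le) e1
    have s0 : eE a α n ≤ 1 := le_trans (le_mul_of_one_le_right p0.le q1') l0
    have s1 : eE a α (n + 1) ≤ 1 := by linarith
    generalize tE a α n = t at *
    generalize eE a α n = x0 at *
    generalize eE a α (n + 1) = x1 at *
    set D0 : ℝ := cfDen a n * α - cfNum a n with hD0
    set D1 : ℝ := cfDen a (n + 1) * α - cfNum a (n + 1) with hD1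
    have P0 : (cfNum a n : ℝ) = cfDen a n * α - D0 := by rw [hD0]; ring
    have P1 : (cfNum a (n + 1) : ℝ) = cfDen a (n + 1) * α - D1 := by rw [hD1]; ring
    have ineq : ∀ (c d e : ℝ), |c| ≤ 1 → |d| ≤ 1 → |e| ≤ 1 → |-((2 * A * α + B) * (c + d)) + 2 * A * e| ≤ K := by
      intro c d e hc hd he
      have h1 : |(2 * A * α + B) * (c + d)| ≤ G * 2 := by
        rw [abs_mul, ← hG]
        exact mul_le_mul_of_nonneg_left ((abs_add_le _ _).trans (by linarith)) hG0
      have h2 : |2 * (A : ℝ) * e| ≤ 2 * |(A : ℝ)| * 1 := by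
        rw [abs_mul, abs_mul, abs_two]
        exact mul_le_mul_of_nonneg_left he (by positivity)
      have h3 := abs_add_le (-((2 * A * α + B) * (c + d))) (2 * A * e)
      rw [abs_neg] at h3
      linarith
    have ineq2 : ∀ (c e : ℝ), |c| ≤ 1 → |e| ≤ 1 → |-((2 * A * α + B) * c) + A * e| ≤ K := by
      intro c e hc he
      have h1 : |(2 * A * α + B) * c| ≤ G * 1 := by
        rw [abs_mul, ← hG]
        exact mul_le_mul_of_nonneg_left hc hG0
      have h2 : |(A : ℝ) * e| ≤ |(A : ℝ)| * 1 := by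
        rw [abs_mul]
        exact mul_le_mul_of_nonneg_left he (by positivity)
      have h3 := abs_add_le (-((2 * A * α + B) * c)) (A * e)
      rw [abs_neg] at h3
      linarith
    have absq : ∀ (D x q : ℝ), |D| = x → 0 < q → x * q ≤ 1 → |q * D| ≤ 1 := by
      intro D x q h hq h1
      rw [abs_mul, h, abs_of_pos hq, mul_comm]; exact h1
    have absD : ∀ (D D' x x' : ℝ), |D| = x → |D'| = x' → x ≤ 1 → x' ≤ 1 → |D * D'| ≤ 1 := by
      intro D D' x x' h h' h1 h1'
      rw [abs_mul, h, h']
      exact mul_le_one₀ h1 (h' ▸ abs_nonneg _) h1'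
    let An : ℤ := A * cfNum a (n + 1) ^ 2 + B * (cfNum a (n + 1) * cfDen a (n + 1)) + C * cfDen a (n + 1) ^ 2
    let Cn : ℤ := A * cfNum a n ^ 2 + B * (cfNum a n * cfDen a n) + C * cfDen a n ^ 2
    let Bn : ℤ := 2 * A * (cfNum a n * cfNum a (n + 1)) + B * (cfNum a n * cfDen a (n + 1) + cfNum a (n + 1) * cfDen a n)
      + 2 * C * (cfDen a n * cfDen a (n + 1))
    have eA : (An : ℝ) = -((2 * A * α + B) * (cfDen a (n + 1) * D1)) + A * (D1 * D1) := by
      simp only [An]; push_cast; rw [P1]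
      linear_combination (cfDen a (n + 1) : ℝ) ^ 2 * hq
    have eC : (Cn : ℝ) = -((2 * A * α + B) * (cfDen a n * D0)) + A * (D0 * D0) := by
      simp only [Cn]; push_cast; rw [P0]
      linear_combination (cfDen a n : ℝ) ^ 2 * hq
    have eB : (Bn : ℝ) = -((2 * A * α + B) * (cfDen a n * D1 + cfDen a (n + 1) * D0)) + 2 * A * (D0 * D1) := by
      simp only [Bn]; push_cast; rw [P0, P1]
      linear_combination 2 * (cfDen a n : ℝ) * cfDen a (n + 1) * hq
    have bA : |(An : ℝ)| ≤ K := by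
      rw [eA]; exact ineq2 _ _ (absq _ _ _ b1 q1 e1) (absD _ _ _ _ b1 b1 s1 s1)
    have bC : |(Cn : ℝ)| ≤ K := by
      rw [eC]; exact ineq2 _ _ (absq _ _ _ b0 q0 e0) (absD _ _ _ _ b0 b0 s0 s0)
    have bB : |(Bn : ℝ)| ≤ K := by
      rw [eB]; exact ineq _ _ _ (absq _ _ _ b1 q0 e10) (absq _ _ _ b0 q1 l0) (absD _ _ _ _ b0 b1 s0 s1)
    have icc : ∀ z : ℤ, |(z : ℝ)| ≤ K → z ∈ Finset.Icc (-(K : ℤ)) K := by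
      intro z hz
      rw [← Int.cast_abs] at hz
      have : |z| ≤ K := by exact_mod_cast hz
      rw [Finset.mem_Icc]; exact abs_le.1 this
    have hAn : An ≠ 0 := by
      intro h0
      rw [h0] at eA
      have hD1 : D1 ≠ 0 := by rw [← abs_pos, b1]; exact p1
      have h1 : D1 * (((cfDen a (n + 1) * B + A * cfNum a (n + 1) : ℤ) : ℝ) + ((A * cfDen a (n + 1) : ℤ) : ℝ) * α) = 0 := by
        push_cast at eA ⊢
        rw [P1]
        linear_combination eA
      have h2 := cf_irr ha hα _ _ ((mul_eq_zero.1 h1).resolve_left hD1)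
      have hqz : (cfDen a (n + 1) : ℤ) ≠ 0 := by have := den_pos ha (n + 1); omega
      have hA : A = 0 := (mul_eq_zero.1 h2.2).resolve_right hqz
      have hB : B = 0 := by
        have := h2.1
        rw [hA, zero_mul, add_zero] at this
        exact (mul_eq_zero.1 this).resolve_left hqz
      refine hne ⟨hA, hB, ?_⟩
      rw [hA, hB] at hq
      simpa using hq
    simp only [S, Set.mem_iUnion]
    refine ⟨(An, Bn, Cn), ?_, ?_⟩
    · rw [Finset.mem_coe, Finset.mem_filter]
      simp only [Finset.mem_product]
      exact ⟨⟨icc _ bA, icc _ bB, icc _ bC⟩, hAn⟩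
    · simp only [Set.mem_setOf_eq]
      rw [eA, eB, eC, hrel']
      have hX : (cfNum a n + t * cfNum a (n + 1) : ℝ) = α * (cfDen a n + t * cfDen a (n + 1)) := by
        rw [P0, P1]; linear_combination -hrel'
      ring
  by_contra hper
  have hinj : Function.Injective (tE a α) := by
    intro n m h
    by_contra hne
    rcases lt_or_gt_of_ne hne with h1 | h1
    · exact hper (tE_per ha hα n m h1 h)
    · exact hper (tE_per ha hα m n h1 h.symm)
  exact Set.infinite_of_injective_forall_mem hinj hmem hS

end SST

end

section
open MvPolynomial Filter Topology

namespace SST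

lemma den_low {a : ℕ → ℕ} (ha : ∀ n, 1 ≤ n → 1 ≤ a n) (n : ℕ) :
    (3 / 2 : ℝ) ^ n ≤ 2 * cfDen a n ∧ (3 / 2 : ℝ) ^ (n + 1) ≤ 2 * cfDen a (n + 1) := by
  induction n with
  | zero =>
    have h1 : (1 : ℝ) ≤ cfDen a 0 := by exact_mod_cast den_pos ha 0
    have h2 : (1 : ℝ) ≤ cfDen a 1 := by exact_mod_cast den_pos ha 1
    constructor
    · simp; linarith
    · norm_num; linarith
  | succ n ih =>
    refine ⟨ih.2, ?_⟩
    have h1 : (1 : ℝ) ≤ a (n + 2) := by exact_mod_cast ha (n + 2) (by omega)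
    have h2 := mul_le_mul_of_nonneg_right h1 (den_posR ha (n + 1)).le
    have h3 : (cfDen a (n + 1 + 1) : ℝ) = a (n + 2) * cfDen a (n + 1) + cfDen a n := by
      rw [cfDen_rec]; push_cast; ring
    rw [h3]
    have h4 : (0 : ℝ) < (3 / 2) ^ n := by positivity
    have h5 := ih.1
    have h6 := ih.2
    rw [pow_succ] at h6
    rw [pow_succ, pow_succ]
    linarith

lemma growth {a : ℕ → ℕ} (ha : ∀ n, 1 ≤ n → 1 ≤ a n)
    (hbdd : ∃ C : ℝ, ∀ ℓ : ℕ, 1 ≤ ℓ → (cfDen a ℓ : ℝ) ^ (1 / (ℓ : ℝ)) ≤ C)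
    (M m : ℝ)
    (hM : M = limsup (fun ℓ : ℕ => (cfDen a ℓ : ℝ) ^ (1 / (ℓ : ℝ))) atTop)
    (hm : m = liminf (fun ℓ : ℕ => (cfDen a ℓ : ℝ) ^ (1 / (ℓ : ℝ))) atTop)
    (w' : ℝ) (hw' : 0 < w') (hww' : w' > 2 * (Real.log M / Real.log m) - 1) :
    ∃ a0 b K : ℝ, 1 ≤ K ∧ 0 < b ∧ 2 * b < a0 * (1 + w') ∧ (∀ ℓ, (cfDen a ℓ : ℝ) ≤ K * Real.exp (b * ℓ)) ∧
      ∀ᶠ ℓ : ℕ in atTop, Real.exp (a0 * ℓ) ≤ cfDen a ℓ := by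
  set u : ℕ → ℝ := fun ℓ : ℕ => (cfDen a ℓ : ℝ) ^ (1 / (ℓ : ℝ)) with hu
  have hupow : ∀ ℓ : ℕ, 1 ≤ ℓ → u ℓ ^ ℓ = cfDen a ℓ := by
    intro ℓ hl
    rw [hu]
    simp only [one_div]
    exact Real.rpow_inv_natCast_pow (Nat.cast_nonneg _) (by omega)
  have hu0 : ∀ ℓ, 0 ≤ u ℓ := fun ℓ => Real.rpow_nonneg (Nat.cast_nonneg _) _
  have hlow : ∀ᶠ ℓ in atTop, (5 / 4 : ℝ) ≤ u ℓ := by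
    have ht : Tendsto (fun n : ℕ => (6 / 5 : ℝ) ^ n) atTop atTop := tendsto_pow_atTop_atTop_of_one_lt (by norm_num)
    filter_upwards [eventually_ge_atTop 1, ht.eventually_ge_atTop 2] with ℓ hl h2
    by_contra hlt
    have h3 : u ℓ ^ ℓ < (5 / 4) ^ ℓ := pow_lt_pow_left₀ (not_le.1 hlt) (hu0 ℓ) (by omega)
    rw [hupow ℓ hl] at h3
    have h4 := (den_low ha ℓ).1
    have h5 : (3 / 2 : ℝ) ^ ℓ = (6 / 5) ^ ℓ * (5 / 4) ^ ℓ := by rw [← mul_pow]; norm_num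
    have h6 := mul_le_mul_of_nonneg_right h2 (by positivity : (0 : ℝ) ≤ (5 / 4) ^ ℓ)
    linarith
  obtain ⟨C, hC⟩ := hbdd
  have hup : ∀ᶠ ℓ in atTop, u ℓ ≤ C := by
    filter_upwards [eventually_ge_atTop 1] with ℓ hl
    exact hC ℓ hl
  have bU : IsBoundedUnder (· ≤ ·) atTop u := ⟨C, by simpa [eventually_map] using hup⟩
  have bL : IsBoundedUnder (· ≥ ·) atTop u := ⟨5 / 4, by simpa [eventually_map] using hlow⟩
  have hm1 : 5 / 4 ≤ m := by rw [hm]; exact le_liminf_of_le bU.isCoboundedUnder_ge hlow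
  have hmM : m ≤ M := by rw [hm, hM]; exact liminf_le_limsup bU bL
  have lm : 0 < Real.log m := Real.log_pos (by linarith)
  have lM : 0 < Real.log M := Real.log_pos (by linarith)
  have hD : 0 < (1 + w') * Real.log m - 2 * Real.log M := by
    have h1 : 2 * (Real.log M / Real.log m) < 1 + w' := by linarith
    have h2 := mul_lt_mul_of_pos_right h1 lm
    have h3 : 2 * (Real.log M / Real.log m) * Real.log m = 2 * Real.log M := by field_simp
    linarith
  set Δ := (1 + w') * Real.log m - 2 * Real.log M with hΔ
  set ε := Δ / (4 + w') with hε
  have hε0 : 0 < ε := by positivity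
  have hε1 : ε * (4 + w') = Δ := by rw [hε]; field_simp
  have hMb : limsup u atTop < Real.exp (Real.log M + ε) := by
    rw [← hM, Real.exp_add, Real.exp_log (by linarith)]
    have := Real.one_lt_exp_iff.2 hε0
    exact lt_mul_of_one_lt_right (by linarith) this
  have hma : Real.exp (Real.log m - ε) < liminf u atTop := by
    rw [← hm, sub_eq_add_neg, Real.exp_add, Real.exp_log (by linarith)]
    have : Real.exp (-ε) < 1 := by rw [← Real.exp_zero]; exact Real.exp_lt_exp.2 (by linarith)
    exact mul_lt_of_lt_one_right (by linarith) this
  have E1 := eventually_lt_of_limsup_lt hMb bU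
  have E2 := eventually_lt_of_lt_liminf hma bL
  obtain ⟨L, hL⟩ := eventually_atTop.1 E1
  refine ⟨Real.log m - ε, Real.log M + ε, cfDen a (L + 1), by exact_mod_cast den_pos ha (L + 1), by linarith, by linarith, ?_, ?_⟩
  · intro ℓ
    have k1 : (1 : ℝ) ≤ cfDen a (L + 1) := by exact_mod_cast den_pos ha (L + 1)
    rcases le_total ℓ (L + 1) with h | h
    · have h1 : (cfDen a ℓ : ℝ) ≤ cfDen a (L + 1) := by exact_mod_cast den_mono ha h
      have h2 : 1 ≤ Real.exp ((Real.log M + ε) * ℓ) := Real.one_le_exp (by positivity)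
      exact h1.trans (le_mul_of_one_le_right (by linarith) h2)
    · have h1 : u ℓ ^ ℓ ≤ Real.exp (Real.log M + ε) ^ ℓ := pow_le_pow_left₀ (hu0 ℓ) (hL ℓ (by omega)).le _
      rw [hupow ℓ (by omega), ← Real.exp_nat_mul, mul_comm (ℓ : ℝ)] at h1
      exact h1.trans (le_mul_of_one_le_left (Real.exp_pos _).le k1)
  · filter_upwards [E2, eventually_ge_atTop 1] with ℓ h hl
    have h1 : Real.exp (Real.log m - ε) ^ ℓ ≤ u ℓ ^ ℓ := pow_le_pow_left₀ (Real.exp_pos _).le h.le _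
    rwa [hupow ℓ hl, ← Real.exp_nat_mul, mul_comm (ℓ : ℝ)] at h1

lemma growth2 {a : ℕ → ℕ} (ha : ∀ n, 1 ≤ n → 1 ≤ a n)
    (w' : ℝ) (hw' : 0 < w') (a0 b K : ℝ) (hK : 1 ≤ K) (hb : 0 < b) (hab : 2 * b < a0 * (1 + w'))
    (h1 : ∀ ℓ, (cfDen a ℓ : ℝ) ≤ K * Real.exp (b * ℓ))
    (h2 : ∀ᶠ ℓ : ℕ in atTop, Real.exp (a0 * ℓ) ≤ cfDen a ℓ) :
    ∃ δ : ℝ, 0 < δ ∧ ∀ᶠ r : ℕ in atTop, ∀ t : ℕ, (1 + w') * t ≤ r →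
      32 * (cfDen a t : ℝ) ^ 4 / (cfDen a r : ℝ) ^ 2 ≤ Real.exp (-(δ * r)) := by
  set δ := a0 - 2 * b / (1 + w') with hδ
  have hδ0 : 0 < δ := by
    rw [hδ, sub_pos, div_lt_iff₀ (by linarith)]; exact hab
  refine ⟨δ, hδ0, ?_⟩
  have ht : Tendsto (fun r : ℕ => Real.exp (δ * r)) atTop atTop :=
    Real.tendsto_exp_atTop.comp ((tendsto_natCast_atTop_atTop).const_mul_atTop hδ0)
  filter_upwards [h2, ht.eventually_ge_atTop (32 * K ^ 4)] with r hr hK4 t htr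
  have q4 : (cfDen a t : ℝ) ^ 4 ≤ K ^ 4 * Real.exp (4 * (b * t)) := by
    have := pow_le_pow_left₀ (Nat.cast_nonneg _) (h1 t) 4
    rw [mul_pow, ← Real.exp_nat_mul] at this
    exact_mod_cast this
  have q2 : Real.exp (2 * (a0 * r)) ≤ (cfDen a r : ℝ) ^ 2 := by
    have := pow_le_pow_left₀ (Real.exp_pos _).le hr 2
    rw [← Real.exp_nat_mul] at this
    exact_mod_cast this
  have hbt : 4 * (b * t) ≤ 2 * (a0 * r) - 2 * (δ * r) := by
    have e : 2 * (a0 * r) - 2 * (δ * r) = 4 * (b / (1 + w')) * r := by rw [hδ]; ring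
    have e2 : 4 * (b * t) = 4 * (b / (1 + w')) * ((1 + w') * t) := by
      have : (1 + w') ≠ 0 := by linarith
      field_simp
    rw [e, e2]
    exact mul_le_mul_of_nonneg_left htr (by positivity)
  rw [div_le_iff₀ (by have := den_posR ha r; positivity)]
  calc 32 * (cfDen a t : ℝ) ^ 4 ≤ 32 * (K ^ 4 * Real.exp (4 * (b * t))) := by linarith
    _ = (32 * K ^ 4) * Real.exp (4 * (b * t)) := by ring
    _ ≤ Real.exp (δ * r) * Real.exp (2 * (a0 * r) - 2 * (δ * r)) := by
        apply mul_le_mul hK4 (Real.exp_le_exp.2 hbt) (Real.exp_pos _).le (Real.exp_pos _).le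
    _ = Real.exp (-(δ * r)) * Real.exp (2 * (a0 * r)) := by rw [← Real.exp_add, ← Real.exp_add]; congr 1; ring
    _ ≤ _ := mul_le_mul_of_nonneg_left q2 (Real.exp_pos _).le

end SST

end

section
open MvPolynomial Filter Topology

namespace SST

def lm (L : List ℕ) : Matrix (Fin 2) (Fin 2) ℤ := (L.map lM).prod

lemma lm_append (L1 L2 : List ℕ) : lm (L1 ++ L2) = lm L1 * lm L2 := by simp [lm]

lemma lM_tr (l : ℕ) : (lM l).transpose = lM l := by
  ext i j
  fin_cases i <;> fin_cases j <;> rfl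

lemma lm_reverse (L : List ℕ) : lm L.reverse = (lm L).transpose := by
  rw [lm, lm, Matrix.transpose_list_prod, List.map_reverse, List.map_map]
  congr 3
  funext l
  exact (lM_tr l).symm

lemma pre_append {L1 L2 : List ℕ} {a : ℕ → ℕ} (h : IsPrefixOfSeq (L1 ++ L2) a) : IsPrefixOfSeq L1 a := by
  intro i hi
  rw [← h i (by rw [List.length_append]; omega), List.getD_append _ _ _ _ hi]

lemma lm_pre (a : ℕ → ℕ) (L : List ℕ) (h : IsPrefixOfSeq L a) : lm L = cm a L.length := by
  induction L using List.reverseRecOn with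
  | nil => simp [lm, cm]
  | append_singleton L x ih =>
    have h1 := ih (pre_append h)
    have h2 := h L.length (by simp)
    rw [List.getD_append_right _ _ _ _ le_rfl] at h2
    simp only [Nat.sub_self, List.getD_cons_zero] at h2
    rw [lm_append, h1, List.length_append, List.length_singleton, cm, ← h2]
    simp [lm]

lemma pal_id (a : ℕ → ℕ) (U V W : List ℕ) (h : IsPrefixOfSeq (W ++ U ++ V ++ U.reverse) a) :
    cm a (W ++ U ++ V).length * (cm a (W ++ U).length).transpose =
      cm a (W ++ U ++ V ++ U.reverse).length * (cm a W.length).transpose := by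
  have h1 := pre_append h
  have h2 := pre_append h1
  have h3 := pre_append h2
  rw [← lm_pre a _ h, ← lm_pre a _ h1, ← lm_pre a _ h2, ← lm_pre a _ h3]
  rw [lm_append (W ++ U ++ V), lm_reverse, lm_append W U, Matrix.transpose_mul, Matrix.mul_assoc]

lemma cm_bd {a : ℕ → ℕ} (ha : ∀ n, 1 ≤ n → 1 ≤ a n) {α : ℝ}
    (hα : Tendsto (fun n => (cfNum a n : ℝ) / cfDen a n) atTop (𝓝 α)) (n : ℕ) :
    ((cm a n 0 0 : ℤ) : ℝ) = cfDen a n ∧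
    (0 ≤ ((cm a n 0 1 : ℤ) : ℝ) ∧ ((cm a n 0 1 : ℤ) : ℝ) ≤ cfDen a n) ∧
    (0 ≤ ((cm a n 1 0 : ℤ) : ℝ) ∧ ((cm a n 1 0 : ℤ) : ℝ) ≤ cfDen a n) ∧
    (0 ≤ ((cm a n 1 1 : ℤ) : ℝ) ∧ ((cm a n 1 1 : ℤ) : ℝ) ≤ cfDen a n) ∧
    |α * ((cm a n 0 0 : ℤ) : ℝ) - ((cm a n 1 0 : ℤ) : ℝ)| ≤ 1 / cfDen a n ∧
    |α * ((cm a n 0 1 : ℤ) : ℝ) - ((cm a n 1 1 : ℤ) : ℝ)| ≤ 1 / cfDen a n := by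
  have gen : ∀ n, |α * (cfDen a n : ℝ) - cfNum a n| ≤ 1 / cfDen a (n + 1) := by
    intro n
    rw [mul_comm, eE_abs a α n (eE_nonneg ha hα n), le_div_iff₀ (den_posR ha _)]
    exact eE_le ha hα n
  have gen2 : ∀ n, |α * (cfDen a n : ℝ) - cfNum a n| ≤ 1 / cfDen a n := by
    intro n
    refine (gen n).trans (one_div_le_one_div_of_le (den_posR ha n) ?_)
    exact_mod_cast den_mono ha (Nat.le_succ n)
  have hnum : (cfNum a n : ℝ) ≤ cfDen a n := by exact_mod_cast num_le ha n
  rw [cm00, cm10]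
  refine ⟨by simp, ?_, ⟨by positivity, by exact_mod_cast hnum⟩, ?_, by exact_mod_cast gen2 n, ?_⟩
  · cases n with
    | zero => simp [cm]
    | succ n =>
      rw [cm01]
      exact ⟨by positivity, by exact_mod_cast den_mono ha (Nat.le_succ n)⟩
  · cases n with
    | zero => simp [cm, cfDen]
    | succ n =>
      rw [cm11]
      exact ⟨by positivity, by exact_mod_cast (num_le ha n).trans (den_mono ha (Nat.le_succ n))⟩
  · cases n with
    | zero => simp [cm, cfDen]
    | succ n =>
      rw [cm01, cm11]
      exact_mod_cast gen n

lemma pal_b {a : ℕ → ℕ} (ha : ∀ n, 1 ≤ n → 1 ≤ a n) {α : ℝ}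
    (hα : Tendsto (fun n => (cfNum a n : ℝ) / cfDen a n) atTop (𝓝 α)) (t r s N : ℕ) (htr : t ≤ r) (hrs : r ≤ s) (hsN : s ≤ N)
    (X : Matrix (Fin 2) (Fin 2) ℤ) (h1 : X = cm a s * (cm a r).transpose) (h2 : X = cm a N * (cm a t).transpose) :
    0 < (X 0 0 : ℝ) ∧ |α * X 0 0 - X 1 0| ≤ 2 * cfDen a t / cfDen a N ∧
    |α * X 0 1 - X 1 1| ≤ 2 * cfDen a t / cfDen a N ∧
    |α * X 0 0 - X 0 1| ≤ 4 * cfDen a t * cfDen a N / (cfDen a r : ℝ) ^ 2 ∧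
    |(X 0 0 : ℝ)| ≤ 2 * cfDen a t * cfDen a N ∧ |(X 0 1 : ℝ)| ≤ 2 * cfDen a t * cfDen a N ∧
    (cfDen a r : ℝ) ^ 2 ≤ 2 * cfDen a t * cfDen a N ∧
    |α * X 0 0 - X 1 0| ≤ 2 / cfDen a r * X 0 0 ∧
    |α * X 0 1 - X 1 1| ≤ 2 / cfDen a r * X 0 0 ∧
    |α * X 0 0 - X 0 1| ≤ 2 / cfDen a r * X 0 0 := by
  obtain ⟨t1, ⟨t2, t2'⟩, ⟨t3, t3'⟩, ⟨t4, t4'⟩, t5, t6⟩ := cm_bd ha hα t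
  obtain ⟨r1, ⟨r2, r2'⟩, ⟨r3, r3'⟩, ⟨r4, r4'⟩, r5, r6⟩ := cm_bd ha hα r
  obtain ⟨s1, ⟨s2, s2'⟩, ⟨s3, s3'⟩, ⟨s4, s4'⟩, s5, s6⟩ := cm_bd ha hα s
  obtain ⟨n1, ⟨n2, n2'⟩, ⟨n3, n3'⟩, ⟨n4, n4'⟩, n5, n6⟩ := cm_bd ha hα N
  have qt : (1 : ℝ) ≤ cfDen a t := by exact_mod_cast den_pos ha t
  have qr : (1 : ℝ) ≤ cfDen a r := by exact_mod_cast den_pos ha r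
  have qs : (1 : ℝ) ≤ cfDen a s := by exact_mod_cast den_pos ha s
  have qN : (1 : ℝ) ≤ cfDen a N := by exact_mod_cast den_pos ha N
  have qrs : (cfDen a r : ℝ) ≤ cfDen a s := by exact_mod_cast den_mono ha hrs
  have qrN : (cfDen a r : ℝ) ≤ cfDen a N := by exact_mod_cast den_mono ha (hrs.trans hsN)
  have x00s : (X 0 0 : ℝ) = (cm a s 0 0 : ℝ) * cm a r 0 0 + cm a s 0 1 * cm a r 0 1 := by
    rw [h1]; simp [Matrix.mul_apply, Fin.sum_univ_two]
  have x01s : (X 0 1 : ℝ) = (cm a s 0 0 : ℝ) * cm a r 1 0 + cm a s 0 1 * cm a r 1 1 := by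
    rw [h1]; simp [Matrix.mul_apply, Fin.sum_univ_two]
  have x00 : (X 0 0 : ℝ) = (cm a N 0 0 : ℝ) * cm a t 0 0 + cm a N 0 1 * cm a t 0 1 := by
    rw [h2]; simp [Matrix.mul_apply, Fin.sum_univ_two]
  have x01 : (X 0 1 : ℝ) = (cm a N 0 0 : ℝ) * cm a t 1 0 + cm a N 0 1 * cm a t 1 1 := by
    rw [h2]; simp [Matrix.mul_apply, Fin.sum_univ_two]
  have x10 : (X 1 0 : ℝ) = (cm a N 1 0 : ℝ) * cm a t 0 0 + cm a N 1 1 * cm a t 0 1 := by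
    rw [h2]; simp [Matrix.mul_apply, Fin.sum_univ_two]
  have x11 : (X 1 1 : ℝ) = (cm a N 1 0 : ℝ) * cm a t 1 0 + cm a N 1 1 * cm a t 1 1 := by
    rw [h2]; simp [Matrix.mul_apply, Fin.sum_univ_two]
  have comb : ∀ (c d e f Y Z : ℝ), 0 ≤ c → c ≤ Y → 0 ≤ d → d ≤ Y → |e| ≤ Z → |f| ≤ Z → |c * e + d * f| ≤ 2 * (Y * Z) := by
    intro c d e f Y Z hc hc' hd hd' he hf
    have e1 : |c * e| ≤ Y * Z := by
      rw [abs_mul, abs_of_nonneg hc]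
      exact mul_le_mul hc' he (abs_nonneg _) (hc.trans hc')
    have e2 : |d * f| ≤ Y * Z := by
      rw [abs_mul, abs_of_nonneg hd]
      exact mul_le_mul hd' hf (abs_nonneg _) (hd.trans hd')
    have := abs_add_le (c * e) (d * f)
    linarith
  have A1 : |α * X 0 0 - X 1 0| ≤ 2 * cfDen a t / cfDen a N := by
    have := comb _ _ _ _ _ _ (by rw [t1]; positivity) t1.le t2 t2' n5 n6
    convert this using 1
    · rw [x00, x10]; congr 1; ring
    · ring
  have A2 : |α * X 0 1 - X 1 1| ≤ 2 * cfDen a t / cfDen a N := by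
    have := comb _ _ _ _ _ _ t3 t3' t4 t4' n5 n6
    convert this using 1
    · rw [x01, x11]; congr 1; ring
    · ring
  have A3 : |α * X 0 0 - X 0 1| ≤ 2 * cfDen a s / cfDen a r := by
    have := comb _ _ _ _ _ _ (by rw [s1]; positivity) s1.le s2 s2' r5 r6
    convert this using 1
    · rw [x00s, x01s]; congr 1; ring
    · ring
  have lows : (cfDen a s : ℝ) * cfDen a r ≤ X 0 0 := by
    rw [x00s, s1, r1]; have := mul_nonneg s2 r2; linarith
  have lowN : (cfDen a N : ℝ) * cfDen a t ≤ X 0 0 := by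
    rw [x00, n1, t1]; have := mul_nonneg n2 t2; linarith
  have t0 : |((cm a t 0 0 : ℤ) : ℝ)| ≤ cfDen a t := by rw [t1]; exact (abs_of_nonneg (by positivity)).le
  have B1 : |(X 0 0 : ℝ)| ≤ 2 * cfDen a t * cfDen a N := by
    have := comb _ _ _ _ _ _ (by rw [n1]; positivity) n1.le n2 n2' t0
      ((abs_of_nonneg t2).le.trans t2')
    rw [← x00] at this
    linarith
  have B2 : |(X 0 1 : ℝ)| ≤ 2 * cfDen a t * cfDen a N := by
    have := comb _ _ _ _ _ _ (by rw [n1]; positivity) n1.le n2 n2' ((abs_of_nonneg t3).le.trans t3')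
      ((abs_of_nonneg t4).le.trans t4')
    rw [← x01] at this
    linarith
  have hpos : 0 < (X 0 0 : ℝ) := lt_of_lt_of_le (by positivity) lows
  have B1' : (X 0 0 : ℝ) ≤ 2 * cfDen a t * cfDen a N := (le_abs_self _).trans B1
  have rr : (cfDen a r : ℝ) ^ 2 ≤ X 0 0 := by
    have := mul_le_mul_of_nonneg_right qrs (by linarith : (0 : ℝ) ≤ cfDen a r)
    rw [sq]; linarith
  have A3' : |α * X 0 0 - X 0 1| ≤ 2 * X 0 0 / (cfDen a r : ℝ) ^ 2 := by
    refine A3.trans ?_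
    rw [div_le_div_iff₀ (by positivity) (by positivity)]
    have := mul_le_mul_of_nonneg_right lows (by linarith : (0 : ℝ) ≤ cfDen a r)
    rw [sq]; linarith
  have C1 : 2 * (cfDen a t : ℝ) / cfDen a N ≤ 2 / cfDen a r * X 0 0 := by
    rw [div_mul_eq_mul_div, div_le_div_iff₀ (by positivity) (by positivity)]
    have g1 : (cfDen a t : ℝ) ≤ X 0 0 := le_trans (le_mul_of_one_le_left (by linarith) qN) lowN
    have := mul_le_mul g1 qrN (by linarith) hpos.le
    linarith
  have C2 : 2 * (X 0 0 : ℝ) / (cfDen a r : ℝ) ^ 2 ≤ 2 / cfDen a r * X 0 0 := by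
    rw [div_mul_eq_mul_div]
    refine div_le_div_of_nonneg_left (by positivity) (by positivity) ?_
    rw [sq]; exact le_mul_of_one_le_left (by linarith) qr
  refine ⟨hpos, A1, A2, A3'.trans ?_, B1, B2, rr.trans B1', A1.trans C1, A2.trans C1, A3'.trans C2⟩
  refine div_le_div_of_nonneg_right ?_ (by positivity)
  linarith

lemma ratio_lim (u c : ℕ → ℝ) (hu : ∀ k, 0 < u k) (x y : ℕ → ℝ) (hc : Tendsto c atTop (𝓝 0))
    (h : ∀ k, |x k - y k| ≤ c k * u k) (L : ℝ) (hx : Tendsto (fun k => x k / u k) atTop (𝓝 L)) :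
    Tendsto (fun k => y k / u k) atTop (𝓝 L) := by
  have h0 : Tendsto (fun k => x k / u k - y k / u k) atTop (𝓝 0) := by
    refine squeeze_zero_norm (fun k => ?_) hc
    rw [Real.norm_eq_abs, ← sub_div, abs_div, abs_of_pos (hu k), div_le_iff₀ (hu k)]
    exact h k
  have := hx.sub h0
  simpa using this

end SST

end

section
open MvPolynomial Filter Topology

namespace SST

lemma det4 (α : ℝ) : (Matrix.of fun i j : Fin 4 => (((!![0,0,-1,0; 0,0,0,-1; 0,-1,0,0; 0,1,0,0] : Matrix (Fin 4) (Fin 4) ℤ) i j : ℤ) : ℝ) +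
    ((!![1,0,0,0; 0,1,0,0; 1,0,0,0; 0,0,0,0] : Matrix (Fin 4) (Fin 4) ℤ) i j : ℤ) * α).det = α ∨
   (Matrix.of fun i j : Fin 4 => (((!![0,0,-1,0; 0,0,0,-1; 0,-1,0,0; 0,1,0,0] : Matrix (Fin 4) (Fin 4) ℤ) i j : ℤ) : ℝ) +
    ((!![1,0,0,0; 0,1,0,0; 1,0,0,0; 0,0,0,0] : Matrix (Fin 4) (Fin 4) ℤ) i j : ℤ) * α).det = -α := by
  have e : (Matrix.of fun i j : Fin 4 => (((!![0,0,-1,0; 0,0,0,-1; 0,-1,0,0; 0,1,0,0] : Matrix (Fin 4) (Fin 4) ℤ) i j : ℤ) : ℝ) +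
    ((!![1,0,0,0; 0,1,0,0; 1,0,0,0; 0,0,0,0] : Matrix (Fin 4) (Fin 4) ℤ) i j : ℤ) * α) =
    !![α,0,-1,0; 0,α,0,-1; α,-1,0,0; 0,1,0,0] := by
    ext i j
    fin_cases i <;> fin_cases j <;> simp
  rw [e]
  simp [Matrix.det_succ_row_zero, Fin.sum_univ_succ, Fin.succAbove]

lemma det3 (α : ℝ) : (Matrix.of fun i j : Fin 3 => (((!![0,-1,0; 0,0,-1; 1,0,0] : Matrix (Fin 3) (Fin 3) ℤ) i j : ℤ) : ℝ) +
    ((!![1,0,0; 0,1,0; 0,0,0] : Matrix (Fin 3) (Fin 3) ℤ) i j : ℤ) * α).det = 1 := by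
  have e : (Matrix.of fun i j : Fin 3 => (((!![0,-1,0; 0,0,-1; 1,0,0] : Matrix (Fin 3) (Fin 3) ℤ) i j : ℤ) : ℝ) +
    ((!![1,0,0; 0,1,0; 0,0,0] : Matrix (Fin 3) (Fin 3) ℤ) i j : ℤ) * α) =
    !![α,-1,0; 0,α,-1; 1,0,0] := by
    ext i j
    fin_cases i <;> fin_cases j <;> simp
  rw [e, Matrix.det_fin_three]
  simp

lemma main_aux {a : ℕ → ℕ} (ha : ∀ n, 1 ≤ n → 1 ≤ a n) {α : ℝ}
    (hα : Tendsto (fun n => (cfNum a n : ℝ) / cfDen a n) atTop (𝓝 α)) (halg : IsAlgebraic ℚ α)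
    (hnq : ∀ A B C : ℤ, (A : ℝ) * α ^ 2 + B * α + C = 0 → A = 0 ∧ B = 0 ∧ C = 0)
    (t r s N : ℕ → ℕ) (htr : ∀ k, t k ≤ r k) (hrs : ∀ k, r k ≤ s k) (hsN : ∀ k, s k ≤ N k)
    (X : ℕ → Matrix (Fin 2) (Fin 2) ℤ) (h1 : ∀ k, X k = cm a (s k) * (cm a (r k)).transpose)
    (h2 : ∀ k, X k = cm a (N k) * (cm a (t k)).transpose)
    (hr : Tendsto r atTop atTop) (δ C : ℝ) (hδ : 0 < δ)
    (hprod : ∀ k, 32 * (cfDen a (t k) : ℝ) ^ 4 / (cfDen a (r k) : ℝ) ^ 2 ≤ Real.exp (-(δ * r k)))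
    (hC : ∀ k, 4 * (cfDen a (N k) : ℝ) ^ 2 ≤ Real.exp (C * r k)) : False := by
  have PB := fun k => pal_b ha hα (t k) (r k) (s k) (N k) (htr k) (hrs k) (hsN k) (X k) (h1 k) (h2 k)
  have qt : ∀ k, (1 : ℝ) ≤ cfDen a (t k) := fun k => by exact_mod_cast den_pos ha _
  have qr : ∀ k, (1 : ℝ) ≤ cfDen a (r k) := fun k => by exact_mod_cast den_pos ha _
  have qN : ∀ k, (1 : ℝ) ≤ cfDen a (N k) := fun k => by exact_mod_cast den_pos ha _
  have qtN : ∀ k, (cfDen a (t k) : ℝ) ≤ cfDen a (N k) := fun k => by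
    exact_mod_cast den_mono ha ((htr k).trans ((hrs k).trans (hsN k)))
  have hα0 : α ≠ 0 := by
    intro h0
    have := (cf_irr ha hα 0 1 (by rw [h0]; simp)).2
    omega
  -- limits
  have hc : Tendsto (fun k => 2 / (cfDen a (r k) : ℝ)) atTop (𝓝 0) := by
    refine Tendsto.const_div_atTop ?_ 2
    refine tendsto_atTop_mono (fun k => ?_) (tendsto_natCast_atTop_atTop.comp hr)
    simp only [Function.comp]
    exact_mod_cast le_den ha (r k)
  have hu : ∀ k, 0 < ((X k 0 0 : ℤ) : ℝ) := fun k => (PB k).1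
  have lim00 : Tendsto (fun k => α * (X k 0 0 : ℝ) / (X k 0 0 : ℝ)) atTop (𝓝 α) := by
    refine tendsto_const_nhds.congr fun k => ?_
    have := (hu k).ne'
    field_simp
  have lim01 : Tendsto (fun k => (X k 0 1 : ℝ) / (X k 0 0 : ℝ)) atTop (𝓝 α) :=
    ratio_lim (fun k => (X k 0 0 : ℝ)) _ hu _ _ hc (fun k => (PB k).2.2.2.2.2.2.2.2.2) _ lim00
  have lim10 : Tendsto (fun k => (X k 1 0 : ℝ) / (X k 0 0 : ℝ)) atTop (𝓝 α) :=
    ratio_lim (fun k => (X k 0 0 : ℝ)) _ hu _ _ hc (fun k => (PB k).2.2.2.2.2.2.2.1) _ lim00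
  have lim11 : Tendsto (fun k => (X k 1 1 : ℝ) / (X k 0 0 : ℝ)) atTop (𝓝 (α * α)) := by
    refine ratio_lim (fun k => (X k 0 0 : ℝ)) _ hu (fun k => α * (X k 0 1 : ℝ)) _ hc (fun k => (PB k).2.2.2.2.2.2.2.2.1) _ ?_
    refine (lim01.const_mul α).congr fun k => by ring
  have relation : ∀ (z1 z2 z3 z4 : ℤ), (∃ᶠ k in atTop, z1 * X k 0 0 + z2 * X k 0 1 + z3 * X k 1 0 + z4 * X k 1 1 = 0) →
      (z4 : ℝ) * α ^ 2 + ((z2 + z3 : ℤ) : ℝ) * α + z1 = 0 := by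
    intro z1 z2 z3 z4 hf
    obtain ⟨φ, hφ, hφ2⟩ := extraction_of_frequently_atTop hf
    have T : Tendsto (fun k => (z1 : ℝ) + z2 * ((X k 0 1 : ℝ) / (X k 0 0 : ℝ)) + z3 * ((X k 1 0 : ℝ) / (X k 0 0 : ℝ)) +
      z4 * ((X k 1 1 : ℝ) / (X k 0 0 : ℝ))) atTop (𝓝 ((z1 : ℝ) + z2 * α + z3 * α + z4 * (α * α))) :=
      ((tendsto_const_nhds.add (lim01.const_mul _)).add (lim10.const_mul _)).add (lim11.const_mul _)
    have T2 := T.comp hφ.tendsto_atTop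
    have T3 : Tendsto (fun _ : ℕ => (0 : ℝ)) atTop (𝓝 ((z1 : ℝ) + z2 * α + z3 * α + z4 * (α * α))) := by
      refine T2.congr fun k => ?_
      have e := congrArg (fun z : ℤ => (z : ℝ)) (hφ2 k)
      push_cast at e
      have := (hu (φ k)).ne'
      simp only [Function.comp]
      field_simp
      linarith
    have := tendsto_nhds_unique T3 tendsto_const_nhds
    push_cast
    linear_combination this
  have hEN : ∀ k, 1 ≤ (cfDen a (N k) : ℝ) ^ 2 := fun k => one_le_pow₀ (qN k)
  have hE1 : ∀ k, 2 * (cfDen a (t k) : ℝ) / cfDen a (N k) ≤ Real.exp (C * r k) := by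
    intro k
    refine le_trans ?_ (hC k)
    have := hEN k
    have : 2 * (cfDen a (t k) : ℝ) / cfDen a (N k) ≤ 2 := by
      have := qN k
      rw [div_le_iff₀ (by linarith)]
      have := qtN k
      linarith
    linarith
  have hE4 : ∀ k, 2 * (cfDen a (t k) : ℝ) * cfDen a (N k) ≤ Real.exp (C * r k) / 2 := by
    intro k
    have h1 := hC k
    have := mul_le_mul_of_nonneg_right (qtN k) (by linarith [qN k] : (0 : ℝ) ≤ cfDen a (N k))
    rw [sq] at h1
    linarith
  have hE3 : ∀ k, 4 * (cfDen a (t k) : ℝ) * cfDen a (N k) / (cfDen a (r k) : ℝ) ^ 2 ≤ Real.exp (C * r k) := by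
    intro k
    have h3 : 1 ≤ (cfDen a (r k) : ℝ) ^ 2 := one_le_pow₀ (qr k)
    have h4 := hE4 k
    have := qt k
    have := qN k
    refine (div_le_self (by positivity) h3).trans ?_
    linarith
  have hℓ : Tendsto (fun k => (r k : ℝ)) atTop atTop := tendsto_natCast_atTop_atTop.comp hr
  -- four-dimensional step
  have step4 : ∃ᶠ k in atTop, X k 0 1 = X k 1 0 := by
    have HH := subspace_alg α halg (n := 4) !![0,0,-1,0; 0,0,0,-1; 0,-1,0,0; 0,1,0,0] !![1,0,0,0; 0,1,0,0; 1,0,0,0; 0,0,0,0]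
      (by rcases det4 α with h | h <;> rw [h] <;> simpa using hα0)
      (fun k => (r k : ℝ)) hℓ (fun k => ![X k 0 0, X k 0 1, X k 1 0, X k 1 1])
      (fun k h0 => by
        have := congrFun h0 0
        simp at this
        have h3 := hu k
        rw [this] at h3
        simp at h3)
      (fun k => ![2 * (cfDen a (t k) : ℝ) / cfDen a (N k), 2 * (cfDen a (t k) : ℝ) / cfDen a (N k),
        4 * (cfDen a (t k) : ℝ) * cfDen a (N k) / (cfDen a (r k) : ℝ) ^ 2, 2 * (cfDen a (t k) : ℝ) * cfDen a (N k)])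
      ?_ C δ hδ ?_ ?_ ?_
    rotate_left
    · intro k i
      have := qt k
      have := qN k
      have := qr k
      fin_cases i <;> simp <;> positivity
    · intro k i
      have := hE4 k
      have := Real.exp_pos (C * r k)
      fin_cases i
      · exact hE1 k
      · exact hE1 k
      · exact hE3 k
      · show 2 * (cfDen a (t k) : ℝ) * cfDen a (N k) ≤ _
        linarith
    · intro k
      refine le_trans (le_of_eq ?_) (hprod k)
      have := qt k
      have := qN k
      have := qr k
      simp [Fin.prod_univ_four]
      field_simp
      ring
    · intro k i
      obtain ⟨-, p1, p2, p3, p4, p5, -⟩ := PB k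
      fin_cases i
      · simp [Fin.sum_univ_four]; convert p1 using 2; ring
      · simp [Fin.sum_univ_four]; convert p2 using 2; ring
      · simp [Fin.sum_univ_four]; convert p3 using 2; ring
      · simp [Fin.sum_univ_four]; exact p5
    obtain ⟨z, hz, hf⟩ := HH
    have hf2 : ∃ᶠ k in atTop, z 0 * X k 0 0 + z 1 * X k 0 1 + z 2 * X k 1 0 + z 3 * X k 1 1 = 0 :=
      hf.mono fun k hk => by simpa [Fin.sum_univ_four] using hk
    obtain ⟨z3, z12, z0⟩ := hnq _ _ _ (relation _ _ _ _ hf2)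
    have z1 : z 1 ≠ 0 := by
      intro z1
      apply hz
      funext i
      fin_cases i
      · exact z0
      · exact z1
      · show z 2 = 0
        omega
      · exact z3
    refine hf2.mono fun k hk => ?_
    have e2 : z 2 = - z 1 := by omega
    rw [z0, z3, e2] at hk
    have : z 1 * (X k 0 1 - X k 1 0) = 0 := by linear_combination hk
    have := (mul_eq_zero.1 this).resolve_left z1
    omega
  obtain ⟨φ, hφ, hφ2⟩ := extraction_of_frequently_atTop step4
  -- three-dimensional step
  have HH := subspace_alg α halg (n := 3) !![0,-1,0; 0,0,-1; 1,0,0] !![1,0,0; 0,1,0; 0,0,0]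
      (by rw [det3]; exact one_ne_zero)
      (fun k => (r (φ k) : ℝ)) (hℓ.comp hφ.tendsto_atTop) (fun k => ![X (φ k) 0 0, X (φ k) 1 0, X (φ k) 1 1])
      (fun k h0 => by
        have := congrFun h0 0
        simp at this
        have h3 := hu (φ k)
        rw [this] at h3
        simp at h3)
      (fun k => ![2 * (cfDen a (t (φ k)) : ℝ) / cfDen a (N (φ k)), 2 * (cfDen a (t (φ k)) : ℝ) / cfDen a (N (φ k)),
        2 * (cfDen a (t (φ k)) : ℝ) * cfDen a (N (φ k))])
      ?_ C δ hδ ?_ ?_ ?_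
  rotate_left
  · intro k i
    have := qt (φ k)
    have := qN (φ k)
    fin_cases i <;> simp <;> positivity
  · intro k i
    have := hE4 (φ k)
    have := Real.exp_pos (C * r (φ k))
    fin_cases i
    · exact hE1 _
    · exact hE1 _
    · show 2 * (cfDen a (t (φ k)) : ℝ) * cfDen a (N (φ k)) ≤ _
      linarith
  · intro k
    refine le_trans ?_ (hprod (φ k))
    have a1 := qt (φ k)
    have a2 := qN (φ k)
    have a3 := qr (φ k)
    have a4 := (PB (φ k)).2.2.2.2.2.2.1
    have e : ∏ i : Fin 3, (![2 * (cfDen a (t (φ k)) : ℝ) / cfDen a (N (φ k)), 2 * (cfDen a (t (φ k)) : ℝ) / cfDen a (N (φ k)),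
        2 * (cfDen a (t (φ k)) : ℝ) * cfDen a (N (φ k))] : Fin 3 → ℝ) i = 8 * (cfDen a (t (φ k)) : ℝ) ^ 3 / cfDen a (N (φ k)) := by
      simp [Fin.prod_univ_three]
      field_simp
      ring
    rw [e, div_le_div_iff₀ (by positivity) (by positivity)]
    have := mul_le_mul_of_nonneg_left a4 (by positivity : (0 : ℝ) ≤ 8 * (cfDen a (t (φ k)) : ℝ) ^ 3)
    have p : (0 : ℝ) ≤ (cfDen a (t (φ k)) : ℝ) ^ 4 * cfDen a (N (φ k)) := by positivity
    have e2 : 8 * (cfDen a (t (φ k)) : ℝ) ^ 3 * (2 * (cfDen a (t (φ k)) : ℝ) * cfDen a (N (φ k))) =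
      16 * ((cfDen a (t (φ k)) : ℝ) ^ 4 * cfDen a (N (φ k))) := by ring
    linarith
  · intro k i
    obtain ⟨-, p1, p2, p3, p4, p5, -⟩ := PB (φ k)
    rw [hφ2 k] at p2
    fin_cases i
    · simp [Fin.sum_univ_three]; convert p1 using 2; ring
    · simp [Fin.sum_univ_three]; convert p2 using 2; ring
    · simp [Fin.sum_univ_three]; exact p4
  obtain ⟨z, hz, hf⟩ := HH
  have hf2 : ∃ᶠ k in atTop, z 0 * X k 0 0 + 0 * X k 0 1 + z 1 * X k 1 0 + z 2 * X k 1 1 = 0 := by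
    refine hφ.tendsto_atTop.frequently (hf.mono fun k hk => ?_)
    simpa [Fin.sum_univ_three] using hk
  obtain ⟨z3, z12, z0⟩ := hnq _ _ _ (relation _ _ _ _ hf2)
  apply hz
  funext i
  fin_cases i
  · exact z0
  · show z 1 = 0
    omega
  · exact z3

end SST

end

section
open MvPolynomial Filter Topology

namespace SST

lemma main_thm (a : ℕ → ℕ) (ha : ∀ n, 1 ≤ n → 1 ≤ a n)
    (α : ℝ)
    (hα : Tendsto (fun n => (cfNum a n : ℝ) / cfDen a n) atTop (𝓝 α))
    (hbdd : ∃ C : ℝ, ∀ ℓ : ℕ, 1 ≤ ℓ → (cfDen a ℓ : ℝ) ^ (1 / (ℓ : ℝ)) ≤ C)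
    (M m : ℝ)
    (hM : M = limsup (fun ℓ : ℕ => (cfDen a ℓ : ℝ) ^ (1 / (ℓ : ℝ))) atTop)
    (hm : m = liminf (fun ℓ : ℕ => (cfDen a ℓ : ℝ) ^ (1 / (ℓ : ℝ))) atTop)
    (w w' : ℚ) (hw : 0 < w) (hw' : 0 < w')
    (hww' : (w' : ℝ) > 2 * (Real.log M / Real.log m) - 1)
    (hcond : ConditionStarStar w w' a) :
    Transcendental ℚ α := by
  intro halg
  obtain ⟨hper, U, V, W, hpre, hV, hU, hmono⟩ := hcond
  have hw'R : (0 : ℝ) < w' := by exact_mod_cast hw'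
  have hwR : (0 : ℝ) < w := by exact_mod_cast hw
  obtain ⟨a0, b, K, hK, hb, hab, g1, g2⟩ := growth ha hbdd M m hM hm w' hw'R hww'
  obtain ⟨δ, hδ, g3⟩ := growth2 ha w' hw'R a0 b K hK hb hab g1 g2
  obtain ⟨R, hR⟩ := eventually_atTop.1 g3
  have hUn : ∀ n, n ≤ (U n).length := fun n => hmono.id_le n
  let f : ℕ → ℕ := fun k => k + R + 1
  have hf1 : ∀ k, 1 ≤ f k := fun k => by simp only [f]; omega
  have hrk : ∀ k, k + R + 1 ≤ (W (f k) ++ U (f k)).length := fun k => by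
    have := hUn (f k)
    rw [List.length_append]
    simp only [f] at this ⊢
    omega
  have hnq : ∀ A B C : ℤ, (A : ℝ) * α ^ 2 + B * α + C = 0 → A = 0 ∧ B = 0 ∧ C = 0 := by
    intro A B C h
    by_contra hne
    exact hper (lagrange ha hα A B C hne h)
  refine main_aux ha hα halg hnq (fun k => (W (f k)).length) (fun k => (W (f k) ++ U (f k)).length)
    (fun k => (W (f k) ++ U (f k) ++ V (f k)).length) (fun k => (W (f k) ++ U (f k) ++ V (f k) ++ (U (f k)).reverse).length)
    (fun k => by simp) (fun k => by simp) (fun k => by simp)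
    (fun k => cm a (W (f k) ++ U (f k) ++ V (f k)).length * (cm a (W (f k) ++ U (f k)).length).transpose)
    (fun k => rfl) (fun k => pal_id a _ _ _ (hpre (f k) (hf1 k)))
    (tendsto_atTop_mono (fun k => by have := hrk k; simp only [id]; omega) tendsto_id) δ (4 * K ^ 2 + 2 * b * (2 + w)) hδ ?_ ?_
  · intro k
    refine hR _ (by have := hrk k; omega) _ ?_
    have h1 := hU (f k) (hf1 k)
    have h2 : (w' : ℝ) * (W (f k)).length ≤ (U (f k)).length := by exact_mod_cast h1
    rw [List.length_append]
    push_cast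
    linarith
  · intro k
    have h1 := hV (f k) (hf1 k)
    have h2 : ((V (f k)).length : ℝ) ≤ w * (U (f k)).length := by exact_mod_cast h1
    have h3 := g1 (W (f k) ++ U (f k) ++ V (f k) ++ (U (f k)).reverse).length
    have h4 : (1 : ℝ) ≤ (W (f k) ++ U (f k)).length := by
      have : 1 ≤ (W (f k) ++ U (f k)).length := by have := hrk k; omega
      exact_mod_cast this
    have h5 : ((W (f k) ++ U (f k) ++ V (f k) ++ (U (f k)).reverse).length : ℝ) ≤ (2 + w) * (W (f k) ++ U (f k)).length := by
      simp only [List.length_append, List.length_reverse]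
      push_cast
      have p1 : (0 : ℝ) ≤ (W (f k)).length := Nat.cast_nonneg _
      have p2 : (0 : ℝ) ≤ w * (W (f k)).length := by positivity
      linarith
    generalize ((W (f k) ++ U (f k)).length : ℝ) = r at *
    have h6 := pow_le_pow_left₀ (Nat.cast_nonneg _) h3 2
    rw [mul_pow, ← Real.exp_nat_mul] at h6
    have h7 : Real.exp ((2 : ℕ) * (b * ((W (f k) ++ U (f k) ++ V (f k) ++ (U (f k)).reverse).length : ℝ))) ≤ Real.exp (2 * b * (2 + w) * r) := by
      apply Real.exp_le_exp.2
      have := mul_le_mul_of_nonneg_left h5 hb.le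
      push_cast
      linarith
    have h8 : 4 * K ^ 2 ≤ Real.exp (4 * K ^ 2 * r) := by
      have e1 := Real.add_one_le_exp (4 * K ^ 2 * r)
      have e2 := le_mul_of_one_le_right (by positivity : 0 ≤ 4 * K ^ 2) h4
      linarith
    rw [add_mul, Real.exp_add]
    have h9 := mul_le_mul h8 h7 (Real.exp_pos _).le (Real.exp_pos _).le
    linarith

end SST

end

/-- Theorem 3: if `(q_ℓ^{1/ℓ})` is bounded, with `M` and `m` its limsup and liminf, and `a`
satisfies Condition `(*)_{w,w'}` with `w' > 2 log M / log m - 1`, then `α` is transcendental. -/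
theorem statement2 (a : ℕ → ℕ) (ha : ∀ n, 1 ≤ n → 1 ≤ a n)
    (α : ℝ)
    (hα : Tendsto (fun n => (cfNum a n : ℝ) / cfDen a n) atTop (𝓝 α))
    (hbdd : ∃ C : ℝ, ∀ ℓ : ℕ, 1 ≤ ℓ → (cfDen a ℓ : ℝ) ^ (1 / (ℓ : ℝ)) ≤ C)
    (M m : ℝ)
    (hM : M = limsup (fun ℓ : ℕ => (cfDen a ℓ : ℝ) ^ (1 / (ℓ : ℝ))) atTop)
    (hm : m = liminf (fun ℓ : ℕ => (cfDen a ℓ : ℝ) ^ (1 / (ℓ : ℝ))) atTop)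
    (w w' : ℚ) (hw : 0 < w) (hw' : 0 < w')
    (hww' : (w' : ℝ) > 2 * (Real.log M / Real.log m) - 1)
    (hcond : ConditionStarStar w w' a) :
    Transcendental ℚ α := by
  exact SST.main_thm a ha α hα hbdd M m hM hm w w' hw hw' hww' hcond
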